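/- Assume 0 < p < 1 is real and the family Ψ_n satisfies properties (P1)–(P6). Define S̄_n^±(ν) = ((⟨↑↑| + ν⟨↓↓|)^{⊗n} ⊗ (⟨↑| ± ⟨↓|)) ψ_n. Then for each k ≥ 1, S̄_{2k}^± and S̄_{2k+1}^± are polynomials in ν whose coefficients are polynomials in ζ, and, with ζ = (ϑ₁(η,p²)/ϑ₄(η,p²))², J₃ = 1/(1+ζ), J₄ = 1/(1−ζ), ν̄ = (ν−ζ)(νζ−1)/((ζ²−1)ν), c_{εε'} = (ζ+ε)(ν+ε'), d_ε = ν(ζ+ε)², d̄_ε = ζ(ν+ε)² (for signs ε, ε' = ±1), the following hold wherever the right-hand sides are defined: S̄_{2k}^+ = ν^k (c_{+−}² H_{2(k+1)}(J₄) H_{2(k+1)}(J₃, ν̄) − c_{−+}² H_{2(k+1)}(J₃) H_{2(k+1)}(J₄, ν̄)) / (2(ν−ζ)(νζ−1)); S̄_{2k}^− = c_{+−} c_{−+} ν^k (H_{2(k+1)}(J₄) H_{2(k+1)}(J₃, ν̄) − H_{2(k+1)}(J₃) H_{2(k+1)}(J₄, ν̄)) / (2(ν−ζ)(νζ−1)); S̄_{2k+1}^+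 = c_{−−} ν^k (d_+ H_{2(k+1)} H_{2(k+2)}(J₃, J₄, ν̄) − d̄_+ H_{2(k+1)}(ν̄) H_{2(k+2)}(J₃, J₄)) / (2ζ(ν−ζ)(νζ−1)); S̄_{2k+1}^− = c_{++} ν^k (d_− H_{2(k+1)} H_{2(k+2)}(J₃, J₄, ν̄) − d̄_− H_{2(k+1)}(ν̄) H_{2(k+2)}(J₃, J₄)) / (2ζ(ν−ζ)(νζ−1)), where all H's are evaluated at the parameter ζ. -/

import Mathlib

noncomputable section

open Complex
open scoped BigOperators

/-- Jacobi theta function `ϑ₁(z|τ)` with nome `p = e^{iπτ}` (Whittaker–Watson convention). -/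
def th1 (z τ : ℂ) : ℂ :=
  -Complex.I * ∑' n : ℤ, (-1 : ℂ) ^ n *
    Complex.exp ((Real.pi : ℂ) * Complex.I * τ * ((n : ℂ) + 1/2) ^ 2 + (2 * (n : ℂ) + 1) * Complex.I * z)

/-- Jacobi theta function `ϑ₂(z|τ)`. -/
def th2 (z τ : ℂ) : ℂ :=
  ∑' n : ℤ,
    Complex.exp ((Real.pi : ℂ) * Complex.I * τ * ((n : ℂ) + 1/2) ^ 2 + (2 * (n : ℂ) + 1) * Complex.I * z)

/-- Jacobi theta function `ϑ₃(z|τ)`. -/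
def th3 (z τ : ℂ) : ℂ :=
  ∑' n : ℤ, Complex.exp ((Real.pi : ℂ) * Complex.I * τ * (n : ℂ) ^ 2 + 2 * (n : ℂ) * Complex.I * z)

/-- Jacobi theta function `ϑ₄(z|τ)`. -/
def th4 (z τ : ℂ) : ℂ :=
  ∑' n : ℤ, (-1 : ℂ) ^ n *
    Complex.exp ((Real.pi : ℂ) * Complex.I * τ * (n : ℂ) ^ 2 + 2 * (n : ℂ) * Complex.I * z)

/-- The crossing parameter `η = π/3`. -/
def ηc : ℂ := (Real.pi : ℂ) / 3

/-- The elliptic nome `p = e^{iπτ}`. -/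
def pnome (τ : ℂ) : ℂ := Complex.exp ((Real.pi : ℂ) * Complex.I * τ)

/-- `ζ = (ϑ₁(η,p²)/ϑ₄(η,p²))²`. -/
def zet (τ : ℂ) : ℂ := (th1 ηc (2 * τ) / th4 ηc (2 * τ)) ^ 2

/-- The nome `p` is real with `0 < p < 1`. -/
def preal (τ : ℂ) : Prop := (pnome τ).im = 0 ∧ 0 < (pnome τ).re ∧ (pnome τ).re < 1

/-- A tuple given by a list of prescribed entries, padded by zeros. -/
def padded {n : ℕ} (l : List ℂ) : Fin n → ℂ := fun j => l.getD (j : ℕ) 0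

/-- Extension of a tuple by a list of prescribed further entries (padded by zeros). -/
def extL {m n : ℕ} (w : Fin m → ℂ) (l : List ℂ) : Fin n → ℂ :=
  fun j => if h : (j : ℕ) < m then w ⟨j, h⟩ else l.getD ((j : ℕ) - m) 0

/-- First `k` entries of a `2k`-tuple. -/
def firstHalf {k : ℕ} (x : Fin (2 * k) → ℂ) : Fin k → ℂ :=
  fun i => x ⟨(i : ℕ), by have := i.2; omega⟩

/-- Last `k` entries of a `2k`-tuple. -/
def secondHalf {k : ℕ} (x : Fin (2 * k) → ℂ) : Fin k → ℂ :=
  fun i => x ⟨k + (i : ℕ), by have := i.2; omega⟩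

/-- `𝕙(x,y) = ϑ₁(x−y+η)ϑ₁(x−y−η)ϑ₁(x+y+η)ϑ₁(x+y−η)`. -/
def hh (τ x y : ℂ) : ℂ :=
  th1 (x - y + ηc) τ * th1 (x - y - ηc) τ * th1 (x + y + ηc) τ * th1 (x + y - ηc) τ

/-- `𝔻(x₁,…,x_k) = ∏_{i<j} ϑ₁(x_j−x_i)ϑ₁(x_j+x_i)`. -/
def vdTheta (τ : ℂ) {k : ℕ} (y : Fin k → ℂ) : ℂ :=
  ∏ i : Fin k, ∏ j : Fin k, if i < j then th1 (y j - y i) τ * th1 (y j + y i) τ else 1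

/-- The elliptic Tsuchiya determinant `ℍ_{2k}(x₁,…,x_k; x_{k+1},…,x_{2k})`. -/
def tsuchiya (τ : ℂ) (k : ℕ) (x : Fin (2 * k) → ℂ) : ℂ :=
  (∏ i : Fin k, ∏ j : Fin k, hh τ (firstHalf x i) (secondHalf x j))
    / (vdTheta τ (firstHalf x) * vdTheta τ (secondHalf x))
    * Matrix.det (Matrix.of fun i j : Fin k => (hh τ (firstHalf x i) (secondHalf x j))⁻¹)

/-- The expression defining the elliptic Tsuchiya determinant is well defined:
the Vandermonde-type denominators and the entries `𝕙(x_i,x_{j+k})` are nonzero. -/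
def tsuDefined (τ : ℂ) (k : ℕ) (x : Fin (2 * k) → ℂ) : Prop :=
  (∀ i j : Fin k, i ≠ j →
    th1 (firstHalf x j - firstHalf x i) τ ≠ 0 ∧ th1 (firstHalf x j + firstHalf x i) τ ≠ 0) ∧
  (∀ i j : Fin k, i ≠ j →
    th1 (secondHalf x j - secondHalf x i) τ ≠ 0 ∧ th1 (secondHalf x j + secondHalf x i) τ ≠ 0) ∧
  (∀ i j : Fin k, hh τ (firstHalf x i) (secondHalf x j) ≠ 0)

/-- `h(w,w') = 1 − (3+ζ²)ww' + (1−ζ²)ww'(w+w')`. -/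
def hpol (ζ w w' : ℂ) : ℂ := 1 - (3 + ζ ^ 2) * w * w' + (1 - ζ ^ 2) * w * w' * (w + w')

/-- Vandermonde product `Δ(w₁,…,w_k) = ∏_{i<j}(w_j − w_i)`. -/
def vdm {k : ℕ} (y : Fin k → ℂ) : ℂ :=
  ∏ i : Fin k, ∏ j : Fin k, if i < j then y j - y i else 1

/-- The determinant-ratio expression defining the polynomial `H_{2k}`. -/
def Hratio (ζ : ℂ) (k : ℕ) (w : Fin (2 * k) → ℂ) : ℂ :=
  (∏ i : Fin k, ∏ j : Fin k, hpol ζ (firstHalf w i) (secondHalf w j))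
    / (vdm (firstHalf w) * vdm (secondHalf w))
    * Matrix.det (Matrix.of fun i j : Fin k => (hpol ζ (firstHalf w i) (secondHalf w j))⁻¹)

/-- The expression `Hratio` is well defined at `w`. -/
def HratioDefined (ζ : ℂ) (k : ℕ) (w : Fin (2 * k) → ℂ) : Prop :=
  (∀ i j : Fin k, i ≠ j → firstHalf w i ≠ firstHalf w j) ∧
  (∀ i j : Fin k, i ≠ j → secondHalf w i ≠ secondHalf w j) ∧
  (∀ i j : Fin k, hpol ζ (firstHalf w i) (secondHalf w j) ≠ 0)

/-- `H` is the family of Rosengren–Zinn-Justin polynomials `H_{2k}` for parameter `ζ`: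
for each `k`, `H k` is a polynomial function of the `2k` variables agreeing with the
determinant-ratio formula wherever the latter is defined, and `H 0 = 1`. -/
def IsHFamily (ζ : ℂ) (H : (k : ℕ) → (Fin (2 * k) → ℂ) → ℂ) : Prop :=
  (∀ w, H 0 w = 1) ∧
  (∀ k : ℕ, ∃ P : MvPolynomial (Fin (2 * k)) ℂ, ∀ w, H k w = MvPolynomial.eval w P) ∧
  (∀ (k : ℕ) (w : Fin (2 * k) → ℂ), HratioDefined ζ k w → H k w = Hratio ζ k w)

/-- Vertex weight `a(u)`. -/
def av (τ u : ℂ) : ℂ := th4 (2*ηc) (2*τ) * th1 (u + 2*ηc) (2*τ) * th4 u (2*τ)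
/-- Vertex weight `b(u)`. -/
def bv (τ u : ℂ) : ℂ := th4 (2*ηc) (2*τ) * th4 (u + 2*ηc) (2*τ) * th1 u (2*τ)
/-- Vertex weight `c(u)`. -/
def cv (τ u : ℂ) : ℂ := th1 (2*ηc) (2*τ) * th4 (u + 2*ηc) (2*τ) * th4 u (2*τ)
/-- Vertex weight `d(u)`. -/
def dv (τ u : ℂ) : ℂ := th1 (2*ηc) (2*τ) * th1 (u + 2*ηc) (2*τ) * th1 u (2*τ)
/-- `r(u) = a(u) + b(u)`. -/
def rv (τ u : ℂ) : ℂ := av τ u + bv τ u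

/-- Entries of the `R`-matrix of the eight-vertex model, in the basis `{↑↑,↑↓,↓↑,↓↓}`
identified with `Fin 2 × Fin 2` (`↑ = 0`, `↓ = 1`). -/
def Rent (τ u : ℂ) (p q : Fin 2 × Fin 2) : ℂ :=
  if p = q then (if p.1 = p.2 then av τ u else bv τ u)
  else if q = (p.2, p.1) then cv τ u
  else if p.1 = p.2 ∧ q.1 = q.2 then dv τ u
  else 0

/-- Entries of `Ř(u) = 𝒫 R(u)`. -/
def Rcheckent (τ u : ℂ) (p q : Fin 2 × Fin 2) : ℂ := Rent τ u (p.2, p.1) q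

/-- The boundary vector `χ(x) ∈ ℂ²⊗ℂ²`. -/
def chiV (τ lam x : ℂ) : Fin 2 × Fin 2 → ℂ := fun p =>
  if p = ((0 : Fin 2), (1 : Fin 2)) then th1 (x + lam) (2*τ) * th4 (x - lam - 2*ηc) (2*τ)
  else if p = ((1 : Fin 2), (0 : Fin 2)) then th1 (x - lam - 2*ηc) (2*τ) * th4 (x + lam) (2*τ)
  else 0

/-- The boundary vector `χ̄(x) ∈ ℂ²⊗ℂ²`. -/
def chibarV (τ lam x : ℂ) : Fin 2 × Fin 2 → ℂ := fun p =>
  if p = ((0 : Fin 2), (0 : Fin 2)) then th1 (x + lam) (2*τ) * th1 (x - lam - 2*ηc) (2*τ)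
  else if p = ((1 : Fin 2), (1 : Fin 2)) then th4 (x - lam - 2*ηc) (2*τ) * th4 (x + lam) (2*τ)
  else 0

/-- A family `Ψ_n(u₁,…,u_{2n+1}) ∈ (ℂ²)^{⊗(2n+1)}`, represented by its components
with respect to spin configurations `α : Fin (2n+1) → Fin 2` (`↑ = 0`, `↓ = 1`). -/
abbrev PsiFam := (n : ℕ) → (Fin (2 * n + 1) → ℂ) → (Fin (2 * n + 1) → Fin 2) → ℂ

/-- The action of `Ř(u)` on tensor factors `i`, `j` of `(ℂ²)^{⊗L}`. -/
def applyRc (τ u : ℂ) {L : ℕ} (i j : Fin L) (ψ : (Fin L → Fin 2) → ℂ) :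
    (Fin L → Fin 2) → ℂ := fun α =>
  ∑ s : Fin 2, ∑ t : Fin 2,
    Rcheckent τ u (α i, α j) (s, t) * ψ (Function.update (Function.update α i s) j t)

/-- Spin flip. -/
def flipS : Fin 2 → Fin 2 := fun s => if s = 0 then 1 else 0

/-- Components of the singlet `s = ↑↓ − ↓↑`. -/
def singletC : Fin 2 → Fin 2 → ℂ := fun s t =>
  if s = 0 ∧ t = 1 then 1 else if s = 1 ∧ t = 0 then -1 else 0

/-- Delete the entries at positions `i`, `i+1` from a tuple. -/
def delTwo {α : Type*} {n : ℕ} (i : ℕ) (u : Fin (2 * (n + 1) + 1) → α) : Fin (2 * n + 1) → α :=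
  fun j => if _h : (j : ℕ) < i then u ⟨j, by have := j.2; omega⟩
           else u ⟨(j : ℕ) + 2, by have := j.2; omega⟩

/-- The components of `Ψ_n` are entire functions of each `u_i`. -/
def PsiEntire (Ψ : PsiFam) : Prop :=
  ∀ (n : ℕ) (u : Fin (2*n+1) → ℂ) (i : Fin (2*n+1)) (α : Fin (2*n+1) → Fin 2),
    Differentiable ℂ fun z => Ψ n (Function.update u i z) α

/-- (P1): the exchange relations. -/
def PsiP1 (τ : ℂ) (Ψ : PsiFam) : Prop :=
  ∀ (n : ℕ) (u : Fin (2*n+1) → ℂ) (i j : Fin (2*n+1)), (j : ℕ) = (i : ℕ) + 1 →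
    applyRc τ (u j - u i) i j (Ψ n u)
      = fun α => rv τ (u j - u i) * Ψ n (fun l => u (Equiv.swap i j l)) α

/-- (P2): local spin flips. -/
def PsiP2 (τ : ℂ) (Ψ : PsiFam) : Prop :=
  ∀ (n : ℕ) (u : Fin (2*n+1) → ℂ) (i : Fin (2*n+1)) (α : Fin (2*n+1) → Fin 2),
    Ψ n u (Function.update α i (flipS (α i)))
      = (-(pnome τ)) ^ n * Complex.exp (-Complex.I * ∑ j, (u j - u i))
        * Ψ n (Function.update u i (u i + Real.pi * τ)) α

/-- (P3): quasi-periodicity of `Ψ_n` in each `u_i`. -/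
def PsiP3 (τ : ℂ) (Ψ : PsiFam) : Prop :=
  ∀ (n : ℕ) (u : Fin (2*n+1) → ℂ) (i : Fin (2*n+1)),
    (Ψ n (Function.update u i (u i + Real.pi))
      = fun α => (∏ j ∈ Finset.univ.erase i, (if α j = 0 then (1:ℂ) else -1)) * Ψ n u α) ∧
    (Ψ n (Function.update u i (u i + 2 * Real.pi * τ))
      = fun α => (pnome τ ^ (4*n))⁻¹ *
          Complex.exp (-2 * Complex.I * ∑ j, (u i - u j)) * Ψ n u α)

/-- (P4): the wheel condition. -/
def PsiP4 (Ψ : PsiFam) : Prop :=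
  ∀ (n : ℕ) (u : Fin (2*n+1) → ℂ),
    (∃ i j k : Fin (2*n+1), i < j ∧ j < k ∧ u j = u i + 2*ηc ∧ u k = u i + 4*ηc) →
    Ψ n u = 0

/-- (P5): the reduction relations. -/
def PsiP5 (τ : ℂ) (Ψ : PsiFam) : Prop :=
  ∀ (n : ℕ) (u : Fin (2*(n+1)+1) → ℂ) (i : ℕ) (hi : i + 1 < 2*(n+1)+1),
    u ⟨i+1, hi⟩ = u ⟨i, by omega⟩ + 2*ηc →
    Ψ (n+1) u = fun α =>
      (∏ j ∈ (Finset.univ.erase (⟨i, by omega⟩ : Fin (2*(n+1)+1))).erase ⟨i+1, hi⟩,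
          th1 (u ⟨i, by omega⟩ - u j - 2*ηc) τ)
        * singletC (α ⟨i, by omega⟩) (α ⟨i+1, hi⟩)
        * Ψ n (delTwo i u) (delTwo i α)

/-- (P6): `Ψ₀ = ↑ + ↓`. -/
def PsiP6 (Ψ : PsiFam) : Prop := ∀ u α, Ψ 0 u α = 1

/-- The inhomogeneity parameters `(x₁,−x₁,…,x_n,−x_n,0)`. -/
def interleave {n : ℕ} (x : Fin n → ℂ) : Fin (2*n+1) → ℂ := fun j =>
  if h : (j : ℕ) < 2*n then
    (if (j : ℕ) % 2 = 0 then x ⟨(j:ℕ)/2, by omega⟩ else -x ⟨(j:ℕ)/2, by omega⟩)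
  else 0

/-- Components of `χ(x)`. -/
def chiC (τ lam x : ℂ) (s t : Fin 2) : ℂ :=
  if s = 0 ∧ t = 1 then th1 (x + lam) (2*τ) * th4 (x - lam - 2*ηc) (2*τ)
  else if s = 1 ∧ t = 0 then th1 (x - lam - 2*ηc) (2*τ) * th4 (x + lam) (2*τ)
  else 0

/-- Components of `χ̄(x)`. -/
def chibarC (τ lam x : ℂ) (s t : Fin 2) : ℂ :=
  if s = 0 ∧ t = 0 then th1 (x + lam) (2*τ) * th1 (x - lam - 2*ηc) (2*τ)
  else if s = 1 ∧ t = 1 then th4 (x - lam - 2*ηc) (2*τ) * th4 (x + lam) (2*τ)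
  else 0

/-- The scalar product `Z_n(x₁,…,x_n) = ⟨ξ_n(x₁,…,x_n), Ψ_n(x₁,−x₁,…,x_n,−x_n,0)⟩`. -/
def Zfun (τ lam : ℂ) (Ψ : PsiFam) (n : ℕ) (x : Fin n → ℂ) : ℂ :=
  ∑ α : Fin (2*n+1) → Fin 2,
    (∏ m : Fin n, chiC τ lam (x m)
        (α ⟨2*(m:ℕ), by have := m.2; omega⟩) (α ⟨2*(m:ℕ)+1, by have := m.2; omega⟩))
      * (if α ⟨2*n, by omega⟩ = 0 then (1:ℂ) else 0)
      * Ψ n (interleave x) α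

/-- The scalar product `Z̄_n^±(x₁,…,x_n)`, with `ε = ±1`. -/
def Zbarfun (τ lam ε : ℂ) (Ψ : PsiFam) (n : ℕ) (x : Fin n → ℂ) : ℂ :=
  ∑ α : Fin (2*n+1) → Fin 2,
    (∏ m : Fin n, chibarC τ lam (x m)
        (α ⟨2*(m:ℕ), by have := m.2; omega⟩) (α ⟨2*(m:ℕ)+1, by have := m.2; omega⟩))
      * (if α ⟨2*n, by omega⟩ = 0 then (1:ℂ) else ε)
      * Ψ n (interleave x) α

/-- The normalisation constant `𝒩_n`. -/
def Ncoef (τ : ℂ) (n : ℕ) : ℂ :=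
  (-1 : ℂ) ^ ((n+1)/2) * (th1 ηc τ ^ (n^2))⁻¹ * (th4 0 (2*τ) / th4 ηc (2*τ)) ^ (n*(n+1)/2)

/-- The vector `ψ_n = 𝒩_n Ψ_n(0,…,0)`. -/
def psiH (τ : ℂ) (Ψ : PsiFam) (n : ℕ) (α : Fin (2*n+1) → Fin 2) : ℂ :=
  Ncoef τ n * Ψ n (fun _ => 0) α

/-- The scalar product `S_n(μ) = ((⟨↑↓| + μ⟨↓↑|)^{⊗n} ⊗ ⟨↑|) ψ_n`. -/
def Sfun (τ : ℂ) (Ψ : PsiFam) (n : ℕ) (μ : ℂ) : ℂ :=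
  ∑ α : Fin (2*n+1) → Fin 2,
    (∏ m : Fin n,
      (if α ⟨2*(m:ℕ), by have := m.2; omega⟩ = 0 ∧ α ⟨2*(m:ℕ)+1, by have := m.2; omega⟩ = 1
        then (1:ℂ)
       else if α ⟨2*(m:ℕ), by have := m.2; omega⟩ = 1 ∧ α ⟨2*(m:ℕ)+1, by have := m.2; omega⟩ = 0
        then μ
       else 0))
      * (if α ⟨2*n, by omega⟩ = 0 then (1:ℂ) else 0) * psiH τ Ψ n α

/-- The scalar product `S̄_n^±(ν) = ((⟨↑↑| + ν⟨↓↓|)^{⊗n} ⊗ (⟨↑| ± ⟨↓|)) ψ_n`, with `ε = ±1`. -/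
def Sbarfun (τ ε : ℂ) (Ψ : PsiFam) (n : ℕ) (ν : ℂ) : ℂ :=
  ∑ α : Fin (2*n+1) → Fin 2,
    (∏ m : Fin n,
      (if α ⟨2*(m:ℕ), by have := m.2; omega⟩ = 0 ∧ α ⟨2*(m:ℕ)+1, by have := m.2; omega⟩ = 0
        then (1:ℂ)
       else if α ⟨2*(m:ℕ), by have := m.2; omega⟩ = 1 ∧ α ⟨2*(m:ℕ)+1, by have := m.2; omega⟩ = 1
        then ν
       else 0))
      * (if α ⟨2*n, by omega⟩ = 0 then (1:ℂ) else ε) * psiH τ Ψ n α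

/-- The alternating spin configuration `↑↓↑↓⋯↑`. -/
def altConf {L : ℕ} : Fin L → Fin 2 := fun j => if (j : ℕ) % 2 = 0 then 0 else 1

/-- The fully polarised spin configuration `↓⋯↓`. -/
def downConf {L : ℕ} : Fin L → Fin 2 := fun _ => 1

/-- The spin configuration `↑⋯↑↓` with a single `↓` at the last site. -/
def lastDownConf {n : ℕ} : Fin (2*n+1) → Fin 2 := fun j => if (j : ℕ) = 2*n then 1 else 0

/-- `J₂ = −1/2`. -/
def J2c : ℂ := -(1/2)
/-- `J₃ = 1/(1+ζ)`. -/
def J3c (ζ : ℂ) : ℂ := 1/(1+ζ)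
/-- `J₄ = 1/(1−ζ)`. -/
def J4c (ζ : ℂ) : ℂ := 1/(1-ζ)
/-- `μ̄ = (μ−1)²/((ζ²−1)μ)`. -/
def mubar (ζ μ : ℂ) : ℂ := (μ - 1)^2 / ((ζ^2 - 1)*μ)
/-- `ν̄ = (ν−ζ)(νζ−1)/((ζ²−1)ν)`. -/
def nubar (ζ ν : ℂ) : ℂ := (ν - ζ)*(ν*ζ - 1) / ((ζ^2 - 1)*ν)

/-- The elliptic function `w(x)`. -/
def wfun (τ x : ℂ) : ℂ :=
  th4 ηc (2*τ) / th4 0 (2*τ) * th1 x τ ^ 2 / (th1 (x - ηc) τ * th1 (x + ηc) τ)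

/-- `β₂ = η + π/2`. -/
def β2c : ℂ := ηc + (Real.pi : ℂ)/2
/-- `β₃ = η + π/2 + πτ/2`. -/
def β3c (τ : ℂ) : ℂ := ηc + (Real.pi : ℂ)/2 + (Real.pi : ℂ)*τ/2
/-- `β₄ = η + πτ/2`. -/
def β4c (τ : ℂ) : ℂ := ηc + (Real.pi : ℂ)*τ/2

/-- `f` is an (even) theta function of degree `m`, nome `p = e^{iπτ}` and norm `0`
with respect to each of its variables. -/
def ThetaLike (τ : ℂ) (m : ℕ) {n : ℕ} (X : (Fin n → ℂ) → ℂ) : Prop :=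
  ∀ (x : Fin n → ℂ) (i : Fin n),
    Differentiable ℂ (fun z => X (Function.update x i z)) ∧
    (∀ z, X (Function.update x i (z + Real.pi)) = X (Function.update x i z)) ∧
    (∀ z, X (Function.update x i (z + Real.pi * τ))
        = ((-(pnome τ)) ^ m)⁻¹ * Complex.exp (-2 * Complex.I * ((m : ℂ) * z))
            * X (Function.update x i z)) ∧
    (∀ z, X (Function.update x i (-z)) = X (Function.update x i z))

/-! ### Entire quasi-periodic functions -/

/-- `f` is entire with `f (z + π) = c₁ f z` and `f (z + πτ) = c₂ e^{-2iNz} f z`. -/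
structure QP (τ : ℂ) (N : ℕ) (c₁ c₂ : ℂ) (f : ℂ → ℂ) : Prop where
  diff : Differentiable ℂ f
  pi : ∀ z, f (z + Real.pi) = c₁ * f z
  tau : ∀ z, f (z + Real.pi * τ) = c₂ * exp (-2 * I * N * z) * f z

/-- The lattice `πℤ + πτℤ`. -/
def PLat (τ z : ℂ) : Prop := ∃ m n : ℤ, z = Real.pi * m + Real.pi * τ * n

theorem entire_mul_cancel {f g h : ℂ → ℂ} (hf : Differentiable ℂ f) (hg : Differentiable ℂ g)
    (hh : Differentiable ℂ h) (hne : ∃ z, g z ≠ 0) (H : ∀ z, f z * g z = h z * g z) : f = h := by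
  have hd : AnalyticOnNhd ℂ (f - h) Set.univ :=
    (hf.sub hh).differentiableOn.analyticOnNhd isOpen_univ
  obtain ⟨z, hz⟩ := hne
  have hev : ∀ᶠ w in nhds z, (f - h) w = 0 := by
    filter_upwards [hg.continuous.continuousAt.eventually_ne hz] with w hw
    have := H w
    simp only [Pi.sub_apply]
    exact sub_eq_zero.2 (mul_right_cancel₀ hw this)
  have := hd.eq_of_eventuallyEq (analyticOnNhd_const (v := (0 : ℂ))) (z₀ := z) hev
  exact sub_eq_zero.1 this

theorem entire_eq_zero_of_mul {f g : ℂ → ℂ} (hf : Differentiable ℂ f) (hg : Differentiable ℂ g)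
    (H : ∀ z, f z * g z = 0) : f = 0 ∨ g = 0 := by
  by_cases h : ∃ z, g z ≠ 0
  · left
    exact entire_mul_cancel hf hg (h := 0) (differentiable_const 0) h (by simpa using H)
  · right
    push Not at h
    exact funext h

/-- Division of entire functions at simple zeros. -/
theorem exists_entire_quotient {f g : ℂ → ℂ} (hf : Differentiable ℂ f) (hg : Differentiable ℂ g)
    (hs : ∀ z, g z = 0 → deriv g z ≠ 0) (hz : ∀ z, g z = 0 → f z = 0) :
    ∃ q : ℂ → ℂ, Differentiable ℂ q ∧ ∀ z, f z = q z * g z := by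
  classical
  refine ⟨fun z => if g z = 0 then deriv f z / deriv g z else f z / g z, fun z₀ => ?_, fun z => ?_⟩
  · by_cases h0 : g z₀ = 0
    · have hdf : Differentiable ℂ (dslope f z₀) := by
        have := (differentiableOn_dslope (f := f) (s := Set.univ) (c := z₀)
          Filter.univ_mem).2 hf.differentiableOn
        exact differentiableOn_univ.1 this
      have hdg : Differentiable ℂ (dslope g z₀) := by
        have := (differentiableOn_dslope (f := g) (s := Set.univ) (c := z₀)
          Filter.univ_mem).2 hg.differentiableOn
        exact differentiableOn_univ.1 this
      have hne : dslope g z₀ z₀ ≠ 0 := by rw [dslope_same]; exact hs _ h0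
      have key : DifferentiableAt ℂ (fun z => dslope f z₀ z / dslope g z₀ z) z₀ :=
        (hdf z₀).div (hdg z₀) hne
      refine key.congr_of_eventuallyEq ?_
      filter_upwards [hdg.continuous.continuousAt.eventually_ne hne] with w hw
      by_cases hwz : w = z₀
      · subst hwz
        simp [h0]
      · have e1 : f w = (w - z₀) * dslope f z₀ w := by
          have := sub_smul_dslope f z₀ w
          rw [hz _ h0, sub_zero, smul_eq_mul] at this
          exact this.symm
        have e2 : g w = (w - z₀) * dslope g z₀ w := by
          have := sub_smul_dslope g z₀ w
          rw [h0, sub_zero, smul_eq_mul] at this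
          exact this.symm
        have hwz' : w - z₀ ≠ 0 := sub_ne_zero.2 hwz
        have hgw : g w ≠ 0 := by rw [e2]; exact mul_ne_zero hwz' hw
        rw [if_neg hgw, e1, e2]
        exact mul_div_mul_left _ _ hwz'
    · have key : DifferentiableAt ℂ (fun z => f z / g z) z₀ := (hf z₀).div (hg z₀) h0
      refine key.congr_of_eventuallyEq ?_
      filter_upwards [hg.continuous.continuousAt.eventually_ne h0] with w hw
      rw [if_neg hw]
  · by_cases h0 : g z = 0
    · simp [h0, hz z h0]
    · simp [h0]

theorem elliptic_eq_const {τ : ℂ} (hτ : 0 < τ.im) {f : ℂ → ℂ} (hf : QP τ 0 1 1 f) (z : ℂ) :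
    f z = f 0 := by
  have h1 : ∀ (n : ℤ) z, f (z + Real.pi * n) = f z := by
    have hp : Function.Periodic f (Real.pi : ℂ) := fun z => by simpa using hf.pi z
    intro n z
    rw [mul_comm]
    exact hp.int_mul n z
  have h2 : ∀ (n : ℤ) z, f (z + Real.pi * τ * n) = f z := by
    have hp : Function.Periodic f (Real.pi * τ : ℂ) := fun z => by simpa using hf.tau z
    intro n z
    rw [mul_comm]
    exact hp.int_mul n z
  refine hf.diff.apply_eq_apply_of_bounded ?_ z 0
  have hcomp : IsCompact ((fun q : ℝ × ℝ => f (Real.pi * (q.1 : ℂ) + Real.pi * τ * (q.2 : ℂ))) ''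
      (Set.Icc 0 1 ×ˢ Set.Icc 0 1)) := by
    refine (isCompact_Icc.prod isCompact_Icc).image ?_
    exact hf.diff.continuous.comp (by fun_prop)
  refine hcomp.isBounded.subset ?_
  rintro _ ⟨w, rfl⟩
  set y : ℝ := w.im / (Real.pi * τ.im) with hy
  set x : ℝ := (w.re - Real.pi * τ.re * y) / Real.pi with hx
  have hπ := Real.pi_ne_zero
  have hw : w = Real.pi * (x : ℂ) + Real.pi * τ * (y : ℂ) := by
    apply Complex.ext
    · simp [hx]; field_simp; ring
    · have e : y * (Real.pi * τ.im) = w.im := by rw [hy]; field_simp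
      simp only [add_im, mul_im, ofReal_re, ofReal_im, mul_re, mul_zero, zero_mul, add_zero,
        sub_zero, zero_add]
      linear_combination -e
  refine ⟨(Int.fract x, Int.fract y), ⟨⟨Int.fract_nonneg _, (Int.fract_lt_one _).le⟩,
    ⟨Int.fract_nonneg _, (Int.fract_lt_one _).le⟩⟩, ?_⟩
  simp only
  rw [← h1 ⌊x⌋, ← h2 ⌊y⌋]
  congr 1
  rw [hw]
  have e1 : (x : ℂ) = (⌊x⌋ : ℂ) + (Int.fract x : ℝ) := by
    conv_lhs => rw [← Int.floor_add_fract x]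
    push_cast; ring
  have e2 : (y : ℂ) = (⌊y⌋ : ℂ) + (Int.fract y : ℝ) := by
    conv_lhs => rw [← Int.floor_add_fract y]
    push_cast; ring
  rw [e1, e2]; ring

/-! ### A theta product with simple zeros exactly on the lattice -/

/-- `G(y) = ∏ (1 - Qⁿ y)`. -/
def Gprod (Q y : ℂ) : ℂ := ∏' n : ℕ, (1 - Q ^ n * y)

theorem summable_norm_pow_mul {Q : ℂ} (hQ : ‖Q‖ < 1) (y : ℂ) :
    Summable fun n : ℕ => ‖-(Q ^ n * y)‖ := by
  simpa using (summable_geometric_of_lt_one (norm_nonneg _) hQ).mul_right ‖y‖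

theorem multipliable_Gprod {Q : ℂ} (hQ : ‖Q‖ < 1) (y : ℂ) :
    Multipliable fun n : ℕ => (1 - Q ^ n * y) := by
  simpa [sub_eq_add_neg] using multipliable_one_add_of_summable (summable_norm_pow_mul hQ y)

theorem Gprod_ne_zero {Q : ℂ} (hQ : ‖Q‖ < 1) {y : ℂ} (hy : ∀ n : ℕ, Q ^ n * y ≠ 1) :
    Gprod Q y ≠ 0 := by
  have := tprod_one_add_ne_zero_of_summable (f := fun n : ℕ => -(Q ^ n * y))
    (fun n => by
      intro h
      exact hy n (by linear_combination -h)) (summable_norm_pow_mul hQ y)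
  simpa [Gprod, sub_eq_add_neg] using this

theorem Gprod_succ {Q : ℂ} (hQ : ‖Q‖ < 1) (y : ℂ) :
    Gprod Q y = (1 - y) * Gprod Q (Q * y) := by
  unfold Gprod
  rw [tprod_eq_zero_mul']
  · simp [pow_succ, mul_assoc]
  · have := multipliable_Gprod hQ (Q * y)
    simpa [pow_succ, mul_assoc] using this

theorem differentiable_Gprod {Q : ℂ} (hQ : ‖Q‖ < 1) : Differentiable ℂ (Gprod Q) := by
  have hm : MultipliableLocallyUniformlyOn (fun (n : ℕ) (y : ℂ) => 1 - Q ^ n * y) Set.univ := by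
    use fun y => ∏' n : ℕ, (1 - Q ^ n * y)
    simp_rw [sub_eq_add_neg]
    apply hasProdLocallyUniformlyOn_of_forall_compact isOpen_univ
    intro K _ hcK
    obtain ⟨R, hR⟩ := hcK.isBounded.exists_norm_le
    refine ((summable_geometric_of_lt_one (norm_nonneg _) hQ).mul_right R).hasProdUniformlyOn_nat_one_add
      hcK (.of_forall fun n x hx ↦ ?_) (fun _ ↦ by fun_prop)
    have : ‖-(Q ^ n * x)‖ = ‖Q‖ ^ n * ‖x‖ := by simp
    rw [this]
    exact mul_le_mul_of_nonneg_left (hR x hx) (by positivity)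
  exact differentiableOn_univ.1 (hm.hasProdLocallyUniformlyOn.differentiableOn
    (.of_forall fun _ ↦ by simpa [Finset.prod_fn] using
      DifferentiableOn.finsetProd (fun _ _ ↦ by fun_prop)) isOpen_univ)

/-- The theta product `P(z) = G(e^{2iz}) G(Q e^{-2iz})` with `Q = e^{2πiτ}`. -/
def Pth (τ z : ℂ) : ℂ :=
  Gprod (exp (2 * Real.pi * I * τ)) (exp (2 * I * z)) *
    Gprod (exp (2 * Real.pi * I * τ)) (exp (2 * Real.pi * I * τ) * exp (-(2 * I * z)))

theorem norm_nome_lt_one {τ : ℂ} (hτ : 0 < τ.im) : ‖exp (2 * Real.pi * I * τ)‖ < 1 := by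
  rw [Complex.norm_exp]
  have : (2 * Real.pi * I * τ).re = -(2 * Real.pi * τ.im) := by simp
  rw [this]
  rw [Real.exp_lt_one_iff]
  have := Real.pi_pos
  have : 0 < 2 * Real.pi * τ.im := by positivity
  linarith

theorem Pth_qp {τ : ℂ} (hτ : 0 < τ.im) : QP τ 1 1 (-1) (Pth τ) := by
  have hQ := norm_nome_lt_one hτ
  have hG := differentiable_Gprod hQ
  refine ⟨?_, ?_, ?_⟩
  · unfold Pth
    exact (hG.comp (by fun_prop)).mul (hG.comp (by fun_prop))
  · intro z
    have e1 : exp (2 * I * (z + Real.pi)) = exp (2 * I * z) := by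
      rw [show 2 * I * (z + Real.pi) = 2 * I * z + 2 * Real.pi * I by ring, exp_periodic _]
    have e2 : exp (-(2 * I * (z + Real.pi))) = exp (-(2 * I * z)) := by
      rw [exp_neg, e1, exp_neg]
    simp only [Pth, e1, e2, one_mul]
  · intro z
    have e1 : exp (2 * I * (z + Real.pi * τ)) = exp (2 * Real.pi * I * τ) * exp (2 * I * z) := by
      rw [← exp_add]; ring_nf
    have e2 : exp (2 * Real.pi * I * τ) * exp (-(2 * I * (z + Real.pi * τ))) = exp (-(2 * I * z)) := by
      rw [← exp_add]; ring_nf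
    simp only [Pth, e2]
    rw [e1, Gprod_succ hQ (exp (2 * I * z)), Gprod_succ hQ (exp (-(2 * I * z)))]
    have e3 : exp (-2 * I * (1 : ℕ) * z) = exp (-(2 * I * z)) := by push_cast; ring_nf
    rw [e3]
    have e4 : exp (-(2 * I * z)) * exp (2 * I * z) = 1 := by rw [← exp_add]; simp
    linear_combination (-Gprod (exp (2 * Real.pi * I * τ)) (exp (2 * Real.pi * I * τ) * exp (2 * I * z)) *
      Gprod (exp (2 * Real.pi * I * τ)) (exp (2 * Real.pi * I * τ) * exp (-(2 * I * z)))) * e4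

theorem Pth_zero_lat {τ : ℂ} (hτ : 0 < τ.im) {z : ℂ} (h : Pth τ z = 0) : PLat τ z := by
  have hQ := norm_nome_lt_one hτ
  have hex : ∀ (n : ℕ) (w : ℂ), exp (2 * Real.pi * I * τ) ^ n * exp (2 * I * w) = 1 →
      ∃ m : ℤ, w = Real.pi * m - Real.pi * τ * n := by
    intro n w hw
    rw [← exp_nat_mul, ← exp_add, exp_eq_one_iff] at hw
    obtain ⟨m, hm⟩ := hw
    refine ⟨m, ?_⟩
    have hI : (2 * I : ℂ) ≠ 0 := by simp
    apply mul_left_cancel₀ hI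
    linear_combination hm
  by_contra hL
  refine mul_ne_zero (Gprod_ne_zero hQ fun n hn => ?_) (Gprod_ne_zero hQ fun n hn => ?_) h
  · obtain ⟨m, hm⟩ := hex n z hn
    exact hL ⟨m, -n, by push_cast; rw [hm]; ring⟩
  · rw [← mul_assoc, ← pow_succ, show -(2 * I * z) = 2 * I * (-z) by ring] at hn
    obtain ⟨m, hm⟩ := hex (n + 1) (-z) hn
    refine hL ⟨-m, n + 1, ?_⟩
    push_cast at hm ⊢
    linear_combination -hm

theorem Pth_zero {τ : ℂ} (hτ : 0 < τ.im) : Pth τ 0 = 0 := by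
  have hQ := norm_nome_lt_one hτ
  unfold Pth
  rw [Gprod_succ hQ]
  simp

theorem Pth_deriv_zero {τ : ℂ} (hτ : 0 < τ.im) : deriv (Pth τ) 0 ≠ 0 := by
  have hQ := norm_nome_lt_one hτ
  set Q := exp (2 * Real.pi * I * τ) with hQd
  have hG := differentiable_Gprod hQ
  have e : Pth τ = fun z => (1 - exp (2 * I * z)) * (Gprod Q (Q * exp (2 * I * z)) *
      Gprod Q (Q * exp (-(2 * I * z)))) := by
    funext z
    unfold Pth
    rw [← hQd, Gprod_succ hQ (exp (2 * I * z))]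
    ring
  have h1 : HasDerivAt (fun z : ℂ => 1 - exp (2 * I * z)) (-(exp (2 * I * 0) * (2 * I))) 0 := by
    have : HasDerivAt (fun z : ℂ => 2 * I * z) (2 * I) 0 := by
      simpa using (hasDerivAt_id (0 : ℂ)).const_mul (2 * I)
    exact (this.cexp).const_sub 1
  have hd2 : DifferentiableAt ℂ (fun z : ℂ => Gprod Q (Q * exp (2 * I * z)) *
      Gprod Q (Q * exp (-(2 * I * z)))) 0 :=
    ((hG.comp (by fun_prop : Differentiable ℂ fun z : ℂ => Q * exp (2 * I * z))).mul
      (hG.comp (by fun_prop : Differentiable ℂ fun z : ℂ => Q * exp (-(2 * I * z))))) 0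
  have h2 := h1.mul hd2.hasDerivAt
  rw [e]
  have h3 := h2.deriv
  simp only [mul_zero, exp_zero, neg_zero, mul_one, one_mul, sub_self, zero_mul, add_zero] at h3
  have hfin : -(2 * I) * (Gprod Q Q * Gprod Q Q) ≠ 0 := by
    have hg : Gprod Q Q ≠ 0 := by
      refine Gprod_ne_zero hQ fun n hn => ?_
      have : ‖Q ^ n * Q‖ < 1 := by
        rw [← pow_succ, norm_pow]
        exact pow_lt_one₀ (norm_nonneg _) hQ (by simp)
      rw [hn] at this
      simp at this
    simp [hg]
  intro h4
  apply hfin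
  rw [← h3]
  exact h4

theorem QP.deriv_pi {τ c₁ c₂ : ℂ} {N : ℕ} {f : ℂ → ℂ} (hf : QP τ N c₁ c₂ f) (z : ℂ) :
    deriv f (z + Real.pi) = c₁ * deriv f z := by
  have : (fun z => f (z + Real.pi)) = fun z => c₁ * f z := funext hf.pi
  have h2 := congrArg (fun g => deriv g z) this
  simpa [deriv_comp_add_const] using h2

theorem QP.deriv_tau {τ c₁ c₂ : ℂ} {N : ℕ} {f : ℂ → ℂ} (hf : QP τ N c₁ c₂ f) {z : ℂ}
    (hz : f z = 0) : deriv f (z + Real.pi * τ) = c₂ * exp (-2 * I * N * z) * deriv f z := by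
  have h0 : (fun z => f (z + Real.pi * τ)) = fun z => c₂ * exp (-2 * I * N * z) * f z := funext hf.tau
  have h2 := congrArg (fun g => deriv g z) h0
  simp only [deriv_comp_add_const] at h2
  rw [h2, deriv_fun_mul (by fun_prop) (hf.diff z), hz]
  simp

theorem int_induction_iff {p : ℤ → Prop} (h0 : p 0) (h : ∀ n, p n ↔ p (n + 1)) (n : ℤ) : p n := by
  induction n using Int.induction_on with
  | zero => exact h0
  | succ i ih => exact (h _).1 ih
  | pred i ih => exact (h _).2 (by simpa using ih)

theorem QP.lattice_zero {τ c₁ c₂ : ℂ} {N : ℕ} {f : ℂ → ℂ} (hf : QP τ N c₁ c₂ f) (h1 : c₁ ≠ 0)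
    (h2 : c₂ ≠ 0) {a : ℂ} (ha : f a = 0) {z : ℂ} (hz : PLat τ (z - a)) : f z = 0 := by
  obtain ⟨m, n, hmn⟩ := hz
  have hA : ∀ m : ℤ, f (a + Real.pi * m) = 0 := by
    refine int_induction_iff (by simpa using ha) fun n => ?_
    have := hf.pi (a + Real.pi * n)
    rw [show a + Real.pi * ((n + 1 : ℤ) : ℂ) = a + Real.pi * n + Real.pi by push_cast; ring, this]
    simp [h1]
  have hB : ∀ n : ℤ, f (a + Real.pi * m + Real.pi * τ * n) = 0 := by
    refine int_induction_iff (by simpa using hA m) fun n => ?_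
    have := hf.tau (a + Real.pi * m + Real.pi * τ * n)
    rw [show a + Real.pi * m + Real.pi * τ * ((n + 1 : ℤ) : ℂ)
      = a + Real.pi * m + Real.pi * τ * n + Real.pi * τ by push_cast; ring, this]
    simp [h2]
  have := hB n
  rwa [show z = a + Real.pi * m + Real.pi * τ * n by linear_combination hmn]

theorem Pth_simple {τ : ℂ} (hτ : 0 < τ.im) {z : ℂ} (h : Pth τ z = 0) : deriv (Pth τ) z ≠ 0 := by
  have hf := Pth_qp hτ
  obtain ⟨m, n, rfl⟩ := Pth_zero_lat hτ h
  have hlz : ∀ m n : ℤ, Pth τ (Real.pi * m + Real.pi * τ * n) = 0 := fun m n =>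
    hf.lattice_zero one_ne_zero (by simp) (Pth_zero hτ) ⟨m, n, by ring⟩
  have hA : ∀ m : ℤ, deriv (Pth τ) (Real.pi * m) ≠ 0 := by
    refine int_induction_iff (by simpa using Pth_deriv_zero hτ) fun n => ?_
    rw [show Real.pi * ((n + 1 : ℤ) : ℂ) = Real.pi * n + Real.pi by push_cast; ring, hf.deriv_pi]
    simp
  refine int_induction_iff (p := fun n : ℤ => deriv (Pth τ) (Real.pi * m + Real.pi * τ * n) ≠ 0)
    (by simpa using hA m) (fun n => ?_) n
  rw [show Real.pi * m + Real.pi * τ * ((n + 1 : ℤ) : ℂ)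
      = Real.pi * m + Real.pi * τ * n + Real.pi * τ by push_cast; ring, hf.deriv_tau (hlz m n)]
  simp

theorem QP.neg_arg_zero {τ c₁ c₂ : ℂ} {f : ℂ → ℂ} (hτ : 0 < τ.im) (hf : QP τ 0 c₁ c₂ f)
    (h1 : c₁ ≠ 0) (h2 : c₂ ≠ 0) {a : ℂ} (ha : f a = 0) : f = 0 := by
  have hg : QP τ 0 1 1 fun z => f (a + z) * f (a - z) := by
    refine ⟨?_, fun z => ?_, fun z => ?_⟩
    · exact (hf.diff.comp (by fun_prop)).mul (hf.diff.comp (by fun_prop))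
    · have e1 := hf.pi (a + z)
      have e2 := hf.pi (a - (z + Real.pi))
      rw [show a - (z + Real.pi) + Real.pi = a - z by ring] at e2
      rw [← add_assoc, e1, e2]; ring
    · have e1 := hf.tau (a + z)
      have e2 := hf.tau (a - (z + Real.pi * τ))
      rw [show a - (z + Real.pi * τ) + Real.pi * τ = a - z by ring] at e2
      simp only [Nat.cast_zero, mul_zero, zero_mul, exp_zero, mul_one, one_mul] at e1 e2 ⊢
      rw [← add_assoc, e1, e2]; ring
  have hz : ∀ z, f (a + z) * f (a - z) = 0 := by
    intro z
    have := elliptic_eq_const hτ hg z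
    simpa [ha] using this
  rcases entire_eq_zero_of_mul (f := fun z => f (a + z)) (g := fun z => f (a - z))
    (hf.diff.comp (by fun_prop)) (hf.diff.comp (by fun_prop)) hz with h | h
  · funext z
    simpa using congrFun h (z - a)
  · funext z
    simpa using congrFun h (a - z)

theorem QP.divide {τ c₁ c₂ : ℂ} {N : ℕ} {f : ℂ → ℂ} (hτ : 0 < τ.im) (hf : QP τ (N + 1) c₁ c₂ f)
    (h1 : c₁ ≠ 0) (h2 : c₂ ≠ 0) {a : ℂ} (ha : f a = 0) :
    ∃ q c₂', c₂' ≠ 0 ∧ QP τ N c₁ c₂' q ∧ ∀ z, f z = q z * Pth τ (z - a) := by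
  have hP := Pth_qp hτ
  obtain ⟨q, hq, hfq⟩ := exists_entire_quotient (g := fun z => Pth τ (z - a)) hf.diff
    (hP.diff.comp (by fun_prop)) (fun z hz => by
      rw [deriv_comp_sub_const]; exact Pth_simple hτ hz)
    (fun z hz => hf.lattice_zero h1 h2 ha (Pth_zero_lat hτ hz))
  have hne : ∃ z, (fun z => Pth τ (z - a)) z ≠ 0 := by
    by_contra hcon
    push Not at hcon
    apply Pth_deriv_zero hτ
    have : Pth τ = fun _ => 0 := by
      funext z
      simpa using hcon (z + a)
    rw [this]; simp
  refine ⟨q, -c₂ * exp (-2 * I * a), by simp [h2], ⟨hq, fun z => ?_, fun z => ?_⟩, hfq⟩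
  · refine congrFun (entire_mul_cancel (f := fun z => q (z + Real.pi)) (h := fun z => c₁ * q z)
      (g := fun z => Pth τ (z - a)) (hq.comp (by fun_prop)) (hP.diff.comp (by fun_prop))
      (by fun_prop) hne fun z => ?_) z
    have e1 := hf.pi z
    rw [hfq, hfq z, show z + Real.pi - a = z - a + Real.pi by ring, hP.pi] at e1
    linear_combination e1
  · refine congrFun (entire_mul_cancel (f := fun z => q (z + Real.pi * τ))
      (h := fun z => -c₂ * exp (-2 * I * a) * exp (-2 * I * N * z) * q z)
      (g := fun z => Pth τ (z - a)) (hq.comp (by fun_prop)) (hP.diff.comp (by fun_prop))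
      (by fun_prop) hne fun z => ?_) z
    have e1 := hf.tau z
    rw [hfq, hfq z, show z + Real.pi * τ - a = z - a + Real.pi * τ by ring, hP.tau] at e1
    have e2 : exp (-2 * I * (N + 1 : ℕ) * z) =
      exp (-2 * I * a) * exp (-2 * I * N * z) * exp (-2 * I * (1 : ℕ) * (z - a)) := by
      rw [← exp_add, ← exp_add]; push_cast; ring_nf
    rw [e2] at e1
    have hE := exp_ne_zero (-2 * I * (1 : ℕ) * (z - a))
    apply mul_left_cancel₀ hE
    linear_combination -e1

/-- A quasi-periodic entire function of degree `N` with `N + 1` inequivalent zeros vanishes. -/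
theorem QP.eq_zero {τ : ℂ} (hτ : 0 < τ.im) : ∀ (N : ℕ) {c₁ c₂ : ℂ} {f : ℂ → ℂ}
    (_ : QP τ N c₁ c₂ f) (_ : c₁ ≠ 0) (_ : c₂ ≠ 0) (l : List ℂ) (_ : N + 1 ≤ l.length)
    (_ : l.Pairwise fun a b => ¬ PLat τ (b - a)) (_ : ∀ a ∈ l, f a = 0), f = 0 := by
  intro N
  induction N with
  | zero =>
    intro c₁ c₂ f hf h1 h2 l hl _ hz
    cases l with
    | nil => simp at hl
    | cons a l => exact hf.neg_arg_zero hτ h1 h2 (hz a (by simp))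
  | succ N ih =>
    intro c₁ c₂ f hf h1 h2 l hl hp hz
    cases l with
    | nil => simp at hl
    | cons a l =>
      obtain ⟨q, c₂', hc, hq, hfq⟩ := hf.divide hτ h1 h2 (hz a (by simp))
      rw [List.pairwise_cons] at hp
      have : q = 0 := by
        refine ih hq h1 hc l (by simpa using hl) hp.2 fun b hb => ?_
        have e := hz b (by simp [hb])
        rw [hfq] at e
        rcases mul_eq_zero.1 e with h | h
        · exact h
        · exact absurd (Pth_zero_lat hτ h) (hp.1 b hb)
      funext z
      rw [hfq, this]; simp

/-! #### Closure properties -/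

theorem QP.mul {τ c₁ c₂ d₁ d₂ : ℂ} {N M : ℕ} {f g : ℂ → ℂ} (hf : QP τ N c₁ c₂ f)
    (hg : QP τ M d₁ d₂ g) : QP τ (N + M) (c₁ * d₁) (c₂ * d₂) fun z => f z * g z := by
  refine ⟨hf.diff.mul hg.diff, fun z => ?_, fun z => ?_⟩
  · rw [hf.pi, hg.pi]; ring
  · rw [hf.tau, hg.tau, show -2 * I * (N + M : ℕ) * z = -2 * I * N * z + -2 * I * M * z by
      push_cast; ring, exp_add]; ring

theorem QP.shift {τ c₁ c₂ : ℂ} {N : ℕ} {f : ℂ → ℂ} (hf : QP τ N c₁ c₂ f) (a : ℂ) :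
    QP τ N c₁ (c₂ * exp (-2 * I * N * a)) fun z => f (z + a) := by
  refine ⟨hf.diff.comp (by fun_prop), fun z => ?_, fun z => ?_⟩
  · rw [← hf.pi]; ring_nf
  · rw [show z + Real.pi * τ + a = z + a + Real.pi * τ by ring, hf.tau,
      show -2 * I * N * (z + a) = -2 * I * N * z + -2 * I * N * a by ring, exp_add]; ring

theorem QP.const_mul {τ c₁ c₂ : ℂ} {N : ℕ} {f : ℂ → ℂ} (hf : QP τ N c₁ c₂ f) (a : ℂ) :
    QP τ N c₁ c₂ fun z => a * f z := by
  refine ⟨hf.diff.const_mul a, fun z => ?_, fun z => ?_⟩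
  · rw [hf.pi]; ring
  · rw [hf.tau]; ring

theorem QP.add {τ c₁ c₂ : ℂ} {N : ℕ} {f g : ℂ → ℂ} (hf : QP τ N c₁ c₂ f) (hg : QP τ N c₁ c₂ g) :
    QP τ N c₁ c₂ fun z => f z + g z := by
  refine ⟨hf.diff.add hg.diff, fun z => ?_, fun z => ?_⟩
  · rw [hf.pi, hg.pi]; ring
  · rw [hf.tau, hg.tau]; ring

theorem QP.sub {τ c₁ c₂ : ℂ} {N : ℕ} {f g : ℂ → ℂ} (hf : QP τ N c₁ c₂ f) (hg : QP τ N c₁ c₂ g) :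
    QP τ N c₁ c₂ fun z => f z - g z := by
  refine ⟨hf.diff.sub hg.diff, fun z => ?_, fun z => ?_⟩
  · rw [hf.pi, hg.pi]; ring
  · rw [hf.tau, hg.tau]; ring

theorem QP.zero {τ c₁ c₂ : ℂ} {N : ℕ} : QP τ N c₁ c₂ fun _ => 0 :=
  ⟨differentiable_const 0, by simp, by simp⟩

theorem QP.congr {τ c₁ c₂ d₁ d₂ : ℂ} {N : ℕ} {f : ℂ → ℂ} (hf : QP τ N c₁ c₂ f) (h1 : c₁ = d₁)
    (h2 : c₂ = d₂) : QP τ N d₁ d₂ f := h1 ▸ h2 ▸ hf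

theorem QP.eq_of_list {τ : ℂ} (hτ : 0 < τ.im) {N : ℕ} {c₁ c₂ : ℂ} {f g : ℂ → ℂ}
    (hf : QP τ N c₁ c₂ f) (hg : QP τ N c₁ c₂ g) (h1 : c₁ ≠ 0) (h2 : c₂ ≠ 0) (l : List ℂ)
    (hl : N + 1 ≤ l.length) (hp : l.Pairwise fun a b => ¬ PLat τ (b - a))
    (hz : ∀ a ∈ l, f a = g a) : f = g := by
  have := QP.eq_zero hτ N (hf.sub hg) h1 h2 l hl hp (fun a ha => sub_eq_zero.2 (hz a ha))
  funext z
  exact sub_eq_zero.1 (congrFun this z)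

/-! ### Jacobi theta functions -/

theorem th4_eq_jacobi (z τ : ℂ) : th4 z τ = jacobiTheta₂ (z / Real.pi + 1 / 2) τ := by
  unfold th4 jacobiTheta₂ jacobiTheta₂_term
  congr 1
  funext n
  have h1 : ((-1 : ℂ)) ^ n = exp (Real.pi * I * n) := by
    rw [← exp_pi_mul_I, ← exp_int_mul]; ring_nf
  have hπ : (Real.pi : ℂ) ≠ 0 := by exact_mod_cast Real.pi_ne_zero
  rw [h1, ← exp_add]
  congr 1
  field_simp
  ring

theorem th4_differentiable {τ : ℂ} (hτ : 0 < τ.im) : Differentiable ℂ fun z => th4 z τ := by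
  have : (fun z => th4 z τ) = (fun z => jacobiTheta₂ z τ) ∘ fun z => z / Real.pi + 1 / 2 :=
    funext fun z => th4_eq_jacobi z τ
  rw [this]
  exact fun z => (differentiableAt_jacobiTheta₂_fst _ hτ).comp z (by fun_prop)

theorem th4_add_pi (z τ : ℂ) : th4 (z + Real.pi) τ = th4 z τ := by
  have hπ : (Real.pi : ℂ) ≠ 0 := by exact_mod_cast Real.pi_ne_zero
  rw [th4_eq_jacobi, th4_eq_jacobi, show (z + Real.pi) / Real.pi + 1 / 2 = z / Real.pi + 1 / 2 + 1 by
    field_simp; ring, jacobiTheta₂_add_left]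

theorem th4_neg (z τ : ℂ) : th4 (-z) τ = th4 z τ := by
  rw [th4_eq_jacobi, th4_eq_jacobi, ← jacobiTheta₂_neg_left,
    ← jacobiTheta₂_add_left (-(-z / Real.pi + 1 / 2)) τ]
  congr 1
  ring

theorem th4_add_pi_tau (z τ : ℂ) :
    th4 (z + Real.pi * τ) τ = -exp (-(Real.pi * I * τ)) * exp (-2 * I * z) * th4 z τ := by
  have hπ : (Real.pi : ℂ) ≠ 0 := by exact_mod_cast Real.pi_ne_zero
  rw [th4_eq_jacobi, th4_eq_jacobi, show (z + Real.pi * τ) / Real.pi + 1 / 2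
    = z / Real.pi + 1 / 2 + τ by field_simp; ring, jacobiTheta₂_add_left']
  congr 1
  have : -exp (-(Real.pi * I * τ)) * exp (-2 * I * z)
    = exp (-(Real.pi * I)) * exp (-(Real.pi * I * τ)) * exp (-2 * I * z) := by
    rw [exp_neg (Real.pi * I), exp_pi_mul_I]; norm_num
  rw [this, ← exp_add, ← exp_add]
  congr 1
  field_simp
  ring

theorem th1_eq_th4 (z τ : ℂ) :
    th1 z τ = -I * exp (Real.pi * I * τ / 4 + I * z) * th4 (z + Real.pi * τ / 2) τ := by
  unfold th1 th4
  rw [mul_assoc (-I)]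
  congr 1
  rw [← tsum_mul_left]
  congr 1
  funext n
  rw [mul_left_comm, ← exp_add]
  congr 2
  ring

theorem th4_add_half (z τ : ℂ) :
    th4 (z + Real.pi * τ / 2) τ = I * exp (-(Real.pi * I * τ / 4) - I * z) * th1 z τ := by
  have h : exp (-(Real.pi * I * τ / 4) - I * z) * exp (Real.pi * I * τ / 4 + I * z) = 1 := by
    rw [← exp_add, show -(Real.pi * I * τ / 4) - I * z + (Real.pi * I * τ / 4 + I * z) = 0 by ring,
      exp_zero]
  rw [th1_eq_th4]
  linear_combination (-th4 (z + Real.pi * τ / 2) τ) * h + (th4 (z + Real.pi * τ / 2) τ *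
    exp (-(Real.pi * I * τ / 4) - I * z) * exp (Real.pi * I * τ / 4 + I * z)) * I_mul_I

theorem th1_add_half (z τ : ℂ) :
    th1 (z + Real.pi * τ / 2) τ = I * exp (-(Real.pi * I * τ / 4) - I * z) * th4 z τ := by
  rw [th1_eq_th4, show z + Real.pi * τ / 2 + Real.pi * τ / 2 = z + Real.pi * τ by ring,
    th4_add_pi_tau]
  have h : exp (Real.pi * I * τ / 4 + I * (z + Real.pi * τ / 2)) * (exp (-(Real.pi * I * τ)) *
      exp (-2 * I * z)) = exp (-(Real.pi * I * τ / 4) - I * z) := by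
    rw [← exp_add, ← exp_add]; congr 1; ring
  linear_combination I * th4 z τ * h

theorem th1_differentiable {τ : ℂ} (hτ : 0 < τ.im) : Differentiable ℂ fun z => th1 z τ := by
  have : (fun z => th1 z τ) = fun z => -I * exp (Real.pi * I * τ / 4 + I * z) *
      th4 (z + Real.pi * τ / 2) τ := funext fun z => th1_eq_th4 z τ
  rw [this]
  have := (th4_differentiable hτ).comp (by fun_prop : Differentiable ℂ fun z : ℂ => z + Real.pi * τ / 2)
  exact (by fun_prop : Differentiable ℂ fun z : ℂ => -I * exp (Real.pi * I * τ / 4 + I * z)).mul this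

theorem th1_add_pi (z τ : ℂ) : th1 (z + Real.pi) τ = -th1 z τ := by
  rw [th1_eq_th4, th1_eq_th4, show z + Real.pi + Real.pi * τ / 2 = z + Real.pi * τ / 2 + Real.pi by ring,
    th4_add_pi, show Real.pi * I * τ / 4 + I * (z + Real.pi) = Real.pi * I * τ / 4 + I * z + Real.pi * I by
    ring, exp_add, exp_pi_mul_I]
  ring

theorem th1_neg (z τ : ℂ) : th1 (-z) τ = -th1 z τ := by
  rw [th1_eq_th4, th1_eq_th4, show z + Real.pi * τ / 2 = -(-z + Real.pi * τ / 2) + Real.pi * τ by ring,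
    th4_add_pi_tau, th4_neg]
  have h : exp (Real.pi * I * τ / 4 + I * z) * (exp (-(Real.pi * I * τ)) *
      exp (-2 * I * -(-z + Real.pi * τ / 2))) = exp (Real.pi * I * τ / 4 + I * -z) := by
    rw [← exp_add, ← exp_add]; congr 1; ring
  linear_combination -I * th4 (-z + Real.pi * τ / 2) τ * (-h)

theorem th1_zero (τ : ℂ) : th1 0 τ = 0 := by
  have := th1_neg 0 τ
  rw [neg_zero] at this
  exact self_eq_neg.1 this

theorem th1_add_pi_tau (z τ : ℂ) :
    th1 (z + Real.pi * τ) τ = -exp (-(Real.pi * I * τ)) * exp (-2 * I * z) * th1 z τ := by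
  rw [th1_eq_th4, th1_eq_th4, show z + Real.pi * τ + Real.pi * τ / 2
    = z + Real.pi * τ / 2 + Real.pi * τ by ring, th4_add_pi_tau]
  have h : exp (Real.pi * I * τ / 4 + I * (z + Real.pi * τ)) * exp (-2 * I * (z + Real.pi * τ / 2))
      = exp (-2 * I * z) * exp (Real.pi * I * τ / 4 + I * z) := by
    rw [← exp_add, ← exp_add]; congr 1; ring
  linear_combination (I * exp (-(Real.pi * I * τ)) * th4 (z + Real.pi * τ / 2) τ) * h

theorem th4_qp {τ : ℂ} (hτ : 0 < τ.im) : QP τ 1 1 (-exp (-(Real.pi * I * τ))) fun z => th4 z τ :=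
  ⟨th4_differentiable hτ, fun z => by rw [th4_add_pi, one_mul], fun z => by
    rw [th4_add_pi_tau]; simp⟩

theorem th1_qp {τ : ℂ} (hτ : 0 < τ.im) : QP τ 1 (-1) (-exp (-(Real.pi * I * τ))) fun z => th1 z τ :=
  ⟨th1_differentiable hτ, fun z => by rw [th1_add_pi]; ring, fun z => by
    rw [th1_add_pi_tau]; simp⟩

/-- A real positive nome in the upper half plane. -/
structure PosNome (τ : ℂ) : Prop where
  im_pos : 0 < τ.im
  nome_im : (exp (Real.pi * I * τ)).im = 0
  nome_pos : 0 < (exp (Real.pi * I * τ)).re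

theorem PosNome.double {τ : ℂ} (h : PosNome τ) : PosNome (2 * τ) := by
  have e : exp (Real.pi * I * (2 * τ)) = exp (Real.pi * I * τ) * exp (Real.pi * I * τ) := by
    rw [← exp_add]; ring_nf
  refine ⟨by have := h.im_pos; simp; exact this, ?_, ?_⟩
  · rw [e, mul_im, h.nome_im]; ring
  · rw [e, mul_re, h.nome_im]
    have := h.nome_pos
    nlinarith

theorem th4_half_pi_ne {τ : ℂ} (h : PosNome τ) : th4 (Real.pi / 2) τ ≠ 0 := by
  have hπ : (Real.pi : ℂ) ≠ 0 := by exact_mod_cast Real.pi_ne_zero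
  rw [th4_eq_jacobi, show (Real.pi : ℂ) / 2 / Real.pi + 1 / 2 = 0 + 1 by field_simp; norm_num,
    jacobiTheta₂_add_left]
  have hs := hasSum_jacobiTheta₂_term 0 h.im_pos
  set p := exp (Real.pi * I * τ) with hp
  have hpr : p = ((p.re : ℝ) : ℂ) := Complex.ext (by simp) (by simpa using h.nome_im)
  have ht : ∀ n : ℤ, (jacobiTheta₂_term n 0 τ).re = p.re ^ (n.natAbs ^ 2) := by
    intro n
    have : jacobiTheta₂_term n 0 τ = p ^ (n.natAbs ^ 2) := by
      unfold jacobiTheta₂_term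
      rw [hp, ← exp_nat_mul]
      congr 1
      have : ((n.natAbs ^ 2 : ℕ) : ℂ) = (n : ℂ) ^ 2 := by
        obtain ⟨k, rfl | rfl⟩ := n.eq_nat_or_neg
        · simp
        · simp
      rw [this]; ring
    rw [this, hpr, ← ofReal_pow, ofReal_re, ofReal_re]
  have hs2 := (Complex.hasSum_re hs)
  have h0 : (jacobiTheta₂_term 0 0 τ).re ≤ (jacobiTheta₂ 0 τ).re := by
    refine le_hasSum hs2 0 fun n _ => ?_
    rw [ht]
    exact pow_nonneg h.nome_pos.le _
  rw [ht] at h0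
  intro hz
  rw [hz] at h0
  norm_num at h0

theorem not_plat_of_im {τ : ℂ} (hτ : 0 < τ.im) {z : ℂ} {a b : ℝ}
    (hz : z = Real.pi * a + Real.pi * τ * b) (h : (∀ m : ℤ, a ≠ m) ∨ ∀ n : ℤ, b ≠ n) : ¬ PLat τ z := by
  rintro ⟨m, n, hmn⟩
  have hπ := Real.pi_ne_zero
  have e : Real.pi * (a : ℂ) + Real.pi * τ * b = Real.pi * m + Real.pi * τ * n := hz.symm.trans hmn
  have hi := congrArg Complex.im e
  have hr := congrArg Complex.re e
  simp at hi hr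
  have hb : b = n := by
    rcases hi with h | h
    · exact h
    · exact absurd h hτ.ne'
  have ha : a = m := by
    rw [hb] at hr
    have : Real.pi * a = Real.pi * m := by linarith
    exact mul_left_cancel₀ hπ this
  rcases h with h | h
  · exact h m ha
  · exact h n hb

theorem th1_eq_zero_iff {τ : ℂ} (h : PosNome τ) (z : ℂ) : th1 z τ = 0 ↔ PLat τ z := by
  have hq := th1_qp h.im_pos
  constructor
  · intro hz
    by_contra hL
    have := hq.eq_zero h.im_pos 1 (by simp) (by simp [exp_ne_zero]) [0, z] (by simp) (by simpa using hL)
      (by simp [hz, th1_zero])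
    have h2 := congrFun this (Real.pi / 2 - Real.pi * τ / 2)
    have h3 := th1_eq_th4 (Real.pi / 2 - Real.pi * τ / 2) τ
    simp only [Pi.zero_apply] at h2
    rw [h2, sub_add_cancel] at h3
    have := th4_half_pi_ne h
    simp [exp_ne_zero, this] at h3
  · intro hL
    exact hq.lattice_zero (by simp) (by simp [exp_ne_zero]) (th1_zero τ) (by simpa using hL)

theorem th4_eq_zero_iff {τ : ℂ} (h : PosNome τ) (z : ℂ) :
    th4 z τ = 0 ↔ PLat τ (z - Real.pi * τ / 2) := by
  rw [← th1_eq_zero_iff h]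
  have := th4_add_half (z - Real.pi * τ / 2) τ
  rw [sub_add_cancel] at this
  rw [this]
  simp [exp_ne_zero]

/-! ### Theta functions of the doubled nome -/

/-- `ϑ₁(z, p²)`. -/
def T1 (τ z : ℂ) : ℂ := th1 z (2 * τ)
/-- `ϑ₄(z, p²)`. -/
def T4 (τ z : ℂ) : ℂ := th4 z (2 * τ)
/-- `ϑ₁(z, p²) ϑ₄(z, p²)`, proportional to `ϑ₁(z, p)`. -/
def Lth (τ z : ℂ) : ℂ := T1 τ z * T4 τ z

section
variable {τ : ℂ}

theorem T1_neg (z : ℂ) : T1 τ (-z) = -T1 τ z := th1_neg z _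
theorem T4_neg (z : ℂ) : T4 τ (-z) = T4 τ z := th4_neg z _
theorem T1_zero : T1 τ 0 = 0 := th1_zero _
theorem T1_pi (z : ℂ) : T1 τ (z + Real.pi) = -T1 τ z := th1_add_pi z _
theorem T4_pi (z : ℂ) : T4 τ (z + Real.pi) = T4 τ z := th4_add_pi z _
theorem Lth_neg (z : ℂ) : Lth τ (-z) = -Lth τ z := by unfold Lth; rw [T1_neg, T4_neg]; ring
theorem Lth_pi (z : ℂ) : Lth τ (z + Real.pi) = -Lth τ z := by unfold Lth; rw [T1_pi, T4_pi]; ring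

/-- The multiplier of `T1`, `T4` under translation by `πτ`. -/
def mul1 (τ z : ℂ) : ℂ := I * exp (-(Real.pi * I * τ / 2) - I * z)

theorem mul1_ne (z : ℂ) : mul1 τ z ≠ 0 := by simp [mul1, exp_ne_zero]

theorem mul1_mul (x y : ℂ) : mul1 τ x * mul1 τ y = -exp (-(Real.pi * I * τ)) * exp (-I * (x + y)) := by
  have h : exp (-(Real.pi * I * τ / 2) - I * x) * exp (-(Real.pi * I * τ / 2) - I * y) =
    exp (-(Real.pi * I * τ)) * exp (-I * (x + y)) := by
    rw [← exp_add, ← exp_add]; congr 1; ring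
  unfold mul1
  linear_combination -h + (exp (-(Real.pi * I * τ / 2) - I * x) *
    exp (-(Real.pi * I * τ / 2) - I * y)) * I_mul_I

theorem T1_tau (z : ℂ) : T1 τ (z + Real.pi * τ) = mul1 τ z * T4 τ z := by
  have := th1_add_half z (2 * τ)
  unfold T1 T4 mul1
  rw [show z + Real.pi * τ = z + Real.pi * (2 * τ) / 2 by ring, this]
  ring_nf

theorem T4_tau (z : ℂ) : T4 τ (z + Real.pi * τ) = mul1 τ z * T1 τ z := by
  have := th4_add_half z (2 * τ)
  unfold T1 T4 mul1
  rw [show z + Real.pi * τ = z + Real.pi * (2 * τ) / 2 by ring, this]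
  ring_nf

theorem Lth_tau (z : ℂ) :
    Lth τ (z + Real.pi * τ) = -exp (-(Real.pi * I * τ)) * exp (-2 * I * z) * Lth τ z := by
  have h := mul1_mul (τ := τ) z z
  rw [show -I * (z + z) = -2 * I * z by ring] at h
  unfold Lth
  rw [T1_tau, T4_tau, ← h]; ring

theorem T1_qp (h : 0 < τ.im) : QP (2 * τ) 1 (-1) (-exp (-(Real.pi * I * (2 * τ)))) (T1 τ) :=
  th1_qp (by simpa using h)

theorem T4_qp (h : 0 < τ.im) : QP (2 * τ) 1 1 (-exp (-(Real.pi * I * (2 * τ)))) (T4 τ) :=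
  th4_qp (by simpa using h)

theorem T1_diff (h : 0 < τ.im) : Differentiable ℂ (T1 τ) := (T1_qp h).diff
theorem T4_diff (h : 0 < τ.im) : Differentiable ℂ (T4 τ) := (T4_qp h).diff
theorem Lth_diff (h : 0 < τ.im) : Differentiable ℂ (Lth τ) := (T1_diff h).mul (T4_diff h)

theorem Lth_qp (h : 0 < τ.im) : QP τ 1 (-1) (-exp (-(Real.pi * I * τ))) (Lth τ) :=
  ⟨Lth_diff h, fun z => by rw [Lth_pi]; ring, fun z => by rw [Lth_tau]; simp⟩

theorem T1_eq_zero_iff (h : PosNome τ) (z : ℂ) : T1 τ z = 0 ↔ PLat (2 * τ) z :=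
  th1_eq_zero_iff h.double z

theorem T4_eq_zero_iff (h : PosNome τ) (z : ℂ) : T4 τ z = 0 ↔ PLat (2 * τ) (z - Real.pi * τ) := by
  rw [show z - Real.pi * τ = z - Real.pi * (2 * τ) / 2 by ring]
  exact th4_eq_zero_iff h.double z

theorem Lth_eq_zero_iff (h : PosNome τ) (z : ℂ) : Lth τ z = 0 ↔ PLat τ z := by
  unfold Lth
  rw [mul_eq_zero, T1_eq_zero_iff h, T4_eq_zero_iff h]
  constructor
  · rintro (⟨m, n, e⟩ | ⟨m, n, e⟩)
    · exact ⟨m, 2 * n, by rw [e]; push_cast; ring⟩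
    · exact ⟨m, 2 * n + 1, by push_cast; linear_combination e⟩
  · rintro ⟨m, n, e⟩
    rcases Int.even_or_odd' n with ⟨k, rfl | rfl⟩
    · left; exact ⟨m, k, by rw [e]; push_cast; ring⟩
    · right; exact ⟨m, k, by rw [e]; push_cast; ring⟩

theorem two_im_pos (h : PosNome τ) : 0 < (2 * τ).im := h.double.im_pos

theorem T4_zero_ne (h : PosNome τ) : T4 τ 0 ≠ 0 := by
  rw [Ne, T4_eq_zero_iff h]
  refine not_plat_of_im (two_im_pos h) (a := 0) (b := -1 / 2) (by push_cast; ring) (Or.inr fun n hn => ?_)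
  have : (-1 : ℝ) = 2 * n := by linarith
  have : (-1 : ℤ) = 2 * n := by exact_mod_cast this
  omega

theorem Lth_half_pi_ne (h : PosNome τ) : Lth τ (Real.pi / 2) ≠ 0 := by
  rw [Ne, Lth_eq_zero_iff h]
  refine not_plat_of_im h.im_pos (a := 1 / 2) (b := 0) (by push_cast; ring) (Or.inl fun n hn => ?_)
  have : (1 : ℝ) = 2 * n := by linarith
  have : (1 : ℤ) = 2 * n := by exact_mod_cast this
  omega

theorem Lth_exists_ne (h : PosNome τ) : ∃ z, Lth τ z ≠ 0 := ⟨_, Lth_half_pi_ne h⟩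

/-- The constant in Landen's relation `ϑ₁(z, p) = C ϑ₁(z, p²) ϑ₄(z, p²)`. -/
def Clan (τ : ℂ) : ℂ := th1 (Real.pi / 2) τ / Lth τ (Real.pi / 2)

theorem Clan_ne (h : PosNome τ) : Clan τ ≠ 0 := by
  refine div_ne_zero ?_ (Lth_half_pi_ne h)
  rw [Ne, th1_eq_zero_iff h, ← Lth_eq_zero_iff h]
  exact Lth_half_pi_ne h

theorem half_pi_not_plat (h : PosNome τ) : ¬ PLat τ (Real.pi / 2) := by
  rw [← Lth_eq_zero_iff h]; exact Lth_half_pi_ne h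

theorem landen (h : PosNome τ) (z : ℂ) : th1 z τ = Clan τ * Lth τ z := by
  refine congrFun (QP.eq_of_list h.im_pos (th1_qp h.im_pos) ((Lth_qp h.im_pos).const_mul (Clan τ))
    (by simp) (by simp [exp_ne_zero]) [0, Real.pi / 2] (by simp) ?_ ?_) z
  · simpa using half_pi_not_plat h
  · have := Lth_half_pi_ne h
    simp only [List.mem_cons, List.not_mem_nil, or_false, forall_eq_or_imp, forall_eq]
    refine ⟨?_, ?_⟩
    · rw [th1_zero]; simp [Lth, T1_zero]
    · unfold Clan; field_simp

/-- The list `[0, πτ, y]` is pairwise inequivalent modulo `πℤ + 2πτℤ` for generic `y`. -/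
theorem pairwise_zero_tau (h : PosNome τ) {y : ℂ} (hy : Lth τ y ≠ 0) :
    [0, Real.pi * τ, y].Pairwise fun a b => ¬ PLat (2 * τ) (b - a) := by
  have h1 : ¬ PLat (2 * τ) y := by
    rw [← T1_eq_zero_iff h]; exact left_ne_zero_of_mul hy
  have h2 : ¬ PLat (2 * τ) (y - Real.pi * τ) := by
    rw [← T4_eq_zero_iff h]; exact right_ne_zero_of_mul hy
  have h3 : ¬ PLat (2 * τ) (Real.pi * τ) := by
    refine not_plat_of_im (two_im_pos h) (a := 0) (b := 1 / 2) (by push_cast; ring) (Or.inr fun n hn => ?_)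
    have : (1 : ℝ) = 2 * n := by linarith
    have : (1 : ℤ) = 2 * n := by exact_mod_cast this
    omega
  simp [h1, h2, h3]

theorem T1_add_sub (h : PosNome τ) (x y : ℂ) :
    T1 τ (x + y) * T1 τ (x - y) * T4 τ 0 ^ 2
      = T1 τ x ^ 2 * T4 τ y ^ 2 - T4 τ x ^ 2 * T1 τ y ^ 2 := by
  have hd1 := T1_diff h.im_pos
  have hd4 := T4_diff h.im_pos
  refine congrFun (entire_mul_cancel (f := fun y => T1 τ (x + y) * T1 τ (x - y) * T4 τ 0 ^ 2)
    (h := fun y => T1 τ x ^ 2 * T4 τ y ^ 2 - T4 τ x ^ 2 * T1 τ y ^ 2) (g := Lth τ)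
    (by fun_prop) (Lth_diff h.im_pos) (by fun_prop) (Lth_exists_ne h) fun y => ?_) y
  by_cases hy : Lth τ y = 0
  · rw [hy, mul_zero, mul_zero]
  congr 1
  have q1 := T1_qp h.im_pos
  have q4 := T4_qp h.im_pos
  have hE : exp (-(Real.pi * I * (2 * τ))) ≠ 0 := exp_ne_zero _
  have f1 := (((q1.shift y).mul (q1.shift (-y))).const_mul (T4 τ 0 ^ 2)).congr
    (d₁ := 1) (d₂ := exp (-(Real.pi * I * (2 * τ))) ^ 2) (by norm_num) (by
      have : exp (-2 * I * (1 : ℕ) * y) * exp (-2 * I * (1 : ℕ) * -y) = 1 := by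
        rw [← exp_add]; simp
      linear_combination exp (-(Real.pi * I * (2 * τ))) ^ 2 * this)
  have f2 := (((q1.mul q1).const_mul (T4 τ y ^ 2)).congr (d₁ := 1)
    (d₂ := exp (-(Real.pi * I * (2 * τ))) ^ 2) (by norm_num) (by ring)).sub
    (((q4.mul q4).const_mul (T1 τ y ^ 2)).congr (d₁ := 1)
      (d₂ := exp (-(Real.pi * I * (2 * τ))) ^ 2) (by norm_num) (by ring))
  have key := congrFun (QP.eq_of_list (two_im_pos h) f1 f2 one_ne_zero (pow_ne_zero _ hE)
    [0, Real.pi * τ, y] (by simp) (pairwise_zero_tau h hy) ?_) x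
  · simp only [← sub_eq_add_neg] at key
    linear_combination key
  · simp only [List.mem_cons, List.not_mem_nil, or_false, forall_eq_or_imp, forall_eq]
    refine ⟨?_, ?_, ?_⟩
    · rw [zero_add, zero_add, T1_neg, T1_zero]; ring
    · have m1 := mul1_mul (τ := τ) y (-y)
      have m2 := mul1_mul (τ := τ) 0 0
      rw [show -I * (y + -y) = -I * (0 + 0) by ring, ← m2] at m1
      rw [add_comm _ y, add_comm _ (-y), T1_tau, T1_tau, show Real.pi * τ = 0 + Real.pi * τ by ring,
        T1_tau, T4_tau, T4_neg, T1_zero]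
      linear_combination (T4 τ 0 ^ 2 * T4 τ y ^ 2) * m1
    · rw [add_neg_cancel, T1_zero]; ring

theorem T4_add_sub (h : PosNome τ) (x y : ℂ) :
    T4 τ (x + y) * T4 τ (x - y) * T4 τ 0 ^ 2
      = T4 τ x ^ 2 * T4 τ y ^ 2 - T1 τ x ^ 2 * T1 τ y ^ 2 := by
  have := T1_add_sub h (x + Real.pi * τ) y
  rw [show x + Real.pi * τ + y = x + y + Real.pi * τ by ring,
    show x + Real.pi * τ - y = x - y + Real.pi * τ by ring, T1_tau, T1_tau, T1_tau, T4_tau] at this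
  have m1 := mul1_mul (τ := τ) (x + y) (x - y)
  have m2 := mul1_mul (τ := τ) x x
  rw [show -I * (x + y + (x - y)) = -I * (x + x) by ring, ← m2] at m1
  have hm := mul_ne_zero (mul1_ne (τ := τ) x) (mul1_ne (τ := τ) x)
  apply mul_left_cancel₀ hm
  linear_combination this - (T4 τ (x + y) * T4 τ (x - y) * T4 τ 0 ^ 2) * m1

theorem T4_double (h : PosNome τ) (x : ℂ) :
    T4 τ (2 * x) * T4 τ 0 ^ 3 = T4 τ x ^ 4 - T1 τ x ^ 4 := by
  have := T4_add_sub h x x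
  rw [sub_self, ← two_mul] at this
  linear_combination this

/-! #### Special values at multiples of `η` -/

theorem three_eta : 3 * ηc = Real.pi := by unfold ηc; ring

theorem T1_two_eta : T1 τ (2 * ηc) = T1 τ ηc := by
  have := T1_pi (τ := τ) (-ηc)
  rw [T1_neg, neg_neg, ← three_eta, show -ηc + 3 * ηc = 2 * ηc by ring] at this
  exact this

theorem T4_two_eta : T4 τ (2 * ηc) = T4 τ ηc := by
  have := T4_pi (τ := τ) (-ηc)
  rw [T4_neg, ← three_eta, show -ηc + 3 * ηc = 2 * ηc by ring] at this
  exact this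

theorem T1_add_four_eta (u : ℂ) : T1 τ (u + 4 * ηc) = -T1 τ (u + ηc) := by
  rw [← T1_pi, ← three_eta]; ring_nf

theorem T4_add_four_eta (u : ℂ) : T4 τ (u + 4 * ηc) = T4 τ (u + ηc) := by
  rw [← T4_pi (u + ηc), ← three_eta]; ring_nf

theorem eta_mul_not_plat {τ : ℂ} (hτ : 0 < τ.im) {m : ℤ} (hm : ¬ (3 : ℤ) ∣ m) {z : ℂ} (hz : z = m * ηc) :
    ¬ PLat τ z := by
  refine not_plat_of_im hτ (a := m / 3) (b := 0) (by rw [hz]; unfold ηc; push_cast; ring)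
    (Or.inl fun n hn => hm ⟨n, ?_⟩)
  have : (m : ℝ) = 3 * n := by linarith
  exact_mod_cast this

theorem T1_eta_ne (h : PosNome τ) : T1 τ ηc ≠ 0 := by
  rw [Ne, T1_eq_zero_iff h]
  exact eta_mul_not_plat (two_im_pos h) (m := 1) (by decide) (by simp)

theorem T4_eta_ne (h : PosNome τ) : T4 τ ηc ≠ 0 := by
  rw [Ne, T4_eq_zero_iff h]
  refine not_plat_of_im (two_im_pos h) (a := 1 / 3) (b := -1 / 2) (by unfold ηc; push_cast; ring)
    (Or.inr fun n hn => ?_)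
  have : (-1 : ℝ) = 2 * n := by linarith
  have : (-1 : ℤ) = 2 * n := by exact_mod_cast this
  omega

theorem three_shift (h : PosNome τ) (u : ℂ) :
    T4 τ ηc * (T1 τ (u - 2 * ηc) * T4 τ u + T4 τ (u - 2 * ηc) * T1 τ u)
      = -(T4 τ 0 * (T1 τ (u + 2 * ηc) * T4 τ (u + 2 * ηc))) := by
  have q1 := T1_qp h.im_pos
  have q4 := T4_qp h.im_pos
  have hE : exp (-(Real.pi * I * (2 * τ))) ≠ 0 := exp_ne_zero _
  set E := exp (-(Real.pi * I * (2 * τ)))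
  have hw : exp (-2 * I * (1 : ℕ) * (2 * ηc)) ^ 2 = exp (-2 * I * (1 : ℕ) * -(2 * ηc)) := by
    rw [← exp_nat_mul]
    have : -2 * I * (1 : ℕ) * -(2 * ηc) = (2 : ℕ) * (-2 * I * (1 : ℕ) * (2 * ηc)) + 2 * Real.pi * I
        + 2 * Real.pi * I := by
      rw [← three_eta]; push_cast; ring
    rw [this, exp_periodic _, exp_periodic _]
  have f1 := (((q1.shift (-(2 * ηc))).mul q4).congr (d₁ := -1)
    (d₂ := E ^ 2 * exp (-2 * I * (1 : ℕ) * -(2 * ηc))) (by norm_num) (by ring)).add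
    (((q4.shift (-(2 * ηc))).mul q1).congr (d₁ := -1)
      (d₂ := E ^ 2 * exp (-2 * I * (1 : ℕ) * -(2 * ηc))) (by norm_num) (by ring))
  have f2 := ((q1.shift (2 * ηc)).mul (q4.shift (2 * ηc))).congr (d₁ := -1)
    (d₂ := E ^ 2 * exp (-2 * I * (1 : ℕ) * -(2 * ηc))) (by norm_num) (by
      rw [← hw]; ring)
  have key := congrFun (QP.eq_of_list (two_im_pos h) (f1.const_mul (T4 τ ηc))
    (f2.const_mul (-T4 τ 0)) (by norm_num)
    (mul_ne_zero (pow_ne_zero _ hE) (exp_ne_zero _)) [0, 2 * ηc, -(2 * ηc)] (by simp) ?_ ?_) u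
  · simp only [← sub_eq_add_neg] at key
    linear_combination key
  · have a1 := eta_mul_not_plat (two_im_pos h) (m := 2) (by decide) (z := 2 * ηc) (by simp)
    have a2 := eta_mul_not_plat (two_im_pos h) (m := -2) (by decide) (z := -(2 * ηc)) (by simp)
    have a3 := eta_mul_not_plat (two_im_pos h) (m := -4) (by decide) (z := -(2 * ηc) - 2 * ηc)
      (by push_cast; ring)
    simp [a1, a2, a3]
  · have b1 := T1_add_four_eta (τ := τ) 0
    have b4 := T4_add_four_eta (τ := τ) 0
    rw [zero_add, zero_add] at b1 b4
    simp only [List.mem_cons, List.not_mem_nil, or_false, forall_eq_or_imp, forall_eq]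
    refine ⟨?_, ?_, ?_⟩
    · rw [zero_add, zero_add, T1_zero, T1_neg, T1_two_eta, T4_two_eta]; ring
    · rw [add_neg_cancel, ← two_mul, show 2 * (2 * ηc) = 4 * ηc by ring, b1, b4, T1_zero,
        T1_two_eta, T4_two_eta]
      ring
    · rw [neg_add_cancel, T1_zero, ← neg_add, ← two_mul, show 2 * (2 * ηc) = 4 * ηc by ring,
        T1_neg, T4_neg, T4_neg, T1_neg, b1, b4, T1_two_eta, T4_two_eta]
      ring

theorem rv_eq (h : PosNome τ) (u : ℂ) : rv τ u = T4 τ 0 * Lth τ (u + ηc) := by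
  have := three_shift h (u + 2 * ηc)
  rw [add_sub_cancel_right, add_assoc, ← two_mul, show 2 * (2 * ηc) = 4 * ηc by ring,
    T1_add_four_eta, T4_add_four_eta] at this
  unfold rv av bv
  change T4 τ (2 * ηc) * T1 τ (u + 2 * ηc) * T4 τ u + T4 τ (2 * ηc) * T4 τ (u + 2 * ηc) * T1 τ u = _
  rw [T4_two_eta, Lth]
  linear_combination this

end

section
variable {τ : ℂ}

/-- `κ = ϑ₄(η,p²)/ϑ₄(0,p²)`. -/
def kap (τ : ℂ) : ℂ := T4 τ ηc / T4 τ 0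

theorem kap_ne (h : PosNome τ) : kap τ ≠ 0 := div_ne_zero (T4_eta_ne h) (T4_zero_ne h)

theorem T4_eta_eq (h : PosNome τ) : T4 τ ηc = kap τ * T4 τ 0 := by
  have := T4_zero_ne h
  unfold kap; field_simp

theorem T1_eta_sq (h : PosNome τ) : T1 τ ηc ^ 2 = zet τ * T4 τ ηc ^ 2 := by
  have := T4_eta_ne h
  change _ = (T1 τ ηc / T4 τ ηc) ^ 2 * _
  field_simp

theorem zet_ne (h : PosNome τ) : zet τ ≠ 0 :=
  pow_ne_zero 2 (div_ne_zero (T1_eta_ne h) (T4_eta_ne h))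

theorem kap_cube (h : PosNome τ) : (1 - zet τ ^ 2) * kap τ ^ 3 = 1 := by
  have h4 := T4_eta_ne h
  have h0 := T4_zero_ne h
  have := T4_double h ηc
  rw [T4_two_eta, show T1 τ ηc ^ 4 = (T1 τ ηc ^ 2) ^ 2 by ring, T1_eta_sq h] at this
  unfold kap
  rw [div_pow]
  have e : (1 - zet τ ^ 2) * T4 τ ηc ^ 3 = T4 τ 0 ^ 3 := by
    apply mul_left_cancel₀ h4
    linear_combination -this
  rw [← mul_div_assoc, e, div_self (pow_ne_zero 3 h0)]

theorem zet_sq_ne (h : PosNome τ) : 1 - zet τ ^ 2 ≠ 0 := by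
  intro h0
  have := kap_cube h
  rw [h0, zero_mul] at this
  exact zero_ne_one this

theorem one_sub_zet_ne (h : PosNome τ) : 1 - zet τ ≠ 0 := by
  intro h0
  exact zet_sq_ne h (by linear_combination (1 + zet τ) * h0)

theorem one_add_zet_ne (h : PosNome τ) : 1 + zet τ ≠ 0 := by
  intro h0
  exact zet_sq_ne h (by linear_combination (1 - zet τ) * h0)

/-- Denominator of the parametrising function `w`. -/
def Dth (τ x : ℂ) : ℂ := (T1 τ x ^ 2 - zet τ * T4 τ x ^ 2) * (T4 τ x ^ 2 - zet τ * T1 τ x ^ 2)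
/-- Numerator of the parametrising function `w`. -/
def Nth (τ x : ℂ) : ℂ := (1 - zet τ ^ 2) * Lth τ x ^ 2
/-- The parametrising function `w`. -/
def wv (τ x : ℂ) : ℂ := Nth τ x / Dth τ x

theorem T1_eta_shift (h : PosNome τ) (x : ℂ) :
    T1 τ (x + ηc) * T1 τ (x - ηc) = kap τ ^ 2 * (T1 τ x ^ 2 - zet τ * T4 τ x ^ 2) := by
  have h0 := T4_zero_ne h
  have := T1_add_sub h x ηc
  rw [T1_eta_sq h, T4_eta_eq h] at this
  apply mul_right_cancel₀ (pow_ne_zero 2 h0)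
  linear_combination this

theorem T4_eta_shift (h : PosNome τ) (x : ℂ) :
    T4 τ (x + ηc) * T4 τ (x - ηc) = kap τ ^ 2 * (T4 τ x ^ 2 - zet τ * T1 τ x ^ 2) := by
  have h0 := T4_zero_ne h
  have := T4_add_sub h x ηc
  rw [T1_eta_sq h, T4_eta_eq h] at this
  apply mul_right_cancel₀ (pow_ne_zero 2 h0)
  linear_combination this

theorem Lth_eta_shift (h : PosNome τ) (x : ℂ) :
    Lth τ (x + ηc) * Lth τ (x - ηc) = kap τ ^ 4 * Dth τ x := by
  unfold Lth Dth
  linear_combination T4 τ (x + ηc) * T4 τ (x - ηc) * T1_eta_shift h x +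
    kap τ ^ 2 * (T1 τ x ^ 2 - zet τ * T4 τ x ^ 2) * T4_eta_shift h x

theorem Dth_ne_iff (h : PosNome τ) (x : ℂ) : Dth τ x ≠ 0 ↔ Lth τ (x + ηc) ≠ 0 ∧ Lth τ (x - ηc) ≠ 0 := by
  rw [← mul_ne_zero_iff, Lth_eta_shift h, mul_ne_zero_iff]
  simp [kap_ne h]

theorem Dth_neg (x : ℂ) : Dth τ (-x) = Dth τ x := by
  unfold Dth; rw [T1_neg, T4_neg]; ring
theorem Nth_neg (x : ℂ) : Nth τ (-x) = Nth τ x := by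
  unfold Nth; rw [Lth_neg]; ring
theorem wv_neg (x : ℂ) : wv τ (-x) = wv τ x := by unfold wv; rw [Dth_neg, Nth_neg]

theorem mul1_pow_four (z : ℂ) :
    mul1 τ z ^ 4 = exp (-(Real.pi * I * τ)) ^ 2 * exp (-2 * I * (2 : ℕ) * z) := by
  have h := mul1_mul (τ := τ) z z
  have e : exp (-I * (z + z)) ^ 2 = exp (-2 * I * (2 : ℕ) * z) := by
    rw [← exp_nat_mul]; push_cast; ring_nf
  rw [← e]
  linear_combination (mul1 τ z * mul1 τ z - exp (-(Real.pi * I * τ)) * exp (-I * (z + z))) * h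

theorem Dth_pi (x : ℂ) : Dth τ (x + Real.pi) = Dth τ x := by
  unfold Dth; rw [T1_pi, T4_pi]; ring
theorem Nth_pi (x : ℂ) : Nth τ (x + Real.pi) = Nth τ x := by
  unfold Nth; rw [Lth_pi]; ring
theorem wv_pi (x : ℂ) : wv τ (x + Real.pi) = wv τ x := by unfold wv; rw [Dth_pi, Nth_pi]
theorem Dth_tau (x : ℂ) : Dth τ (x + Real.pi * τ) = mul1 τ x ^ 4 * Dth τ x := by
  unfold Dth; rw [T1_tau, T4_tau]; ring
theorem Nth_tau (x : ℂ) : Nth τ (x + Real.pi * τ) = mul1 τ x ^ 4 * Nth τ x := by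
  unfold Nth Lth; rw [T1_tau, T4_tau]; ring
theorem wv_tau (x : ℂ) : wv τ (x + Real.pi * τ) = wv τ x := by
  unfold wv
  rw [Dth_tau, Nth_tau, mul_div_mul_left _ _ (pow_ne_zero 4 (mul1_ne x))]

theorem Dth_diff (h : PosNome τ) : Differentiable ℂ (Dth τ) := by
  have h1 := T1_diff h.im_pos
  have h4 := T4_diff h.im_pos
  unfold Dth
  fun_prop

theorem Nth_diff (h : PosNome τ) : Differentiable ℂ (Nth τ) := by
  have h1 := Lth_diff h.im_pos
  unfold Nth
  fun_prop

theorem Dth_qp (h : PosNome τ) : QP τ 2 1 (exp (-(Real.pi * I * τ)) ^ 2) (Dth τ) :=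
  ⟨Dth_diff h, fun z => by rw [Dth_pi, one_mul], fun z => by rw [Dth_tau, mul1_pow_four]⟩

theorem Nth_qp (h : PosNome τ) : QP τ 2 1 (exp (-(Real.pi * I * τ)) ^ 2) (Nth τ) :=
  ⟨Nth_diff h, fun z => by rw [Nth_pi, one_mul], fun z => by rw [Nth_tau, mul1_pow_four]⟩

theorem Nth_Dth_sub (h : PosNome τ) (x y : ℂ) :
    Nth τ x * Dth τ y - Nth τ y * Dth τ x
      = -((1 - zet τ ^ 2) * zet τ * T4 τ 0 ^ 4 * (Lth τ (x + y) * Lth τ (x - y))) := by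
  have e : T4 τ 0 ^ 4 * (Lth τ (x + y) * Lth τ (x - y)) =
      (T1 τ x ^ 2 * T4 τ y ^ 2 - T4 τ x ^ 2 * T1 τ y ^ 2) *
      (T4 τ x ^ 2 * T4 τ y ^ 2 - T1 τ x ^ 2 * T1 τ y ^ 2) := by
    rw [← T1_add_sub h, ← T4_add_sub h]; unfold Lth; ring
  rw [mul_assoc, e]
  unfold Nth Dth Lth
  ring

theorem wv_sub (h : PosNome τ) {x y : ℂ} (hx : Dth τ x ≠ 0) (hy : Dth τ y ≠ 0) :
    wv τ x - wv τ y = -((1 - zet τ ^ 2) * zet τ * T4 τ 0 ^ 4 * (Lth τ (x + y) * Lth τ (x - y)))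
      / (Dth τ x * Dth τ y) := by
  rw [← Nth_Dth_sub h]
  unfold wv
  field_simp

theorem Lth_add_two_eta (x : ℂ) : Lth τ (x + 2 * ηc) = -Lth τ (x - ηc) := by
  rw [← Lth_pi, ← three_eta]; ring_nf

theorem Lth_sub_two_eta (x : ℂ) : Lth τ (x - 2 * ηc) = -Lth τ (x + ηc) := by
  have := Lth_pi (τ := τ) (x - 2 * ηc)
  rw [← three_eta, show x - 2 * ηc + 3 * ηc = x + ηc by ring] at this
  rw [this, neg_neg]

theorem Dth_add_eta (h : PosNome τ) (x : ℂ) :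
    kap τ ^ 4 * Dth τ (x + ηc) = -(Lth τ (x - ηc) * Lth τ x) := by
  rw [← Lth_eta_shift h, add_sub_cancel_right, add_assoc, ← two_mul, Lth_add_two_eta]; ring

theorem Dth_sub_eta (h : PosNome τ) (x : ℂ) :
    kap τ ^ 4 * Dth τ (x - ηc) = -(Lth τ x * Lth τ (x + ηc)) := by
  rw [← Lth_eta_shift h, sub_add_cancel, sub_sub, ← two_mul, Lth_sub_two_eta]; ring

theorem Dth_mul_shift (h : PosNome τ) (x : ℂ) :
    kap τ ^ 4 * (Dth τ (x + ηc) * Dth τ (x - ηc)) = Lth τ x ^ 2 * Dth τ x := by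
  have hk := kap_ne h
  apply mul_left_cancel₀ (pow_ne_zero 4 hk)
  linear_combination kap τ ^ 4 * Dth τ (x - ηc) * Dth_add_eta h x - Lth τ (x - ηc) * Lth τ x *
    Dth_sub_eta h x + Lth τ x ^ 2 * Lth_eta_shift h x

/-! #### The wheel relation -/

theorem theta_cross (h : PosNome τ) (x : ℂ) :
    kap τ * (T1 τ (x + ηc) * T4 τ (x - ηc) + T4 τ (x + ηc) * T1 τ (x - ηc)) = Lth τ x := by
  have hd1 := T1_diff h.im_pos
  have hd4 := T4_diff h.im_pos
  have hq : QP τ 1 (-1) (-exp (-(Real.pi * I * τ)))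
      fun x => T1 τ (x + ηc) * T4 τ (x - ηc) + T4 τ (x + ηc) * T1 τ (x - ηc) := by
    refine ⟨by fun_prop, fun z => ?_, fun z => ?_⟩
    · rw [show z + Real.pi + ηc = z + ηc + Real.pi by ring,
        show z + Real.pi - ηc = z - ηc + Real.pi by ring, T1_pi, T4_pi, T1_pi, T4_pi]; ring
    · rw [show z + Real.pi * τ + ηc = z + ηc + Real.pi * τ by ring,
        show z + Real.pi * τ - ηc = z - ηc + Real.pi * τ by ring, T1_tau, T4_tau, T1_tau, T4_tau]
      have := mul1_mul (τ := τ) (z + ηc) (z - ηc)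
      rw [show -I * (z + ηc + (z - ηc)) = -2 * I * z by ring] at this
      push_cast
      rw [mul_one]
      linear_combination (T1 τ (z + ηc) * T4 τ (z - ηc) + T4 τ (z + ηc) * T1 τ (z - ηc)) * this
  refine congrFun (QP.eq_of_list h.im_pos (hq.const_mul (kap τ)) (Lth_qp h.im_pos)
    (by simp) (by simp [exp_ne_zero]) [0, ηc] (by simp) ?_ ?_) x
  · simpa using eta_mul_not_plat h.im_pos (m := 1) (by decide) (z := ηc) (by simp)
  · simp only [List.mem_cons, List.not_mem_nil, or_false, forall_eq_or_imp, forall_eq]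
    refine ⟨?_, ?_⟩
    · rw [zero_add, zero_sub, T1_neg, T4_neg, Lth, T1_zero]; ring
    · rw [sub_self, T1_zero, ← two_mul, T1_two_eta, Lth, T4_eta_eq h]; ring

theorem wheel_theta (h : PosNome τ) (x : ℂ) :
    T1 τ x ^ 2 * T4 τ (x + ηc) ^ 2 + T4 τ x ^ 2 * T1 τ (x + ηc) ^ 2
      - (1 - zet τ ^ 2) * (T1 τ x * T4 τ x * T1 τ (x + ηc) * T4 τ (x + ηc))
      - zet τ * (T4 τ x ^ 2 * T4 τ (x + ηc) ^ 2 + T1 τ x ^ 2 * T1 τ (x + ηc) ^ 2) = 0 := by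
  have hd1 := T1_diff h.im_pos
  have hd4 := T4_diff h.im_pos
  have hk := kap_ne h
  refine congrFun (entire_mul_cancel (f := fun x => T1 τ x ^ 2 * T4 τ (x + ηc) ^ 2
      + T4 τ x ^ 2 * T1 τ (x + ηc) ^ 2
      - (1 - zet τ ^ 2) * (T1 τ x * T4 τ x * T1 τ (x + ηc) * T4 τ (x + ηc))
      - zet τ * (T4 τ x ^ 2 * T4 τ (x + ηc) ^ 2 + T1 τ x ^ 2 * T1 τ (x + ηc) ^ 2))
    (g := fun x => T1 τ x * T4 τ (x + ηc) + T4 τ x * T1 τ (x + ηc)) (h := fun _ => 0)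
    (by fun_prop) (by fun_prop) (by fun_prop) ⟨0, ?_⟩ fun x => ?_) x
  · simp [T1_zero, T4_zero_ne h, T1_eta_ne h]
  · have a1 := T1_eta_shift h x
    have a4 := T4_eta_shift h x
    have b1 := T1_eta_shift h (x + ηc)
    have b4 := T4_eta_shift h (x + ηc)
    have c1 : T1 τ (x + ηc + ηc) = -T1 τ (x - ηc) := by
      rw [← T1_pi, ← three_eta]; ring_nf
    have c4 : T4 τ (x + ηc + ηc) = T4 τ (x - ηc) := by
      rw [← T4_pi (x - ηc), ← three_eta]; ring_nf
    rw [c1, add_sub_cancel_right] at b1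
    rw [c4, add_sub_cancel_right] at b4
    apply mul_left_cancel₀ (pow_ne_zero 4 hk)
    generalize T1 τ (x - ηc) = u1 at *
    generalize T4 τ (x - ηc) = u4 at *
    generalize T1 τ (x + ηc) = v1 at *
    generalize T4 τ (x + ηc) = v4 at *
    generalize T1 τ x = x1 at *
    generalize T4 τ x = x4 at *
    linear_combination -(v4 * x1) * (v1 * u1 * b4 + kap τ ^ 2 * (v4 ^ 2 - zet τ * v1 ^ 2) * a1)
      - (v1 * x4) * (v4 * u4 * b1 + kap τ ^ 2 * (v1 ^ 2 - zet τ * v4 ^ 2) * a4)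

theorem hpol_wheel (h : PosNome τ) {x : ℂ} (hx : Dth τ x ≠ 0) (hy : Dth τ (x + ηc) ≠ 0) :
    hpol (zet τ) (wv τ x) (wv τ (x + ηc)) = 0 := by
  have key := wheel_theta h x
  unfold hpol wv
  have e : Dth τ x ^ 2 * Dth τ (x + ηc) ^ 2 - (3 + zet τ ^ 2) * (Nth τ x * Nth τ (x + ηc)) *
      (Dth τ x * Dth τ (x + ηc)) + (1 - zet τ ^ 2) * (Nth τ x * Nth τ (x + ηc)) *
      (Nth τ x * Dth τ (x + ηc) + Nth τ (x + ηc) * Dth τ x) = 0 := by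
    unfold Dth Nth Lth
    generalize T1 τ (x + ηc) = v1 at *
    generalize T4 τ (x + ηc) = v4 at *
    generalize T1 τ x = x1 at *
    generalize T4 τ x = x4 at *
    generalize zet τ = z at *
    linear_combination (z ^ 2 * (x1 ^ 2 * v4 ^ 2 + x4 ^ 2 * v1 ^ 2 + (1 - z ^ 2) * (x1 * x4 * v1 * v4)
      - z * (x4 ^ 2 * v4 ^ 2 + x1 ^ 2 * v1 ^ 2)) *
      (x4 ^ 2 * v4 ^ 2 + x1 ^ 2 * v1 ^ 2 - (1 - z ^ 2) * (x1 * x4 * v1 * v4)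
      - z * (x1 ^ 2 * v4 ^ 2 + x4 ^ 2 * v1 ^ 2)) *
      (x4 ^ 2 * v4 ^ 2 + x1 ^ 2 * v1 ^ 2 + (1 - z ^ 2) * (x1 * x4 * v1 * v4)
      - z * (x1 ^ 2 * v4 ^ 2 + x4 ^ 2 * v1 ^ 2))) * key
  field_simp
  linear_combination e

theorem wv_prod (h : PosNome τ) {x : ℂ} (h0 : Lth τ x ≠ 0) (h1 : Lth τ (x + ηc) ≠ 0)
    (h2 : Lth τ (x - ηc) ≠ 0) :
    (1 - zet τ ^ 2) * (wv τ x * wv τ (x + ηc) * wv τ (x - ηc)) = 1 := by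
  have hk := kap_ne h
  have hk3 := kap_cube h
  have e0 := Lth_eta_shift h x
  have e1 := Dth_add_eta h x
  have e2 := Dth_sub_eta h x
  have d0 : Dth τ x = Lth τ (x + ηc) * Lth τ (x - ηc) / kap τ ^ 4 := by
    field_simp; linear_combination -e0
  have d1 : Dth τ (x + ηc) = -(Lth τ (x - ηc) * Lth τ x) / kap τ ^ 4 := by
    field_simp; linear_combination e1
  have d2 : Dth τ (x - ηc) = -(Lth τ x * Lth τ (x + ηc)) / kap τ ^ 4 := by
    field_simp; linear_combination e2
  unfold wv
  rw [d0, d1, d2]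
  unfold Nth
  have hB := zet_sq_ne h
  field_simp
  have : ((1 - zet τ ^ 2) * kap τ ^ 3) ^ 4 = 1 := by rw [hk3]; ring
  linear_combination this

theorem Lth_ne_Dth (h : PosNome τ) {x : ℂ} (h0 : Lth τ x ≠ 0) (h1 : Lth τ (x + ηc) ≠ 0)
    (h2 : Lth τ (x - ηc) ≠ 0) : Dth τ x ≠ 0 ∧ Dth τ (x + ηc) ≠ 0 ∧ Dth τ (x - ηc) ≠ 0 := by
  refine ⟨(Dth_ne_iff h x).2 ⟨h1, h2⟩, ?_, ?_⟩
  · intro e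
    have := Dth_add_eta h x
    rw [e] at this
    simp [h0, h2] at this
  · intro e
    have := Dth_sub_eta h x
    rw [e] at this
    simp [h0, h1] at this

theorem wv_ne_zero (h : PosNome τ) {x : ℂ} (h0 : Lth τ x ≠ 0) (hd : Dth τ x ≠ 0) : wv τ x ≠ 0 :=
  div_ne_zero (mul_ne_zero (zet_sq_ne h) (pow_ne_zero 2 h0)) hd

theorem wv_sum (h : PosNome τ) {x : ℂ} (h0 : Lth τ x ≠ 0) (h1 : Lth τ (x + ηc) ≠ 0)
    (h2 : Lth τ (x - ηc) ≠ 0) :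
    (1 - zet τ ^ 2) * (wv τ x + wv τ (x + ηc) + wv τ (x - ηc)) = 3 + zet τ ^ 2 := by
  obtain ⟨d0, d1, d2⟩ := Lth_ne_Dth h h0 h1 h2
  have e1 := hpol_wheel h d0 d1
  have e2 := wv_prod h h0 h1 h2
  have n0 := wv_ne_zero h h0 d0
  have n1 := wv_ne_zero h h1 d1
  unfold hpol at e1
  apply mul_left_cancel₀ (mul_ne_zero n0 n1)
  linear_combination e1 + e2

/-! #### Special values -/

theorem T1_half_tau : T1 τ (Real.pi * τ / 2) = I * T4 τ (Real.pi * τ / 2) := by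
  have := T1_tau (τ := τ) (-(Real.pi * τ / 2))
  rw [show -(Real.pi * τ / 2) + Real.pi * τ = Real.pi * τ / 2 by ring, T4_neg] at this
  rw [this, mul1, show -(Real.pi * I * τ / 2) - I * -(Real.pi * τ / 2) = 0 by ring, exp_zero, mul_one]

theorem T1_half_tau_pi : T1 τ (Real.pi / 2 + Real.pi * τ / 2) = T4 τ (Real.pi / 2 + Real.pi * τ / 2) := by
  have e := T1_tau (τ := τ) (-(Real.pi / 2 + Real.pi * τ / 2))
  have e2 := T1_pi (τ := τ) (-(Real.pi / 2 + Real.pi * τ / 2) + Real.pi * τ)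
  rw [e, show -(Real.pi / 2 + Real.pi * τ / 2) + Real.pi * τ + Real.pi
    = Real.pi / 2 + Real.pi * τ / 2 by ring, T4_neg] at e2
  rw [e2, mul1, show -(Real.pi * I * τ / 2) - I * -(Real.pi / 2 + Real.pi * τ / 2) = Real.pi / 2 * I by ring,
    exp_pi_div_two_mul_I]
  linear_combination -T4 τ (Real.pi / 2 + Real.pi * τ / 2) * I_mul_I

theorem tau_half_ne (h : PosNome τ) (a : ℝ) : Lth τ (Real.pi * a + Real.pi * τ / 2) ≠ 0 := by
  rw [Ne, Lth_eq_zero_iff h]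
  refine not_plat_of_im h.im_pos (a := a) (b := 1 / 2) (by push_cast; ring) (Or.inr fun n hn => ?_)
  have : (1 : ℝ) = 2 * n := by linarith
  have : (1 : ℤ) = 2 * n := by exact_mod_cast this
  omega

theorem tau_half_ne' (h : PosNome τ) {z : ℂ} (a : ℝ) (hz : z = Real.pi * a + Real.pi * τ / 2) :
    Lth τ z ≠ 0 := hz ▸ tau_half_ne h a

theorem wv_half_tau (h : PosNome τ) : wv τ (Real.pi * τ / 2) = (1 - zet τ) / (1 + zet τ) := by
  have hl := tau_half_ne' h (z := Real.pi * τ / 2) 0 (by push_cast; ring)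
  have h4 : T4 τ (Real.pi * τ / 2) ≠ 0 := right_ne_zero_of_mul hl
  have := one_add_zet_ne h
  have e : Dth τ (Real.pi * τ / 2) = -(1 + zet τ) ^ 2 * T4 τ (Real.pi * τ / 2) ^ 4 := by
    unfold Dth; rw [T1_half_tau, mul_pow, I_sq]; ring
  unfold wv
  rw [e]
  unfold Nth Lth
  rw [T1_half_tau, show (I * T4 τ (Real.pi * τ / 2) * T4 τ (Real.pi * τ / 2)) ^ 2
    = I ^ 2 * T4 τ (Real.pi * τ / 2) ^ 4 by ring, I_sq]
  field_simp
  ring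

theorem wv_half_tau_pi (h : PosNome τ) :
    wv τ (Real.pi / 2 + Real.pi * τ / 2) = (1 + zet τ) / (1 - zet τ) := by
  have hl := tau_half_ne' h (z := Real.pi / 2 + Real.pi * τ / 2) (1 / 2) (by push_cast; ring)
  have h4 : T4 τ (Real.pi / 2 + Real.pi * τ / 2) ≠ 0 := right_ne_zero_of_mul hl
  have := one_sub_zet_ne h
  have e : Dth τ (Real.pi / 2 + Real.pi * τ / 2)
      = (1 - zet τ) ^ 2 * T4 τ (Real.pi / 2 + Real.pi * τ / 2) ^ 4 := by
    unfold Dth; rw [T1_half_tau_pi]; ring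
  unfold wv
  rw [e]
  unfold Nth Lth
  rw [T1_half_tau_pi]
  generalize T4 τ (Real.pi / 2 + Real.pi * τ / 2) = t at *
  field_simp
  ring

theorem wv_beta4 (h : PosNome τ) : wv τ (β4c τ) = J4c (zet τ) := by
  have l0 := tau_half_ne' h (z := Real.pi * τ / 2) 0 (by push_cast; ring)
  have l1 := tau_half_ne' h (z := Real.pi * τ / 2 + ηc) (1 / 3) (by unfold ηc; push_cast; ring)
  have l2 := tau_half_ne' h (z := Real.pi * τ / 2 - ηc) (-1 / 3) (by unfold ηc; push_cast; ring)
  have e := wv_sum h l0 l1 l2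
  have e2 : wv τ (Real.pi * τ / 2 - ηc) = wv τ (β4c τ) := by
    rw [← wv_neg, ← wv_tau]; congr 1; unfold β4c; ring
  have e3 : wv τ (Real.pi * τ / 2 + ηc) = wv τ (β4c τ) := by congr 1; unfold β4c; ring
  rw [e2, e3, wv_half_tau h] at e
  have h1 := one_add_zet_ne h
  have h2 := one_sub_zet_ne h
  unfold J4c
  field_simp at e ⊢
  have h3 : (2 : ℂ) * (1 + zet τ) ^ 2 ≠ 0 := by simp [h1]
  apply mul_left_cancel₀ h3
  linear_combination e

theorem wv_beta3 (h : PosNome τ) : wv τ (β3c τ) = J3c (zet τ) := by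
  have l0 := tau_half_ne' h (z := Real.pi / 2 + Real.pi * τ / 2) (1 / 2) (by push_cast; ring)
  have l1 := tau_half_ne' h (z := Real.pi / 2 + Real.pi * τ / 2 + ηc) (1 / 2 + 1 / 3)
    (by unfold ηc; push_cast; ring)
  have l2 := tau_half_ne' h (z := Real.pi / 2 + Real.pi * τ / 2 - ηc) (1 / 2 + -1 / 3)
    (by unfold ηc; push_cast; ring)
  have e := wv_sum h l0 l1 l2
  have e2 : wv τ (Real.pi / 2 + Real.pi * τ / 2 - ηc) = wv τ (β3c τ) := by
    rw [← wv_neg, ← wv_tau, ← wv_pi]; congr 1; unfold β3c; ring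
  have e3 : wv τ (Real.pi / 2 + Real.pi * τ / 2 + ηc) = wv τ (β3c τ) := by congr 1; unfold β3c; ring
  rw [e2, e3, wv_half_tau_pi h] at e
  have h1 := one_add_zet_ne h
  have h2 := one_sub_zet_ne h
  unfold J3c
  field_simp at e ⊢
  have h3 : (2 : ℂ) * (1 - zet τ) ^ 2 ≠ 0 := by simp [h2]
  apply mul_left_cancel₀ h3
  linear_combination e

theorem T4_double_shift (h : PosNome τ) {x : ℂ} (hx : Dth τ x ≠ 0) :
    zet τ ^ 2 * T4 τ 0 ^ 6 * (T4 τ (2 * (x + ηc)) * T4 τ (2 * (x - ηc)))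
      = (1 - zet τ ^ 2) * kap τ ^ 2 * Dth τ x ^ 2 *
        ((J3c (zet τ) - wv τ x) * (J4c (zet τ) - wv τ x)) := by
  have hk := kap_ne h
  have hk3 := kap_cube h
  have h1 := one_add_zet_ne h
  have h2 := one_sub_zet_ne h
  have d1 := T4_double h (x + ηc)
  have d2 := T4_double h (x - ηc)
  have hU := T4_eta_shift h x
  have hV := T1_eta_shift h x
  have hW := theta_cross h x
  have eR : (1 - zet τ ^ 2) * kap τ ^ 2 * Dth τ x ^ 2 *
        ((J3c (zet τ) - wv τ x) * (J4c (zet τ) - wv τ x)) =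
      kap τ ^ 2 * ((Dth τ x - (1 + zet τ) * Nth τ x) * (Dth τ x - (1 - zet τ) * Nth τ x)) := by
    unfold J3c J4c wv
    field_simp
    ring
  rw [eR]
  have eL : T4 τ 0 ^ 6 * (T4 τ (2 * (x + ηc)) * T4 τ (2 * (x - ηc))) =
      (T4 τ (x + ηc) ^ 4 - T1 τ (x + ηc) ^ 4) * (T4 τ (x - ηc) ^ 4 - T1 τ (x - ηc) ^ 4) := by
    linear_combination T4 τ 0 ^ 3 * T4 τ (2 * (x - ηc)) * d1 +
      (T4 τ (x + ηc) ^ 4 - T1 τ (x + ηc) ^ 4) * d2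
  rw [mul_assoc, eL]
  have eM : (T4 τ (x + ηc) ^ 4 - T1 τ (x + ηc) ^ 4) * (T4 τ (x - ηc) ^ 4 - T1 τ (x - ηc) ^ 4) =
      ((T4 τ (x + ηc) * T4 τ (x - ηc) + T1 τ (x + ηc) * T1 τ (x - ηc)) ^ 2
        - (T1 τ (x + ηc) * T4 τ (x - ηc) + T4 τ (x + ηc) * T1 τ (x - ηc)) ^ 2) *
      ((T4 τ (x + ηc) * T4 τ (x - ηc) - T1 τ (x + ηc) * T1 τ (x - ηc)) ^ 2
        + (T1 τ (x + ηc) * T4 τ (x - ηc) + T4 τ (x + ηc) * T1 τ (x - ηc)) ^ 2) := by ring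
  have hW' : T1 τ (x + ηc) * T4 τ (x - ηc) + T4 τ (x + ηc) * T1 τ (x - ηc)
      = (1 - zet τ ^ 2) * kap τ ^ 2 * Lth τ x := by
    apply mul_left_cancel₀ hk
    linear_combination hW - Lth τ x * hk3
  rw [eM, hU, hV, hW']
  have hk9 : (1 - zet τ ^ 2) ^ 2 * kap τ ^ 6 = 1 := by
    linear_combination ((1 - zet τ ^ 2) * kap τ ^ 3 + 1) * hk3
  rw [show kap τ ^ 2 * ((Dth τ x - (1 + zet τ) * Nth τ x) * (Dth τ x - (1 - zet τ) * Nth τ x))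
    = ((1 - zet τ ^ 2) ^ 2 * kap τ ^ 6) * kap τ ^ 2 *
    ((Dth τ x - (1 + zet τ) * Nth τ x) * (Dth τ x - (1 - zet τ) * Nth τ x)) by rw [hk9, one_mul]]
  unfold Dth Nth Lth
  ring

end

theorem getD_append_cons {α : Type*} (pre post : List α) (x d : α) (j : ℕ) :
    (pre ++ x :: post).getD j d =
      if j < pre.length then pre.getD j d
      else if j = pre.length then x else post.getD (j - pre.length - 1) d := by
  split_ifs with h1 h2
  · rw [List.getD_append _ _ _ _ h1]
  · subst h2; rw [List.getD_append_right _ _ _ _ le_rfl]; simp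
  · rw [List.getD_append_right _ _ _ _ (by omega)]
    obtain ⟨k, hk⟩ : ∃ k, j - pre.length = k + 1 := ⟨j - pre.length - 1, by omega⟩
    rw [hk]; simp

theorem prod_fin_getD {M : Type*} [CommMonoid M] {m : ℕ} (l : List M) (hl : l.length = m) (d : M) :
    ∏ j : Fin m, l.getD j d = l.prod := by
  subst hl
  simp [List.getD_eq_getElem, ← List.prod_ofFn]

theorem sum_fin_getD {m : ℕ} (l : List ℂ) (hl : l.length = m) (d : ℂ) :
    ∑ j : Fin m, l.getD j d = l.sum := by
  subst hl
  simp [List.getD_eq_getElem, ← List.sum_ofFn]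

theorem map_getD {α β : Type*} (f : α → β) (l : List α) (d : α) (j : ℕ) :
    f (l.getD j d) = (l.map f).getD j (f d) := by
  rw [List.getD_map]

/-- The sites of a chain: spectral parameter and spin. -/
abbrev SiteList := List (ℂ × Fin 2)

/-- Component of `Ψ_n` read off from a list of sites. -/
def PsiL (Ψ : PsiFam) (n : ℕ) (l : SiteList) : ℂ :=
  Ψ n (fun j => (l.getD j (0, 0)).1) (fun j => (l.getD j (0, 0)).2)

/-- Sum of the spectral parameters. -/
def usum (l : SiteList) : ℂ := (l.map Prod.fst).sum
/-- Product of the `σ^z` eigenvalues. -/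
def sgn (l : SiteList) : ℂ := (l.map fun s => if s.2 = 0 then (1 : ℂ) else -1).prod

theorem prod_erase_getD {m : ℕ} {α : Type*} (pre post : List α) (x d : α)
    (hl : pre.length + 1 + post.length = m) (f : α → ℂ) (i : Fin m) (hi : (i : ℕ) = pre.length) :
    ∏ j ∈ Finset.univ.erase i, f ((pre ++ x :: post).getD j d)
      = (pre.map f).prod * (post.map f).prod := by
  have h1 : ∏ j ∈ Finset.univ.erase i, f ((pre ++ x :: post).getD j d)
      = ∏ j ∈ Finset.univ.erase i, (pre.map f ++ 1 :: post.map f).getD j (f d) := by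
    refine Finset.prod_congr rfl fun j hj => ?_
    have hj : (j : ℕ) ≠ pre.length := by
      rw [← hi]; simpa [Fin.ext_iff] using hj
    rw [getD_append_cons, getD_append_cons]
    simp only [List.length_map, hj, if_false, List.getD_map]
    split_ifs <;> rfl
  rw [h1, Finset.prod_erase, prod_fin_getD]
  · simp
  · simp; omega
  · rw [getD_append_cons]; simp [hi]

section
variable {τ : ℂ} {Ψ : PsiFam} {n : ℕ}

theorem PsiL_diff (h : PsiEntire Ψ) (pre post : SiteList) (a : Fin 2)
    (hl : pre.length < 2 * n + 1) :
    Differentiable ℂ fun z => PsiL Ψ n (pre ++ (z, a) :: post) := by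
  convert h n (fun j => ((pre ++ ((0 : ℂ), a) :: post).getD j (0, 0)).1) ⟨pre.length, hl⟩
    (fun j => ((pre ++ ((0 : ℂ), a) :: post).getD j (0, 0)).2) using 2 with z
  unfold PsiL
  congr 1 <;> funext j <;> simp only [Function.update_apply, getD_append_cons, Fin.ext_iff]
  · split_ifs <;> first | rfl | omega
  · split_ifs <;> rfl

theorem PsiL_P1 (h : PsiP1 τ Ψ) (pre post : SiteList) (u v : ℂ) (a b : Fin 2)
    (hl : pre.length + 2 + post.length = 2 * n + 1) :
    ∑ s : Fin 2, ∑ t : Fin 2, Rcheckent τ (v - u) (a, b) (s, t)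
        * PsiL Ψ n (pre ++ (u, s) :: (v, t) :: post)
      = rv τ (v - u) * PsiL Ψ n (pre ++ (v, a) :: (u, b) :: post) := by
  have hi : pre.length < 2 * n + 1 := by omega
  have hj : pre.length + 1 < 2 * n + 1 := by omega
  have key := congrFun (h n (fun j => ((pre ++ (u, a) :: (v, b) :: post).getD j (0, 0)).1)
    ⟨pre.length, hi⟩ ⟨pre.length + 1, hj⟩ rfl)
    (fun j => ((pre ++ (u, a) :: (v, b) :: post).getD j (0, 0)).2)
  have e1 : ((pre ++ (u, a) :: (v, b) :: post).getD pre.length (0, 0)) = (u, a) := by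
    rw [getD_append_cons]; simp
  have e2 : ((pre ++ (u, a) :: (v, b) :: post).getD (pre.length + 1) (0, 0)) = (v, b) := by
    rw [getD_append_cons]; simp
  unfold applyRc at key
  simp only [e1, e2] at key
  have e3 : ∀ s t : Fin 2, PsiL Ψ n (pre ++ (u, s) :: (v, t) :: post) =
      Ψ n (fun j => ((pre ++ (u, a) :: (v, b) :: post).getD j (0, 0)).1)
        (Function.update (Function.update
          (fun j : Fin (2 * n + 1) => ((pre ++ (u, a) :: (v, b) :: post).getD j (0, 0)).2)
            ⟨pre.length, hi⟩ s) ⟨pre.length + 1, hj⟩ t) := by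
    intro s t
    unfold PsiL
    congr 1 <;> funext j <;> simp only [Function.update_apply, getD_append_cons, Fin.ext_iff]
    · split_ifs with h1 h2
      · rfl
      · rfl
      · obtain ⟨k, hk⟩ : ∃ k, (j : ℕ) - pre.length - 1 = k := ⟨_, rfl⟩
        rw [hk]; cases k <;> simp
    · by_cases h1 : (j : ℕ) < pre.length
      · simp [h1, show (j : ℕ) ≠ pre.length by omega, show (j : ℕ) ≠ pre.length + 1 by omega]
      by_cases h2 : (j : ℕ) = pre.length
      · simp [h2]
      by_cases h3 : (j : ℕ) = pre.length + 1
      · simp [h3]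
      · obtain ⟨k, hk⟩ : ∃ k, (j : ℕ) - pre.length - 1 = k + 1 :=
          ⟨(j : ℕ) - pre.length - 2, by omega⟩
        simp [h1, h2, h3, hk]
  have e4 : PsiL Ψ n (pre ++ (v, a) :: (u, b) :: post) =
      Ψ n (fun l => ((pre ++ (u, a) :: (v, b) :: post).getD
        ((Equiv.swap (⟨pre.length, hi⟩ : Fin (2 * n + 1)) ⟨pre.length + 1, hj⟩ l : Fin (2 * n + 1)) : ℕ)
          (0, 0)).1)
        (fun j => ((pre ++ (u, a) :: (v, b) :: post).getD j (0, 0)).2) := by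
    unfold PsiL
    congr 1 <;> funext j
    · rw [Equiv.swap_apply_def]
      simp only [Fin.ext_iff]
      split_ifs with h1 h2
      · simp only [h1, e2]; rw [getD_append_cons]; simp
      · simp only [h2, e1]; rw [getD_append_cons]; simp
      · simp only [getD_append_cons]
        split_ifs with h3
        · rfl
        · obtain ⟨k, hk⟩ : ∃ k, (j : ℕ) - pre.length - 1 = k + 1 :=
            ⟨(j : ℕ) - pre.length - 2, by omega⟩
          rw [hk]; simp
    · simp only [getD_append_cons]
      split_ifs with h1 h2
      · rfl
      · rfl
      · obtain ⟨k, hk⟩ : ∃ k, (j : ℕ) - pre.length - 1 = k := ⟨_, rfl⟩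
        rw [hk]; cases k <;> simp
  rw [e4, ← key]
  simp only [e3]

theorem PsiL_P2 (h : PsiP2 τ Ψ) (pre post : SiteList) (u : ℂ) (a : Fin 2)
    (hl : pre.length + 1 + post.length = 2 * n + 1) :
    PsiL Ψ n (pre ++ (u, flipS a) :: post)
      = (-(pnome τ)) ^ n * exp (-I * (usum pre + usum post - 2 * n * u))
        * PsiL Ψ n (pre ++ (u + Real.pi * τ, a) :: post) := by
  have hi : pre.length < 2 * n + 1 := by omega
  have key := h n (fun j => ((pre ++ (u, a) :: post).getD j (0, 0)).1)
    ⟨pre.length, hi⟩ (fun j => ((pre ++ (u, a) :: post).getD j (0, 0)).2)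
  have e1 : ((pre ++ (u, a) :: post).getD pre.length (0, 0)) = (u, a) := by
    rw [getD_append_cons]; simp
  have e2 : ∑ j : Fin (2 * n + 1), (((pre ++ (u, a) :: post).getD j (0, 0)).1 - u)
      = usum pre + usum post - 2 * n * u := by
    rw [Finset.sum_sub_distrib]
    have : ∑ j : Fin (2 * n + 1), ((pre ++ (u, a) :: post).getD j (0, 0)).1
        = usum pre + (u + usum post) := by
      simp only [map_getD Prod.fst]
      rw [sum_fin_getD]
      · simp [usum]
      · simp; omega
    rw [this]
    simp; ring
  simp only [e1, e2] at key
  convert key using 1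
  · unfold PsiL
    congr 1 <;> funext j <;> simp only [Function.update_apply, getD_append_cons, Fin.ext_iff] <;>
      split_ifs <;> first | rfl | omega
  · congr 1
    unfold PsiL
    congr 1 <;> funext j <;> simp only [Function.update_apply, getD_append_cons, Fin.ext_iff] <;>
      split_ifs <;> first | rfl | omega

theorem PsiL_P3_pi (h : PsiP3 τ Ψ) (pre post : SiteList) (u : ℂ) (a : Fin 2)
    (hl : pre.length + 1 + post.length = 2 * n + 1) :
    PsiL Ψ n (pre ++ (u + Real.pi, a) :: post)
      = sgn pre * sgn post * PsiL Ψ n (pre ++ (u, a) :: post) := by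
  have hi : pre.length < 2 * n + 1 := by omega
  have key := congrFun (h n (fun j => ((pre ++ (u, a) :: post).getD j (0, 0)).1)
    ⟨pre.length, hi⟩).1 (fun j => ((pre ++ (u, a) :: post).getD j (0, 0)).2)
  have e1 : ((pre ++ (u, a) :: post).getD pre.length (0, 0)) = (u, a) := by
    rw [getD_append_cons]; simp
  have e2 := prod_erase_getD pre post (u, a) (0, 0) hl
    (fun s => if s.2 = 0 then (1 : ℂ) else -1) ⟨pre.length, hi⟩ rfl
  simp only [e1, e2] at key
  refine Eq.trans ?_ key
  unfold PsiL
  congr 1 <;> funext j <;> simp only [Function.update_apply, getD_append_cons, Fin.ext_iff] <;>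
    split_ifs <;> first | rfl | omega

theorem PsiL_P3_tau (h : PsiP3 τ Ψ) (pre post : SiteList) (u : ℂ) (a : Fin 2)
    (hl : pre.length + 1 + post.length = 2 * n + 1) :
    PsiL Ψ n (pre ++ (u + 2 * Real.pi * τ, a) :: post)
      = (pnome τ ^ (4 * n))⁻¹ * exp (-2 * I * (2 * n * u - usum pre - usum post))
        * PsiL Ψ n (pre ++ (u, a) :: post) := by
  have hi : pre.length < 2 * n + 1 := by omega
  have key := congrFun (h n (fun j => ((pre ++ (u, a) :: post).getD j (0, 0)).1)
    ⟨pre.length, hi⟩).2 (fun j => ((pre ++ (u, a) :: post).getD j (0, 0)).2)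
  have e1 : ((pre ++ (u, a) :: post).getD pre.length (0, 0)) = (u, a) := by
    rw [getD_append_cons]; simp
  have e2 : ∑ j : Fin (2 * n + 1), (u - ((pre ++ (u, a) :: post).getD j (0, 0)).1)
      = 2 * n * u - usum pre - usum post := by
    rw [Finset.sum_sub_distrib]
    have : ∑ j : Fin (2 * n + 1), ((pre ++ (u, a) :: post).getD j (0, 0)).1
        = usum pre + (u + usum post) := by
      simp only [map_getD Prod.fst]
      rw [sum_fin_getD]
      · simp [usum]
      · simp; omega
    rw [this]
    simp; ring
  simp only [e1, e2] at key
  refine Eq.trans ?_ key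
  unfold PsiL
  congr 1 <;> funext j <;> simp only [Function.update_apply, getD_append_cons, Fin.ext_iff] <;>
    split_ifs <;> first | rfl | omega

theorem PsiL_P5 (h : PsiP5 τ Ψ) (pre post : SiteList) (u : ℂ) (a b : Fin 2)
    (hl : pre.length + post.length = 2 * n + 1) :
    PsiL Ψ (n + 1) (pre ++ (u, a) :: (u + 2 * ηc, b) :: post)
      = ((pre ++ post).map fun s => th1 (u - s.1 - 2 * ηc) τ).prod * singletC a b
        * PsiL Ψ n (pre ++ post) := by
  have hi : pre.length < 2 * (n + 1) + 1 := by omega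
  have hj : pre.length + 1 < 2 * (n + 1) + 1 := by omega
  have e1 : ((pre ++ (u, a) :: (u + 2 * ηc, b) :: post).getD pre.length (0, 0)) = (u, a) := by
    rw [getD_append_cons]; simp
  have e2 : ((pre ++ (u, a) :: (u + 2 * ηc, b) :: post).getD (pre.length + 1) (0, 0))
      = (u + 2 * ηc, b) := by
    rw [getD_append_cons]; simp
  have key := congrFun (h n
    (fun j => ((pre ++ (u, a) :: (u + 2 * ηc, b) :: post).getD j (0, 0)).1) pre.length hj
    (by simp only [e1, e2]))
    (fun j => ((pre ++ (u, a) :: (u + 2 * ηc, b) :: post).getD j (0, 0)).2)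
  have e3 : ∏ j ∈ (Finset.univ.erase (⟨pre.length, hi⟩ : Fin (2*(n+1)+1))).erase ⟨pre.length+1, hj⟩,
          th1 (u - ((pre ++ (u, a) :: (u + 2 * ηc, b) :: post).getD j (0, 0)).1 - 2*ηc) τ
      = ((pre ++ post).map fun s => th1 (u - s.1 - 2 * ηc) τ).prod := by
    have e4 : ∏ j ∈ (Finset.univ.erase (⟨pre.length, hi⟩ : Fin (2*(n+1)+1))).erase
          ⟨pre.length+1, hj⟩,
          th1 (u - ((pre ++ (u, a) :: (u + 2 * ηc, b) :: post).getD j (0, 0)).1 - 2*ηc) τ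
        = ∏ j ∈ (Finset.univ.erase (⟨pre.length, hi⟩ : Fin (2*(n+1)+1))).erase ⟨pre.length+1, hj⟩,
          ((pre.map fun s => th1 (u - s.1 - 2 * ηc) τ) ++ 1 :: 1 ::
            (post.map fun s => th1 (u - s.1 - 2 * ηc) τ)).getD j (th1 (u - 0 - 2 * ηc) τ) := by
      refine Finset.prod_congr rfl fun j hj => ?_
      have hj' : (j : ℕ) ≠ pre.length ∧ (j : ℕ) ≠ pre.length + 1 := by
        simp [Fin.ext_iff] at hj; tauto
      rw [getD_append_cons, getD_append_cons]
      simp only [List.length_map, hj'.1, if_false]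
      split_ifs
      · rw [map_getD (fun s : ℂ × Fin 2 => th1 (u - s.1 - 2 * ηc) τ)]
      · obtain ⟨k, hk⟩ : ∃ k, (j : ℕ) - pre.length - 1 = k + 1 :=
          ⟨(j : ℕ) - pre.length - 2, by omega⟩
        rw [hk]
        simp only [List.getD_cons_succ]
        rw [map_getD (fun s : ℂ × Fin 2 => th1 (u - s.1 - 2 * ηc) τ)]
    rw [e4, Finset.prod_erase, Finset.prod_erase, prod_fin_getD]
    · simp
    · simp; omega
    · rw [getD_append_cons]; simp
    · rw [getD_append_cons]; simp
  simp only [e1, e2, e3] at key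
  convert key using 1
  congr 1
  unfold PsiL delTwo
  refine congrArg _ (congrArg₂ (Ψ n) (funext fun j => ?_) (funext fun j => ?_)) <;> dsimp only <;>
    split_ifs with h1
  · rw [getD_append_cons, if_pos h1, List.getD_append _ _ _ _ h1]
  · rw [getD_append_cons, if_neg (by omega), if_neg (by omega),
      List.getD_append_right _ _ _ _ (by omega),
      show (j : ℕ) + 2 - pre.length - 1 = (j : ℕ) - pre.length + 1 by omega, List.getD_cons_succ]
  · rw [getD_append_cons, if_pos h1, List.getD_append _ _ _ _ h1]
  · rw [getD_append_cons, if_neg (by omega), if_neg (by omega),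
      List.getD_append_right _ _ _ _ (by omega),
      show (j : ℕ) + 2 - pre.length - 1 = (j : ℕ) - pre.length + 1 by omega, List.getD_cons_succ]

end

section
variable {τ : ℂ}

/-- The `↑↑` coefficient of the boundary covector. -/
def Ka (τ t x : ℂ) : ℂ := T1 τ (x - ηc) ^ 2 - t * T4 τ (x - ηc) ^ 2
/-- The `↓↓` coefficient of the boundary covector. -/
def Kd (τ t x : ℂ) : ℂ := T4 τ (x - ηc) ^ 2 - t * T1 τ (x - ηc) ^ 2

/-- Contraction of the first two sites with the boundary covector at `x`. -/
def con (τ t x : ℂ) (Φ : SiteList → ℂ) : SiteList → ℂ := fun l =>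
  Ka τ t x * Φ ((x, 0) :: (-x, 0) :: l) + Kd τ t x * Φ ((x, 1) :: (-x, 1) :: l)

/-- Iterated contraction, with `⟨↑| + ε⟨↓|` on the last site. -/
def Zl (τ t ε : ℂ) : List ℂ → (SiteList → ℂ) → ℂ
  | [], Φ => Φ [(0, 0)] + ε * Φ [(0, 1)]
  | x :: xs, Φ => Zl τ t ε xs (con τ t x Φ)

/-- The site lists occurring in `Zl`, with last spin `e`. -/
def Sites : List ℂ → Fin 2 → SiteList → Prop
  | [], e, l => l = [(0, e)]
  | x :: xs, e, l => ∃ a l', l = (x, a) :: (-x, a) :: l' ∧ Sites xs e l'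

theorem Sites.length : ∀ {xs : List ℂ} {e : Fin 2} {l : SiteList}, Sites xs e l →
    l.length = 2 * xs.length + 1
  | [], _, _, h => by cases h; rfl
  | x :: xs, e, l, h => by
    obtain ⟨a, l', rfl, h'⟩ := h
    have := h'.length
    simp; omega

theorem Sites.usum : ∀ {xs : List ℂ} {e : Fin 2} {l : SiteList}, Sites xs e l → usum l = 0
  | [], _, _, h => by cases h; simp [_root_.usum]
  | x :: xs, e, l, h => by
    obtain ⟨a, l', rfl, h'⟩ := h
    have := h'.usum
    simp only [_root_.usum] at this
    simp [_root_.usum, this]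

theorem Sites.sgn : ∀ {xs : List ℂ} {e : Fin 2} {l : SiteList}, Sites xs e l →
    sgn l = if e = 0 then 1 else -1
  | [], _, _, h => by cases h; simp [_root_.sgn]
  | x :: xs, e, l, h => by
    obtain ⟨a, l', rfl, h'⟩ := h
    have := h'.sgn
    simp only [_root_.sgn] at this
    simp only [_root_.sgn, List.map_cons, List.prod_cons, this]
    split_ifs <;> simp

theorem Sites.prod (f : ℂ → ℂ) : ∀ {xs : List ℂ} {e : Fin 2} {l : SiteList}, Sites xs e l →
    (l.map fun s => f s.1).prod = f 0 * (xs.map fun x => f x * f (-x)).prod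
  | [], _, _, h => by cases h; simp
  | x :: xs, e, l, h => by
    obtain ⟨a, l', rfl, h'⟩ := h
    have := h'.prod f
    simp only [List.map_cons, List.prod_cons, this]
    ring

theorem Zl_congr {t ε ε' c : ℂ} : ∀ (xs : List ℂ) {Φ Φ' : SiteList → ℂ},
    (∀ l, Sites xs 0 l → Φ l = c * Φ' l) → (∀ l, Sites xs 1 l → ε * Φ l = c * (ε' * Φ' l)) →
    Zl τ t ε xs Φ = c * Zl τ t ε' xs Φ'
  | [], Φ, Φ', h0, h1 => by
    have e0 := h0 _ rfl
    have e1 := h1 _ rfl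
    simp only [Zl]
    linear_combination e0 + e1
  | x :: xs, Φ, Φ', h0, h1 => by
    refine Zl_congr xs (fun l hl => ?_) (fun l hl => ?_)
    · have a := h0 _ ⟨0, l, rfl, hl⟩
      have b := h0 _ ⟨1, l, rfl, hl⟩
      unfold con
      linear_combination Ka τ t x * a + Kd τ t x * b
    · have a := h1 _ ⟨0, l, rfl, hl⟩
      have b := h1 _ ⟨1, l, rfl, hl⟩
      unfold con
      linear_combination Ka τ t x * a + Kd τ t x * b

theorem Zl_congr' {t ε c : ℂ} (xs : List ℂ) {Φ Φ' : SiteList → ℂ}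
    (h : ∀ e l, Sites xs e l → Φ l = c * Φ' l) : Zl τ t ε xs Φ = c * Zl τ t ε xs Φ' :=
  Zl_congr xs (h 0) (fun l hl => by rw [h 1 l hl]; ring)

theorem Zl_diff {t ε : ℂ} : ∀ (xs : List ℂ) {Φ : ℂ → SiteList → ℂ},
    (∀ e l, Sites xs e l → Differentiable ℂ fun z => Φ z l) →
    Differentiable ℂ fun z => Zl τ t ε xs (Φ z)
  | [], Φ, h => by
    have e0 := h 0 _ rfl
    have e1 := h 1 _ rfl
    simp only [Zl]
    fun_prop
  | x :: xs, Φ, h => by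
    refine Zl_diff xs (Φ := fun z => con τ t x (Φ z)) fun e l hl => ?_
    have a := h e _ ⟨0, l, rfl, hl⟩
    have b := h e _ ⟨1, l, rfl, hl⟩
    unfold con
    fun_prop

/-- Entire functions with fixed multipliers form a finite-dimensional space. -/
theorem qp_expand {σ : ℂ} (hσ : 0 < σ.im) (N : ℕ) {c₁ c₂ : ℂ} (h1 : c₁ ≠ 0) (h2 : c₂ ≠ 0) :
    ∃ (a : Fin (N + 1) → ℂ) (b : Fin (N + 1) → ℂ → ℂ), (∀ k, Differentiable ℂ (b k)) ∧
      ∀ f, QP σ N c₁ c₂ f → ∀ z, f z = ∑ k, f (a k) * b k z := by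
  let V : Submodule ℂ (ℂ → ℂ) :=
    { carrier := {f | QP σ N c₁ c₂ f}
      add_mem' := fun hf hg => hf.add hg
      zero_mem' := QP.zero
      smul_mem' := fun c f hf => hf.const_mul c }
  let a : Fin (N + 1) → ℂ := fun k => Real.pi * ((k : ℕ) / (N + 1) : ℝ)
  let ev : V →ₗ[ℂ] (Fin (N + 1) → ℂ) :=
    { toFun := fun f k => f.1 (a k), map_add' := fun f g => rfl, map_smul' := fun c f => rfl }
  have hinj : LinearMap.ker ev = ⊥ := by
    rw [LinearMap.ker_eq_bot']
    intro f hf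
    have : f.1 = 0 := by
      refine QP.eq_zero hσ N f.2 h1 h2 (List.ofFn a) (by simp) ?_ ?_
      · rw [List.pairwise_ofFn]
        intro i j hij
        refine not_plat_of_im hσ (a := (((j : ℕ) : ℝ) - (i : ℕ)) / (N + 1)) (b := 0) ?_ (Or.inl ?_)
        · simp only [a]; push_cast; ring
        · intro m hm
          have hN : (0 : ℝ) < N + 1 := by positivity
          rw [div_eq_iff hN.ne'] at hm
          have hi := i.2
          have hj := j.2
          have e : ((j : ℕ) : ℤ) - (i : ℕ) = m * (N + 1) := by exact_mod_cast hm
          have hij' : (i : ℕ) < j := hij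
          have h0 : 0 < m * ((N : ℤ) + 1) := by omega
          have hm0 : 0 < m := by
            by_contra hc
            push Not at hc
            nlinarith
          nlinarith
      · intro x hx
        obtain ⟨k, rfl⟩ := (List.mem_ofFn' _ _).1 hx
        exact congrFun hf k
    exact Subtype.ext this
  obtain ⟨g, hg⟩ := LinearMap.exists_leftInverse_of_injective ev hinj
  refine ⟨a, fun k => (g (Pi.single k 1)).1, fun k => QP.diff (g (Pi.single k 1)).2, fun f hf z => ?_⟩
  have e := congrArg (fun v : V => v.1 z) (LinearMap.congr_fun hg ⟨f, hf⟩)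
  simp only [LinearMap.comp_apply, LinearMap.id_apply] at e
  rw [← e]
  have e2 : ev ⟨f, hf⟩ = ∑ k, f (a k) • (Pi.single k (1 : ℂ) : Fin (N + 1) → ℂ) := by
    funext j
    simp [Finset.sum_apply, Pi.single_apply]
    rfl
  rw [e2, map_sum]
  simp only [map_smul]
  rw [AddSubmonoidClass.coe_finsetSum, Finset.sum_apply]
  rfl

end

/-- The defining properties of the family `Ψ`. -/
structure PsiOK (τ : ℂ) (Ψ : PsiFam) : Prop where
  ent : PsiEntire Ψ
  p1 : PsiP1 τ Ψ
  p2 : PsiP2 τ Ψ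
  p3 : PsiP3 τ Ψ
  p5 : PsiP5 τ Ψ
  p6 : PsiP6 Ψ

section
variable {τ : ℂ} {Ψ : PsiFam}

theorem sgn_cons (s : ℂ × Fin 2) (l : SiteList) :
    sgn (s :: l) = (if s.2 = 0 then 1 else -1) * sgn l := by simp [sgn]

theorem usum_cons (s : ℂ × Fin 2) (l : SiteList) : usum (s :: l) = s.1 + usum l := by simp [usum]

theorem usum_nil : usum [] = 0 := rfl
theorem sgn_nil : sgn [] = 1 := rfl

theorem sgn_ne : ∀ l : SiteList, sgn l ≠ 0
  | [] => one_ne_zero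
  | s :: l => by
    rw [sgn_cons]
    have := sgn_ne l
    split_ifs <;> simpa

theorem PsiL_pair_diff (h : PosNome τ) (hΨ : PsiOK τ Ψ) (n : ℕ) (a : Fin 2) (l : SiteList)
    (hl : l.length + 2 = 2 * n + 1) :
    Differentiable ℂ fun z => PsiL Ψ n ((z, a) :: (-z, a) :: l) := by
  set s : ℂ := (if a = 0 then 1 else -1) * sgn l with hs
  have hs0 : s ≠ 0 := by rw [hs]; have := sgn_ne l; split_ifs <;> simpa
  set c : ℂ := -(pnome τ ^ (4 * n))⁻¹ * exp (2 * I * usum l) * exp (-(Real.pi * I * (2 * τ))) with hc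
  have hc0 : c ≠ 0 := by rw [hc]; simp [pnome, exp_ne_zero]
  have h2 : 0 < (2 * τ).im := by simpa using h.im_pos
  have q4 := T4_qp h.im_pos
  have hq : ∀ z2, QP (2 * τ) (2 * n + 1) s c
      (fun z1 => PsiL Ψ n ((z1, a) :: (z2, a) :: l) * T4 τ (z1 + z2)) := by
    intro z2
    refine ⟨?_, fun z => ?_, fun z => ?_⟩
    · have := PsiL_diff (n := n) hΨ.ent [] ((z2, a) :: l) a (by simp)
      have := q4.diff
      simp only [List.nil_append] at *
      fun_prop
    · have e := PsiL_P3_pi (n := n) hΨ.p3 [] ((z2, a) :: l) z a (by simp; omega)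
      simp only [List.nil_append, sgn_nil, sgn_cons, one_mul] at e
      rw [e, show z + Real.pi + z2 = z + z2 + Real.pi by ring, q4.pi, ← hs]
      ring
    · have e := PsiL_P3_tau (n := n) hΨ.p3 [] ((z2, a) :: l) z a (by simp; omega)
      simp only [List.nil_append, usum_nil, usum_cons] at e
      rw [show z + Real.pi * (2 * τ) = z + 2 * Real.pi * τ by ring, e,
        show z + 2 * Real.pi * τ + z2 = z + z2 + Real.pi * (2 * τ) by ring, q4.tau, hc]
      have e1 : exp (-2 * I * (2 * n * z - 0 - (z2 + usum l))) * exp (-2 * I * (1 : ℕ) * (z + z2))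
          = exp (2 * I * usum l) * exp (-2 * I * (2 * n + 1 : ℕ) * z) := by
        rw [← exp_add, ← exp_add]; congr 1; push_cast; ring
      linear_combination -(pnome τ ^ (4 * n))⁻¹ * PsiL Ψ n ((z, a) :: (z2, a) :: l) *
        exp (-(Real.pi * I * (2 * τ))) * T4 τ (z + z2) * e1
  obtain ⟨α, b, hb, hexp⟩ := qp_expand h2 (2 * n + 1) hs0 hc0
  have h40 := T4_zero_ne h
  have key : ∀ z, PsiL Ψ n ((z, a) :: (-z, a) :: l)
      = (T4 τ 0)⁻¹ * ∑ k, PsiL Ψ n ((α k, a) :: (-z, a) :: l) * T4 τ (α k + -z) * b k z := by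
    intro z
    have := hexp _ (hq (-z)) z
    rw [add_neg_cancel] at this
    rw [← this]
    field_simp
  have e : (fun z => PsiL Ψ n ((z, a) :: (-z, a) :: l)) = fun z =>
      (T4 τ 0)⁻¹ * ∑ k, PsiL Ψ n ((α k, a) :: (-z, a) :: l) * T4 τ (α k + -z) * b k z := funext key
  rw [e]
  have h4 := q4.diff
  have hp : ∀ k, Differentiable ℂ fun z => PsiL Ψ n ((α k, a) :: (-z, a) :: l) := by
    intro k
    have := PsiL_diff (n := n) hΨ.ent [(α k, a)] l a (by simp; omega)
    exact this.comp differentiable_neg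
  refine Differentiable.const_mul (Differentiable.fun_sum fun k _ => ?_) _
  exact ((hp k).mul (by fun_prop)).mul (hb k)

theorem Ka_pi (t x : ℂ) : Ka τ t (x + Real.pi) = Ka τ t x := by
  unfold Ka
  rw [show x + Real.pi - ηc = x - ηc + Real.pi by ring, T1_pi, T4_pi]; ring

theorem Kd_pi (t x : ℂ) : Kd τ t (x + Real.pi) = Kd τ t x := by
  unfold Kd
  rw [show x + Real.pi - ηc = x - ηc + Real.pi by ring, T1_pi, T4_pi]; ring

theorem Ka_tau (t x : ℂ) : Ka τ t (x + Real.pi * τ) = mul1 τ (x - ηc) ^ 2 * Kd τ t x := by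
  unfold Ka Kd
  rw [show x + Real.pi * τ - ηc = x - ηc + Real.pi * τ by ring, T1_tau, T4_tau]; ring

theorem Kd_tau (t x : ℂ) : Kd τ t (x + Real.pi * τ) = mul1 τ (x - ηc) ^ 2 * Ka τ t x := by
  unfold Ka Kd
  rw [show x + Real.pi * τ - ηc = x - ηc + Real.pi * τ by ring, T1_tau, T4_tau]; ring

theorem PsiL_pair_pi (hΨ : PsiOK τ Ψ) (n : ℕ) (a : Fin 2) (l : SiteList)
    (hl : l.length + 2 = 2 * n + 1) (z : ℂ) :
    PsiL Ψ n ((z + Real.pi, a) :: (-(z + Real.pi), a) :: l) = PsiL Ψ n ((z, a) :: (-z, a) :: l) := by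
  have e1 := PsiL_P3_pi (n := n) hΨ.p3 [] ((-(z + Real.pi), a) :: l) z a (by simp; omega)
  have e2 := PsiL_P3_pi (n := n) hΨ.p3 [(z, a)] l (-(z + Real.pi)) a (by simp; omega)
  simp only [List.nil_append, List.cons_append, sgn_nil, sgn_cons, one_mul, mul_one] at e1 e2
  rw [show -(z + Real.pi) + Real.pi = -z by ring] at e2
  rw [e1, e2]

theorem exp_pnome (m : ℕ) : exp (-(m * (Real.pi * I * τ))) = (pnome τ ^ m)⁻¹ := by
  rw [exp_neg, exp_nat_mul]; rfl

theorem PsiL_pair_tau (hΨ : PsiOK τ Ψ) (n : ℕ) (a : Fin 2) (l : SiteList)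
    (hl : l.length + 2 = 2 * n + 1) (hu : usum l = 0) (z : ℂ) :
    PsiL Ψ n ((z + Real.pi * τ, a) :: (-(z + Real.pi * τ), a) :: l)
      = (pnome τ ^ (2 * n + 1))⁻¹ * exp (-2 * I * (2 * n + 1) * z) *
        PsiL Ψ n ((z, flipS a) :: (-z, flipS a) :: l) := by
  have e1 := PsiL_P2 (n := n) hΨ.p2 [] ((-(z + Real.pi * τ), a) :: l) z a (by simp; omega)
  have e2 := PsiL_P2 (n := n) hΨ.p2 [(z, flipS a)] l (-(z + Real.pi * τ)) (flipS a) (by simp; omega)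
  have hf : flipS (flipS a) = a := by fin_cases a <;> rfl
  simp only [List.nil_append, List.cons_append, usum_nil, usum_cons, hu, hf] at e1 e2
  rw [show -(z + Real.pi * τ) + Real.pi * τ = -z by ring] at e2
  rw [e1] at e2
  have hp : (-(pnome τ)) ^ n ≠ 0 := pow_ne_zero _ (neg_ne_zero.2 (exp_ne_zero _))
  have hE := exp_ne_zero (-I * (0 + (-(z + Real.pi * τ) + 0) - 2 * n * z))
  apply mul_left_cancel₀ (mul_ne_zero hp hE)
  rw [e2]
  have e3 : exp (-I * (z + 0 + 0 - 2 * n * -(z + Real.pi * τ)))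
    = exp (-I * (0 + (-(z + Real.pi * τ) + 0) - 2 * n * z)) * (pnome τ ^ (2 * n + 1))⁻¹ *
      exp (-2 * I * (2 * n + 1) * z) := by
    rw [← exp_pnome, ← exp_add, ← exp_add]; congr 1; push_cast; ring
  linear_combination (-pnome τ) ^ n * PsiL Ψ n ((z, flipS a) :: (-z, flipS a) :: l) * e3

theorem Zl_qp (h : PosNome τ) (hΨ : PsiOK τ Ψ) (t ε : ℂ) (n : ℕ) (xs : List ℂ)
    (hn : xs.length + 1 = n) :
    QP τ (2 * n + 2) 1 (-exp (2 * I * ηc) * (pnome τ ^ (2 * n + 2))⁻¹)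
      (fun z => Zl τ t ε (z :: xs) (PsiL Ψ n)) := by
  have hd1 := T1_diff h.im_pos
  have hd4 := T4_diff h.im_pos
  refine ⟨?_, fun z => ?_, fun z => ?_⟩
  · refine Zl_diff xs (Φ := fun z => con τ t z (PsiL Ψ n)) fun e l hl => ?_
    have hl' := hl.length
    have d0 := PsiL_pair_diff h hΨ n 0 l (by omega)
    have d1 := PsiL_pair_diff h hΨ n 1 l (by omega)
    unfold con Ka Kd
    fun_prop
  · refine Zl_congr' xs fun e l hl => ?_
    have hl' := hl.length
    unfold con
    rw [Ka_pi, Kd_pi, PsiL_pair_pi hΨ n 0 l (by omega), PsiL_pair_pi hΨ n 1 l (by omega), one_mul]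
  · refine Zl_congr' xs fun e l hl => ?_
    have hl' := hl.length
    unfold con
    rw [Ka_tau, Kd_tau, PsiL_pair_tau hΨ n 0 l (by omega) hl.usum,
      PsiL_pair_tau hΨ n 1 l (by omega) hl.usum]
    have f0 : flipS 0 = 1 := rfl
    have f1 : flipS 1 = 0 := rfl
    rw [f0, f1]
    have e3 : mul1 τ (z - ηc) ^ 2 * ((pnome τ ^ (2 * n + 1))⁻¹ * exp (-2 * I * (2 * n + 1) * z))
      = -exp (2 * I * ηc) * (pnome τ ^ (2 * n + 2))⁻¹ * exp (-2 * I * (2 * n + 2 : ℕ) * z) := by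
      rw [sq, mul1_mul, ← exp_pnome, ← exp_pnome]
      have e4 : exp (-(Real.pi * I * τ)) * exp (-I * (z - ηc + (z - ηc))) *
          (exp (-((2 * n + 1 : ℕ) * (Real.pi * I * τ))) * exp (-2 * I * (2 * n + 1) * z))
          = exp (2 * I * ηc) * exp (-((2 * n + 2 : ℕ) * (Real.pi * I * τ))) *
            exp (-2 * I * (2 * n + 2 : ℕ) * z) := by
        simp only [← exp_add]; congr 1; push_cast; ring
      linear_combination -e4
    linear_combination (Kd τ t z * PsiL Ψ n ((z, 1) :: (-z, 1) :: l) +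
      Ka τ t z * PsiL Ψ n ((z, 0) :: (-z, 0) :: l)) * e3

/-- Auxiliary addition formulas behind the reflection `x ↦ -x`. -/
theorem T_reflect (h : PosNome τ) (x : ℂ) :
    T1 τ (x + ηc) ^ 2 * T4 τ ηc * T4 τ (2 * x) - T4 τ (x + ηc) ^ 2 * T1 τ ηc * T1 τ (2 * x)
      = T4 τ 0 * T4 τ (2 * x + 2 * ηc) * T1 τ (x - ηc) ^ 2 ∧
    T4 τ (x + ηc) ^ 2 * T4 τ ηc * T4 τ (2 * x) - T1 τ (x + ηc) ^ 2 * T1 τ ηc * T1 τ (2 * x)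
      = T4 τ 0 * T4 τ (2 * x + 2 * ηc) * T4 τ (x - ηc) ^ 2 := by
  have h40 := T4_zero_ne h
  have e1 := T1_add_sub h (x - ηc) (x + ηc)
  have e4 := T4_add_sub h (x - ηc) (x + ηc)
  have ed := T4_double h (x + ηc)
  rw [show x - ηc + (x + ηc) = 2 * x by ring, show x - ηc - (x + ηc) = -(2 * ηc) by ring] at e1 e4
  rw [T1_neg, T1_two_eta] at e1
  rw [T4_neg, T4_two_eta] at e4
  rw [show 2 * (x + ηc) = 2 * x + 2 * ηc by ring] at ed
  constructor <;> apply mul_left_cancel₀ (pow_ne_zero 2 h40)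
  · linear_combination T1 τ (x + ηc) ^ 2 * e4 + T4 τ (x + ηc) ^ 2 * e1 - T1 τ (x - ηc) ^ 2 * ed
  · linear_combination T4 τ (x + ηc) ^ 2 * e4 + T1 τ (x + ηc) ^ 2 * e1 - T4 τ (x - ηc) ^ 2 * ed

theorem Ka_neg (t x : ℂ) : Ka τ t (-x) = T1 τ (x + ηc) ^ 2 - t * T4 τ (x + ηc) ^ 2 := by
  unfold Ka; rw [show -x - ηc = -(x + ηc) by ring, T1_neg, T4_neg]; ring

theorem Kd_neg (t x : ℂ) : Kd τ t (-x) = T4 τ (x + ηc) ^ 2 - t * T1 τ (x + ηc) ^ 2 := by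
  unfold Kd; rw [show -x - ηc = -(x + ηc) by ring, T1_neg, T4_neg]; ring

theorem Zl_reflect (h : PosNome τ) (hΨ : PsiOK τ Ψ) (t ε : ℂ) (n : ℕ) (xs : List ℂ)
    (hn : xs.length + 1 = n) {x : ℂ} (hx : Lth τ (ηc - 2 * x) ≠ 0) :
    T1 τ (2 * x + 2 * ηc) * Zl τ t ε (-x :: xs) (PsiL Ψ n)
      = T1 τ (-2 * x + 2 * ηc) * Zl τ t ε (x :: xs) (PsiL Ψ n) := by
  have hr : rv τ (-x - x) = T4 τ 0 * Lth τ (ηc - 2 * x) := by rw [rv_eq h]; congr 2; ring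
  have hr0 : rv τ (-x - x) ≠ 0 := by rw [hr]; exact mul_ne_zero (T4_zero_ne h) hx
  have key : Zl τ t ε (-x :: xs) (fun l => T1 τ (2 * x + 2 * ηc) * PsiL Ψ n l)
      = T1 τ (-2 * x + 2 * ηc) * Zl τ t ε (x :: xs) (PsiL Ψ n) := by
    refine Zl_congr' xs fun e l hl => ?_
    have hl' := hl.length
    apply mul_left_cancel₀ hr0
    have p0 := PsiL_P1 (n := n) hΨ.p1 [] l x (-x) 0 0 (by simp; omega)
    have p1 := PsiL_P1 (n := n) hΨ.p1 [] l x (-x) 1 1 (by simp; omega)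
    simp only [Fin.sum_univ_two, List.nil_append, Rcheckent, Rent] at p0 p1
    simp at p0 p1
    unfold con
    simp only [neg_neg]
    have ea : av τ (-x - x) = T4 τ ηc * T1 τ (-2 * x + 2 * ηc) * T4 τ (2 * x) := by
      change T4 τ (2 * ηc) * T1 τ (-x - x + 2 * ηc) * T4 τ (-x - x) = _
      rw [T4_two_eta, show -x - x = -(2 * x) by ring, T4_neg]; ring_nf
    have ed : dv τ (-x - x) = -(T1 τ ηc * T1 τ (-2 * x + 2 * ηc) * T1 τ (2 * x)) := by
      change T1 τ (2 * ηc) * T1 τ (-x - x + 2 * ηc) * T1 τ (-x - x) = _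
      rw [T1_two_eta, show -x - x = -(2 * x) by ring, T1_neg]; ring_nf
    have hL : Lth τ (ηc - 2 * x) = T1 τ (2 * x + 2 * ηc) * T4 τ (2 * x + 2 * ηc) := by
      rw [show ηc - 2 * x = -(2 * x - ηc) by ring, Lth_neg, ← Lth_add_two_eta]; rfl
    obtain ⟨r1, r4⟩ := T_reflect h x
    rw [hr, hL] at p0 p1 ⊢
    rw [ea, ed] at p0 p1
    rw [Ka_neg, Kd_neg]
    unfold Ka Kd
    generalize PsiL Ψ n ((x, 0) :: (-x, 0) :: l) = P0 at *
    generalize PsiL Ψ n ((x, 1) :: (-x, 1) :: l) = P1 at *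
    generalize PsiL Ψ n ((-x, 0) :: (x, 0) :: l) = Q0 at *
    generalize PsiL Ψ n ((-x, 1) :: (x, 1) :: l) = Q1 at *
    linear_combination -T1 τ (2 * x + 2 * ηc) * (T1 τ (x + ηc) ^ 2 - t * T4 τ (x + ηc) ^ 2) * p0
      - T1 τ (2 * x + 2 * ηc) * (T4 τ (x + ηc) ^ 2 - t * T1 τ (x + ηc) ^ 2) * p1
      + T1 τ (-2 * x + 2 * ηc) * T1 τ (2 * x + 2 * ηc) * ((r1 - t * r4) * P0 + (r4 - t * r1) * P1)
  rw [← key]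
  symm
  exact Zl_congr' (-x :: xs) fun e l hl => rfl

end

section
variable {τ : ℂ} {Ψ : PsiFam}

/-- The exchange relations for functions of site lists of length `N`. -/
def Exch (τ : ℂ) (N : ℕ) (Φ : SiteList → ℂ) : Prop :=
  ∀ (pre post : SiteList) (u v : ℂ) (a b : Fin 2), pre.length + 2 + post.length = N →
    ∑ s, ∑ t, Rcheckent τ (v - u) (a, b) (s, t) * Φ (pre ++ (u, s) :: (v, t) :: post)
      = rv τ (v - u) * Φ (pre ++ (v, a) :: (u, b) :: post)

theorem PsiL_exch (hΨ : PsiOK τ Ψ) (n : ℕ) : Exch τ (2 * n + 1) (PsiL Ψ n) :=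
  fun pre post u v a b hl => PsiL_P1 hΨ.p1 pre post u v a b hl

theorem Exch.con {N : ℕ} {Φ : SiteList → ℂ} (hΦ : Exch τ (N + 2) Φ) (t x : ℂ) :
    Exch τ N (con τ t x Φ) := by
  intro pre post u v a b hl
  have h0 := hΦ ((x, 0) :: (-x, 0) :: pre) post u v a b (by simp; omega)
  have h1 := hΦ ((x, 1) :: (-x, 1) :: pre) post u v a b (by simp; omega)
  simp only [Fin.sum_univ_two, List.cons_append] at h0 h1
  simp only [Fin.sum_univ_two, _root_.con]
  linear_combination Ka τ t x * h0 + Kd τ t x * h1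

theorem K_cross (h : PosNome τ) (t x y : ℂ) :
    Ka τ t x * Kd τ t y - Kd τ t x * Ka τ t y
      = -((1 - t ^ 2) * T4 τ 0 ^ 2 * T1 τ (-x - y + 2 * ηc) * T1 τ (x - y)) := by
  have := T1_add_sub h (x - ηc) (y - ηc)
  rw [show x - ηc + (y - ηc) = -(-x - y + 2 * ηc) by ring, T1_neg,
    show x - ηc - (y - ηc) = x - y by ring] at this
  unfold Ka Kd
  linear_combination -(1 - t ^ 2) * this

theorem K_diag (h : PosNome τ) (t x y : ℂ) :
    Ka τ t x * Ka τ t y - Kd τ t x * Kd τ t y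
      = -((1 - t ^ 2) * T4 τ 0 ^ 2 * T4 τ (-x - y + 2 * ηc) * T4 τ (x - y)) := by
  have := T4_add_sub h (x - ηc) (y - ηc)
  rw [show x - ηc + (y - ηc) = -(-x - y + 2 * ηc) by ring, T4_neg,
    show x - ηc - (y - ηc) = x - y by ring] at this
  unfold Ka Kd
  linear_combination (1 - t ^ 2) * this

theorem con_swap (h : PosNome τ) {N : ℕ} {Φ : SiteList → ℂ} (hΦ : Exch τ (N + 4) Φ) (t : ℂ)
    {x y : ℂ} (h1 : Lth τ (ηc - x - y) ≠ 0) (h2 : Lth τ (ηc + x - y) ≠ 0) (l : SiteList)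
    (hl : l.length = N) :
    con τ t y (con τ t x Φ) l = con τ t x (con τ t y Φ) l := by
  have hs : rv τ (-x - y) ≠ 0 := by
    rw [rv_eq h, show -x - y + ηc = ηc - x - y by ring]; exact mul_ne_zero (T4_zero_ne h) h1
  have hw : rv τ (x - y) ≠ 0 := by
    rw [rv_eq h, show x - y + ηc = ηc + x - y by ring]; exact mul_ne_zero (T4_zero_ne h) h2
  have X := K_cross h t x y
  have Y := K_diag h t x y
  have e1 : cv τ (-x - y) * av τ (x - y) * (Ka τ t x * Kd τ t y - Kd τ t x * Ka τ t y)
      = av τ (-x - y) * dv τ (x - y) * (Ka τ t x * Ka τ t y - Kd τ t x * Kd τ t y) := by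
    rw [X, Y]; unfold av cv dv T1 T4; ring
  have e2 : bv τ (-x - y) * cv τ (x - y) * (Ka τ t x * Kd τ t y - Kd τ t x * Ka τ t y)
      = dv τ (-x - y) * bv τ (x - y) * (Ka τ t x * Ka τ t y - Kd τ t x * Kd τ t y) := by
    rw [X, Y]; unfold bv cv dv T1 T4; ring
  have A1 : ∀ a d, rv τ (x - y) * (rv τ (-x - y) *
      Φ ((x, a) :: (-x, a) :: (y, d) :: (-y, d) :: l))
      = ∑ s, ∑ t, Rcheckent τ (-x - y) (a, d) (s, t) *
        ∑ i, ∑ j, Rcheckent τ (x - y) (a, s) (i, j) *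
          Φ ((y, i) :: (x, j) :: (-x, t) :: (-y, d) :: l) := by
    intro a d
    have p := hΦ [(x, a)] ((-y, d) :: l) y (-x) a d (by simp; omega)
    simp only [List.cons_append, List.nil_append] at p
    rw [← p, Finset.mul_sum]
    refine Finset.sum_congr rfl fun s _ => ?_
    rw [Finset.mul_sum]
    refine Finset.sum_congr rfl fun t _ => ?_
    have q := hΦ [] ((-x, t) :: (-y, d) :: l) y x a s (by simp; omega)
    simp only [List.nil_append] at q
    rw [q]; ring
  have A2 : ∀ a d, rv τ (x - y) * (rv τ (-x - y) *
      Φ ((y, a) :: (-y, a) :: (x, d) :: (-x, d) :: l))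
      = ∑ s, ∑ t, Rcheckent τ (-x - y) (a, d) (s, t) *
        ∑ i, ∑ j, Rcheckent τ (x - y) (t, d) (i, j) *
          Φ ((y, a) :: (x, s) :: (-x, i) :: (-y, j) :: l) := by
    intro a d
    have p := hΦ [(y, a)] ((-x, d) :: l) x (-y) a d (by simp; omega)
    simp only [List.cons_append, List.nil_append] at p
    rw [show -y - x = -x - y by ring] at p
    rw [← p, Finset.mul_sum]
    refine Finset.sum_congr rfl fun s _ => ?_
    rw [Finset.mul_sum]
    refine Finset.sum_congr rfl fun t _ => ?_
    have q := hΦ [(y, a), (x, s)] l (-x) (-y) t d (by simp; omega)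
    simp only [List.cons_append, List.nil_append] at q
    rw [show -y - -x = x - y by ring] at q
    rw [q]; ring
  apply mul_left_cancel₀ (mul_ne_zero hw hs)
  unfold con
  have a00 := A1 0 0
  have a01 := A1 0 1
  have a10 := A1 1 0
  have a11 := A1 1 1
  have b00 := A2 0 0
  have b01 := A2 0 1
  have b10 := A2 1 0
  have b11 := A2 1 1
  simp only [Fin.sum_univ_two, Rcheckent, Rent] at a00 a01 a10 a11 b00 b01 b10 b11
  simp at a00 a01 a10 a11 b00 b01 b10 b11
  linear_combination Ka τ t x * Ka τ t y * (a00 - b00) + Ka τ t x * Kd τ t y * (a01 - b10)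
    + Kd τ t x * Ka τ t y * (a10 - b01) + Kd τ t x * Kd τ t y * (a11 - b11)
    + (Φ ((y, 0) :: (x, 0) :: (-x, 1) :: (-y, 1) :: l) -
       Φ ((y, 1) :: (x, 1) :: (-x, 0) :: (-y, 0) :: l)) * e1
    + (Φ ((y, 0) :: (x, 1) :: (-x, 0) :: (-y, 1) :: l) -
       Φ ((y, 1) :: (x, 0) :: (-x, 1) :: (-y, 0) :: l)) * e2

end

section
variable {τ : ℂ} {Ψ : PsiFam}

/-- The scalar product with the vector `Ψ_n(x₁,-x₁,…,x_n,-x_n,0)`. -/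
def Zn (τ t ε : ℂ) (Ψ : PsiFam) (xs : List ℂ) : ℂ := Zl τ t ε xs (PsiL Ψ xs.length)

/-- Genericity of a pair of spectral parameters for the exchange relation. -/
def Gen (τ x y : ℂ) : Prop :=
  Lth τ (ηc - x - y) ≠ 0 ∧ Lth τ (ηc + x - y) ≠ 0 ∧ Lth τ (ηc + y - x) ≠ 0

theorem Gen.symm {x y : ℂ} (h : Gen τ x y) : Gen τ y x :=
  ⟨by rw [sub_right_comm]; exact h.1, h.2.2, h.2.1⟩

theorem Zl_perm (h : PosNome τ) (t ε : ℂ) {l₁ l₂ : List ℂ} (hp : l₁.Perm l₂) :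
    ∀ {Φ : SiteList → ℂ}, Exch τ (2 * l₁.length + 1) Φ → l₁.Pairwise (Gen τ) →
      Zl τ t ε l₁ Φ = Zl τ t ε l₂ Φ := by
  induction hp with
  | nil => intros; rfl
  | cons x _ ih =>
    intro Φ hΦ hg
    exact ih (Exch.con (by simpa [mul_add, add_right_comm] using hΦ) t x) (List.pairwise_cons.1 hg).2
  | @swap x y l =>
    intro Φ hΦ hg
    have hg' := (List.pairwise_cons.1 hg).1 x (by simp)
    simp only [Zl]
    rw [← one_mul (Zl τ t ε l (con τ t y (con τ t x Φ)))]
    refine Zl_congr' l fun e m hm => ?_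
    rw [one_mul]
    refine con_swap h (N := 2 * l.length + 1) ?_ t hg'.1 hg'.2.1 m hm.length
    simpa [mul_add, add_right_comm, add_assoc] using hΦ
  | @trans l₁ l₂ l₃ h1 h2 ih1 ih2 =>
    intro Φ hΦ hg
    rw [ih1 hΦ hg]
    exact ih2 (by rw [← h1.length_eq]; exact hΦ) ((h1.pairwise_iff (fun h => Gen.symm h)).1 hg)

theorem Zn_perm (h : PosNome τ) (hΨ : PsiOK τ Ψ) (t ε : ℂ) {l₁ l₂ : List ℂ} (hp : l₁.Perm l₂)
    (hg : l₁.Pairwise (Gen τ)) : Zn τ t ε Ψ l₁ = Zn τ t ε Ψ l₂ := by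
  unfold Zn
  rw [← hp.length_eq]
  exact Zl_perm h t ε hp (PsiL_exch hΨ _) hg

theorem Zn_cons_perm (h : PosNome τ) (hΨ : PsiOK τ Ψ) (t ε z : ℂ) {l₁ l₂ : List ℂ} (hp : l₁.Perm l₂)
    (hg : l₁.Pairwise (Gen τ)) : Zn τ t ε Ψ (z :: l₁) = Zn τ t ε Ψ (z :: l₂) := by
  unfold Zn
  rw [List.length_cons, List.length_cons, ← hp.length_eq]
  exact Zl_perm h t ε hp (Exch.con (PsiL_exch hΨ (l₁.length + 1)) t z) hg

theorem Zn_nil (hΨ : PsiOK τ Ψ) (t ε : ℂ) : Zn τ t ε Ψ [] = 1 + ε := by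
  have h6 := hΨ.p6
  simp [Zn, Zl, PsiL, h6 _ _]

theorem list_prod_map_mul_const {α : Type*} (l : List α) (c : ℂ) (f g : α → ℂ)
    (hfg : ∀ x, f x = c * g x) : (l.map f).prod = c ^ l.length * (l.map g).prod := by
  induction l with
  | nil => simp
  | cons a l ih => simp only [List.map_cons, List.prod_cons, ih, hfg, List.length_cons]; ring

theorem list_prod_map_congr {α : Type*} (l : List α) (f g : α → ℂ)
    (hfg : ∀ x, f x = g x) : (l.map f).prod = (l.map g).prod := by
  rw [funext hfg]

/-- The product over sites arising from the reduction relations. -/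
def Lprod (τ y : ℂ) (xs : List ℂ) : ℂ := (xs.map fun x => Lth τ (y + x) * Lth τ (y - x)).prod

theorem Sites.prod_th1 (h : PosNome τ) {xs : List ℂ} {e : Fin 2} {l : SiteList} (hl : Sites xs e l)
    (y : ℂ) : (l.map fun s => th1 (y + s.1) τ).prod
      = Clan τ ^ (2 * xs.length + 1) * (Lth τ y * Lprod τ y xs) := by
  rw [hl.prod (fun s => th1 (y + s) τ), add_zero, landen h]
  rw [list_prod_map_mul_const xs (Clan τ ^ 2) _ (fun x => Lth τ (y + x) * Lth τ (y - x))]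
  · unfold Lprod; ring
  · intro x; rw [landen h, landen h, sub_eq_add_neg]; ring

theorem th1_neg_pi_sub (h : PosNome τ) (y : ℂ) : th1 (-Real.pi - y) τ = th1 y τ := by
  have := th1_add_pi y τ
  rw [show -Real.pi - y = -(y + Real.pi) by ring, th1_neg, this, neg_neg]

theorem Zn_beta4 (h : PosNome τ) (hΨ : PsiOK τ Ψ) (t ε : ℂ) (xs : List ℂ) :
    Zn τ t ε Ψ (-β4c τ :: xs) = (-1) ^ (xs.length + 1) * exp (-(I * (Real.pi * τ / 2))) *
      exp (-I * ((2 * xs.length + 3) * ηc)) * (Ka τ t (-β4c τ) - Kd τ t (-β4c τ)) *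
      Clan τ ^ (2 * xs.length + 1) * (Lth τ (Real.pi * τ / 2) * Lprod τ (Real.pi * τ / 2) xs) *
      Zn τ t ε Ψ xs := by
  unfold Zn
  rw [List.length_cons]
  set n := xs.length with hn
  refine Zl_congr' xs fun e l hl => ?_
  have hlen := hl.length
  have p2 : ∀ a, PsiL Ψ (n + 1) ((-β4c τ, a) :: (β4c τ, a) :: l)
      = (-1) ^ (n + 1) * exp (-(I * (Real.pi * τ / 2))) * exp (-I * ((2 * n + 3) * ηc)) *
        PsiL Ψ (n + 1) ((-β4c τ, a) :: (-β4c τ + 2 * ηc, flipS a) :: l) := by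
    intro a
    have e2 := PsiL_P2 (n := n + 1) hΨ.p2 [(-β4c τ, a)] l (-β4c τ + 2 * ηc) a (by simp; omega)
    simp only [List.cons_append, List.nil_append, usum_cons, usum_nil, hl.usum] at e2
    rw [show -β4c τ + 2 * ηc + Real.pi * τ = β4c τ by unfold β4c; ring] at e2
    rw [e2]
    have e3 : exp (-(I * (Real.pi * τ / 2))) * exp (-I * ((2 * n + 3) * ηc)) *
        (exp (↑(n + 1) * (Real.pi * I * τ)) *
        exp (-I * (-β4c τ + 0 + 0 - 2 * ((n + 1 : ℕ) : ℂ) * (-β4c τ + 2 * ηc)))) = 1 := by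
      rw [← exp_add, ← exp_add, ← exp_add, ← exp_zero]; congr 1; unfold β4c; push_cast; ring
    rw [exp_nat_mul] at e3
    have e4 : (-1 : ℂ) ^ (n + 1) * (-(pnome τ)) ^ (n + 1) = exp (Real.pi * I * τ) ^ (n + 1) := by
      rw [← mul_pow, neg_mul_neg, one_mul]; rfl
    linear_combination (-PsiL Ψ (n + 1) ((-β4c τ, a) :: (β4c τ, a) :: l)) * (e3 +
      exp (-(I * (Real.pi * τ / 2))) * exp (-I * ((2 * n + 3) * ηc)) *
        exp (-I * (-β4c τ + 0 + 0 - 2 * ((n + 1 : ℕ) : ℂ) * (-β4c τ + 2 * ηc))) * e4)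
  have p5 : ∀ a, PsiL Ψ (n + 1) ((-β4c τ, a) :: (-β4c τ + 2 * ηc, flipS a) :: l)
      = Clan τ ^ (2 * n + 1) * (Lth τ (Real.pi * τ / 2) * Lprod τ (Real.pi * τ / 2) xs) *
        singletC a (flipS a) * PsiL Ψ n l := by
    intro a
    have e5 := PsiL_P5 (n := n) hΨ.p5 [] l (-β4c τ) a (flipS a) (by simp; omega)
    simp only [List.nil_append] at e5
    rw [e5, ← hl.prod_th1 h]
    congr 2
    refine list_prod_map_congr _ _ _ fun s => ?_
    rw [← th1_neg_pi_sub h]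
    congr 1; unfold β4c; linear_combination three_eta
  simp only [con, neg_neg]
  rw [p2, p2, p5, p5]
  have f0 : flipS 0 = 1 := rfl
  have f1 : flipS 1 = 0 := rfl
  rw [f0, f1]
  have s0 : singletC 0 1 = 1 := by simp [singletC]
  have s1 : singletC 1 0 = -1 := by simp [singletC]
  rw [s0, s1]
  ring

theorem Zn_beta3 (h : PosNome τ) (hΨ : PsiOK τ Ψ) (t ε : ℂ) (xs : List ℂ) :
    Zn τ t ε Ψ (-β3c τ :: xs) = -I * exp (-(I * (Real.pi * τ / 2))) *
      exp (-I * ((2 * xs.length + 3) * ηc)) * (Ka τ t (-β3c τ) + Kd τ t (-β3c τ)) *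
      Clan τ ^ (2 * xs.length + 1) * (Lth τ (Real.pi / 2 + Real.pi * τ / 2) *
        Lprod τ (Real.pi / 2 + Real.pi * τ / 2) xs) *
      Zn τ t (-ε) Ψ xs := by
  unfold Zn
  rw [List.length_cons]
  set n := xs.length with hn
  have key : ∀ e l, Sites xs e l → con τ t (-β3c τ) (PsiL Ψ (n + 1)) l =
      -I * exp (-(I * (Real.pi * τ / 2))) *
      exp (-I * ((2 * n + 3) * ηc)) * (Ka τ t (-β3c τ) + Kd τ t (-β3c τ)) *
      Clan τ ^ (2 * n + 1) * (Lth τ (Real.pi / 2 + Real.pi * τ / 2) *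
        Lprod τ (Real.pi / 2 + Real.pi * τ / 2) xs) * (if e = 0 then 1 else -1) * PsiL Ψ n l := by
    intro e l hl
    have hlen := hl.length
    have p2 : ∀ a, PsiL Ψ (n + 1) ((-β3c τ, a) :: (β3c τ, a) :: l)
        = (if a = 0 then 1 else -1) * (if e = 0 then 1 else -1) *
          (-I * exp (-(I * (Real.pi * τ / 2))) * exp (-I * ((2 * n + 3) * ηc))) *
          PsiL Ψ (n + 1) ((-β3c τ, a) :: (-β3c τ + 2 * ηc, flipS a) :: l) := by
      intro a
      have e3 := PsiL_P3_pi (n := n + 1) hΨ.p3 [(-β3c τ, a)] l (β3c τ - Real.pi) a (by simp; omega)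
      have e2 := PsiL_P2 (n := n + 1) hΨ.p2 [(-β3c τ, a)] l (-β3c τ + 2 * ηc) a (by simp; omega)
      simp only [List.cons_append, List.nil_append, usum_cons, usum_nil, hl.usum, sgn_cons, sgn_nil,
        hl.sgn, sub_add_cancel, mul_one] at e2 e3
      rw [show -β3c τ + 2 * ηc + Real.pi * τ = β3c τ - Real.pi by unfold β3c; ring] at e2
      rw [e2, e3]
      have e3 : exp (-(I * (Real.pi * τ / 2))) * exp (-I * ((2 * n + 3) * ηc)) *
          (exp (↑(n + 1) * (Real.pi * I * τ)) *
          exp (-I * (-β3c τ + 0 + 0 - 2 * ((n + 1 : ℕ) : ℂ) * (-β3c τ + 2 * ηc))))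
            = exp (-(n * (Real.pi * I)) + -(Real.pi / 2 * I)) := by
        rw [← exp_add, ← exp_add, ← exp_add]; congr 1; unfold β3c; push_cast; ring
      have e8 : exp (-(n * (Real.pi * I)) + -(Real.pi / 2 * I)) = ((-1) ^ n)⁻¹ * I⁻¹ := by
        rw [exp_add, exp_neg, exp_neg, exp_nat_mul, exp_pi_mul_I, exp_pi_div_two_mul_I]
      rw [exp_nat_mul, e8] at e3
      have e4 : (-1 : ℂ) ^ (n + 1) * (-(pnome τ)) ^ (n + 1) = exp (Real.pi * I * τ) ^ (n + 1) := by
        rw [← mul_pow, neg_mul_neg, one_mul]; rfl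
      have e5 : ((-1 : ℂ) ^ n)⁻¹ = (-1) ^ n := by
        rw [← inv_pow]; norm_num
      have e6 : (-1 : ℂ) ^ n * (-1) ^ n = 1 := by rw [← mul_pow]; norm_num
      rw [e5, inv_I] at e3
      have e7 : -I * exp (-(I * (Real.pi * τ / 2))) * exp (-I * ((2 * n + 3) * ηc)) *
          ((-(pnome τ)) ^ (n + 1) *
          exp (-I * (-β3c τ + 0 + 0 - 2 * ((n + 1 : ℕ) : ℂ) * (-β3c τ + 2 * ηc)))) = 1 := by
        rw [← e4] at e3
        rw [pow_succ (-1 : ℂ) n] at e3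
        linear_combination I * (-1) ^ n * e3 + (I * (exp (-(I * (Real.pi * τ / 2))) *
          exp (-I * ((2 * n + 3) * ηc)) * ((-(pnome τ)) ^ (n + 1) *
          exp (-I * (-β3c τ + 0 + 0 - 2 * ((n + 1 : ℕ) : ℂ) * (-β3c τ + 2 * ηc))))) - I ^ 2) * e6 - I_sq
      linear_combination (-(if a = 0 then 1 else -1) * (if e = 0 then 1 else -1) *
        PsiL Ψ (n + 1) ((-β3c τ, a) :: (β3c τ - Real.pi, a) :: l)) * e7
    have p5 : ∀ a, PsiL Ψ (n + 1) ((-β3c τ, a) :: (-β3c τ + 2 * ηc, flipS a) :: l)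
        = Clan τ ^ (2 * n + 1) * (Lth τ (Real.pi / 2 + Real.pi * τ / 2) *
            Lprod τ (Real.pi / 2 + Real.pi * τ / 2) xs) *
          singletC a (flipS a) * PsiL Ψ n l := by
      intro a
      have e5 := PsiL_P5 (n := n) hΨ.p5 [] l (-β3c τ) a (flipS a) (by simp; omega)
      simp only [List.nil_append] at e5
      rw [e5, ← hl.prod_th1 h]
      congr 2
      refine list_prod_map_congr _ _ _ fun s => ?_
      rw [← th1_neg_pi_sub h]
      congr 1; rw [← three_eta]; unfold β3c; rw [← three_eta]; ring
    simp only [con, neg_neg]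
    rw [p2, p2, p5, p5]
    have f0 : flipS 0 = 1 := rfl
    have f1 : flipS 1 = 0 := rfl
    rw [f0, f1]
    have s0 : singletC 0 1 = 1 := by simp [singletC]
    have s1 : singletC 1 0 = -1 := by simp [singletC]
    rw [s0, s1]
    simp only [if_true, if_neg (show ¬ (1 : Fin 2) = 0 by decide)]
    ring
  refine Zl_congr xs (fun l hl => ?_) (fun l hl => ?_)
  · rw [key 0 l hl, if_pos rfl]; ring
  · rw [key 1 l hl, if_neg (by decide)]; ring

theorem Zn_wheel (h : PosNome τ) (hΨ : PsiOK τ Ψ) (t ε x : ℂ) (xs : List ℂ) :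
    Zn τ t ε Ψ (x :: (2 * ηc - x) :: xs) = Ka τ t x * Kd τ t x * Clan τ ^ (4 * xs.length + 4) *
      (Lth τ (2 * x) * Lth τ (2 * x + 2 * ηc)) * (Lth τ (x - ηc) * Lprod τ (x - ηc) xs) ^ 2 *
      Zn τ t ε Ψ xs := by
  unfold Zn
  rw [List.length_cons, List.length_cons]
  set n := xs.length with hn
  refine Zl_congr' xs fun e l hl => ?_
  have hlen := hl.length
  have p5 : ∀ a b, PsiL Ψ (n + 1 + 1) ((x, a) :: (-x, a) :: (2 * ηc - x, b) :: (-(2 * ηc - x), b) :: l)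
      = Clan τ ^ (2 * n + 3) * (Lth τ (2 * x) * Lth τ (2 * x + 2 * ηc)) *
        (Lth τ (x - ηc) * Lprod τ (x - ηc) xs) *
        singletC a b * PsiL Ψ (n + 1) ((x, a) :: (x - 2 * ηc, b) :: l) := by
    intro a b
    have e5 := PsiL_P5 (n := n + 1) hΨ.p5 [(x, a)] ((-(2 * ηc - x), b) :: l) (-x) a b (by simp; omega)
    simp only [List.cons_append, List.nil_append, List.map_cons, List.prod_cons] at e5
    rw [show -x + 2 * ηc = 2 * ηc - x by ring] at e5
    have e6 : (l.map fun s => th1 (-x - s.1 - 2 * ηc) τ).prod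
        = Clan τ ^ (2 * n + 1) * (Lth τ (x - ηc) * Lprod τ (x - ηc) xs) := by
      rw [← hl.prod_th1 h]
      refine list_prod_map_congr _ _ _ fun s => ?_
      rw [← th1_neg_pi_sub h]
      congr 1; rw [← three_eta]; ring
    rw [e5, e6, landen h, landen h, show -x - x - 2 * ηc = -(2 * x + 2 * ηc) by ring,
      show -x - -(2 * ηc - x) - 2 * ηc = -(2 * x) by ring, Lth_neg, Lth_neg,
      show -(2 * ηc - x) = x - 2 * ηc by ring]
    ring
  have e7 : PsiL Ψ (n + 1) ((x, 0) :: (x - 2 * ηc, 1) :: l) -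
      PsiL Ψ (n + 1) ((x, 1) :: (x - 2 * ηc, 0) :: l)
      = Clan τ ^ (2 * n + 1) * (Lth τ (x - ηc) * Lprod τ (x - ηc) xs) * PsiL Ψ n l := by
    have q1 := PsiL_P1 (n := n + 1) hΨ.p1 [] l x (x - 2 * ηc) 0 1 (by simp; omega)
    have q5 := PsiL_P5 (n := n) hΨ.p5 [] l (x - 2 * ηc) 0 1 (by simp; omega)
    simp only [List.nil_append, Fin.sum_univ_two, Rcheckent, Rent] at q1 q5
    simp at q1
    have e6 : (l.map fun s => th1 (x - 2 * ηc - s.1 - 2 * ηc) τ).prod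
        = -(Clan τ ^ (2 * n + 1) * (Lth τ (x - ηc) * Lprod τ (x - ηc) xs)) := by
      rw [hl.prod (fun s => th1 (x - 2 * ηc - s - 2 * ηc) τ)]
      have f : ∀ s, th1 (x - 2 * ηc - s - 2 * ηc) τ = -(Clan τ * Lth τ (x - ηc - s)) := by
        intro s
        rw [landen h, show x - ηc - s = (x - 2 * ηc - s - 2 * ηc) + 3 * ηc by ring, three_eta, Lth_pi]
        ring
      rw [list_prod_map_mul_const xs (Clan τ ^ 2) _
        (fun y => Lth τ (x - ηc + y) * Lth τ (x - ηc - y))]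
      · rw [f]; unfold Lprod; rw [sub_zero]; ring
      · intro y; rw [f, f, sub_neg_eq_add]; ring
    rw [sub_add_cancel, e6, show singletC 0 1 = 1 by simp [singletC]] at q5
    have hb : bv τ (-(2 * ηc)) = -(T4 τ ηc * T4 τ 0 * T1 τ ηc) := by
      change T4 τ (2 * ηc) * T4 τ (-(2 * ηc) + 2 * ηc) * T1 τ (-(2 * ηc)) = _
      rw [neg_add_cancel, T1_neg, T1_two_eta, T4_two_eta]; ring
    have hc : cv τ (-(2 * ηc)) = T4 τ ηc * T4 τ 0 * T1 τ ηc := by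
      change T1 τ (2 * ηc) * T4 τ (-(2 * ηc) + 2 * ηc) * T4 τ (-(2 * ηc)) = _
      rw [neg_add_cancel, T4_neg, T1_two_eta, T4_two_eta]; ring
    have ha : av τ (-(2 * ηc)) = 0 := by
      change T4 τ (2 * ηc) * T1 τ (-(2 * ηc) + 2 * ηc) * T4 τ (-(2 * ηc)) = _
      rw [neg_add_cancel, T1_zero]; ring
    have hne : T4 τ ηc * T4 τ 0 * T1 τ ηc ≠ 0 :=
      mul_ne_zero (mul_ne_zero (T4_eta_ne h) (T4_zero_ne h)) (T1_eta_ne h)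
    rw [q5, rv, ha, hb, hc] at q1
    apply mul_left_cancel₀ hne
    linear_combination q1
  have k1 : Ka τ t (2 * ηc - x) = Ka τ t x := by
    unfold Ka; rw [show 2 * ηc - x - ηc = -(x - ηc) by ring, T1_neg, T4_neg]; ring
  have k2 : Kd τ t (2 * ηc - x) = Kd τ t x := by
    unfold Kd; rw [show 2 * ηc - x - ηc = -(x - ηc) by ring, T1_neg, T4_neg]; ring
  simp only [con]
  rw [p5, p5, p5, p5, k1, k2]
  have s0 : singletC 0 1 = 1 := by simp [singletC]
  have s1 : singletC 1 0 = -1 := by simp [singletC]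
  have s2 : singletC 0 0 = 0 := by simp [singletC]
  have s3 : singletC 1 1 = 0 := by simp [singletC]
  rw [s0, s1, s2, s3]
  linear_combination Ka τ t x * Kd τ t x * (Clan τ ^ (2 * n + 3) * (Lth τ (2 * x) * Lth τ (2 * x + 2 * ηc)) *
        (Lth τ (x - ηc) * Lprod τ (x - ηc) xs)) * e7

end

section
variable {τ : ℂ} {Ψ : PsiFam}

/-- The sixth root of unity `e^{iη}`. -/
def eeta : ℂ := exp (I * ηc)

theorem eeta_ne : eeta ≠ 0 := exp_ne_zero _

theorem eeta_cube : eeta ^ 3 = -1 := by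
  unfold eeta
  rw [← exp_nat_mul, show ((3 : ℕ) : ℂ) * (I * ηc) = (3 * ηc) * I by push_cast; ring, three_eta,
    exp_pi_mul_I]

theorem exp_neg_eeta (m : ℕ) : exp (-I * (m * ηc)) = (eeta ^ m)⁻¹ := by
  unfold eeta
  rw [← exp_nat_mul, ← exp_neg]; congr 1; ring

theorem mul1_eta_sub_half : mul1 τ (ηc - Real.pi * τ / 2) = I * eeta⁻¹ := by
  unfold mul1 eeta
  rw [← exp_neg]; congr 2; ring

theorem mul1_eta_sub_half_pi : mul1 τ (ηc - (Real.pi / 2 + Real.pi * τ / 2)) = -eeta⁻¹ := by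
  unfold mul1 eeta
  rw [← exp_neg, show -(Real.pi * I * τ / 2) - I * (ηc - (Real.pi / 2 + Real.pi * τ / 2))
    = -(I * ηc) + Real.pi / 2 * I by ring, exp_add, exp_pi_div_two_mul_I]
  linear_combination exp (-(I * ηc)) * I_mul_I

/-- The reflection of a half period shifted by `η`. -/
theorem half_shift {y c : ℂ} (hy : ηc + y = ηc - y + Real.pi * τ ∨ ηc + y = ηc - y + Real.pi * τ + Real.pi)
    (hc : c = mul1 τ (ηc - y)) :
    Lth τ (ηc + y) ^ 2 = c ^ 4 * Lth τ (ηc - y) ^ 2 := by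
  subst hc
  rcases hy with hy | hy
  · rw [hy]; unfold Lth; rw [T1_tau, T4_tau]; ring
  · rw [hy, Lth_pi]; unfold Lth; rw [T1_tau, T4_tau]; ring

theorem Dth_half_shift (h : PosNome τ) {y c J : ℂ}
    (hy : ηc + y = ηc - y + Real.pi * τ ∨ ηc + y = ηc - y + Real.pi * τ + Real.pi)
    (hc : c = mul1 τ (ηc - y)) (hJ : wv τ (ηc + y) = J) (hJ0 : J ≠ 0) :
    kap τ ^ 5 * c ^ 4 * Dth τ (ηc + y) = J * Lth τ y ^ 2 := by
  have h1 := Dth_add_eta h y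
  have h2 := half_shift hy hc
  have hD : Dth τ (ηc + y) ≠ 0 := by
    intro h0; rw [wv, h0, div_zero] at hJ; exact hJ0 hJ.symm
  have h3 : J * Dth τ (ηc + y) = (1 - zet τ ^ 2) * Lth τ (ηc + y) ^ 2 := by
    rw [← hJ, wv, div_mul_cancel₀ _ hD, Nth]
  have hB := kap_cube h
  have hN : Lth τ (y - ηc) = -Lth τ (ηc - y) := by rw [← Lth_neg]; congr 1; ring
  rw [add_comm y, hN] at h1
  apply mul_right_cancel₀ (mul_ne_zero hD (pow_ne_zero 3 (kap_ne h)))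
  have h4 : kap τ ^ 8 * Dth τ (ηc + y) ^ 2 = Lth τ (ηc - y) ^ 2 * Lth τ y ^ 2 := by
    linear_combination (kap τ ^ 4 * Dth τ (ηc + y) + Lth τ (ηc - y) * Lth τ y) * h1
  linear_combination c ^ 4 * h4 - Lth τ y ^ 2 * h2 - kap τ ^ 3 * Lth τ y ^ 2 * h3 - Lth τ y ^ 2 * Lth τ (ηc + y) ^ 2 * hB

theorem J4c_ne (h : PosNome τ) : J4c (zet τ) ≠ 0 := one_div_ne_zero (one_sub_zet_ne h)
theorem J3c_ne (h : PosNome τ) : J3c (zet τ) ≠ 0 := one_div_ne_zero (one_add_zet_ne h)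

theorem Dth_beta4 (h : PosNome τ) :
    kap τ ^ 5 * Dth τ (β4c τ) = J4c (zet τ) * eeta ^ 4 * Lth τ (Real.pi * τ / 2) ^ 2 := by
  have := Dth_half_shift h (y := Real.pi * τ / 2) (c := I * eeta⁻¹) (Or.inl (by ring))
    mul1_eta_sub_half.symm (wv_beta4 h) (J4c_ne h)
  rw [mul_pow, I_pow_four, inv_pow, one_mul] at this
  have e := pow_ne_zero 4 eeta_ne
  rw [β4c]
  have h4 : eeta ^ 4 * (eeta ^ 4)⁻¹ = 1 := mul_inv_cancel₀ e
  linear_combination eeta ^ 4 * this - kap τ ^ 5 * Dth τ (ηc + Real.pi * τ / 2) * h4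

theorem Dth_beta3 (h : PosNome τ) :
    kap τ ^ 5 * Dth τ (β3c τ) = J3c (zet τ) * eeta ^ 4 * Lth τ (Real.pi / 2 + Real.pi * τ / 2) ^ 2 := by
  have hb : ηc + (Real.pi / 2 + Real.pi * τ / 2) = β3c τ := by unfold β3c; ring
  have := Dth_half_shift h (y := Real.pi / 2 + Real.pi * τ / 2) (c := -eeta⁻¹)
    (Or.inr (by ring)) mul1_eta_sub_half_pi.symm (by rw [hb]; exact wv_beta3 h) (J3c_ne h)
  have e := pow_ne_zero 4 eeta_ne
  rw [hb, neg_pow, inv_pow] at this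
  have h4 : eeta ^ 4 * (eeta ^ 4)⁻¹ = 1 := mul_inv_cancel₀ e
  linear_combination eeta ^ 4 * this - kap τ ^ 5 * Dth τ (β3c τ) * h4

theorem theta_sq_beta4 (h : PosNome τ) :
    kap τ * (T1 τ (β4c τ + ηc) ^ 2 - T4 τ (β4c τ + ηc) ^ 2) = -I * eeta ^ 4 * Lth τ (Real.pi * τ / 2) := by
  set y := Real.pi * τ / 2 with hy
  have e1 : β4c τ + ηc = -(ηc - y) + Real.pi := by unfold β4c; linear_combination three_eta
  have h1 := theta_cross h y
  have e2 : y + ηc = (ηc - y) + Real.pi * τ := by rw [hy]; ring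
  have e3 : y - ηc = -(ηc - y) := by ring
  rw [e2, e3, T1_tau, T4_tau, T1_neg, T4_neg, mul1_eta_sub_half] at h1
  rw [e1, T1_pi, T4_pi, T1_neg, T4_neg]
  have e := eeta_ne
  field_simp at h1
  have e3 := eeta_cube
  linear_combination (-I * eeta ^ 3) * h1 - (kap τ * (T1 τ (ηc - y) ^ 2 - T4 τ (ηc - y) ^ 2)) * eeta ^ 3 * I_sq
    + (kap τ * (T1 τ (ηc - y) ^ 2 - T4 τ (ηc - y) ^ 2)) * e3

theorem theta_sq_beta3 (h : PosNome τ) :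
    kap τ * (T1 τ (β3c τ + ηc) ^ 2 + T4 τ (β3c τ + ηc) ^ 2)
      = -eeta ^ 4 * Lth τ (Real.pi / 2 + Real.pi * τ / 2) := by
  set y := Real.pi / 2 + Real.pi * τ / 2 with hy
  have e1 : β3c τ + ηc = -(ηc - y) + Real.pi := by unfold β3c; linear_combination three_eta
  have h1 := theta_cross h y
  have e2 : y + ηc = (ηc - y) + Real.pi * τ + Real.pi := by rw [hy]; ring
  have e3 : y - ηc = -(ηc - y) := by ring
  rw [e2, e3, T1_pi, T4_pi, T1_tau, T4_tau, T1_neg, T4_neg, mul1_eta_sub_half_pi] at h1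
  rw [e1, T1_pi, T4_pi, T1_neg, T4_neg]
  have e := eeta_ne
  field_simp at h1
  have e3 := eeta_cube
  linear_combination (-eeta ^ 3) * h1 +
     (kap τ * (T1 τ (ηc - y) ^ 2 + T4 τ (ηc - y) ^ 2)) * e3

theorem Ka_sub_Kd_beta4 (h : PosNome τ) (t : ℂ) :
    kap τ * (Ka τ t (-β4c τ) - Kd τ t (-β4c τ)) = -(1 + t) * (I * eeta ^ 4 * Lth τ (Real.pi * τ / 2)) := by
  rw [Ka_neg, Kd_neg]
  linear_combination (1 + t) * theta_sq_beta4 h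

theorem Ka_add_Kd_beta3 (h : PosNome τ) (t : ℂ) :
    kap τ * (Ka τ t (-β3c τ) + Kd τ t (-β3c τ))
      = -(1 - t) * (eeta ^ 4 * Lth τ (Real.pi / 2 + Real.pi * τ / 2)) := by
  rw [Ka_neg, Kd_neg]
  linear_combination (1 - t) * theta_sq_beta3 h

theorem T1_beta4 : T1 τ (2 * (-β4c τ) + 2 * ηc) = -I * exp (-(I * (Real.pi * τ / 2))) * T4 τ 0 := by
  rw [show 2 * (-β4c τ) + 2 * ηc = -(0 + Real.pi * τ) by unfold β4c; ring, T1_neg, T1_tau, mul1]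
  rw [show -(Real.pi * I * τ / 2) - I * 0 = -(I * (Real.pi * τ / 2)) by ring]; ring

theorem T1_beta3 : T1 τ (2 * (-β3c τ) + 2 * ηc) = I * exp (-(I * (Real.pi * τ / 2))) * T4 τ 0 := by
  rw [show 2 * (-β3c τ) + 2 * ηc = -(0 + Real.pi * τ + Real.pi) by unfold β3c; ring, T1_neg, T1_pi,
    T1_tau, mul1]
  rw [show -(Real.pi * I * τ / 2) - I * 0 = -(I * (Real.pi * τ / 2)) by ring]; ring

theorem Dth_half_ne (h : PosNome τ) : Dth τ (Real.pi * τ / 2) ≠ 0 := by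
  intro h0
  have := wv_half_tau h
  rw [wv, h0, div_zero] at this
  exact div_ne_zero (one_sub_zet_ne h) (one_add_zet_ne h) this.symm

theorem Dth_half_pi_ne (h : PosNome τ) : Dth τ (Real.pi / 2 + Real.pi * τ / 2) ≠ 0 := by
  intro h0
  have := wv_half_tau_pi h
  rw [wv, h0, div_zero] at this
  exact div_ne_zero (one_add_zet_ne h) (one_sub_zet_ne h) this.symm

theorem wv_mul_Dth {x : ℂ} (hx : Dth τ x ≠ 0) : wv τ x * Dth τ x = (1 - zet τ ^ 2) * Lth τ x ^ 2 := by
  rw [wv, div_mul_cancel₀ _ hx, Nth]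

theorem Dth_mul_wv_sub_prod (h : PosNome τ) {y : ℂ} (hy : Dth τ y ≠ 0) : ∀ (xs : List ℂ)
    (_ : ∀ x ∈ xs, Dth τ x ≠ 0),
    (xs.map fun x => Dth τ x * (wv τ x - wv τ y)).prod
      = ((1 - zet τ ^ 2) * (zet τ * T4 τ 0 ^ 4) / Dth τ y) ^ xs.length * Lprod τ y xs
  | [], _ => by simp [Lprod]
  | x :: xs, hx => by
    have ih := Dth_mul_wv_sub_prod h hy xs fun z hz => hx z (List.mem_cons_of_mem _ hz)
    have hx0 := hx x (List.mem_cons_self ..)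
    have hL : Lprod τ y (x :: xs) = Lth τ (y + x) * Lth τ (y - x) * Lprod τ y xs := by simp [Lprod]
    rw [List.map_cons, List.prod_cons, ih, wv_sub h hx0 hy, hL,
      List.length_cons, pow_succ (_ / _), add_comm x y, show x - y = -(y - x) by ring, Lth_neg]
    field_simp

end

section
variable {τ : ℂ} {Ψ : PsiFam}

/-- The normalisation constant of the scalar products. -/
def gco (τ : ℂ) : ℕ → ℂ
  | 0 => 1
  | n + 1 => gco τ n * (Clan τ ^ (2 * n + 1) * kap τ ^ (5 * n + 4) /
      (T4 τ 0 * (zet τ * T4 τ 0 ^ 4) ^ n))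

/-- The theta function prefactor of the scalar products. -/
def Pref (τ : ℂ) (n : ℕ) (xs : List ℂ) : ℂ :=
  (xs.map fun x => T1 τ (2 * x + 2 * ηc) * Dth τ x ^ n).prod

theorem Pref_cons (n : ℕ) (x : ℂ) (xs : List ℂ) :
    Pref τ n (x :: xs) = T1 τ (2 * x + 2 * ηc) * Dth τ x ^ n * Pref τ n xs := by simp [Pref]

theorem Pref_add (n m : ℕ) (xs : List ℂ) :
    Pref τ (n + m) xs = Pref τ n xs * (xs.map (Dth τ)).prod ^ m := by
  induction xs with
  | nil => simp [Pref]
  | cons x xs ih => rw [Pref_cons, Pref_cons, ih, List.map_cons, List.prod_cons]; ring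

theorem Dth_prod_mul (xs : List ℂ) (c : ℂ) :
    (xs.map (Dth τ)).prod * ((xs.map (wv τ)).map fun w => w - c).prod
      = (xs.map fun x => Dth τ x * (wv τ x - c)).prod := by
  rw [List.map_map, ← List.prod_map_mul]; rfl

theorem Zn_beta4_eq (h : PosNome τ) (hΨ : PsiOK τ Ψ) (t ε r : ℂ) (xs : List ℂ)
    (hx : ∀ x ∈ xs, Dth τ x ≠ 0)
    (hr : Zn τ t ε Ψ xs = gco τ xs.length * Pref τ xs.length xs * r) :
    Zn τ t ε Ψ (-β4c τ :: xs) = gco τ (xs.length + 1) * Pref τ (xs.length + 1) (-β4c τ :: xs) *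
      ((-1) ^ xs.length * (1 + t) / (J4c (zet τ) ^ (xs.length + 1) *
        ((1 - zet τ) / (1 + zet τ)) ^ xs.length) *
        (((xs.map (wv τ)).map fun w => w - (1 - zet τ) / (1 + zet τ)).prod) * r) := by
  have hB := kap_cube h
  rw [Zn_beta4 h hΨ, hr, Pref_cons, Pref_add, T1_beta4, Dth_neg]
  have hP := Dth_mul_wv_sub_prod h (Dth_half_ne h) xs hx
  rw [wv_half_tau h, ← Dth_prod_mul] at hP
  have hD := wv_mul_Dth (Dth_half_ne h)
  rw [wv_half_tau h] at hD
  have hD4 := Dth_beta4 h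
  have hK := Ka_sub_Kd_beta4 h t
  have hL : Lth τ (Real.pi * τ / 2) ≠ 0 := tau_half_ne' h 0 (by push_cast; ring)
  set y := Real.pi * τ / 2 with hy
  have hO : (1 - zet τ) / (1 + zet τ) ≠ 0 := div_ne_zero (one_sub_zet_ne h) (one_add_zet_ne h)
  set Ω := (1 - zet τ) / (1 + zet τ)
  have hDy := Dth_half_ne h
  have hJ := J4c_ne h
  have hk := kap_ne h
  have hT := T4_zero_ne h
  have hζ := zet_ne h
  have he := eeta_ne
  have hBn := zet_sq_ne h
  set m := xs.length
  set P := (xs.map (Dth τ)).prod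
  set Q := ((xs.map (wv τ)).map fun w => w - Ω).prod
  have hK' : Ka τ t (-β4c τ) - Kd τ t (-β4c τ) = -(1 + t) * (I * eeta ^ 4 * Lth τ y) / kap τ := by
    rw [eq_div_iff hk, ← hK]; ring
  have hD4' : Dth τ (β4c τ) = J4c (zet τ) * eeta ^ 4 * Lth τ y ^ 2 / kap τ ^ 5 := by
    rw [eq_div_iff (pow_ne_zero 5 hk), ← hD4]; ring
  have hB' : (1 - zet τ ^ 2) / Dth τ y = Ω / Lth τ y ^ 2 := by
    rw [div_eq_div_iff hDy (pow_ne_zero 2 hL), ← hD]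
  have hP' : P * Q = (Ω * (zet τ * T4 τ 0 ^ 4) / Lth τ y ^ 2) ^ m * Lprod τ y xs := by
    rw [hP, mul_div_right_comm, hB']; congr 2; ring
  have hexp : exp (-I * ((2 * (m : ℂ) + 3) * ηc)) * eeta ^ 4 = -(eeta ^ 4) ^ (m + 1) := by
    have := exp_neg_eeta (2 * m + 3)
    push_cast at this
    rw [this, inv_mul_eq_iff_eq_mul₀ (pow_ne_zero _ he),
      show eeta ^ (2 * m + 3) * -(eeta ^ 4) ^ (m + 1) = -(eeta ^ 3) ^ (2 * m + 1) * eeta ^ 4 by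
        rw [← pow_mul, ← pow_mul, ← mul_neg_one, mul_comm (eeta ^ (2 * m + 3)), ← neg_one_mul,
          ← neg_one_mul (eeta ^ _)]
        ring]
    rw [eeta_cube, Odd.neg_one_pow ⟨m, rfl⟩]; ring
  rw [hK', hD4']
  rw [show gco τ (m + 1) = gco τ m * (Clan τ ^ (2 * m + 1) * kap τ ^ (5 * m + 4) /
      (T4 τ 0 * (zet τ * T4 τ 0 ^ 4) ^ m)) from rfl]
  trans ((-1) ^ (m + 1) * exp (-(I * y)) * (exp (-I * ((2 * (m : ℂ) + 3) * ηc)) * eeta ^ 4) *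
    (-(1 + t) * I * Lth τ y ^ 2 / kap τ) * Clan τ ^ (2 * m + 1) * Lprod τ y xs *
      (gco τ m * Pref τ m xs * r))
  · ring
  trans (gco τ m * (Clan τ ^ (2 * m + 1) * kap τ ^ (5 * m + 4) /
      (T4 τ 0 * (zet τ * T4 τ 0 ^ 4) ^ m)) * (-I * exp (-(I * y)) * T4 τ 0 *
      (J4c (zet τ) * eeta ^ 4 * Lth τ y ^ 2 / kap τ ^ 5) ^ (m + 1) * Pref τ m xs) *
      ((-1) ^ m * (1 + t) / (J4c (zet τ) ^ (m + 1) * Ω ^ m) * (P * Q) * r))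
  swap
  · ring
  rw [hP', hexp]
  rw [show kap τ ^ (5 * m + 4) = (kap τ ^ 5) ^ (m + 1) / kap τ by
    rw [eq_div_iff hk, ← pow_mul, ← pow_succ]; ring]
  simp only [div_pow, mul_pow _ _ m, mul_pow _ _ (m + 1)]
  have h1 := pow_ne_zero m hO
  have h2 := pow_ne_zero (m + 1) hJ
  have h3 := pow_ne_zero (m + 1) (pow_ne_zero 5 hk)
  have h4 := pow_ne_zero m hζ
  have h5 := pow_ne_zero m (pow_ne_zero 4 hT)
  have h6 := pow_ne_zero m (pow_ne_zero 2 hL)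
  rw [pow_succ (Lth τ y ^ 2) m, pow_succ (-1 : ℂ) m]
  generalize Ω ^ m = a1 at *
  generalize J4c (zet τ) ^ (m + 1) = a2 at *
  generalize (kap τ ^ 5) ^ (m + 1) = a3 at *
  generalize zet τ ^ m = a4 at *
  generalize (T4 τ 0 ^ 4) ^ m = a5 at *
  generalize (Lth τ y ^ 2) ^ m = a6 at *
  field_simp

theorem Zn_beta3_eq (h : PosNome τ) (hΨ : PsiOK τ Ψ) (t ε r : ℂ) (xs : List ℂ)
    (hx : ∀ x ∈ xs, Dth τ x ≠ 0)
    (hr : Zn τ t (-ε) Ψ xs = gco τ xs.length * Pref τ xs.length xs * r) :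
    Zn τ t ε Ψ (-β3c τ :: xs) = gco τ (xs.length + 1) * Pref τ (xs.length + 1) (-β3c τ :: xs) *
      (-(1 - t) / (J3c (zet τ) ^ (xs.length + 1) *
        ((1 + zet τ) / (1 - zet τ)) ^ xs.length) *
        (((xs.map (wv τ)).map fun w => w - (1 + zet τ) / (1 - zet τ)).prod) * r) := by
  have hB := kap_cube h
  rw [Zn_beta3 h hΨ, hr, Pref_cons, Pref_add, T1_beta3, Dth_neg]
  have hP := Dth_mul_wv_sub_prod h (Dth_half_pi_ne h) xs hx
  rw [wv_half_tau_pi h, ← Dth_prod_mul] at hP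
  have hD := wv_mul_Dth (Dth_half_pi_ne h)
  rw [wv_half_tau_pi h] at hD
  have hD4 := Dth_beta3 h
  have hK := Ka_add_Kd_beta3 h t
  have hL : Lth τ (Real.pi / 2 + Real.pi * τ / 2) ≠ 0 := tau_half_ne' h (1 / 2) (by push_cast; ring)
  have hDy := Dth_half_pi_ne h
  set y := Real.pi / 2 + Real.pi * τ / 2 with hy
  have hO : (1 + zet τ) / (1 - zet τ) ≠ 0 := div_ne_zero (one_add_zet_ne h) (one_sub_zet_ne h)
  set Ω := (1 + zet τ) / (1 - zet τ)
  have hJ := J3c_ne h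
  have hk := kap_ne h
  have hT := T4_zero_ne h
  have hζ := zet_ne h
  have he := eeta_ne
  have hBn := zet_sq_ne h
  set m := xs.length
  set P := (xs.map (Dth τ)).prod
  set Q := ((xs.map (wv τ)).map fun w => w - Ω).prod
  have hK' : Ka τ t (-β3c τ) + Kd τ t (-β3c τ) = -(1 - t) * (eeta ^ 4 * Lth τ y) / kap τ := by
    rw [eq_div_iff hk, ← hK]; ring
  have hD4' : Dth τ (β3c τ) = J3c (zet τ) * eeta ^ 4 * Lth τ y ^ 2 / kap τ ^ 5 := by
    rw [eq_div_iff (pow_ne_zero 5 hk), ← hD4]; ring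
  have hB' : (1 - zet τ ^ 2) / Dth τ y = Ω / Lth τ y ^ 2 := by
    rw [div_eq_div_iff hDy (pow_ne_zero 2 hL), ← hD]
  have hP' : P * Q = (Ω * (zet τ * T4 τ 0 ^ 4) / Lth τ y ^ 2) ^ m * Lprod τ y xs := by
    rw [hP, mul_div_right_comm, hB']; congr 2; ring
  have hexp : exp (-I * ((2 * (m : ℂ) + 3) * ηc)) * eeta ^ 4 = -(eeta ^ 4) ^ (m + 1) := by
    have := exp_neg_eeta (2 * m + 3)
    push_cast at this
    rw [this, inv_mul_eq_iff_eq_mul₀ (pow_ne_zero _ he),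
      show eeta ^ (2 * m + 3) * -(eeta ^ 4) ^ (m + 1) = -(eeta ^ 3) ^ (2 * m + 1) * eeta ^ 4 by
        rw [← pow_mul, ← pow_mul, ← mul_neg_one, mul_comm (eeta ^ (2 * m + 3)), ← neg_one_mul,
          ← neg_one_mul (eeta ^ _)]
        ring]
    rw [eeta_cube, Odd.neg_one_pow ⟨m, rfl⟩]; ring
  rw [hK', hD4']
  rw [show gco τ (m + 1) = gco τ m * (Clan τ ^ (2 * m + 1) * kap τ ^ (5 * m + 4) /
      (T4 τ 0 * (zet τ * T4 τ 0 ^ 4) ^ m)) from rfl]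
  trans (-I * exp (-(I * (Real.pi * τ / 2))) * (exp (-I * ((2 * (m : ℂ) + 3) * ηc)) * eeta ^ 4) *
    (-(1 - t) * Lth τ y ^ 2 / kap τ) * Clan τ ^ (2 * m + 1) * Lprod τ y xs *
      (gco τ m * Pref τ m xs * r))
  · ring
  trans (gco τ m * (Clan τ ^ (2 * m + 1) * kap τ ^ (5 * m + 4) /
      (T4 τ 0 * (zet τ * T4 τ 0 ^ 4) ^ m)) * (I * exp (-(I * (Real.pi * τ / 2))) * T4 τ 0 *
      (J3c (zet τ) * eeta ^ 4 * Lth τ y ^ 2 / kap τ ^ 5) ^ (m + 1) * Pref τ m xs) *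
      (-(1 - t) / (J3c (zet τ) ^ (m + 1) * Ω ^ m) * (P * Q) * r))
  swap
  · ring
  rw [hP', hexp]
  rw [show kap τ ^ (5 * m + 4) = (kap τ ^ 5) ^ (m + 1) / kap τ by
    rw [eq_div_iff hk, ← pow_mul, ← pow_succ]; ring]
  simp only [div_pow, mul_pow _ _ m, mul_pow _ _ (m + 1)]
  have h1 := pow_ne_zero m hO
  have h2 := pow_ne_zero (m + 1) hJ
  have h3 := pow_ne_zero (m + 1) (pow_ne_zero 5 hk)
  have h4 := pow_ne_zero m hζ
  have h5 := pow_ne_zero m (pow_ne_zero 4 hT)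
  have h6 := pow_ne_zero m (pow_ne_zero 2 hL)
  rw [pow_succ (Lth τ y ^ 2) m]
  generalize Ω ^ m = a1 at *
  generalize J3c (zet τ) ^ (m + 1) = a2 at *
  generalize (kap τ ^ 5) ^ (m + 1) = a3 at *
  generalize zet τ ^ m = a4 at *
  generalize (T4 τ 0 ^ 4) ^ m = a5 at *
  generalize (Lth τ y ^ 2) ^ m = a6 at *
  field_simp

/-- The constant `-(1-tζ)(ζ-t)/ζ²`. -/
def mco (ζ t : ℂ) : ℂ := -((1 - t * ζ) * (ζ - t)) / ζ ^ 2

/-- The parameter `ν̄` in terms of `t`. -/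
def ybar (ζ t : ℂ) : ℂ := (1 - ζ ^ 2) * t / ((t - ζ) * (1 - t * ζ))

theorem Ka_mul_Kd (h : PosNome τ) {t x : ℂ} (h1 : t - zet τ ≠ 0) (h2 : 1 - t * zet τ ≠ 0)
    (hx : Dth τ (x - ηc) ≠ 0) :
    Ka τ t x * Kd τ t x = (ybar (zet τ) t - wv τ (x - ηc)) * Dth τ (x - ηc) * (t - zet τ) *
      (1 - t * zet τ) / ((1 - zet τ ^ 2) * zet τ) := by
  have hζ := zet_ne h
  have hB := zet_sq_ne h
  have hw := wv_mul_Dth hx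
  have hy : ybar (zet τ) t * ((t - zet τ) * (1 - t * zet τ)) = (1 - zet τ ^ 2) * t := by
    rw [ybar, div_mul_cancel₀ _ (mul_ne_zero h1 h2)]
  rw [eq_div_iff (mul_ne_zero hB hζ)]
  have : (ybar (zet τ) t - wv τ (x - ηc)) * Dth τ (x - ηc) * (t - zet τ) * (1 - t * zet τ)
    = (1 - zet τ ^ 2) * t * Dth τ (x - ηc) -
      (1 - zet τ ^ 2) * Lth τ (x - ηc) ^ 2 * ((t - zet τ) * (1 - t * zet τ)) := by
    linear_combination Dth τ (x - ηc) * hy - (t - zet τ) * (1 - t * zet τ) * hw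
  rw [this, Ka, Kd, Dth, Lth]
  ring

theorem T1_wheel (z : ℂ) : T1 τ (2 * (2 * ηc - z) + 2 * ηc) = -T1 τ (2 * z) := by
  rw [show 2 * (2 * ηc - z) + 2 * ηc = -(2 * z) + Real.pi + Real.pi by linear_combination 2 * three_eta,
    T1_pi, T1_pi, T1_neg]; ring

theorem Zn_wheel_eq (h : PosNome τ) (hΨ : PsiOK τ Ψ) (t ε r z : ℂ) (xs : List ℂ)
    (h1 : t - zet τ ≠ 0) (h2 : 1 - t * zet τ ≠ 0)
    (hx : ∀ x ∈ xs, Dth τ x ≠ 0) (hz : Dth τ (z - ηc) ≠ 0) (hz' : Lth τ (z - ηc) ≠ 0)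
    (hr : Zn τ t ε Ψ xs = gco τ xs.length * Pref τ xs.length xs * r) :
    Zn τ t ε Ψ (z :: (2 * ηc - z) :: xs)
      = gco τ (xs.length + 2) * Pref τ (xs.length + 2) (z :: (2 * ηc - z) :: xs) *
      (mco (zet τ) t * ((1 - zet τ ^ 2) / wv τ (z - ηc)) ^ (xs.length + 2) *
        (-wv τ (z - ηc) * (J3c (zet τ) - wv τ (z - ηc)) * (J4c (zet τ) - wv τ (z - ηc)) *
          (ybar (zet τ) t - wv τ (z - ηc))) *
        (((xs.map (wv τ)).map fun w => w - wv τ (z - ηc)).prod) ^ 2 * r) := by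
  have hB := kap_cube h
  have hk := kap_ne h
  have hT := T4_zero_ne h
  have hζ := zet_ne h
  have hBn := zet_sq_ne h
  rw [Zn_wheel h hΨ, hr, Pref_cons, Pref_cons, Pref_add, T1_wheel, Ka_mul_Kd h h1 h2 hz]
  have hP := Dth_mul_wv_sub_prod h hz xs hx
  rw [← Dth_prod_mul] at hP
  have hS := Dth_mul_shift h (z - ηc)
  rw [sub_add_cancel, show z - ηc - ηc = -(2 * ηc - z) by ring, Dth_neg] at hS
  have hw := wv_mul_Dth hz
  have hwn : wv τ (z - ηc) ≠ 0 := wv_ne_zero h hz' hz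
  have hT4 := T4_double_shift h hz
  rw [sub_add_cancel, show 2 * (z - ηc - ηc) = 2 * z - 4 * ηc by ring,
    show T4 τ (2 * z - 4 * ηc) = T4 τ (2 * z + 2 * ηc) by
      rw [show 2 * z + 2 * ηc = 2 * z - 4 * ηc + Real.pi + Real.pi by linear_combination 2 * three_eta,
        T4_pi, T4_pi]] at hT4
  set w := wv τ (z - ηc)
  set D := Dth τ (z - ηc)
  set m := xs.length
  set P := (xs.map (Dth τ)).prod
  set Q := ((xs.map (wv τ)).map fun v => v - w).prod
  set Jw := (J3c (zet τ) - w) * (J4c (zet τ) - w) with hJw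
  have hL : Lth τ (2 * z) * Lth τ (2 * z + 2 * ηc) = T1 τ (2 * z) * T1 τ (2 * z + 2 * ηc) *
      ((1 - zet τ ^ 2) * kap τ ^ 2 * D ^ 2 * Jw / (zet τ ^ 2 * T4 τ 0 ^ 6)) := by
    rw [← hT4]; unfold Lth; field_simp
  have hDD : Dth τ z * Dth τ (2 * ηc - z) * ((1 - zet τ ^ 2) / w) = D ^ 2 / kap τ ^ 4 := by
    field_simp
    linear_combination (1 - zet τ ^ 2) * hS - D * hw
  have hBk : 1 - zet τ ^ 2 = (kap τ ^ 3)⁻¹ := eq_inv_of_mul_eq_one_left hB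
  rw [hL]
  rw [show gco τ (m + 2) = gco τ m * (Clan τ ^ (2 * m + 1) * kap τ ^ (5 * m + 4) /
      (T4 τ 0 * (zet τ * T4 τ 0 ^ 4) ^ m)) * (Clan τ ^ (2 * (m + 1) + 1) * kap τ ^ (5 * (m + 1) + 4) /
      (T4 τ 0 * (zet τ * T4 τ 0 ^ 4) ^ (m + 1))) from rfl]
  trans gco τ m * Pref τ m xs * r * Clan τ ^ (4 * m + 4) * (T1 τ (2 * z) * T1 τ (2 * z + 2 * ηc)) *
    (ybar (zet τ) t - w) * Jw * (t - zet τ) * (1 - t * zet τ) * Lprod τ (z - ηc) xs ^ 2 *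
    (kap τ ^ 2 * D ^ 3 * Lth τ (z - ηc) ^ 2 / (zet τ ^ 3 * T4 τ 0 ^ 6))
  · clear_value Jw D w
    generalize 1 - zet τ ^ 2 = B at *
    generalize Lth τ (z - ηc) = l1 at *
    generalize T1 τ (2 * z) * T1 τ (2 * z + 2 * ηc) = l2 at *
    generalize gco τ m * Pref τ m xs * r = G
    generalize ybar (zet τ) t - w = Y
    generalize (1 - t * zet τ) = y1
    generalize (t - zet τ) = y2
    generalize Clan τ ^ (4 * m + 4) = y3
    clear hP hS hw hT4 hL hDD hr hx
    field_simp
  trans gco τ m * Pref τ m xs * r * (Clan τ ^ (2 * m + 1) * kap τ ^ (5 * m + 4) /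
      (T4 τ 0 * (zet τ * T4 τ 0 ^ 4) ^ m)) * (Clan τ ^ (2 * (m + 1) + 1) * kap τ ^ (5 * (m + 1) + 4) /
      (T4 τ 0 * (zet τ * T4 τ 0 ^ 4) ^ (m + 1))) * (T1 τ (2 * z) * T1 τ (2 * z + 2 * ηc)) *
     (Dth τ z * Dth τ (2 * ηc - z) * ((1 - zet τ ^ 2) / w)) ^ (m + 2) * mco (zet τ) t * w * Jw *
      (ybar (zet τ) t - w) * (P * Q) ^ 2
  swap
  · rw [hJw, mul_pow _ _ (m + 2), mul_pow _ _ (m + 2)]; ring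
  have hwD : w = (1 - zet τ ^ 2) * Lth τ (z - ηc) ^ 2 / D := by rw [eq_div_iff hz]; exact hw
  rw [hP, hDD, mco, hBk]
  rw [show ∀ a b : ℂ, a * w * b = a * ((1 - zet τ ^ 2) * Lth τ (z - ηc) ^ 2 / D) * b by
    intro a b; rw [← hwD], hBk]
  clear_value w Jw P Q D
  generalize ybar (zet τ) t - w = Y
  generalize gco τ m * Pref τ m xs * r = G
  have hz2 := pow_ne_zero m hT
  rw [show T4 τ 0 * (zet τ * T4 τ 0 ^ 4) ^ m = T4 τ 0 * (zet τ ^ m * (T4 τ 0 ^ m) ^ 4) by ring,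
    show T4 τ 0 * (zet τ * T4 τ 0 ^ 4) ^ (m + 1)
      = T4 τ 0 * (zet τ ^ m * (T4 τ 0 ^ m) ^ 4 * (zet τ * T4 τ 0 ^ 4)) by ring,
    show kap τ ^ (5 * m + 4) = (kap τ ^ m) ^ 5 * kap τ ^ 4 by ring,
    show kap τ ^ (5 * (m + 1) + 4) = (kap τ ^ m) ^ 5 * kap τ ^ 9 by ring,
    show Clan τ ^ (4 * m + 4) = Clan τ ^ (2 * m + 1) * Clan τ ^ (2 * (m + 1) + 1) by
      rw [← pow_add]; congr 1; ring]
  rw [show (D ^ 2 / kap τ ^ 4) ^ (m + 2) = (D ^ m) ^ 2 / (kap τ ^ m) ^ 4 * (D ^ 4 / kap τ ^ 8) by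
      rw [pow_add, div_pow, ← pow_mul, ← pow_mul, div_pow]; ring,
    show ((kap τ ^ 3)⁻¹ * (zet τ * T4 τ 0 ^ 4) / D) ^ m
      = zet τ ^ m * (T4 τ 0 ^ m) ^ 4 / ((kap τ ^ m) ^ 3 * D ^ m) by
      rw [div_pow, mul_pow, mul_pow, inv_pow, ← pow_mul, ← pow_mul, ← pow_mul, ← pow_mul]
      field_simp
      ring]
  have e1 := pow_ne_zero m hT
  have e2 := pow_ne_zero m hζ
  have e3 := pow_ne_zero m hk
  have e4 := pow_ne_zero m hz
  generalize T4 τ 0 ^ m = a1 at *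
  generalize zet τ ^ m = a2 at *
  generalize kap τ ^ m = a3 at *
  generalize D ^ m = a4 at *
  field_simp
  ring

end

section PolyFun

/-- A polynomial function of finitely many variables. -/
def PolyFun {σ : Type} (F : (σ → ℂ) → ℂ) : Prop := ∃ P : MvPolynomial σ ℂ, ∀ w, F w = MvPolynomial.eval w P

variable {σ ρ : Type} {F G Q : (σ → ℂ) → ℂ}

theorem PolyFun.const (c : ℂ) : PolyFun fun _ : σ → ℂ => c := ⟨MvPolynomial.C c, by simp⟩
theorem PolyFun.coord (i : σ) : PolyFun fun w : σ → ℂ => w i := ⟨MvPolynomial.X i, by simp⟩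
theorem PolyFun.add (hF : PolyFun F) (hG : PolyFun G) : PolyFun fun w => F w + G w := by
  obtain ⟨P, hP⟩ := hF; obtain ⟨R, hR⟩ := hG
  exact ⟨P + R, fun w => by simp [hP, hR]⟩
theorem PolyFun.sub (hF : PolyFun F) (hG : PolyFun G) : PolyFun fun w => F w - G w := by
  obtain ⟨P, hP⟩ := hF; obtain ⟨R, hR⟩ := hG
  exact ⟨P - R, fun w => by simp [hP, hR]⟩
theorem PolyFun.mul (hF : PolyFun F) (hG : PolyFun G) : PolyFun fun w => F w * G w := by
  obtain ⟨P, hP⟩ := hF; obtain ⟨R, hR⟩ := hG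
  exact ⟨P * R, fun w => by simp [hP, hR]⟩
theorem PolyFun.prod {ι : Type} (s : Finset ι) {f : ι → (σ → ℂ) → ℂ} (hf : ∀ i ∈ s, PolyFun (f i)) :
    PolyFun fun w => ∏ i ∈ s, f i w := by
  classical
  induction s using Finset.induction_on with
  | empty => simpa using PolyFun.const 1
  | insert a s ha ih =>
    simp only [Finset.prod_insert ha]
    exact (hf a (by simp)).mul (ih fun i hi => hf i (by simp [hi]))
theorem PolyFun.sum {ι : Type} (s : Finset ι) {f : ι → (σ → ℂ) → ℂ} (hf : ∀ i ∈ s, PolyFun (f i)) :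
    PolyFun fun w => ∑ i ∈ s, f i w := by
  classical
  induction s using Finset.induction_on with
  | empty => simpa using PolyFun.const 0
  | insert a s ha ih =>
    simp only [Finset.sum_insert ha]
    exact (hf a (by simp)).add (ih fun i hi => hf i (by simp [hi]))

theorem PolyFun.det {n : ℕ} {M : Fin n → Fin n → (σ → ℂ) → ℂ} (hM : ∀ i j, PolyFun (M i j)) :
    PolyFun fun w => Matrix.det (Matrix.of fun i j => M i j w) := by
  simp only [Matrix.det_apply']
  exact PolyFun.sum _ fun p _ => (PolyFun.const _).mul (PolyFun.prod _ fun i _ => hM _ _)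

theorem PolyFun.comp {f : σ → (ρ → ℂ) → ℂ} (hF : PolyFun F) (hf : ∀ i, PolyFun (f i)) :
    PolyFun fun w => F fun i => f i w := by
  obtain ⟨P, hP⟩ := hF
  choose R hR using hf
  refine ⟨MvPolynomial.bind₁ R P, fun w => ?_⟩
  have : F (fun i => f i w) = MvPolynomial.eval (fun i => MvPolynomial.eval w (R i)) P := by
    rw [hP]; simp only [hR]
  refine this.trans ?_
  change _ = MvPolynomial.eval₂Hom (RingHom.id ℂ) w (MvPolynomial.bind₁ R P)
  rw [MvPolynomial.eval₂Hom_bind₁]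
  rfl

theorem PolyFun.ne_mul (hF : PolyFun F) (hG : PolyFun G) (h1 : ∃ w, F w ≠ 0) (h2 : ∃ w, G w ≠ 0) :
    ∃ w, F w * G w ≠ 0 := by
  by_contra! hc
  obtain ⟨P, hP⟩ := hF; obtain ⟨R, hR⟩ := hG
  have : P * R = 0 := MvPolynomial.funext fun w => by simp [← hP, ← hR, hc]
  rcases mul_eq_zero.1 this with h | h
  · obtain ⟨w, hw⟩ := h1; exact hw (by simp [hP, h])
  · obtain ⟨w, hw⟩ := h2; exact hw (by simp [hR, h])

theorem PolyFun.ne_prod {ι : Type} (s : Finset ι) {f : ι → (σ → ℂ) → ℂ} (hf : ∀ i ∈ s, PolyFun (f i))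
    (hn : ∀ i ∈ s, ∃ w, f i w ≠ 0) : ∃ w, ∏ i ∈ s, f i w ≠ 0 := by
  classical
  induction s using Finset.induction_on with
  | empty => simp
  | insert a s ha ih =>
    simp only [Finset.prod_insert ha]
    exact (hf a (by simp)).ne_mul (PolyFun.prod s fun i hi => hf i (by simp [hi])) (hn a (by simp))
      (ih (fun i hi => hf i (by simp [hi])) fun i hi => hn i (by simp [hi]))

theorem PolyFun.eq_of_mul (hF : PolyFun F) (hG : PolyFun G) (hQ : PolyFun Q) (hn : ∃ w, Q w ≠ 0)
    (h : ∀ w, Q w ≠ 0 → F w = G w) (w : σ → ℂ) : F w = G w := by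
  by_contra hc
  obtain ⟨v, hv⟩ := (hF.sub hG).ne_mul hQ ⟨w, sub_ne_zero.2 hc⟩ hn
  have := right_ne_zero_of_mul hv
  exact hv (by rw [h v this, sub_self, zero_mul])

end PolyFun

theorem hpol_comm (ζ w w' : ℂ) : hpol ζ w w' = hpol ζ w' w := by unfold hpol; ring

theorem PolyFun.hpol {σ : Type} {F G : (σ → ℂ) → ℂ} (ζ : ℂ) (hF : PolyFun F) (hG : PolyFun G) :
    PolyFun fun w => hpol ζ (F w) (G w) := by
  unfold _root_.hpol
  exact ((PolyFun.const 1).sub (((PolyFun.const _).mul hF).mul hG)).add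
    ((((PolyFun.const _).mul hF).mul hG).mul (hF.add hG))

section halves
variable {K : ℕ}

/-- Splitting of the index set of `2K` variables into halves. -/
def halfEquiv (K : ℕ) : Fin (2 * K) ≃ Fin K ⊕ Fin K := (finCongr (two_mul K)).trans finSumFinEquiv.symm

theorem firstHalf_comp (w : Fin K ⊕ Fin K → ℂ) : firstHalf (fun j => w (halfEquiv K j)) = fun i => w (Sum.inl i) := by
  funext i
  have : halfEquiv K ⟨(i : ℕ), by have := i.2; omega⟩ = Sum.inl i := by
    rw [← Equiv.eq_symm_apply]; simp [halfEquiv, Fin.ext_iff]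
  simp [firstHalf, this]

theorem secondHalf_comp (w : Fin K ⊕ Fin K → ℂ) : secondHalf (fun j => w (halfEquiv K j)) = fun i => w (Sum.inr i) := by
  funext i
  have : halfEquiv K ⟨K + (i : ℕ), by have := i.2; omega⟩ = Sum.inr i := by
    rw [← Equiv.eq_symm_apply]; simp [halfEquiv, Fin.ext_iff, add_comm]
  simp [secondHalf, this]

theorem PolyFun.vdm {σ : Type} (f : Fin K → (σ → ℂ) → ℂ) (hf : ∀ i, PolyFun (f i)) :
    PolyFun fun w => vdm fun i => f i w := by
  unfold _root_.vdm
  refine PolyFun.prod _ fun i _ => PolyFun.prod _ fun j _ => ?_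
  split_ifs
  · exact (hf j).sub (hf i)
  · exact PolyFun.const 1

theorem vdm_ne_zero_iff (w : Fin K → ℂ) : vdm w ≠ 0 ↔ ∀ i j, i ≠ j → w i ≠ w j := by
  unfold vdm
  simp only [Finset.prod_ne_zero_iff, Finset.mem_univ, true_implies]
  constructor
  · intro h i j hij
    rcases lt_or_gt_of_ne hij with h1 | h1
    · have := h i j; rw [if_pos h1] at this; exact fun e => this (by rw [e, sub_self])
    · have := h j i; rw [if_pos h1] at this; exact fun e => this (by rw [e, sub_self])
  · intro h i j
    split_ifs with h1
    · exact sub_ne_zero.2 (h i j h1.ne).symm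
    · exact one_ne_zero

/-- The polynomial numerator of `H_{2K}`. -/
def Mdet (ζ : ℂ) {K : ℕ} (a b : Fin K → ℂ) : ℂ :=
  Matrix.det (Matrix.of fun i j : Fin K => ∏ l ∈ Finset.univ.erase j, hpol ζ (a i) (b l))

theorem Mdet_eq (ζ : ℂ) (a b : Fin K → ℂ) (h : ∀ i j, hpol ζ (a i) (b j) ≠ 0) :
    (∏ i : Fin K, ∏ j : Fin K, hpol ζ (a i) (b j)) *
      Matrix.det (Matrix.of fun i j : Fin K => (hpol ζ (a i) (b j))⁻¹) = Mdet ζ a b := by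
  rw [← Matrix.det_mul_column]
  unfold Mdet
  congr 1
  ext i j
  simp only [Matrix.of_apply]
  rw [← Finset.mul_prod_erase _ _ (Finset.mem_univ j), mul_right_comm, mul_inv_cancel₀ (h i j), one_mul]

theorem PolyFun.Mdet {σ : Type} (ζ : ℂ) (f g : Fin K → (σ → ℂ) → ℂ) (hf : ∀ i, PolyFun (f i))
    (hg : ∀ i, PolyFun (g i)) : PolyFun fun w => Mdet ζ (fun i => f i w) (fun i => g i w) := by
  unfold _root_.Mdet
  exact PolyFun.det fun i j => PolyFun.prod _ fun l _ => PolyFun.hpol ζ (hf i) (hg l)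

end halves

section H
variable {ζ : ℂ} {H : (k : ℕ) → (Fin (2 * k) → ℂ) → ℂ}

/-- `H` as a function of two sets of variables. -/
def Hs (H : (k : ℕ) → (Fin (2 * k) → ℂ) → ℂ) (K : ℕ) (w : Fin K ⊕ Fin K → ℂ) : ℂ :=
  H K fun j => w (halfEquiv K j)

theorem Hs_poly (hH : IsHFamily ζ H) (K : ℕ) : PolyFun (Hs H K) := by
  have : PolyFun (H K) := hH.2.1 K
  exact this.comp fun i => PolyFun.coord _

theorem hpol_ne_generic {σ : Type} (ζ : ℂ) (i j : σ) : ∃ w : σ → ℂ, hpol ζ (w i) (w j) ≠ 0 :=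
  ⟨fun _ => 0, by simp [hpol]⟩

theorem coord_sub_ne {σ : Type} {i j : σ} (h : i ≠ j) : ∃ w : σ → ℂ, w i - w j ≠ 0 := by
  classical
  exact ⟨fun k => if k = i then 1 else 0, by simp [h.symm]⟩

/-- The pairwise genericity polynomial. -/
def genQ (ζ : ℂ) {σ : Type} [Fintype σ] [DecidableEq σ] (w : σ → ℂ) : ℂ :=
  (∏ i, w i) * ∏ i, ∏ j ∈ Finset.univ.erase i, ((w i - w j) * hpol ζ (w i) (w j))

theorem genQ_poly {σ : Type} [Fintype σ] [DecidableEq σ] : PolyFun (genQ ζ (σ := σ)) := by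
  unfold genQ
  exact (PolyFun.prod _ fun i _ => PolyFun.coord i).mul (PolyFun.prod _ fun i _ => PolyFun.prod _ fun j _ =>
    ((PolyFun.coord i).sub (PolyFun.coord j)).mul (PolyFun.hpol ζ (PolyFun.coord i) (PolyFun.coord j)))

theorem genQ_ne {σ : Type} [Fintype σ] [DecidableEq σ] : ∃ w : σ → ℂ, genQ ζ w ≠ 0 := by
  unfold genQ
  have hp : ∀ i j : σ, PolyFun fun w : σ → ℂ => (w i - w j) * hpol ζ (w i) (w j) := fun i j =>
    ((PolyFun.coord i).sub (PolyFun.coord j)).mul (PolyFun.hpol ζ (PolyFun.coord i) (PolyFun.coord j))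
  refine PolyFun.ne_mul (PolyFun.prod _ fun i _ => PolyFun.coord i) (PolyFun.prod _ fun i _ => PolyFun.prod _ fun j _ => hp i j)
    (PolyFun.ne_prod _ (fun i _ => PolyFun.coord i) fun i _ => ⟨fun _ => 1, one_ne_zero⟩)
    (PolyFun.ne_prod _ (fun i _ => PolyFun.prod _ fun j _ => hp i j) fun i _ =>
      PolyFun.ne_prod _ (fun j _ => hp i j) fun j hj => ?_)
  exact PolyFun.ne_mul ((PolyFun.coord i).sub (PolyFun.coord j)) (PolyFun.hpol ζ (PolyFun.coord i) (PolyFun.coord j))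
    (coord_sub_ne (Finset.ne_of_mem_erase hj).symm) (hpol_ne_generic ζ i j)

theorem genQ_spec {σ : Type} [Fintype σ] [DecidableEq σ] {w : σ → ℂ} (h : genQ ζ w ≠ 0) :
    (∀ i, w i ≠ 0) ∧ ∀ i j, i ≠ j → w i ≠ w j ∧ hpol ζ (w i) (w j) ≠ 0 := by
  unfold genQ at h
  rw [mul_ne_zero_iff] at h
  simp only [Finset.prod_ne_zero_iff, Finset.mem_univ, true_implies] at h
  refine ⟨h.1, fun i j hij => ?_⟩
  have := h.2 i j (by simp [hij.symm])
  exact ⟨sub_ne_zero.1 (left_ne_zero_of_mul this), right_ne_zero_of_mul this⟩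

theorem Hs_mul_vdm (hH : IsHFamily ζ H) (K : ℕ) (w : Fin K ⊕ Fin K → ℂ) :
    Hs H K w * (vdm (fun i => w (Sum.inl i)) * vdm fun i => w (Sum.inr i))
      = Mdet ζ (fun i => w (Sum.inl i)) fun i => w (Sum.inr i) := by
  have hv : PolyFun fun w : Fin K ⊕ Fin K → ℂ => vdm (fun i => w (Sum.inl i)) * vdm fun i => w (Sum.inr i) :=
    (PolyFun.vdm _ fun i => PolyFun.coord _).mul (PolyFun.vdm _ fun i => PolyFun.coord _)
  refine ((Hs_poly hH K).mul hv).eq_of_mul (PolyFun.Mdet ζ _ _ (fun i => PolyFun.coord _)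
    fun i => PolyFun.coord _) (genQ_poly (ζ := ζ)) genQ_ne (fun w hw => ?_) w
  obtain ⟨-, hw⟩ := genQ_spec hw
  have hh : ∀ i j : Fin K, hpol ζ (w (Sum.inl i)) (w (Sum.inr j)) ≠ 0 := fun i j => (hw _ _ (by simp)).2
  have h1 : ∀ i j : Fin K, i ≠ j → w (Sum.inl i) ≠ w (Sum.inl j) := fun i j hij => (hw _ _ (by simpa)).1
  have h2 : ∀ i j : Fin K, i ≠ j → w (Sum.inr i) ≠ w (Sum.inr j) := fun i j hij => (hw _ _ (by simpa)).1
  have := hH.2.2 K (fun j => w (halfEquiv K j)) (by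
    unfold HratioDefined; rw [firstHalf_comp, secondHalf_comp]; exact ⟨h1, h2, hh⟩)
  simp only [Hs]
  rw [this, Hratio, firstHalf_comp, secondHalf_comp]
  rw [← Mdet_eq ζ _ _ hh]
  have v1 := (vdm_ne_zero_iff _).2 h1
  have v2 := (vdm_ne_zero_iff _).2 h2
  field_simp

end H

section DegLE

/-- `f` is a polynomial function of degree at most `d`. -/
def DegLE (d : ℕ) (f : ℂ → ℂ) : Prop := ∃ p : Polynomial ℂ, p.natDegree ≤ d ∧ ∀ x, f x = p.eval x

variable {d e : ℕ} {f g : ℂ → ℂ}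

theorem DegLE.const (c : ℂ) : DegLE d fun _ => c := ⟨Polynomial.C c, by simp, by simp⟩
theorem DegLE.mono (hf : DegLE d f) (h : d ≤ e) : DegLE e f := by
  obtain ⟨p, hp, h'⟩ := hf; exact ⟨p, hp.trans h, h'⟩
theorem DegLE.mul (hf : DegLE d f) (hg : DegLE e g) : DegLE (d + e) fun x => f x * g x := by
  obtain ⟨p, hp, h'⟩ := hf; obtain ⟨q, hq, h''⟩ := hg
  exact ⟨p * q, Polynomial.natDegree_mul_le.trans (add_le_add hp hq), fun x => by simp [h', h'']⟩
theorem DegLE.add (hf : DegLE d f) (hg : DegLE d g) : DegLE d fun x => f x + g x := by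
  obtain ⟨p, hp, h'⟩ := hf; obtain ⟨q, hq, h''⟩ := hg
  exact ⟨p + q, (Polynomial.natDegree_add_le _ _).trans (max_le hp hq), fun x => by simp [h', h'']⟩
theorem DegLE.const_mul (c : ℂ) (hf : DegLE d f) : DegLE d fun x => c * f x := by
  have := (DegLE.const (d := 0) c).mul hf; rwa [zero_add] at this
theorem DegLE.sub (hf : DegLE d f) (hg : DegLE d g) : DegLE d fun x => f x - g x := by
  simpa [sub_eq_add_neg] using hf.add (hg.const_mul (-1))
theorem DegLE.sum {ι : Type} (s : Finset ι) {f : ι → ℂ → ℂ} (hf : ∀ i ∈ s, DegLE d (f i)) :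
    DegLE d fun x => ∑ i ∈ s, f i x := by
  classical
  induction s using Finset.induction_on with
  | empty => simpa using DegLE.const 0
  | insert a s ha ih =>
    simp only [Finset.sum_insert ha]
    exact (hf a (by simp)).add (ih fun i hi => hf i (by simp [hi]))
theorem DegLE.prod {ι : Type} (s : Finset ι) {f : ι → ℂ → ℂ} (hf : ∀ i ∈ s, DegLE d (f i)) :
    DegLE (s.card * d) fun x => ∏ i ∈ s, f i x := by
  classical
  induction s using Finset.induction_on with
  | empty => simpa using DegLE.const 1
  | insert a s ha ih =>
    simp only [Finset.prod_insert ha, Finset.card_insert_of_notMem ha]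
    exact ((hf a (by simp)).mul (ih fun i hi => hf i (by simp [hi]))).mono (by ring_nf; rfl)

theorem DegLE.hpol (ζ c : ℂ) : DegLE 2 fun x => hpol ζ x c := by
  refine ⟨1 - Polynomial.C ((3 + ζ ^ 2) * c) * Polynomial.X + Polynomial.C ((1 - ζ ^ 2) * c) * Polynomial.X ^ 2
    + Polynomial.C ((1 - ζ ^ 2) * c * c) * Polynomial.X, by compute_degree, fun x => ?_⟩
  simp [_root_.hpol]; ring

theorem DegLE.eq_of_injective {ι : Type} [Fintype ι] (hf : DegLE d f) (hg : DegLE d g) {u : ι → ℂ}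
    (hu : Function.Injective u) (h : ∀ i, f (u i) = g (u i)) (hd : d < Fintype.card ι) : f = g := by
  obtain ⟨p, hp, h'⟩ := hf.sub hg
  have : p = 0 := Polynomial.eq_zero_of_natDegree_lt_card_of_eval_eq_zero p hu
    (fun i => by rw [← h']; exact sub_eq_zero.2 (h i)) (lt_of_le_of_lt hp hd)
  funext x
  rw [← sub_eq_zero]
  exact (h' x).trans (by rw [this, Polynomial.eval_zero])

/-- A degree bound in one variable at generic points holds everywhere. -/
theorem PolyFun.degLE_of_generic {σ : Type} [DecidableEq σ] {F Q : (σ → ℂ) → ℂ} (hF : PolyFun F)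
    (hQ : PolyFun Q) (hn : ∃ w, Q w ≠ 0) (i : σ)
    (h : ∀ w, Q w ≠ 0 → DegLE d fun x => F (Function.update w i x)) (w : σ → ℂ) :
    DegLE d fun x => F (Function.update w i x) := by
  obtain ⟨P, hP⟩ := hF
  set R : Polynomial (MvPolynomial σ ℂ) := MvPolynomial.aeval
    (fun j => if j = i then Polynomial.X else Polynomial.C (MvPolynomial.X j)) P with hR
  have key : ∀ w x, F (Function.update w i x) = (R.map (MvPolynomial.eval w)).eval x := by
    intro w x
    rw [hP, hR]
    clear_value R
    clear hP hR
    induction P using MvPolynomial.induction_on with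
    | C a => simp
    | add p q hp hq => simp only [map_add, Polynomial.map_add, Polynomial.eval_add, hp, hq]
    | mul_X p j hp =>
      simp only [map_mul, Polynomial.map_mul, Polynomial.eval_mul, MvPolynomial.aeval_X, MvPolynomial.eval_X]
      rw [hp]
      congr 1
      by_cases hj : j = i
      · subst hj; simp
      · simp [hj]
  refine ⟨R.map (MvPolynomial.eval w), ?_, key w⟩
  rw [Polynomial.natDegree_le_iff_coeff_eq_zero]
  intro m hm
  rw [Polynomial.coeff_map]
  refine PolyFun.eq_of_mul (F := fun w => MvPolynomial.eval w (R.coeff m)) (G := fun _ => 0)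
    ⟨_, fun w => rfl⟩ (PolyFun.const 0) hQ hn (fun w hw => ?_) w
  obtain ⟨p, hp, hpx⟩ := h w hw
  have : R.map (MvPolynomial.eval w) = p := Polynomial.funext fun x => by rw [← key, ← hpx]
  rw [← Polynomial.coeff_map, this]
  exact Polynomial.coeff_eq_zero_of_natDegree_lt (lt_of_le_of_lt hp hm)

end DegLE

section
variable {ζ : ℂ} {H : (k : ℕ) → (Fin (2 * k) → ℂ) → ℂ} {K : ℕ}

theorem vdm_eq_det (a : Fin K → ℂ) : vdm a = (Matrix.vandermonde a).det := by
  rw [Matrix.det_vandermonde]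
  unfold vdm
  refine Finset.prod_congr rfl fun i _ => ?_
  rw [← Finset.prod_filter]
  congr 1
  ext j; simp

theorem vdm_perm (a : Fin K → ℂ) (s : Equiv.Perm (Fin K)) :
    vdm (fun i => a (s i)) = (Equiv.Perm.sign s : ℂ) * vdm a := by
  rw [vdm_eq_det, vdm_eq_det, ← Matrix.det_permute]
  rfl

theorem vdm_cons (x : ℂ) (a : Fin K → ℂ) : vdm (Fin.cons x a : Fin (K + 1) → ℂ) = (∏ i, (a i - x)) * vdm a := by
  unfold vdm
  rw [Fin.prod_univ_succ]
  congr 1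
  · rw [Fin.prod_univ_succ]; simp
  · refine Finset.prod_congr rfl fun i _ => ?_
    rw [Fin.prod_univ_succ]; simp

theorem Mdet_perm_left (a b : Fin K → ℂ) (s : Equiv.Perm (Fin K)) :
    Mdet ζ (fun i => a (s i)) b = (Equiv.Perm.sign s : ℂ) * Mdet ζ a b := by
  unfold Mdet
  rw [← Matrix.det_permute]
  rfl

theorem Mdet_perm_right (a b : Fin K → ℂ) (s : Equiv.Perm (Fin K)) :
    Mdet ζ a (fun i => b (s i)) = (Equiv.Perm.sign s : ℂ) * Mdet ζ a b := by
  unfold Mdet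
  rw [← Matrix.det_permute']
  congr 1
  ext i j
  simp only [Matrix.of_apply, Matrix.submatrix_apply, id]
  refine Finset.prod_bij (fun l _ => s l) (fun l hl => by simpa using hl) (fun l _ l' _ h => s.injective h)
    (fun l hl => ⟨s.symm l, by simpa [Equiv.symm_apply_eq] using hl, by simp⟩) fun l _ => rfl

theorem prod_erase_zero (f : Fin (K + 1) → ℂ) : ∏ l ∈ Finset.univ.erase 0, f l = ∏ l, f (Fin.succ l) := by
  rw [Fin.univ_succ]; simp

theorem prod_erase_succ (f : Fin (K + 1) → ℂ) (j : Fin K) :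
    ∏ l ∈ Finset.univ.erase j.succ, f l = f 0 * ∏ l ∈ Finset.univ.erase j, f (Fin.succ l) := by
  rw [← Finset.mul_prod_erase _ _ (a := (0 : Fin (K + 1))) (by simp [Fin.ext_iff])]
  congr 1
  rw [Finset.erase_right_comm, Fin.univ_succ, Finset.erase_cons]
  have := Finset.prod_map (Finset.univ.erase j) (Fin.succEmb K) f
  simp only [Fin.coe_succEmb] at this
  rw [← this]
  congr 1
  ext l; simp

theorem Mdet_cons_of_zero {w₁ w₂ : ℂ} (h : hpol ζ w₁ w₂ = 0) (a b : Fin K → ℂ) :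
    Mdet ζ (Fin.cons w₁ a : Fin (K + 1) → ℂ) (Fin.cons w₂ b : Fin (K + 1) → ℂ)
      = (∏ j, hpol ζ w₁ (b j)) * (∏ i, hpol ζ (a i) w₂) * Mdet ζ a b := by
  unfold Mdet
  rw [Matrix.det_succ_row_zero, Finset.sum_eq_single 0]
  · simp only [Matrix.of_apply, prod_erase_zero, Fin.cons_zero, Fin.cons_succ, Fin.val_zero, pow_zero, one_mul]
    rw [mul_assoc]
    congr 1
    rw [← Matrix.det_mul_column]
    congr 1
    ext i j
    simp [prod_erase_succ]
  · intro j _ hj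
    obtain ⟨j', rfl⟩ := Fin.exists_succ_eq.2 hj
    simp [prod_erase_succ, h]
  · simp

/-- `H` as a function of two tuples. -/
def Hab (H : (k : ℕ) → (Fin (2 * k) → ℂ) → ℂ) {K : ℕ} (a b : Fin K → ℂ) : ℂ := Hs H K (Sum.elim a b)

theorem Hab_mul_vdm (hH : IsHFamily ζ H) (a b : Fin K → ℂ) : Hab H a b * (vdm a * vdm b) = Mdet ζ a b :=
  Hs_mul_vdm hH K (Sum.elim a b)

theorem PolyFun.Hab {σ : Type} (hH : IsHFamily ζ H) {f g : Fin K → (σ → ℂ) → ℂ} (hf : ∀ i, PolyFun (f i))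
    (hg : ∀ i, PolyFun (g i)) : PolyFun fun w => Hab H (fun i => f i w) (fun i => g i w) := by
  have := (Hs_poly hH K).comp (f := Sum.elim f g) (fun i => by cases i <;> simp [hf, hg])
  convert this using 3 with w
  unfold _root_.Hab
  congr 1
  funext i
  cases i <;> rfl

/-- Generic-point induction for identities between polynomial functions of two tuples. -/
theorem generic_pair (ζ : ℂ) {K L : ℕ} {F G : (Fin K → ℂ) → (Fin L → ℂ) → ℂ}
    {Q : (Fin K ⊕ Fin L → ℂ) → ℂ} (hQ : PolyFun Q) (hn : ∃ w, Q w ≠ 0)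
    (hF : PolyFun fun w : Fin K ⊕ Fin L → ℂ => F (fun i => w (Sum.inl i)) fun i => w (Sum.inr i))
    (hG : PolyFun fun w : Fin K ⊕ Fin L → ℂ => G (fun i => w (Sum.inl i)) fun i => w (Sum.inr i))
    (h : ∀ a b, Q (Sum.elim a b) ≠ 0 → vdm a ≠ 0 → vdm b ≠ 0 →
      (∀ i j, i ≠ j → hpol ζ (a i) (a j) ≠ 0) → (∀ i, a i ≠ 0) → F a b = G a b) (a b) : F a b = G a b := by
  have := hF.eq_of_mul hG (hQ.mul (genQ_poly (ζ := ζ))) (hQ.ne_mul genQ_poly hn genQ_ne) (fun w hw => ?_) (Sum.elim a b)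
  · simpa using this
  · have h1 := left_ne_zero_of_mul hw
    obtain ⟨h0, h2⟩ := genQ_spec (right_ne_zero_of_mul hw)
    refine h _ _ ?_ ((vdm_ne_zero_iff _).2 fun i j hij => (h2 _ _ (by simpa)).1)
      ((vdm_ne_zero_iff _).2 fun i j hij => (h2 _ _ (by simpa)).1) (fun i j hij => (h2 _ _ (by simpa)).2) fun i => h0 _
    convert h1 using 2
    funext i; cases i <;> rfl

theorem Hab_perm_left (hH : IsHFamily ζ H) (a b : Fin K → ℂ) (s : Equiv.Perm (Fin K)) :
    Hab H (fun i => a (s i)) b = Hab H a b := by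
  refine generic_pair ζ (F := fun a b => Hab H (fun i => a (s i)) b) (G := fun a b => Hab H a b) (PolyFun.const 1)
    ⟨fun _ => 0, one_ne_zero⟩ (PolyFun.Hab hH (fun i => PolyFun.coord _) fun i => PolyFun.coord _)
    (PolyFun.Hab hH (fun i => PolyFun.coord _) fun i => PolyFun.coord _) (fun a b _ ha hb _ _ => ?_) a b
  have h1 := Hab_mul_vdm hH a b
  have h2 := Hab_mul_vdm hH (fun i => a (s i)) b
  rw [vdm_perm, Mdet_perm_left, ← h1] at h2
  have hs : (Equiv.Perm.sign s : ℂ) ≠ 0 := by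
    rcases Int.units_eq_one_or (Equiv.Perm.sign s) with h | h <;> simp [h]
  refine mul_right_cancel₀ (mul_ne_zero hs (mul_ne_zero ha hb)) ?_
  linear_combination h2

theorem Hab_perm_right (hH : IsHFamily ζ H) (a b : Fin K → ℂ) (s : Equiv.Perm (Fin K)) :
    Hab H a (fun i => b (s i)) = Hab H a b := by
  refine generic_pair ζ (F := fun a b => Hab H a (fun i => b (s i))) (G := fun a b => Hab H a b) (PolyFun.const 1)
    ⟨fun _ => 0, one_ne_zero⟩ (PolyFun.Hab hH (fun i => PolyFun.coord _) fun i => PolyFun.coord _)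
    (PolyFun.Hab hH (fun i => PolyFun.coord _) fun i => PolyFun.coord _) (fun a b _ ha hb _ _ => ?_) a b
  have h1 := Hab_mul_vdm hH a b
  have h2 := Hab_mul_vdm hH a (fun i => b (s i))
  rw [vdm_perm, Mdet_perm_right, ← h1] at h2
  have hs : (Equiv.Perm.sign s : ℂ) ≠ 0 := by
    rcases Int.units_eq_one_or (Equiv.Perm.sign s) with h | h <;> simp [h]
  refine mul_right_cancel₀ (mul_ne_zero hs (mul_ne_zero ha hb)) ?_
  linear_combination h2

end

section
variable {ζ : ℂ} {H : (k : ℕ) → (Fin (2 * k) → ℂ) → ℂ} {K : ℕ}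

theorem DegLE.Mdet_cons (ζ : ℂ) (a : Fin K → ℂ) (b : Fin (K + 1) → ℂ) :
    DegLE (K * 2) fun x => Mdet ζ (Fin.cons x a : Fin (K + 1) → ℂ) b := by
  unfold Mdet
  simp only [Matrix.det_succ_row_zero]
  refine DegLE.sum _ fun j _ => ?_
  have h1 : ∀ x, Matrix.det (Matrix.submatrix (Matrix.of fun i j : Fin (K + 1) => ∏ l ∈ Finset.univ.erase j,
      _root_.hpol ζ ((Fin.cons x a : Fin (K + 1) → ℂ) i) (b l)) Fin.succ j.succAbove)
      = Matrix.det (Matrix.submatrix (Matrix.of fun i j : Fin (K + 1) => ∏ l ∈ Finset.univ.erase j,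
      _root_.hpol ζ ((Fin.cons 0 a : Fin (K + 1) → ℂ) i) (b l)) Fin.succ j.succAbove) := by
    intro x
    congr 1
  simp only [h1, Matrix.of_apply, Fin.cons_zero]
  have h2 := DegLE.prod (Finset.univ.erase j) (f := fun l x => _root_.hpol ζ x (b l)) fun l _ => DegLE.hpol ζ (b l)
  simp only [Finset.card_erase_of_mem (Finset.mem_univ j), Finset.card_univ, Fintype.card_fin, Nat.add_sub_cancel] at h2
  exact ((h2.const_mul ((-1) ^ (j : ℕ))).mul (DegLE.const (d := 0) _)).mono le_rfl

theorem MvPolynomial.eval_eq_eval_aeval_X (P : MvPolynomial Unit ℂ) (x : ℂ) :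
    MvPolynomial.eval (fun _ => x) P = (MvPolynomial.aeval (fun _ => (Polynomial.X : Polynomial ℂ)) P).eval x := by
  induction P using MvPolynomial.induction_on with
  | C c => simp
  | add p q hp hq => rw [map_add, map_add, Polynomial.eval_add, hp, hq]
  | mul_X p j hp => rw [map_mul, map_mul, Polynomial.eval_mul, hp]; simp

theorem DegLE.Hab_cons (hH : IsHFamily ζ H) (a : Fin K → ℂ) (b : Fin (K + 1) → ℂ) :
    DegLE K fun x => Hab H (Fin.cons x a : Fin (K + 1) → ℂ) b := by
  have hu : ∀ (w : Fin (K + 1) ⊕ Fin (K + 1) → ℂ) (x : ℂ), (Function.update w (Sum.inl 0) x)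
      = Sum.elim (Fin.cons x fun i => w (Sum.inl i.succ) : Fin (K + 1) → ℂ) fun i => w (Sum.inr i) := by
    intro w x
    funext i
    rcases i with i | i
    · refine Fin.cases ?_ (fun i => ?_) i
      · simp
      · simp [Fin.ext_iff]
    · simp
  have := (Hs_poly hH (K + 1)).degLE_of_generic (d := K) (genQ_poly (ζ := ζ)) genQ_ne (Sum.inl 0) (fun w hw => ?_)
    (Sum.elim (Fin.cons 0 a : Fin (K + 1) → ℂ) b)
  · simp only [hu, Sum.elim_inl, Sum.elim_inr, Fin.cons_succ] at this
    exact this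
  · obtain ⟨-, hw⟩ := genQ_spec hw
    simp only [hu]
    set a := fun i : Fin K => w (Sum.inl i.succ) with ha
    set b := fun i => w (Sum.inr i) with hb
    have va : vdm a ≠ 0 := (vdm_ne_zero_iff _).2 fun i j hij => (hw _ _ (by simpa)).1
    have vb : vdm b ≠ 0 := (vdm_ne_zero_iff _).2 fun i j hij => (hw _ _ (by simpa)).1
    obtain ⟨P, hP⟩ := PolyFun.Hab (σ := Unit) hH (K := K + 1)
      (f := (Fin.cons (fun w => w ()) fun i _ => a i : Fin (K + 1) → (Unit → ℂ) → ℂ)) (g := fun i _ => b i)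
      (fun i => by
        refine Fin.cases ?_ (fun i => ?_) i
        · exact PolyFun.coord ()
        · exact PolyFun.const _) fun i => PolyFun.const _
    set p : Polynomial ℂ := MvPolynomial.aeval (fun _ => Polynomial.X) P with hp
    have hpe : ∀ x, Hab H (Fin.cons x a : Fin (K + 1) → ℂ) b = p.eval x := by
      intro x
      have h1 := hP fun _ => x
      have h2 : (fun i => (Fin.cons (fun w => w ()) fun i _ => a i : Fin (K + 1) → (Unit → ℂ) → ℂ) i fun _ => x)
          = (Fin.cons x a : Fin (K + 1) → ℂ) := by
        funext i
        refine Fin.cases ?_ (fun i => ?_) i <;> simp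
      simp only [h2] at h1
      refine h1.trans ?_
      exact MvPolynomial.eval_eq_eval_aeval_X P x
    refine ⟨p, ?_, hpe⟩
    obtain ⟨q, hq, hqx⟩ := DegLE.Mdet_cons ζ a b
    have hprod : p * ((∏ i, (Polynomial.C (a i) - Polynomial.X)) * Polynomial.C (vdm a * vdm b)) = q := by
      refine Polynomial.funext fun x => ?_
      rw [← hqx]
      dsimp only
      rw [← Hab_mul_vdm hH, vdm_cons, hpe]
      simp only [Polynomial.eval_mul, Polynomial.eval_prod, Polynomial.eval_sub, Polynomial.eval_C, Polynomial.eval_X]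
      ring
    by_cases hp0 : p = 0
    · simp [hp0]
    have hfac : ∀ i, (Polynomial.C (a i) - Polynomial.X : Polynomial ℂ).natDegree = 1 := fun i => by
      rw [← neg_sub, Polynomial.natDegree_neg, Polynomial.natDegree_X_sub_C]
    have hfne : ∀ i, (Polynomial.C (a i) - Polynomial.X : Polynomial ℂ) ≠ 0 := fun i h => by
      have := hfac i; simp [h] at this
    rw [← hprod, Polynomial.natDegree_mul hp0 (mul_ne_zero (Finset.prod_ne_zero_iff.2 fun i _ => hfne i)
      (by simp [va, vb])), Polynomial.natDegree_mul_C (mul_ne_zero va vb),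
      Polynomial.natDegree_prod _ _ fun i _ => hfne i] at hq
    simp only [hfac, Finset.sum_const, Finset.card_univ, Fintype.card_fin, smul_eq_mul, mul_one] at hq
    omega

theorem hpol_factor {w₁ w₂ w₃ : ℂ} (h : hpol ζ w₁ w₂ = 0) (h3 : (1 - ζ ^ 2) * w₁ * w₂ * w₃ = 1) (w : ℂ) :
    hpol ζ w₁ w = (1 - ζ ^ 2) * w₁ * (w - w₂) * (w - w₃) := by
  have h2 : w₂ ≠ 0 := by rintro rfl; simp at h3
  have h1 : w₁ ≠ 0 := by rintro rfl; simp at h3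
  have hs : (1 - ζ ^ 2) * (w₁ + w₂ + w₃) = 3 + ζ ^ 2 := by
    refine mul_left_cancel₀ (mul_ne_zero h1 h2) ?_
    unfold hpol at h
    linear_combination h + h3
  unfold hpol
  linear_combination w₁ * w * hs - h3

theorem Hab_wheel_cons (hH : IsHFamily ζ H) {w₁ w₂ w₃ : ℂ} (h : hpol ζ w₁ w₂ = 0)
    (h3 : (1 - ζ ^ 2) * w₁ * w₂ * w₃ = 1) (a b : Fin K → ℂ) :
    Hab H (Fin.cons w₁ a : Fin (K + 1) → ℂ) (Fin.cons w₂ b : Fin (K + 1) → ℂ)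
      = ((1 - ζ ^ 2) / w₃) ^ K * ((∏ i, (a i - w₃)) * ∏ i, (b i - w₃)) * Hab H a b := by
  have hc : ∀ (c : ℂ) (s : Fin K → Fin K ⊕ Fin K) (i : Fin (K + 1)),
      PolyFun ((Fin.cons (fun _ => c) fun i w => w (s i) : Fin (K + 1) → (Fin K ⊕ Fin K → ℂ) → ℂ) i) := by
    intro c s i
    refine Fin.cases ?_ (fun i => ?_) i
    · exact PolyFun.const _
    · exact PolyFun.coord _
  have hcc : ∀ (c : ℂ) (s : Fin K → Fin K ⊕ Fin K) (w : Fin K ⊕ Fin K → ℂ),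
      (fun i => (Fin.cons (fun _ => c) fun i w => w (s i) : Fin (K + 1) → (Fin K ⊕ Fin K → ℂ) → ℂ) i w)
        = (Fin.cons c fun i => w (s i) : Fin (K + 1) → ℂ) := by
    intro c s w
    funext i
    refine Fin.cases ?_ (fun i => ?_) i <;> simp
  have hF := PolyFun.Hab hH (hc w₁ Sum.inl) (hc w₂ Sum.inr)
  simp only [hcc] at hF
  have hQ : PolyFun fun w : Fin K ⊕ Fin K → ℂ => (∏ i, (w (Sum.inl i) - w₁)) * ∏ i, (w (Sum.inr i) - w₂) :=
    (PolyFun.prod _ fun i _ => (PolyFun.coord _).sub (PolyFun.const _)).mul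
      (PolyFun.prod _ fun i _ => (PolyFun.coord _).sub (PolyFun.const _))
  have hG : PolyFun fun w : Fin K ⊕ Fin K → ℂ => ((1 - ζ ^ 2) / w₃) ^ K *
      ((∏ i, (w (Sum.inl i) - w₃)) * ∏ i, (w (Sum.inr i) - w₃)) *
      Hab H (fun i => w (Sum.inl i)) fun i => w (Sum.inr i) :=
    ((PolyFun.const _).mul ((PolyFun.prod _ fun i _ => (PolyFun.coord _).sub (PolyFun.const _)).mul
      (PolyFun.prod _ fun i _ => (PolyFun.coord _).sub (PolyFun.const _)))).mul
      (PolyFun.Hab hH (fun i => PolyFun.coord _) fun i => PolyFun.coord _)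
  refine generic_pair ζ (F := fun a b => Hab H (Fin.cons w₁ a : Fin (K + 1) → ℂ) (Fin.cons w₂ b : Fin (K + 1) → ℂ))
    (G := fun a b => ((1 - ζ ^ 2) / w₃) ^ K * ((∏ i, (a i - w₃)) * ∏ i, (b i - w₃)) * Hab H a b)
    hQ ⟨Sum.elim (fun _ => w₁ + 1) fun _ => w₂ + 1, by simp⟩ hF hG (fun a b hq ha hb _ _ => ?_) a b
  simp only [Sum.elim_inl, Sum.elim_inr] at hq
  have h1 := Hab_mul_vdm hH (Fin.cons w₁ a : Fin (K + 1) → ℂ) (Fin.cons w₂ b : Fin (K + 1) → ℂ)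
  rw [vdm_cons, vdm_cons, Mdet_cons_of_zero h, ← Hab_mul_vdm hH] at h1
  have e1 : ∀ j, hpol ζ w₁ (b j) = (1 - ζ ^ 2) * w₁ * (b j - w₂) * (b j - w₃) := fun j => hpol_factor h h3 _
  have e2 : ∀ j, hpol ζ (a j) w₂ = (1 - ζ ^ 2) * w₂ * (a j - w₁) * (a j - w₃) := fun j => by
    rw [hpol_comm]; exact hpol_factor (by rw [hpol_comm]; exact h) (by linear_combination h3) _
  simp only [e1, e2, Finset.prod_mul_distrib, Finset.prod_const, Finset.card_univ, Fintype.card_fin] at h1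
  have h3' : w₃ ≠ 0 := by rintro rfl; simp at h3
  have e3 : (1 - ζ ^ 2) / w₃ = ((1 - ζ ^ 2) * w₁) * ((1 - ζ ^ 2) * w₂) := by
    field_simp; linear_combination (-(1 - ζ ^ 2)) * h3
  rw [e3, mul_pow, mul_pow, mul_pow]
  refine mul_right_cancel₀ (mul_ne_zero hq (mul_ne_zero ha hb)) ?_
  linear_combination h1

end

section
variable {ζ : ℂ} {H : (k : ℕ) → (Fin (2 * k) → ℂ) → ℂ} {K : ℕ}

theorem Hab_comm (hH : IsHFamily ζ H) (a b : Fin K → ℂ) : Hab H a b = Hab H b a := by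
  have hQ : PolyFun fun w : Fin K ⊕ Fin K → ℂ => ∏ i, ∏ j, hpol ζ (w (Sum.inl i)) (w (Sum.inr j)) :=
    PolyFun.prod _ fun i _ => PolyFun.prod _ fun j _ => PolyFun.hpol ζ (PolyFun.coord _) (PolyFun.coord _)
  refine generic_pair ζ (F := fun a b => Hab H a b) (G := fun a b => Hab H b a) hQ
    ⟨fun _ => 0, by simp [hpol]⟩ (PolyFun.Hab hH (fun i => PolyFun.coord _) fun i => PolyFun.coord _)
    (PolyFun.Hab hH (fun i => PolyFun.coord _) fun i => PolyFun.coord _) (fun a b hq ha hb _ _ => ?_) a b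
  simp only [Sum.elim_inl, Sum.elim_inr, Finset.prod_ne_zero_iff, Finset.mem_univ, true_implies] at hq
  refine mul_right_cancel₀ (mul_ne_zero ha hb) ?_
  rw [Hab_mul_vdm hH, mul_comm (vdm a), Hab_mul_vdm hH, ← Mdet_eq ζ a b hq, ← Mdet_eq ζ b a
    (fun i j => by rw [hpol_comm]; exact hq j i), Finset.prod_comm, ← Matrix.det_transpose]
  congr 2
  · simp only [hpol_comm ζ]
  · ext i j
    simp [hpol_comm ζ (a j)]

theorem Hab_swap_left (hH : IsHFamily ζ H) (x : ℂ) (a : Fin K → ℂ) (b : Fin (K + 1) → ℂ) (i : Fin K) :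
    Hab H (Fin.cons x a : Fin (K + 1) → ℂ) b
      = Hab H (Fin.cons (a i) (Function.update a i x) : Fin (K + 1) → ℂ) b := by
  rw [← Hab_perm_left hH (Fin.cons x a : Fin (K + 1) → ℂ) b (Equiv.swap 0 i.succ)]
  congr 1
  funext j
  refine Fin.cases ?_ (fun j => ?_) j
  · simp
  · by_cases h : j = i
    · subst h; simp
    · rw [Equiv.swap_apply_of_ne_of_ne (by simp [Fin.ext_iff]) (by simpa using h)]; simp [h]

theorem Hab_swap_right (hH : IsHFamily ζ H) (x : ℂ) (b : Fin K → ℂ) (a : Fin (K + 1) → ℂ) (i : Fin K) :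
    Hab H a (Fin.cons x b : Fin (K + 1) → ℂ)
      = Hab H a (Fin.cons (b i) (Function.update b i x) : Fin (K + 1) → ℂ) := by
  rw [Hab_comm hH, Hab_swap_left hH x b a i, Hab_comm hH]

theorem Hab_one (hH : IsHFamily ζ H) (a b : Fin 1 → ℂ) : Hab H a b = 1 := by
  have := Hab_mul_vdm hH a b
  simpa [vdm, Mdet] using this

theorem hpol_roots {a : ℂ} (hB : 1 - ζ ^ 2 ≠ 0) (ha : a ≠ 0)
    (hd : ((1 - ζ ^ 2) * a ^ 2 - (3 + ζ ^ 2) * a) ^ 2 - 4 * (1 - ζ ^ 2) * a ≠ 0) :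
    ∃ r s, r ≠ s ∧ hpol ζ a r = 0 ∧ hpol ζ a s = 0 ∧ (1 - ζ ^ 2) * a * r * s = 1 := by
  obtain ⟨δ, hδ⟩ := IsAlgClosed.exists_eq_mul_self
    (((1 - ζ ^ 2) * a ^ 2 - (3 + ζ ^ 2) * a) ^ 2 - 4 * (1 - ζ ^ 2) * a)
  have hδ0 : δ ≠ 0 := by rintro rfl; exact hd (by rw [hδ]; ring)
  set b := (1 - ζ ^ 2) * a ^ 2 - (3 + ζ ^ 2) * a with hb
  set c := (1 - ζ ^ 2) * a with hc
  have hc0 : c ≠ 0 := mul_ne_zero hB ha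
  have hq : ∀ x, hpol ζ a x = c * x ^ 2 + b * x + 1 := fun x => by rw [hb, hc]; unfold hpol; ring
  refine ⟨(-b + δ) / (2 * c), (-b - δ) / (2 * c), ?_, ?_, ?_, ?_⟩
  · intro h
    field_simp at h
    exact hδ0 (by linear_combination h / 2)
  · rw [hq]; field_simp; linear_combination -hδ
  · rw [hq]; field_simp; linear_combination -hδ
  · field_simp; linear_combination hδ

theorem exists_disc_ne (hB : 1 - ζ ^ 2 ≠ 0) :
    ∃ a : ℂ, ((1 - ζ ^ 2) * a ^ 2 - (3 + ζ ^ 2) * a) ^ 2 - 4 * (1 - ζ ^ 2) * a ≠ 0 := by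
  by_cases hA : 3 + ζ ^ 2 = 0
  · have : ζ ^ 2 = -3 := by linear_combination hA
    exact ⟨2, by rw [this]; norm_num⟩
  · refine ⟨(3 + ζ ^ 2) / (1 - ζ ^ 2), ?_⟩
    intro h
    field_simp at h
    have : (3 + ζ ^ 2) * (1 - ζ ^ 2) ^ 2 = 0 := by linear_combination (-1 / 4) * h
    exact mul_ne_zero hA (pow_ne_zero 2 hB) this

theorem Hab_exchange (hH : IsHFamily ζ H) (hB : 1 - ζ ^ 2 ≠ 0) (x y : ℂ) (a b : Fin K → ℂ) :
    Hab H (Fin.cons x a : Fin (K + 1) → ℂ) (Fin.cons y b : Fin (K + 1) → ℂ)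
      = Hab H (Fin.cons y a : Fin (K + 1) → ℂ) (Fin.cons x b : Fin (K + 1) → ℂ) := by
  induction K with
  | zero => rw [Hab_one hH, Hab_one hH]
  | succ M ih =>
    have hc : ∀ (c : ℂ) (s : Fin (M + 1) → Fin (M + 1) ⊕ Fin (M + 1)) (i : Fin (M + 1 + 1)),
        PolyFun ((Fin.cons (fun _ => c) fun i w => w (s i) : Fin (M + 1 + 1) → (Fin (M + 1) ⊕ Fin (M + 1) → ℂ) → ℂ) i) := by
      intro c s i
      refine Fin.cases ?_ (fun i => ?_) i
      · exact PolyFun.const _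
      · exact PolyFun.coord _
    have hcc : ∀ (c : ℂ) (s : Fin (M + 1) → Fin (M + 1) ⊕ Fin (M + 1)) (w : Fin (M + 1) ⊕ Fin (M + 1) → ℂ),
        (fun i => (Fin.cons (fun _ => c) fun i w => w (s i) : Fin (M + 1 + 1) → (Fin (M + 1) ⊕ Fin (M + 1) → ℂ) → ℂ) i w)
          = (Fin.cons c fun i => w (s i) : Fin (M + 1 + 1) → ℂ) := by
      intro c s w
      funext i
      refine Fin.cases ?_ (fun i => ?_) i <;> simp
    have hF := PolyFun.Hab hH (hc x Sum.inl) (hc y Sum.inr)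
    have hG := PolyFun.Hab hH (hc y Sum.inl) (hc x Sum.inr)
    simp only [hcc] at hF hG
    have hQ : PolyFun fun w : Fin (M + 1) ⊕ Fin (M + 1) → ℂ => ∏ i : Fin (M + 1),
        (((1 - ζ ^ 2) * w (Sum.inl i) * w (Sum.inl i) - (3 + ζ ^ 2) * w (Sum.inl i)) *
        ((1 - ζ ^ 2) * w (Sum.inl i) * w (Sum.inl i) - (3 + ζ ^ 2) * w (Sum.inl i)) - 4 * (1 - ζ ^ 2) * w (Sum.inl i)) := by
      refine PolyFun.prod _ fun i _ => PolyFun.sub (PolyFun.mul (PolyFun.sub ?_ ?_) (PolyFun.sub ?_ ?_)) ?_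
      · exact ((PolyFun.const _).mul (PolyFun.coord _)).mul (PolyFun.coord _)
      · exact ((PolyFun.const _).mul (PolyFun.coord _))
      · exact ((PolyFun.const _).mul (PolyFun.coord _)).mul (PolyFun.coord _)
      · exact ((PolyFun.const _).mul (PolyFun.coord _))
      · exact ((PolyFun.const _).mul (PolyFun.coord _))
    obtain ⟨a₀, ha₀⟩ := exists_disc_ne hB
    refine generic_pair ζ (F := fun a b => Hab H (Fin.cons x a : Fin (M + 1 + 1) → ℂ) (Fin.cons y b : Fin (M + 1 + 1) → ℂ))
      (G := fun a b => Hab H (Fin.cons y a : Fin (M + 1 + 1) → ℂ) (Fin.cons x b : Fin (M + 1 + 1) → ℂ)) hQ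
      ⟨fun _ => a₀, Finset.prod_ne_zero_iff.2 fun i _ => by convert ha₀ using 1; ring⟩ hF hG
      (fun a b hq ha _ hh h0 => ?_) a b
    simp only [Sum.elim_inl, Finset.prod_ne_zero_iff, Finset.mem_univ, true_implies] at hq
    have hroots := fun i => hpol_roots (ζ := ζ) hB (h0 i) (by convert hq i using 1; ring)
    choose r s hrs hr hs hrs1 using hroots
    have hinj : Function.Injective (fun e : Fin (M + 1) × Bool => if e.2 then r e.1 else s e.1) := by
      have key : ∀ i j u v, i ≠ j → hpol ζ (a i) u = 0 → hpol ζ (a j) u = 0 → hpol ζ (a i) v = 0 →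
          (1 - ζ ^ 2) * a i * u * v = 1 → False := by
        intro i j u v hij h1 h2 h3 h4
        have hu : u ≠ 0 := by rintro rfl; simp at h4
        rw [hpol_comm] at h1 h2
        rw [hpol_factor h1 (w₃ := v) (by linear_combination h4)] at h2
        have haij := (vdm_ne_zero_iff a).1 ha j i hij.symm
        simp only [mul_eq_zero, hB, hu, sub_eq_zero, haij, false_or] at h2
        exact hh i j hij (by rw [h2]; exact h3)
      rintro ⟨i, e⟩ ⟨j, f⟩ h
      by_cases hij : i = j
      · subst hij
        cases e <;> cases f <;> simp_all
        · exact absurd h.symm (hrs i)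
      · exfalso
        have hswap : (1 - ζ ^ 2) * a i * s i * r i = 1 := by linear_combination hrs1 i
        cases e <;> cases f <;> simp only [if_true, if_false, Bool.false_eq_true] at h
        · exact key i j _ _ hij (hs i) (by rw [h]; exact hs j) (hr i) hswap
        · exact key i j _ _ hij (hs i) (by rw [h]; exact hr j) (hr i) hswap
        · exact key i j _ _ hij (hr i) (by rw [h]; exact hs j) (hs i) (hrs1 i)
        · exact key i j _ _ hij (hr i) (by rw [h]; exact hr j) (hs i) (hrs1 i)
    have red : ∀ (x y u v : ℂ) (t : Fin M → ℂ) i, hpol ζ (a i) u = 0 → (1 - ζ ^ 2) * a i * u * v = 1 →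
        Hab H (Fin.cons x a : Fin (M + 1 + 1) → ℂ) (Fin.cons u (Fin.cons y t : Fin (M + 1) → ℂ) : Fin (M + 1 + 1) → ℂ)
        = ((1 - ζ ^ 2) / v) ^ (M + 1) * (((x - v) * ∏ j : Fin M, (a (Equiv.swap 0 i j.succ) - v)) *
          ((y - v) * ∏ j, (t j - v))) *
          Hab H (Fin.cons x fun j => a (Equiv.swap 0 i j.succ) : Fin (M + 1) → ℂ) (Fin.cons y t : Fin (M + 1) → ℂ) := by
      intro x y u v t i h1 h2
      have hupd : (fun j => (Function.update a i x) (Equiv.swap 0 i j))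
          = (Fin.cons x fun j => a (Equiv.swap 0 i j.succ) : Fin (M + 1) → ℂ) := by
        funext j
        refine Fin.cases ?_ (fun j => ?_) j
        · simp
        · rw [Function.update_of_ne, Fin.cons_succ]
          rw [Ne, ← Equiv.eq_symm_apply]; simp [Fin.ext_iff]
      have hprod : ∏ j, (Function.update a i x j - v) = (x - v) * ∏ j : Fin M, (a (Equiv.swap 0 i j.succ) - v) := by
        rw [← Equiv.prod_comp (Equiv.swap 0 i)]
        have : ∀ j, Function.update a i x (Equiv.swap 0 i j) - v
          = (Fin.cons x fun j => a (Equiv.swap 0 i j.succ) : Fin (M + 1) → ℂ) j - v := fun j => by rw [← hupd]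
        simp only [this]
        rw [Fin.prod_univ_succ]; simp
      rw [Hab_swap_left hH x a _ i, Hab_wheel_cons hH h1 h2, hprod,
        ← Hab_perm_left hH (Function.update a i x) _ (Equiv.swap 0 i), hupd, Fin.prod_univ_succ (f := fun j => _ - v)]
      simp
    obtain ⟨u₀, t, rfl⟩ : ∃ u t, b = (Fin.cons u t : Fin (M + 1) → ℂ) := ⟨b 0, Fin.tail b, (Fin.cons_self_tail b).symm⟩
    have hsw : ∀ (c : Fin (M + 1 + 1) → ℂ) (y u : ℂ), Hab H c (Fin.cons y (Fin.cons u t : Fin (M + 1) → ℂ) : Fin (M + 1 + 1) → ℂ)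
        = Hab H c (Fin.cons u (Fin.cons y t : Fin (M + 1) → ℂ) : Fin (M + 1 + 1) → ℂ) := by
      intro c y u
      rw [Hab_swap_right hH _ _ _ 0]; simp [Fin.update_cons_zero]
    have hdeg : ∀ x y, DegLE (M + 1) fun u => Hab H (Fin.cons x a : Fin (M + 1 + 1) → ℂ)
        (Fin.cons u (Fin.cons y t : Fin (M + 1) → ℂ) : Fin (M + 1 + 1) → ℂ) := by
      intro x y
      simp only [Hab_comm hH (Fin.cons x a : Fin (M + 1 + 1) → ℂ)]
      exact DegLE.Hab_cons hH _ _
    rw [hsw _ y u₀, hsw _ x u₀]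
    refine congrFun (DegLE.eq_of_injective (hdeg x y) (hdeg y x) hinj (fun e => ?_) (by simp)) u₀
    obtain ⟨i, e⟩ := e
    cases e
    · simp only [Bool.false_eq_true, if_false]
      rw [red x y _ (r i) t i (hs i) (by linear_combination hrs1 i),
        red y x _ (r i) t i (hs i) (by linear_combination hrs1 i), ih]
      ring
    · simp only [if_true]
      rw [red x y _ (s i) t i (hr i) (hrs1 i), red y x _ (s i) t i (hr i) (hrs1 i), ih]
      ring

end

section
variable {ζ : ℂ} {H : (k : ℕ) → (Fin (2 * k) → ℂ) → ℂ} {K : ℕ}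

theorem Hs_eq_Hab (w : Fin K ⊕ Fin K → ℂ) :
    Hs H K w = Hab H (fun i => w (Sum.inl i)) fun i => w (Sum.inr i) := by
  unfold Hab
  congr 1
  funext i; cases i <;> rfl

theorem cons_tail_swap (a : Fin (K + 1) → ℂ) (i : Fin (K + 1)) :
    (fun j => a (Equiv.swap 0 i j)) = (Fin.cons (a i) fun j => a (Equiv.swap 0 i j.succ) : Fin (K + 1) → ℂ) := by
  funext j
  refine Fin.cases ?_ (fun j => ?_) j <;> simp

theorem Hab_exchange_apply (hH : IsHFamily ζ H) (hB : 1 - ζ ^ 2 ≠ 0) (a b : Fin K → ℂ) (i j : Fin K) :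
    Hab H (Function.update a i (b j)) (Function.update b j (a i)) = Hab H a b := by
  cases K with
  | zero => exact i.elim0
  | succ M =>
    have hu : ∀ (a : Fin (M + 1) → ℂ) (i : Fin (M + 1)) (x : ℂ),
        (fun j => Function.update a i x (Equiv.swap 0 i j))
          = (Fin.cons x fun j => a (Equiv.swap 0 i j.succ) : Fin (M + 1) → ℂ) := by
      intro a i x
      rw [cons_tail_swap]
      congr 1
      · simp
      · funext j
        rw [Function.update_of_ne]
        rw [Ne, ← Equiv.eq_symm_apply]; simp [Fin.ext_iff]
    rw [← Hab_perm_left hH (Function.update a i (b j)) _ (Equiv.swap 0 i),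
      ← Hab_perm_right hH _ (Function.update b j (a i)) (Equiv.swap 0 j), hu, hu, Hab_exchange hH hB,
      ← cons_tail_swap, ← cons_tail_swap, Hab_perm_left hH, Hab_perm_right hH]

theorem Hs_perm (hH : IsHFamily ζ H) (hB : 1 - ζ ^ 2 ≠ 0) (s : Equiv.Perm (Fin K ⊕ Fin K)) (w : Fin K ⊕ Fin K → ℂ) :
    Hs H K (fun i => w (s i)) = Hs H K w := by
  have hmix : ∀ (w : Fin K ⊕ Fin K → ℂ) i j,
      Hs H K (fun e => w (Equiv.swap (Sum.inl i) (Sum.inr j) e)) = Hs H K w := by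
    intro w i j
    rw [Hs_eq_Hab w, ← Hab_exchange_apply hH hB _ _ i j, Hs_eq_Hab]
    congr 1
    · funext l
      by_cases h : l = i
      · subst h; simp
      · rw [Function.update_of_ne h, Equiv.swap_apply_of_ne_of_ne (by simpa) (by simp)]
    · funext l
      by_cases h : l = j
      · subst h; simp
      · rw [Function.update_of_ne h, Equiv.swap_apply_of_ne_of_ne (by simp) (by simpa)]
  induction s using Equiv.Perm.swap_induction_on generalizing w with
  | one => rfl
  | swap_mul f x y hxy ih =>
    simp only [Equiv.Perm.mul_apply]
    rw [ih (fun i => w (Equiv.swap x y i))]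
    rcases x with x | x <;> rcases y with y | y
    · rw [Hs_eq_Hab, Hs_eq_Hab, ← Hab_perm_left hH (fun i => w (Sum.inl i)) _ (Equiv.swap x y)]
      congr 1
      funext l
      congr 1
      exact (Sum.inl_injective.swap_apply x y l)
    · exact hmix w x y
    · rw [Equiv.swap_comm]; exact hmix w y x
    · rw [Hs_eq_Hab, Hs_eq_Hab, ← Hab_perm_right hH _ (fun i => w (Sum.inr i)) (Equiv.swap x y)]
      congr 1
      funext l
      congr 1
      exact (Sum.inr_injective.swap_apply x y l)

theorem H_perm (hH : IsHFamily ζ H) (hB : 1 - ζ ^ 2 ≠ 0) (s : Equiv.Perm (Fin (2 * K))) (v : Fin (2 * K) → ℂ) :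
    H K (fun i => v (s i)) = H K v := by
  have := Hs_perm hH hB (((halfEquiv K).symm.trans s).trans (halfEquiv K)) (fun i => v ((halfEquiv K).symm i))
  simpa [Hs] using this

/-- `H` at a list of arguments, padded by zeros. -/
def HL (H : (k : ℕ) → (Fin (2 * k) → ℂ) → ℂ) (K : ℕ) (l : List ℂ) : ℂ := H K (padded l)

theorem HL_perm (hH : IsHFamily ζ H) (hB : 1 - ζ ^ 2 ≠ 0) {l l' : List ℂ} (h : l.Perm l') (hl : l.length ≤ 2 * K) :
    HL H K l = HL H K l' := by
  have key : ∀ p : List ℂ, p.length + l.length ≤ 2 * K → HL H K (p ++ l) = HL H K (p ++ l') := by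
    clear hl
    induction h with
    | nil => intros; rfl
    | @cons x l₁ l₂ h ih =>
      intro p hp
      have := ih (p ++ [x]) (by simp at hp ⊢; omega)
      simpa using this
    | @swap x y l =>
      intro p hp
      simp only [List.length_cons] at hp
      have h1 : p.length < 2 * K := by omega
      have h2 : p.length + 1 < 2 * K := by omega
      unfold HL
      rw [← H_perm hH hB (Equiv.swap ⟨p.length, h1⟩ ⟨p.length + 1, h2⟩)]
      congr 1
      funext i
      unfold padded
      by_cases hi : i = ⟨p.length, h1⟩
      · subst hi
        rw [Equiv.swap_apply_left]
        simp only [List.getD_eq_getElem?_getD]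
        rw [List.getElem?_append_right (by simp), List.getElem?_append_right (by simp)]
        simp
      · by_cases hi' : i = ⟨p.length + 1, h2⟩
        · subst hi'
          rw [Equiv.swap_apply_right]
          simp only [List.getD_eq_getElem?_getD]
          rw [List.getElem?_append_right (by simp), List.getElem?_append_right (by simp)]
          simp
        · rw [Equiv.swap_apply_of_ne_of_ne hi hi']
          simp only [List.getD_eq_getElem?_getD]
          rcases lt_or_ge (i : ℕ) p.length with hlt | hge
          · rw [List.getElem?_append_left hlt, List.getElem?_append_left hlt]
          · rw [List.getElem?_append_right hge, List.getElem?_append_right hge]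
            have : ∃ m, (i : ℕ) - p.length = m + 2 := ⟨(i : ℕ) - p.length - 2, by
              have e1 : (i : ℕ) ≠ p.length := fun h => hi (Fin.ext h)
              have e2 : (i : ℕ) ≠ p.length + 1 := fun h => hi' (Fin.ext h)
              omega⟩
            obtain ⟨m, hm⟩ := this
            simp [hm]
    | trans h₁ h₂ ih₁ ih₂ =>
      intro p hp
      rw [ih₁ p hp, ih₂ p (by rw [← h₁.length_eq]; exact hp)]
  simpa using key [] (by simpa using hl)

theorem HL_append {as bs : List ℂ} (ha : as.length = K) :
    HL H K (as ++ bs) = Hab H (fun i : Fin K => as.getD i 0) fun i : Fin K => bs.getD i 0 := by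
  unfold HL Hab Hs
  congr 1
  funext j
  obtain ⟨e, rfl⟩ := (halfEquiv K).symm.surjective j
  rw [Equiv.apply_symm_apply]
  unfold padded
  simp only [List.getD_eq_getElem?_getD]
  rcases e with i | i
  · have : ((halfEquiv K).symm (Sum.inl i) : ℕ) = i := by simp [halfEquiv]
    rw [this, List.getElem?_append_left (by omega)]; rfl
  · have : ((halfEquiv K).symm (Sum.inr i) : ℕ) = K + i := by simp [halfEquiv, add_comm]
    rw [this, List.getElem?_append_right (by omega)]; simp [ha]

theorem getD_cons_eq (x : ℂ) (l : List ℂ) :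
    (fun i : Fin (K + 1) => (x :: l).getD i 0) = (Fin.cons x fun i : Fin K => l.getD i 0 : Fin (K + 1) → ℂ) := by
  funext i
  refine Fin.cases ?_ (fun i => ?_) i <;> simp

theorem HL_pad (l : List ℂ) (m : ℕ) : HL H K (l ++ List.replicate m 0) = HL H K l := by
  unfold HL
  congr 1
  funext j
  unfold padded
  simp only [List.getD_eq_getElem?_getD]
  rcases lt_or_ge (j : ℕ) l.length with h | h
  · rw [List.getElem?_append_left h]
  · rw [List.getElem?_append_right h, List.getElem?_eq_none h, List.getElem?_replicate]
    split_ifs <;> rfl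

theorem HL_deg (hH : IsHFamily ζ H) (l : List ℂ) : DegLE K fun x => HL H (K + 1) (x :: l) := by
  have h : ∀ x, HL H (K + 1) (x :: l) = Hab H (Fin.cons x fun i : Fin K => (l ++ List.replicate K 0).getD i 0 : Fin (K + 1) → ℂ)
      (fun i : Fin (K + 1) => ((l ++ List.replicate K 0).drop K).getD i 0) := by
    intro x
    rw [← HL_pad (x :: l) K, List.cons_append]
    conv_lhs => rw [← List.take_append_drop K (l ++ List.replicate K 0), ← List.cons_append]
    rw [HL_append (by simp), getD_cons_eq]
    congr 2
    funext i
    simp only [List.getD_eq_getElem?_getD]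
    rw [List.getElem?_take_of_lt i.2]
  simp only [h]
  exact DegLE.Hab_cons hH _ _

theorem prod_getD_sub (l : List ℂ) (c : ℂ) (h : l.length = K) :
    ∏ i : Fin K, (l.getD i 0 - c) = (l.map fun w => w - c).prod := by
  subst h
  rw [← List.prod_ofFn]
  congr 1
  refine List.ext_getElem (by simp) fun i h1 h2 => ?_
  simp at h1
  simp [List.getD_eq_getElem?_getD, h1]

theorem HL_wheel (hH : IsHFamily ζ H) (hB : 1 - ζ ^ 2 ≠ 0) {w₁ w₂ w₃ : ℂ} (h : hpol ζ w₁ w₂ = 0)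
    (h3 : (1 - ζ ^ 2) * w₁ * w₂ * w₃ = 1) (l : List ℂ) (hl : l.length = 2 * K) :
    HL H (K + 1) (w₁ :: w₂ :: l) = ((1 - ζ ^ 2) / w₃) ^ K * (l.map fun w => w - w₃).prod * HL H K l := by
  have ha : (l.take K).length = K := by simp; omega
  have hb : (l.drop K).length = K := by simp; omega
  have hp : (w₁ :: w₂ :: l).Perm ((w₁ :: l.take K) ++ (w₂ :: l.drop K)) := by
    conv_lhs => rw [← List.take_append_drop K l]
    simp only [List.cons_append]
    exact List.Perm.cons _ List.perm_middle.symm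
  rw [HL_perm hH hB hp (by simp; omega), HL_append (by simp [ha]), getD_cons_eq, getD_cons_eq,
    Hab_wheel_cons hH h h3, prod_getD_sub _ _ ha, prod_getD_sub _ _ hb, ← List.prod_append, ← List.map_append,
    List.take_append_drop, ← HL_append ha, List.take_append_drop]

end

section
variable {ζ t ε : ℂ} {H : (k : ℕ) → (Fin (2 * k) → ℂ) → ℂ}

/-- The closed form of the scalar product with an even number `2k` of arguments. -/
def Rev (H : (k : ℕ) → (Fin (2 * k) → ℂ) → ℂ) (ζ t ε : ℂ) (k : ℕ) (ws : List ℂ) : ℂ :=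
  mco ζ t ^ k / (2 * t) *
    ((1 + t) * (ε * (1 + ε * t)) * HL H (k + 1) (ws ++ [0, J4c ζ]) * HL H (k + 1) (ws ++ [J3c ζ, ybar ζ t])
      - (1 - t) * (ε * (1 - ε * t)) * HL H (k + 1) (ws ++ [0, J3c ζ]) * HL H (k + 1) (ws ++ [J4c ζ, ybar ζ t]))

/-- The closed form of the scalar product with an odd number `2k+1` of arguments. -/
def Rod (H : (k : ℕ) → (Fin (2 * k) → ℂ) → ℂ) (ζ t ε : ℂ) (k : ℕ) (ws : List ℂ) : ℂ :=
  ε * (1 + ε * t) * mco ζ t ^ (k + 1) / (2 * t) *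
    (HL H (k + 1) (ws ++ [0]) * HL H (k + 2) (ws ++ [J3c ζ, J4c ζ, ybar ζ t])
      - ζ * (1 - ε * t) ^ 2 / ((1 - t * ζ) * (ζ - t)) * HL H (k + 1) (ws ++ [ybar ζ t])
        * HL H (k + 2) (ws ++ [0, J3c ζ, J4c ζ]))

theorem Rev_perm (hH : IsHFamily ζ H) (hB : 1 - ζ ^ 2 ≠ 0) {k : ℕ} {ws ws' : List ℂ} (h : ws.Perm ws')
    (hl : ws.length = 2 * k) : Rev H ζ t ε k ws = Rev H ζ t ε k ws' := by
  unfold Rev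
  have e : ∀ a b : ℂ, HL H (k + 1) (ws ++ [a, b]) = HL H (k + 1) (ws' ++ [a, b]) := fun a b =>
    HL_perm hH hB (h.append_right _) (by simp [hl]; omega)
  simp only [e]

theorem Rod_perm (hH : IsHFamily ζ H) (hB : 1 - ζ ^ 2 ≠ 0) {k : ℕ} {ws ws' : List ℂ} (h : ws.Perm ws')
    (hl : ws.length = 2 * k + 1) : Rod H ζ t ε k ws = Rod H ζ t ε k ws' := by
  unfold Rod
  have e1 : ∀ a : ℂ, HL H (k + 1) (ws ++ [a]) = HL H (k + 1) (ws' ++ [a]) := fun a =>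
    HL_perm hH hB (h.append_right _) (by simp [hl]; omega)
  have e2 : ∀ a b c : ℂ, HL H (k + 2) (ws ++ [a, b, c]) = HL H (k + 2) (ws' ++ [a, b, c]) := fun a b c =>
    HL_perm hH hB (h.append_right _) (by simp [hl]; omega)
  simp only [e1, e2]

theorem Rev_deg (hH : IsHFamily ζ H) (k : ℕ) (ws : List ℂ) : DegLE (2 * k) fun x => Rev H ζ t ε k (x :: ws) := by
  unfold Rev
  simp only [List.cons_append, mul_assoc ((1 + t) * (ε * (1 + ε * t))), mul_assoc ((1 - t) * (ε * (1 - ε * t)))]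
  refine DegLE.const_mul _ (DegLE.sub (DegLE.const_mul _ ?_) (DegLE.const_mul _ ?_))
  · rw [two_mul]; exact (HL_deg hH _).mul (HL_deg hH _)
  · rw [two_mul]; exact (HL_deg hH _).mul (HL_deg hH _)

theorem Rod_deg (hH : IsHFamily ζ H) (k : ℕ) (ws : List ℂ) : DegLE (2 * k + 1) fun x => Rod H ζ t ε k (x :: ws) := by
  unfold Rod
  simp only [List.cons_append, mul_assoc (ζ * (1 - ε * t) ^ 2 / ((1 - t * ζ) * (ζ - t)))]
  have e : 2 * k + 1 = k + (k + 1) := by ring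
  rw [e]
  exact DegLE.const_mul _ (DegLE.sub ((HL_deg hH _).mul (HL_deg hH _))
    (DegLE.const_mul _ ((HL_deg hH _).mul (HL_deg hH _))))

theorem HL_one (hH : IsHFamily ζ H) (l : List ℂ) : HL H 1 l = 1 := by
  have h := HL_append (H := H) (K := 1) (as := [l.getD 0 0]) (bs := [l.getD 1 0]) rfl
  rw [Hab_one hH] at h
  rw [← h]
  unfold HL
  congr 1
  funext j
  fin_cases j <;> simp [padded]

theorem Rev_nil (hH : IsHFamily ζ H) (ht : t ≠ 0) (hε : ε = 1 ∨ ε = -1) : Rev H ζ t ε 0 [] = 1 + ε := by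
  unfold Rev
  simp only [zero_add, HL_one hH]
  rcases hε with rfl | rfl
  · field_simp; ring
  · ring

/-! Reduction at a pair of equal arguments, and at a pair on the zero locus of `hpol`. -/

theorem Rev_wheel (hH : IsHFamily ζ H) (hB : 1 - ζ ^ 2 ≠ 0) {w₁ w₂ w₃ : ℂ} (h : hpol ζ w₁ w₂ = 0)
    (h3 : (1 - ζ ^ 2) * w₁ * w₂ * w₃ = 1) {k : ℕ} (ws : List ℂ) (hl : ws.length = 2 * k) :
    Rev H ζ t ε (k + 1) (w₁ :: w₂ :: ws) = mco ζ t * ((1 - ζ ^ 2) / w₃) ^ (2 * k + 2)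
      * (-w₃ * (J3c ζ - w₃) * (J4c ζ - w₃) * (ybar ζ t - w₃)) * ((ws.map fun w => w - w₃).prod) ^ 2
      * Rev H ζ t ε k ws := by
  have e : ∀ a b : ℂ, HL H (k + 1 + 1) (w₁ :: w₂ :: ws ++ [a, b])
      = ((1 - ζ ^ 2) / w₃) ^ (k + 1) * ((ws.map fun w => w - w₃).prod * ((a - w₃) * (b - w₃)))
        * HL H (k + 1) (ws ++ [a, b]) := fun a b => by
    rw [List.cons_append, List.cons_append, HL_wheel hH hB h h3 _ (by simp [hl]; ring)]
    simp
  unfold Rev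
  simp only [e]
  ring

theorem Rod_wheel (hH : IsHFamily ζ H) (hB : 1 - ζ ^ 2 ≠ 0) {w₁ w₂ w₃ : ℂ} (h : hpol ζ w₁ w₂ = 0)
    (h3 : (1 - ζ ^ 2) * w₁ * w₂ * w₃ = 1) {k : ℕ} (ws : List ℂ) (hl : ws.length = 2 * k + 1) :
    Rod H ζ t ε (k + 1) (w₁ :: w₂ :: ws) = mco ζ t * ((1 - ζ ^ 2) / w₃) ^ (2 * k + 3)
      * (-w₃ * (J3c ζ - w₃) * (J4c ζ - w₃) * (ybar ζ t - w₃)) * ((ws.map fun w => w - w₃).prod) ^ 2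
      * Rod H ζ t ε k ws := by
  have e1 : ∀ a : ℂ, HL H (k + 1 + 1) (w₁ :: w₂ :: ws ++ [a])
      = ((1 - ζ ^ 2) / w₃) ^ (k + 1) * ((ws.map fun w => w - w₃).prod * (a - w₃))
        * HL H (k + 1) (ws ++ [a]) := fun a => by
    rw [List.cons_append, List.cons_append, HL_wheel hH hB h h3 _ (by simp [hl]; ring)]
    simp
  have e2 : ∀ a b c : ℂ, HL H (k + 1 + 2) (w₁ :: w₂ :: ws ++ [a, b, c])
      = ((1 - ζ ^ 2) / w₃) ^ (k + 2) * ((ws.map fun w => w - w₃).prod * ((a - w₃) * ((b - w₃) * (c - w₃))))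
        * HL H (k + 2) (ws ++ [a, b, c]) := fun a b c => by
    rw [List.cons_append, List.cons_append, HL_wheel (K := k + 2) hH hB h h3 _ (by simp [hl]; ring)]
    simp
  unfold Rod
  simp only [e1, e2]
  ring

theorem one_sub_sq_ne (hB : 1 - ζ ^ 2 ≠ 0) : 1 - ζ ≠ 0 ∧ 1 + ζ ≠ 0 :=
  mul_ne_zero_iff.1 (by convert hB using 1; ring)

theorem hpol_J4 (hB : 1 - ζ ^ 2 ≠ 0) : hpol ζ (J4c ζ) (J4c ζ) = 0 := by
  obtain ⟨h1, h2⟩ := one_sub_sq_ne hB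
  unfold hpol J4c; field_simp; ring

theorem hpol_J3 (hB : 1 - ζ ^ 2 ≠ 0) : hpol ζ (J3c ζ) (J3c ζ) = 0 := by
  obtain ⟨h1, h2⟩ := one_sub_sq_ne hB
  unfold hpol J3c; field_simp; ring

theorem J4_sq (hB : 1 - ζ ^ 2 ≠ 0) : (1 - ζ ^ 2) * J4c ζ * J4c ζ * ((1 - ζ) / (1 + ζ)) = 1 := by
  obtain ⟨h1, h2⟩ := one_sub_sq_ne hB
  unfold J4c; field_simp; ring

theorem J3_sq (hB : 1 - ζ ^ 2 ≠ 0) : (1 - ζ ^ 2) * J3c ζ * J3c ζ * ((1 + ζ) / (1 - ζ)) = 1 := by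
  obtain ⟨h1, h2⟩ := one_sub_sq_ne hB
  unfold J3c; field_simp; ring

/-- Reduction of a pair of equal arguments, one of which is in the tail. -/
theorem HL_pair (hH : IsHFamily ζ H) (hB : 1 - ζ ^ 2 ≠ 0) {J w₃ : ℂ} (h : hpol ζ J J = 0)
    (h3 : (1 - ζ ^ 2) * J * J * w₃ = 1) {K : ℕ} (ws l l' : List ℂ) (hp : l.Perm (J :: l'))
    (hl : ws.length + l'.length = 2 * K) :
    HL H (K + 1) (J :: ws ++ l) = ((1 - ζ ^ 2) / w₃) ^ K * ((ws.map fun w => w - w₃).prod * (l'.map fun w => w - w₃).prod)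
        * HL H K (ws ++ l') := by
  have hp' : (J :: ws ++ l).Perm (J :: J :: (ws ++ l')) := by
    rw [List.cons_append]
    exact List.Perm.cons _ ((hp.append_left ws).trans List.perm_middle)
  rw [HL_perm hH hB hp' (by rw [hp'.length_eq]; simp; omega), HL_wheel hH hB h h3 _ (by simp; omega)]
  simp

end

section
variable {ζ t ε : ℂ} {H : (k : ℕ) → (Fin (2 * k) → ℂ) → ℂ}

theorem ybar_sub_four (hB : 1 - ζ ^ 2 ≠ 0) (h1 : t - ζ ≠ 0) (h2 : 1 - t * ζ ≠ 0) :
    ybar ζ t - (1 - ζ) / (1 + ζ) = -(ζ * (1 + t) ^ 2 / ((1 - t * ζ) * (ζ - t))) * ((1 - ζ) / (1 + ζ)) := by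
  obtain ⟨h3, h4⟩ := one_sub_sq_ne hB
  have h5 : ζ - t = -(t - ζ) := by ring
  have h6 : 1 - ζ * t ≠ 0 := by rwa [mul_comm]
  unfold ybar; rw [h5]; field_simp; ring

theorem ybar_sub_three (hB : 1 - ζ ^ 2 ≠ 0) (h1 : t - ζ ≠ 0) (h2 : 1 - t * ζ ≠ 0) :
    ybar ζ t - (1 + ζ) / (1 - ζ) = -(ζ * (1 - t) ^ 2 / ((1 - t * ζ) * (ζ - t))) * ((1 + ζ) / (1 - ζ)) := by
  obtain ⟨h3, h4⟩ := one_sub_sq_ne hB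
  have h5 : ζ - t = -(t - ζ) := by ring
  have h6 : 1 - ζ * t ≠ 0 := by rwa [mul_comm]
  unfold ybar; rw [h5]; field_simp; ring

theorem J3_sub (hB : 1 - ζ ^ 2 ≠ 0) : J3c ζ - (1 - ζ) / (1 + ζ) = ζ * ((1 - ζ) / (1 + ζ)) * J4c ζ := by
  obtain ⟨h3, h4⟩ := one_sub_sq_ne hB
  unfold J3c J4c; field_simp; ring

theorem J4_sub (hB : 1 - ζ ^ 2 ≠ 0) : J4c ζ - (1 + ζ) / (1 - ζ) = -(ζ * ((1 + ζ) / (1 - ζ)) * J3c ζ) := by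
  obtain ⟨h3, h4⟩ := one_sub_sq_ne hB
  unfold J3c J4c; field_simp; ring

theorem pair_scalar_even {B J Ω : ℂ} (h : B * J * J * Ω = 1) (k : ℕ) :
    1 / (J ^ (2 * k + 1 + 1) * Ω ^ (2 * k + 1)) = (B / Ω) ^ (k + 1) * Ω := by
  have hJ : J ≠ 0 := by rintro rfl; simp at h
  have hΩ : Ω ≠ 0 := by rintro rfl; simp at h
  have hc : B / Ω * Ω ^ 2 * J ^ 2 = 1 := by field_simp; linear_combination h
  generalize B / Ω = c at hc
  rw [eq_comm, eq_div_iff (mul_ne_zero (pow_ne_zero _ hJ) (pow_ne_zero _ hΩ))]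
  have hk : (c * Ω ^ 2 * J ^ 2) ^ (k + 1) = 1 := by rw [hc, one_pow]
  rw [← hk]
  ring

theorem pair_scalar_odd {B J Ω : ℂ} (h : B * J * J * Ω = 1) (k : ℕ) :
    1 / (J ^ (2 * k + 1) * Ω ^ (2 * k)) = (B / Ω) ^ (k + 1) * Ω ^ 2 * J := by
  have hJ : J ≠ 0 := by rintro rfl; simp at h
  have hΩ : Ω ≠ 0 := by rintro rfl; simp at h
  have hc : B / Ω * Ω ^ 2 * J ^ 2 = 1 := by field_simp; linear_combination h
  generalize B / Ω = c at hc
  rw [eq_comm, eq_div_iff (mul_ne_zero (pow_ne_zero _ hJ) (pow_ne_zero _ hΩ))]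
  have hk : (c * Ω ^ 2 * J ^ 2) ^ (k + 1) = 1 := by rw [hc, one_pow]
  rw [← hk]
  ring

theorem Rev_J4 (hH : IsHFamily ζ H) (hB : 1 - ζ ^ 2 ≠ 0) (h1 : t - ζ ≠ 0) (h2 : 1 - t * ζ ≠ 0)
    (hε : ε = 1 ∨ ε = -1) {k : ℕ} (ws : List ℂ) (hl : ws.length = 2 * k + 1) :
    Rev H ζ t ε (k + 1) (J4c ζ :: ws) = (-1) ^ (2 * k + 1) * (1 + t)
      / (J4c ζ ^ (2 * k + 1 + 1) * ((1 - ζ) / (1 + ζ)) ^ (2 * k + 1))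
      * (ws.map fun w => w - (1 - ζ) / (1 + ζ)).prod * Rod H ζ t ε k ws := by
  have e := fun l l' hp hl => HL_pair hH hB (hpol_J4 hB) (J4_sq hB) (K := k + 1) ws l l' hp hl
  have p : ∀ l l' : List ℂ, l.Perm (J4c ζ :: l') → l.length = 3 →
      HL H (k + 2) (J4c ζ :: ws ++ l') = HL H (k + 2) (ws ++ l) := fun l l' hp h3 =>
    (HL_perm hH hB ((hp.append_left ws).trans List.perm_middle) (by simp [h3, hl]; omega)).symm
  unfold Rev Rod
  rw [e [0, J4c ζ] [0] (List.Perm.swap _ _ _) (by simp [hl]; ring), e [J4c ζ, ybar ζ t] [ybar ζ t] (List.Perm.refl _) (by simp [hl]; ring),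
    p [J3c ζ, J4c ζ, ybar ζ t] [J3c ζ, ybar ζ t] (List.Perm.swap _ _ _) rfl,
    p [0, J3c ζ, J4c ζ] [0, J3c ζ] (by simpa using (List.perm_append_comm (l₁ := [0, J3c ζ]) (l₂ := [J4c ζ]))) rfl,
    div_eq_mul_one_div (_ * (1 + t)), pair_scalar_even (J4_sq hB)]
  simp only [List.map_cons, List.map_nil, List.prod_cons, List.prod_nil, mul_one]
  rw [ybar_sub_four hB h1 h2, pow_succ (-1 : ℂ), pow_mul]
  rcases hε with rfl | rfl <;> ring

theorem Rod_J4 (hH : IsHFamily ζ H) (hB : 1 - ζ ^ 2 ≠ 0) (hζ : ζ ≠ 0) (h1 : t - ζ ≠ 0) (h2 : 1 - t * ζ ≠ 0)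
    (hε : ε = 1 ∨ ε = -1) {k : ℕ} (ws : List ℂ) (hl : ws.length = 2 * k) :
    Rod H ζ t ε k (J4c ζ :: ws) = (-1) ^ (2 * k) * (1 + t)
      / (J4c ζ ^ (2 * k + 1) * ((1 - ζ) / (1 + ζ)) ^ (2 * k))
      * (ws.map fun w => w - (1 - ζ) / (1 + ζ)).prod * Rev H ζ t ε k ws := by
  have e := fun l l' hp hl => HL_pair hH hB (hpol_J4 hB) (J4_sq hB) (K := k + 1) ws l l' hp hl
  have p : ∀ l l' : List ℂ, l.Perm (J4c ζ :: l') → l.length = 2 →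
      HL H (k + 1) (J4c ζ :: ws ++ l') = HL H (k + 1) (ws ++ l) := fun l l' hp h3 =>
    (HL_perm hH hB ((hp.append_left ws).trans List.perm_middle) (by simp [h3, hl]; omega)).symm
  unfold Rev Rod
  rw [e [J3c ζ, J4c ζ, ybar ζ t] [J3c ζ, ybar ζ t] (List.Perm.swap _ _ _) (by simp [hl]; ring),
    e [0, J3c ζ, J4c ζ] [0, J3c ζ] (by simpa using (List.perm_append_comm (l₁ := [0, J3c ζ]) (l₂ := [J4c ζ]))) (by simp [hl]; ring),
    p [0, J4c ζ] [0] (List.Perm.swap _ _ _) rfl, p [J4c ζ, ybar ζ t] [ybar ζ t] (List.Perm.refl _) rfl,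
    div_eq_mul_one_div (_ * (1 + t)), pair_scalar_odd (J4_sq hB)]
  simp only [List.map_cons, List.map_nil, List.prod_cons, List.prod_nil, mul_one]
  rw [ybar_sub_four hB h1 h2, J3_sub hB, pow_succ (mco ζ t), pow_mul]
  have hm : mco ζ t * (ζ / ((1 - t * ζ) * (ζ - t)) * ζ) = -1 := by
    have h5 : ζ - t ≠ 0 := fun h => h1 (by linear_combination -h)
    unfold mco; field_simp
  generalize ((1 - ζ) / (1 + ζ)) = Ω at *
  generalize J4c ζ = J at *
  generalize (ws.map fun w => w - Ω).prod = P
  generalize HL H (k + 1) (ws ++ [0, J3c ζ]) = Y1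
  generalize HL H (k + 1) (ws ++ [J, ybar ζ t]) = Y2
  generalize HL H (k + 1) (ws ++ [0, J]) = X1
  generalize HL H (k + 1) (ws ++ [J3c ζ, ybar ζ t]) = X2
  have hg : ∀ s : ℂ, ζ * s / ((1 - t * ζ) * (ζ - t)) = ζ / ((1 - t * ζ) * (ζ - t)) * s := fun s => by ring
  rw [hg, hg]
  generalize ζ / ((1 - t * ζ) * (ζ - t)) = g at *
  generalize mco ζ t = m at *
  rcases hε with rfl | rfl
  · linear_combination (-(1 + t) * m ^ k / (2 * t) * ((1 - ζ ^ 2) / Ω) ^ (k + 1) * P * Ω ^ 2 * J * ((1 + t) ^ 2 * X1 * X2 - (1 - t) ^ 2 * Y1 * Y2)) * hm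
  · linear_combination ((1 - t) * m ^ k / (2 * t) * ((1 - ζ ^ 2) / Ω) ^ (k + 1) * P * Ω ^ 2 * J * ((1 + t) ^ 2 * X1 * X2 - (1 + t) ^ 2 * Y1 * Y2)) * hm

theorem Rev_J3 (hH : IsHFamily ζ H) (hB : 1 - ζ ^ 2 ≠ 0) (h1 : t - ζ ≠ 0) (h2 : 1 - t * ζ ≠ 0)
    (hε : ε = 1 ∨ ε = -1) {k : ℕ} (ws : List ℂ) (hl : ws.length = 2 * k + 1) :
    Rev H ζ t ε (k + 1) (J3c ζ :: ws) = -(1 - t)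
      / (J3c ζ ^ (2 * k + 1 + 1) * ((1 + ζ) / (1 - ζ)) ^ (2 * k + 1))
      * (ws.map fun w => w - (1 + ζ) / (1 - ζ)).prod * Rod H ζ t (-ε) k ws := by
  have e := fun l l' hp hl => HL_pair hH hB (hpol_J3 hB) (J3_sq hB) (K := k + 1) ws l l' hp hl
  have p : ∀ l l' : List ℂ, l.Perm (J3c ζ :: l') → l.length = 3 →
      HL H (k + 2) (J3c ζ :: ws ++ l') = HL H (k + 2) (ws ++ l) := fun l l' hp h3 =>
    (HL_perm hH hB ((hp.append_left ws).trans List.perm_middle) (by simp [h3, hl]; omega)).symm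
  unfold Rev Rod
  rw [e [0, J3c ζ] [0] (List.Perm.swap _ _ _) (by simp [hl]; ring), e [J3c ζ, ybar ζ t] [ybar ζ t] (List.Perm.refl _) (by simp [hl]; ring),
    p [J3c ζ, J4c ζ, ybar ζ t] [J4c ζ, ybar ζ t] (List.Perm.refl _) rfl,
    p [0, J3c ζ, J4c ζ] [0, J4c ζ] (List.Perm.swap _ _ _) rfl,
    div_eq_mul_one_div (-(1 - t)), pair_scalar_even (J3_sq hB)]
  simp only [List.map_cons, List.map_nil, List.prod_cons, List.prod_nil, mul_one]
  rw [ybar_sub_three hB h1 h2]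
  rcases hε with rfl | rfl <;> ring

theorem Rod_J3 (hH : IsHFamily ζ H) (hB : 1 - ζ ^ 2 ≠ 0) (hζ : ζ ≠ 0) (h1 : t - ζ ≠ 0) (h2 : 1 - t * ζ ≠ 0)
    (hε : ε = 1 ∨ ε = -1) {k : ℕ} (ws : List ℂ) (hl : ws.length = 2 * k) :
    Rod H ζ t ε k (J3c ζ :: ws) = -(1 - t)
      / (J3c ζ ^ (2 * k + 1) * ((1 + ζ) / (1 - ζ)) ^ (2 * k))
      * (ws.map fun w => w - (1 + ζ) / (1 - ζ)).prod * Rev H ζ t (-ε) k ws := by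
  have e := fun l l' hp hl => HL_pair hH hB (hpol_J3 hB) (J3_sq hB) (K := k + 1) ws l l' hp hl
  have p : ∀ l l' : List ℂ, l.Perm (J3c ζ :: l') → l.length = 2 →
      HL H (k + 1) (J3c ζ :: ws ++ l') = HL H (k + 1) (ws ++ l) := fun l l' hp h3 =>
    (HL_perm hH hB ((hp.append_left ws).trans List.perm_middle) (by simp [h3, hl]; omega)).symm
  unfold Rev Rod
  rw [e [J3c ζ, J4c ζ, ybar ζ t] [J4c ζ, ybar ζ t] (List.Perm.refl _) (by simp [hl]; ring),
    e [0, J3c ζ, J4c ζ] [0, J4c ζ] (List.Perm.swap _ _ _) (by simp [hl]; ring),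
    p [0, J3c ζ] [0] (List.Perm.swap _ _ _) rfl, p [J3c ζ, ybar ζ t] [ybar ζ t] (List.Perm.refl _) rfl,
    div_eq_mul_one_div (-(1 - t)), pair_scalar_odd (J3_sq hB)]
  simp only [List.map_cons, List.map_nil, List.prod_cons, List.prod_nil, mul_one]
  rw [ybar_sub_three hB h1 h2, J4_sub hB, pow_succ (mco ζ t)]
  have hm : mco ζ t * (ζ / ((1 - t * ζ) * (ζ - t)) * ζ) = -1 := by
    have h5 : ζ - t ≠ 0 := fun h => h1 (by linear_combination -h)
    unfold mco; field_simp
  generalize ((1 + ζ) / (1 - ζ)) = Ω at *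
  generalize J3c ζ = J at *
  generalize (ws.map fun w => w - Ω).prod = P
  generalize HL H (k + 1) (ws ++ [0, J4c ζ]) = Y1
  generalize HL H (k + 1) (ws ++ [J, ybar ζ t]) = Y2
  generalize HL H (k + 1) (ws ++ [0, J]) = X1
  generalize HL H (k + 1) (ws ++ [J4c ζ, ybar ζ t]) = X2
  have hg : ∀ s : ℂ, ζ * s / ((1 - t * ζ) * (ζ - t)) = ζ / ((1 - t * ζ) * (ζ - t)) * s := fun s => by ring
  rw [hg, hg]
  generalize ζ / ((1 - t * ζ) * (ζ - t)) = g at *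
  generalize mco ζ t = m at *
  rcases hε with rfl | rfl
  · linear_combination ((1 + t) * m ^ k / (2 * t) * ((1 - ζ ^ 2) / Ω) ^ (k + 1) * P * Ω ^ 2 * J * ((1 - t) ^ 2 * X1 * X2 - (1 - t) ^ 2 * Y1 * Y2)) * hm
  · linear_combination (-(1 - t) * m ^ k / (2 * t) * ((1 - ζ ^ 2) / Ω) ^ (k + 1) * P * Ω ^ 2 * J * ((1 - t) ^ 2 * X1 * X2 - (1 + t) ^ 2 * Y1 * Y2)) * hm

end

section
variable {ζ t ε : ℂ} {H : (k : ℕ) → (Fin (2 * k) → ℂ) → ℂ}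

/-- The closed form of the scalar product. -/
def Rn (H : (k : ℕ) → (Fin (2 * k) → ℂ) → ℂ) (ζ t ε : ℂ) (ws : List ℂ) : ℂ :=
  if ws.length % 2 = 0 then Rev H ζ t ε (ws.length / 2) ws else Rod H ζ t ε (ws.length / 2) ws

theorem Rn_even {k : ℕ} {ws : List ℂ} (h : ws.length = 2 * k) : Rn H ζ t ε ws = Rev H ζ t ε k ws := by
  rw [Rn, h, if_pos (by omega), Nat.mul_div_cancel_left _ (by norm_num)]

theorem Rn_odd {k : ℕ} {ws : List ℂ} (h : ws.length = 2 * k + 1) : Rn H ζ t ε ws = Rod H ζ t ε k ws := by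
  rw [Rn, h, if_neg (by omega), show (2 * k + 1) / 2 = k by omega]

theorem Rn_nil (hH : IsHFamily ζ H) (ht : t ≠ 0) (hε : ε = 1 ∨ ε = -1) : Rn H ζ t ε [] = 1 + ε := by
  rw [Rn_even (k := 0) rfl, Rev_nil hH ht hε]

theorem Rn_perm (hH : IsHFamily ζ H) (hB : 1 - ζ ^ 2 ≠ 0) {ws ws' : List ℂ} (h : ws.Perm ws') :
    Rn H ζ t ε ws = Rn H ζ t ε ws' := by
  rcases Nat.even_or_odd' ws.length with ⟨k, hk | hk⟩
  · rw [Rn_even hk, Rn_even (h.length_eq ▸ hk), Rev_perm hH hB h hk]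
  · rw [Rn_odd hk, Rn_odd (h.length_eq ▸ hk), Rod_perm hH hB h hk]

theorem Rn_deg (hH : IsHFamily ζ H) (ws : List ℂ) : DegLE (ws.length + 1) fun x => Rn H ζ t ε (x :: ws) := by
  rcases Nat.even_or_odd' ws.length with ⟨k, hk | hk⟩
  · rw [hk]
    have : (fun x => Rn H ζ t ε (x :: ws)) = fun x => Rod H ζ t ε k (x :: ws) :=
      funext fun x => Rn_odd (by simp [hk])
    rw [this]; exact Rod_deg hH k ws
  · rw [hk]
    have : (fun x => Rn H ζ t ε (x :: ws)) = fun x => Rev H ζ t ε (k + 1) (x :: ws) :=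
      funext fun x => Rn_even (by simp [hk]; ring)
    rw [this]; exact Rev_deg hH (k + 1) ws

theorem Rn_wheel (hH : IsHFamily ζ H) (hB : 1 - ζ ^ 2 ≠ 0) {w₁ w₂ w₃ : ℂ} (h : hpol ζ w₁ w₂ = 0)
    (h3 : (1 - ζ ^ 2) * w₁ * w₂ * w₃ = 1) (ws : List ℂ) :
    Rn H ζ t ε (w₁ :: w₂ :: ws) = mco ζ t * ((1 - ζ ^ 2) / w₃) ^ (ws.length + 2)
      * (-w₃ * (J3c ζ - w₃) * (J4c ζ - w₃) * (ybar ζ t - w₃)) * ((ws.map fun w => w - w₃).prod) ^ 2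
      * Rn H ζ t ε ws := by
  rcases Nat.even_or_odd' ws.length with ⟨k, hk | hk⟩
  · rw [Rn_even hk, Rn_even (k := k + 1) (by simp [hk]; ring), Rev_wheel hH hB h h3 ws hk, hk]
  · rw [Rn_odd hk, Rn_odd (k := k + 1) (by simp [hk]; ring), Rod_wheel hH hB h h3 ws hk, hk]

theorem Rn_J4 (hH : IsHFamily ζ H) (hB : 1 - ζ ^ 2 ≠ 0) (hζ : ζ ≠ 0) (h1 : t - ζ ≠ 0) (h2 : 1 - t * ζ ≠ 0)
    (hε : ε = 1 ∨ ε = -1) (ws : List ℂ) :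
    Rn H ζ t ε (J4c ζ :: ws) = (-1) ^ ws.length * (1 + t)
      / (J4c ζ ^ (ws.length + 1) * ((1 - ζ) / (1 + ζ)) ^ ws.length)
      * (ws.map fun w => w - (1 - ζ) / (1 + ζ)).prod * Rn H ζ t ε ws := by
  rcases Nat.even_or_odd' ws.length with ⟨k, hk | hk⟩
  · rw [Rn_even hk, Rn_odd (k := k) (by simp [hk]), Rod_J4 hH hB hζ h1 h2 hε ws hk, hk]
  · rw [Rn_odd hk, Rn_even (k := k + 1) (by simp [hk]; ring), Rev_J4 hH hB h1 h2 hε ws hk, hk]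

theorem Rn_J3 (hH : IsHFamily ζ H) (hB : 1 - ζ ^ 2 ≠ 0) (hζ : ζ ≠ 0) (h1 : t - ζ ≠ 0) (h2 : 1 - t * ζ ≠ 0)
    (hε : ε = 1 ∨ ε = -1) (ws : List ℂ) :
    Rn H ζ t ε (J3c ζ :: ws) = -(1 - t)
      / (J3c ζ ^ (ws.length + 1) * ((1 + ζ) / (1 - ζ)) ^ ws.length)
      * (ws.map fun w => w - (1 + ζ) / (1 - ζ)).prod * Rn H ζ t (-ε) ws := by
  rcases Nat.even_or_odd' ws.length with ⟨k, hk | hk⟩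
  · rw [Rn_even hk, Rn_odd (k := k) (by simp [hk]), Rod_J3 hH hB hζ h1 h2 hε ws hk, hk]
  · rw [Rn_odd hk, Rn_even (k := k + 1) (by simp [hk]; ring), Rev_J3 hH hB h1 h2 hε ws hk, hk]

end

theorem QP.pow {τ c₁ c₂ : ℂ} {N : ℕ} {f : ℂ → ℂ} (hf : QP τ N c₁ c₂ f) (k : ℕ) :
    QP τ (k * N) (c₁ ^ k) (c₂ ^ k) fun z => f z ^ k := by
  refine ⟨hf.diff.pow k, fun z => ?_, fun z => ?_⟩
  · rw [hf.pi, mul_pow]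
  · rw [hf.tau, mul_pow, mul_pow, ← exp_nat_mul]
    congr 3
    push_cast; ring

theorem QP.sum {τ c₁ c₂ : ℂ} {N : ℕ} {ι : Type*} (s : Finset ι) {f : ι → ℂ → ℂ}
    (hf : ∀ i ∈ s, QP τ N c₁ c₂ (f i)) : QP τ N c₁ c₂ fun z => ∑ i ∈ s, f i z := by
  refine ⟨Differentiable.fun_sum fun i hi => (hf i hi).diff, fun z => ?_, fun z => ?_⟩
  · rw [Finset.mul_sum]; exact Finset.sum_congr rfl fun i hi => (hf i hi).pi z
  · rw [Finset.mul_sum]; exact Finset.sum_congr rfl fun i hi => (hf i hi).tau z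

section
variable {τ : ℂ} {Ψ : PsiFam}

/-- The homogenised form `D(z)^n p(N(z)/D(z))` of a polynomial of degree at most `n`. -/
def homog (τ : ℂ) (p : Polynomial ℂ) (n : ℕ) (z : ℂ) : ℂ :=
  ∑ i ∈ Finset.range (n + 1), p.coeff i * (Nth τ z ^ i * Dth τ z ^ (n - i))

theorem homog_eq {p : Polynomial ℂ} {n : ℕ} (hp : p.natDegree ≤ n) {z : ℂ} (hz : Dth τ z ≠ 0) :
    homog τ p n z = Dth τ z ^ n * p.eval (wv τ z) := by
  rw [Polynomial.eval_eq_sum_range' (Nat.lt_succ_of_le hp), Finset.mul_sum]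
  refine Finset.sum_congr rfl fun i hi => ?_
  have hi' : i ≤ n := Nat.lt_succ_iff.1 (Finset.mem_range.1 hi)
  have : Dth τ z ^ n = Dth τ z ^ (n - i) * Dth τ z ^ i := by rw [← pow_add, Nat.sub_add_cancel hi']
  rw [this, wv, div_pow]
  field_simp

theorem homog_neg (p : Polynomial ℂ) (n : ℕ) (z : ℂ) : homog τ p n (-z) = homog τ p n z := by
  simp only [homog, Nth_neg, Dth_neg]

theorem homog_qp (h : PosNome τ) (p : Polynomial ℂ) (n : ℕ) :
    QP τ (2 * n) 1 (exp (-(Real.pi * I * τ)) ^ (2 * n)) (homog τ p n) := by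
  refine QP.sum _ fun i hi => QP.const_mul ?_ _
  have hi' : i ≤ n := Nat.lt_succ_iff.1 (Finset.mem_range.1 hi)
  have := ((Nth_qp h).pow i).mul ((Dth_qp h).pow (n - i))
  rw [← add_mul, Nat.add_sub_cancel' hi', mul_comm n 2] at this
  refine this.congr (by simp) ?_
  rw [← pow_add, Nat.add_sub_cancel' hi', ← pow_mul]

theorem T1_double_qp (h : PosNome τ) :
    QP τ 2 1 (-(exp (-(Real.pi * I * τ)) ^ 2 * exp (2 * I * ηc))) fun z => T1 τ (2 * z + 2 * ηc) := by
  have q := T1_qp h.im_pos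
  refine ⟨q.diff.comp (by fun_prop), fun z => ?_, fun z => ?_⟩
  · rw [show 2 * (z + Real.pi) + 2 * ηc = 2 * z + 2 * ηc + Real.pi + Real.pi by ring, T1_pi, T1_pi]; ring
  · rw [show 2 * (z + Real.pi * τ) + 2 * ηc = 2 * z + 2 * ηc + Real.pi * (2 * τ) by ring, q.tau]
    congr 1
    have e1 : exp (-2 * I * (1 : ℕ) * (2 * z + 2 * ηc)) = exp (2 * I * ηc) * exp (-2 * I * (2 : ℕ) * z) := by
      rw [← exp_add, ← exp_periodic.sub_eq (2 * I * ηc + -2 * I * (2 : ℕ) * z)]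
      congr 1
      unfold ηc; push_cast; ring
    have e2 : exp (-(Real.pi * I * (2 * τ))) = exp (-(Real.pi * I * τ)) ^ 2 := by
      rw [← exp_nat_mul]; congr 1; push_cast; ring
    rw [e1, e2]; ring

theorem ne_int_of_between {a : ℝ} (n : ℤ) (h1 : (n : ℝ) < a) (h2 : a < n + 1) (m : ℤ) : a ≠ m := by
  rintro rfl
  have h1' : n < m := by exact_mod_cast h1
  have h2' : m < n + 1 := by exact_mod_cast h2
  omega

theorem Lth_ne_of_real (h : PosNome τ) {z : ℂ} (a : ℝ) (hz : z = Real.pi * a) (n : ℤ) (h1 : (n : ℝ) < a)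
    (h2 : a < n + 1) : Lth τ z ≠ 0 := by
  rw [Ne, Lth_eq_zero_iff h]
  exact not_plat_of_im h.im_pos (a := a) (b := 0) (by rw [hz]; simp) (Or.inl (ne_int_of_between n h1 h2))

theorem T1_ne_of_real (h : PosNome τ) {z : ℂ} (a : ℝ) (hz : z = Real.pi * a) (n : ℤ) (h1 : (n : ℝ) < a)
    (h2 : a < n + 1) : T1 τ z ≠ 0 := by
  rw [Ne, T1_eq_zero_iff h]
  exact not_plat_of_im (two_im_pos h) (a := a) (b := 0) (by rw [hz]; simp) (Or.inl (ne_int_of_between n h1 h2))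

/-- Admissible real arguments, in units of `π`. -/
def SmallArg (a : ℝ) : Prop := 0 ≤ a ∧ a < 1 / 100

theorem Dth_ne_of_small (h : PosNome τ) {a : ℝ} (ha : SmallArg a) : Dth τ (Real.pi * a) ≠ 0 := by
  obtain ⟨h1, h2⟩ := ha
  rw [Dth_ne_iff h]
  exact ⟨Lth_ne_of_real h (a + 1 / 3) (by unfold ηc; push_cast; ring) 0 (by push_cast; linarith) (by push_cast; linarith),
    Lth_ne_of_real h (a - 1 / 3) (by unfold ηc; push_cast; ring) (-1) (by push_cast; linarith) (by push_cast; linarith)⟩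

theorem Gen_of_small (h : PosNome τ) {a b : ℝ} (ha : SmallArg a) (hb : SmallArg b) :
    Gen τ (Real.pi * a) (Real.pi * b) := by
  obtain ⟨h1, h2⟩ := ha
  obtain ⟨h3, h4⟩ := hb
  exact ⟨Lth_ne_of_real h (1 / 3 - a - b) (by unfold ηc; push_cast; ring) 0 (by push_cast; linarith) (by push_cast; linarith),
    Lth_ne_of_real h (1 / 3 + a - b) (by unfold ηc; push_cast; ring) 0 (by push_cast; linarith) (by push_cast; linarith),
    Lth_ne_of_real h (1 / 3 + b - a) (by unfold ηc; push_cast; ring) 0 (by push_cast; linarith) (by push_cast; linarith)⟩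

/-- The list of arguments with given real coordinates. -/
def pts (as : List ℝ) : List ℂ := as.map fun a : ℝ => (Real.pi : ℂ) * a

theorem pts_gen (h : PosNome τ) {as : List ℝ} (ha : ∀ a ∈ as, SmallArg a) : (pts as).Pairwise (Gen τ) := by
  rw [pts, List.pairwise_map]
  exact List.pairwise_iff_forall_sublist.2 fun {a b} hs => Gen_of_small h (ha a (hs.subset (by simp)))
    (ha b (hs.subset (by simp)))

theorem pts_Dth (h : PosNome τ) {as : List ℝ} (ha : ∀ a ∈ as, SmallArg a) : ∀ x ∈ pts as, Dth τ x ≠ 0 := by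
  intro x hx
  obtain ⟨a, h1, rfl⟩ := List.mem_map.1 hx
  exact Dth_ne_of_small h (ha a h1)

/-- The interpolation nodes, in coordinates with respect to `π` and `πτ`. -/
def nodes (as : List ℝ) : List (ℝ × ℝ) :=
  [(-1/3, 0), (-1/3, -1/2), (1/3, 1/2), (-5/6, -1/2), (5/6, 1/2)]
    ++ (as.map (fun a => (2/3 - a, 0)) ++ as.map fun a => (a - 2/3, 0))

/-- The point with coordinates `q` with respect to `π` and `πτ`. -/
def latPt (τ : ℂ) (q : ℝ × ℝ) : ℂ := Real.pi * q.1 + Real.pi * τ * q.2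

theorem nodes_pairwise (h : PosNome τ) {as : List ℝ} (ha : ∀ a ∈ as, SmallArg a) (h0 : ∀ a ∈ as, a ≠ 0) (hd : as.Nodup) :
    ((nodes as).map (latPt τ)).Pairwise fun a b => ¬ PLat τ (b - a) := by
  have hS : ∀ a ∈ as, 0 < a ∧ a < 1 / 100 := fun a h => ⟨lt_of_le_of_ne (ha a h).1 (h0 a h).symm, (ha a h).2⟩
  have key : ∀ p q : ℝ × ℝ, ((∃ n : ℤ, (n : ℝ) < q.1 - p.1 ∧ q.1 - p.1 < n + 1) ∨
      (∃ n : ℤ, (n : ℝ) < q.2 - p.2 ∧ q.2 - p.2 < n + 1)) → ¬ PLat τ (latPt τ q - latPt τ p) := by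
    intro p q hpq
    refine not_plat_of_im h.im_pos (a := q.1 - p.1) (b := q.2 - p.2) (by unfold latPt; push_cast; ring) ?_
    rcases hpq with ⟨n, h1, h2⟩ | ⟨n, h1, h2⟩
    · exact Or.inl (ne_int_of_between n h1 h2)
    · exact Or.inr (ne_int_of_between n h1 h2)
  rw [List.pairwise_map]
  refine List.Pairwise.imp (fun {a b} h => key a b h) ?_
  unfold nodes
  rw [List.pairwise_append]
  refine ⟨?_, ?_, ?_⟩
  · simp only [List.pairwise_cons, List.mem_cons, List.not_mem_nil, or_false, forall_eq_or_imp, forall_eq,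
      List.Pairwise.nil, IsEmpty.forall_iff, implies_true, and_true]
    refine ⟨⟨Or.inr ⟨-1, ?_, ?_⟩, Or.inr ⟨0, ?_, ?_⟩, Or.inr ⟨-1, ?_, ?_⟩, Or.inr ⟨0, ?_, ?_⟩⟩,
      ⟨Or.inl ⟨0, ?_, ?_⟩, Or.inl ⟨-1, ?_, ?_⟩, Or.inl ⟨1, ?_, ?_⟩⟩,
      ⟨Or.inl ⟨-2, ?_, ?_⟩, Or.inl ⟨0, ?_, ?_⟩⟩, Or.inl ⟨1, ?_, ?_⟩⟩ <;> norm_num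
  · rw [List.pairwise_append]
    refine ⟨?_, ?_, ?_⟩
    · rw [List.pairwise_map]
      refine hd.imp_of_mem fun {a b} ha hb hab => Or.inl ?_
      have := hS a ha
      have := hS b hb
      rcases lt_or_gt_of_ne hab with hlt | hlt
      · exact ⟨-1, by push_cast; constructor <;> linarith⟩
      · exact ⟨0, by push_cast; constructor <;> linarith⟩
    · rw [List.pairwise_map]
      refine hd.imp_of_mem fun {a b} ha hb hab => Or.inl ?_
      have := hS a ha
      have := hS b hb
      rcases lt_or_gt_of_ne hab with hlt | hlt
      · exact ⟨0, by push_cast; constructor <;> linarith⟩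
      · exact ⟨-1, by push_cast; constructor <;> linarith⟩
    · simp only [List.mem_map]
      rintro _ ⟨a, ha, rfl⟩ _ ⟨b, hb, rfl⟩
      have := hS a ha
      have := hS b hb
      exact Or.inl ⟨-2, by push_cast; constructor <;> linarith⟩
  · intro p hp q hq
    simp only [List.mem_cons, List.not_mem_nil, or_false] at hp
    simp only [List.mem_append, List.mem_map] at hq
    rcases hq with ⟨b, hb, rfl⟩ | ⟨b, hb, rfl⟩ <;> have := hS b hb <;> rcases hp with rfl | rfl | rfl | rfl | rfl
    · exact Or.inl ⟨0, by push_cast; constructor <;> linarith⟩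
    · exact Or.inr ⟨0, by push_cast; constructor <;> linarith⟩
    · exact Or.inr ⟨-1, by push_cast; constructor <;> linarith⟩
    · exact Or.inr ⟨0, by push_cast; constructor <;> linarith⟩
    · exact Or.inr ⟨-1, by push_cast; constructor <;> linarith⟩
    · exact Or.inl ⟨-1, by push_cast; constructor <;> linarith⟩
    · exact Or.inr ⟨0, by push_cast; constructor <;> linarith⟩
    · exact Or.inr ⟨-1, by push_cast; constructor <;> linarith⟩
    · exact Or.inr ⟨0, by push_cast; constructor <;> linarith⟩
    · exact Or.inr ⟨-1, by push_cast; constructor <;> linarith⟩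

end

section
variable {τ : ℂ} {Ψ : PsiFam} {H : (k : ℕ) → (Fin (2 * k) → ℂ) → ℂ}

/-- The scalar product has the expected closed form at the arguments `xs`. -/
def Closed (τ : ℂ) (Ψ : PsiFam) (H : (k : ℕ) → (Fin (2 * k) → ℂ) → ℂ) (t ε : ℂ) (xs : List ℂ) : Prop :=
  Zn τ t ε Ψ xs = gco τ xs.length * Pref τ xs.length xs * Rn H (zet τ) t ε (xs.map (wv τ))

/-- The closed form, as a function of the first argument. -/
def closedFun (τ : ℂ) (p : Polynomial ℂ) (xs : List ℂ) (z : ℂ) : ℂ :=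
  gco τ (xs.length + 1) * Pref τ (xs.length + 1) xs * (T1 τ (2 * z + 2 * ηc) * homog τ p (xs.length + 1) z)

theorem closedFun_eq {t ε : ℂ} {p : Polynomial ℂ} {xs : List ℂ} (hp : p.natDegree ≤ xs.length + 1)
    (hR : ∀ x, Rn H (zet τ) t ε (x :: xs.map (wv τ)) = p.eval x) {z : ℂ} (hz : Dth τ z ≠ 0) :
    closedFun τ p xs z = gco τ (z :: xs).length * Pref τ (z :: xs).length (z :: xs)
      * Rn H (zet τ) t ε ((z :: xs).map (wv τ)) := by
  rw [closedFun, homog_eq hp hz, Pref_cons, List.map_cons, hR, List.length_cons]; ring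

theorem closedFun_qp (h : PosNome τ) (p : Polynomial ℂ) (xs : List ℂ) :
    QP τ (2 * (xs.length + 1) + 2) 1 (-exp (2 * I * ηc) * (pnome τ ^ (2 * (xs.length + 1) + 2))⁻¹)
      (closedFun τ p xs) := by
  have := ((T1_double_qp h).mul (homog_qp h p (xs.length + 1))).const_mul
    (gco τ (xs.length + 1) * Pref τ (xs.length + 1) xs)
  rw [add_comm 2] at this
  refine this.congr (one_mul 1) ?_
  have e : exp (-(Real.pi * I * τ)) = (pnome τ)⁻¹ := by rw [exp_neg]; rfl
  rw [e, ← inv_pow]; ring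

theorem closedFun_reflect (p : Polynomial ℂ) (xs : List ℂ) (x : ℂ) :
    T1 τ (2 * x + 2 * ηc) * closedFun τ p xs (-x) = T1 τ (-2 * x + 2 * ηc) * closedFun τ p xs x := by
  unfold closedFun
  rw [homog_neg, show 2 * -x + 2 * ηc = -2 * x + 2 * ηc by ring]; ring

theorem eq_at_reflected (h : PosNome τ) (hΨ : PsiOK τ Ψ) (t ε : ℂ) (p : Polynomial ℂ) (xs : List ℂ) {x : ℂ}
    (hx : Lth τ (ηc - 2 * x) ≠ 0) (hx' : T1 τ (2 * (-x) + 2 * ηc) ≠ 0)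
    (he : Zn τ t ε Ψ (-x :: xs) = closedFun τ p xs (-x)) : Zn τ t ε Ψ (x :: xs) = closedFun τ p xs x := by
  have h1 := Zl_reflect h hΨ t ε _ xs rfl hx
  have h2 := closedFun_reflect (τ := τ) p xs x
  refine mul_left_cancel₀ (a := T1 τ (-2 * x + 2 * ηc)) (by rwa [show -2 * x = 2 * -x by ring]) ?_
  rw [← h2, ← he]
  exact h1.symm

theorem Zn_qp (h : PosNome τ) (hΨ : PsiOK τ Ψ) (t ε : ℂ) (xs : List ℂ) :
    QP τ (2 * (xs.length + 1) + 2) 1 (-exp (2 * I * ηc) * (pnome τ ^ (2 * (xs.length + 1) + 2))⁻¹)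
      fun z => Zn τ t ε Ψ (z :: xs) :=
  Zl_qp h hΨ t ε _ xs rfl

theorem Dth_beta4_ne (h : PosNome τ) : Dth τ (-β4c τ) ≠ 0 := by
  rw [Dth_neg, Dth_ne_iff h, Ne, Ne, Lth_eq_zero_iff h, Lth_eq_zero_iff h]
  exact ⟨not_plat_of_im h.im_pos (a := 2 / 3) (b := 1 / 2) (by unfold β4c ηc; push_cast; ring)
      (Or.inr (ne_int_of_between 0 (by norm_num) (by norm_num))),
    not_plat_of_im h.im_pos (a := 0) (b := 1 / 2) (by unfold β4c ηc; push_cast; ring)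
      (Or.inr (ne_int_of_between 0 (by norm_num) (by norm_num)))⟩

theorem Dth_beta3_ne (h : PosNome τ) : Dth τ (-β3c τ) ≠ 0 := by
  rw [Dth_neg, Dth_ne_iff h, Ne, Ne, Lth_eq_zero_iff h, Lth_eq_zero_iff h]
  exact ⟨not_plat_of_im h.im_pos (a := 2 / 3 + 1 / 2) (b := 1 / 2) (by unfold β3c ηc; push_cast; ring)
      (Or.inr (ne_int_of_between 0 (by norm_num) (by norm_num))),
    not_plat_of_im h.im_pos (a := 1 / 2) (b := 1 / 2) (by unfold β3c ηc; push_cast; ring)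
      (Or.inr (ne_int_of_between 0 (by norm_num) (by norm_num)))⟩

/-- Good lists of real arguments: small, nonzero and distinct. -/
def GoodArgs (as : List ℝ) : Prop := (∀ a ∈ as, SmallArg a) ∧ (∀ a ∈ as, a ≠ 0) ∧ as.Nodup

theorem GoodArgs.of_cons {a : ℝ} {as : List ℝ} (h : GoodArgs (a :: as)) : GoodArgs as :=
  ⟨fun b hb => h.1 b (List.mem_cons_of_mem _ hb), fun b hb => h.2.1 b (List.mem_cons_of_mem _ hb),
    (List.nodup_cons.1 h.2.2).2⟩

theorem GoodArgs.perm {as bs : List ℝ} (h : GoodArgs as) (hp : as.Perm bs) : GoodArgs bs :=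
  ⟨fun b hb => h.1 b (hp.mem_iff.2 hb), fun b hb => h.2.1 b (hp.mem_iff.2 hb), hp.nodup_iff.1 h.2.2⟩

theorem closed_wheel (h : PosNome τ) (hΨ : PsiOK τ Ψ) (hH : IsHFamily (zet τ) H) {t ε : ℂ}
    (h1 : t - zet τ ≠ 0) (h2 : 1 - t * zet τ ≠ 0) {a : ℝ} (ha : SmallArg a) (ha0 : a ≠ 0) {xs : List ℂ}
    (hx : ∀ x ∈ xs, Dth τ x ≠ 0) (hc : Closed τ Ψ H t ε xs) :
    Closed τ Ψ H t ε ((2 * ηc - Real.pi * a) :: (Real.pi * a) :: xs) := by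
  obtain ⟨ha1, ha2⟩ := ha
  have ha1 : 0 < a := lt_of_le_of_ne ha1 ha0.symm
  have hB : 1 - zet τ ^ 2 ≠ 0 := zet_sq_ne h
  have hη := three_eta
  have l0 : Lth τ (Real.pi * a) ≠ 0 :=
    Lth_ne_of_real h a rfl 0 (by push_cast; linarith) (by push_cast; linarith)
  have l1 : Lth τ (Real.pi * a + ηc) ≠ 0 :=
    Lth_ne_of_real h (a + 1 / 3) (by unfold ηc; push_cast; ring) 0 (by push_cast; linarith) (by push_cast; linarith)
  have l2 : Lth τ (Real.pi * a - ηc) ≠ 0 :=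
    Lth_ne_of_real h (a - 1 / 3) (by unfold ηc; push_cast; ring) (-1) (by push_cast; linarith) (by push_cast; linarith)
  have l3 : Lth τ (Real.pi * a + 2 * ηc) ≠ 0 :=
    Lth_ne_of_real h (a + 2 / 3) (by unfold ηc; push_cast; ring) 0 (by push_cast; linarith) (by push_cast; linarith)
  have l4 : Lth τ (Real.pi * a - 2 * ηc) ≠ 0 :=
    Lth_ne_of_real h (a - 2 / 3) (by unfold ηc; push_cast; ring) (-1) (by push_cast; linarith) (by push_cast; linarith)
  have d0 : Dth τ (Real.pi * a) ≠ 0 := (Dth_ne_iff h _).2 ⟨l1, l2⟩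
  have d1 : Dth τ (Real.pi * a + ηc) ≠ 0 := (Dth_ne_iff h _).2
    ⟨by rwa [show Real.pi * a + ηc + ηc = Real.pi * a + 2 * ηc by ring],
      by rwa [show Real.pi * a + ηc - ηc = Real.pi * a by ring]⟩
  have d2 : Dth τ (Real.pi * a - ηc) ≠ 0 := (Dth_ne_iff h _).2
    ⟨by rwa [show Real.pi * a - ηc + ηc = Real.pi * a by ring],
      by rwa [show Real.pi * a - ηc - ηc = Real.pi * a - 2 * ηc by ring]⟩
  have eneg : 2 * ηc - Real.pi * a - ηc = -(Real.pi * a - ηc) := by ring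
  have ew : wv τ (2 * ηc - Real.pi * a) = wv τ (Real.pi * a + ηc) := by
    rw [← wv_neg, ← wv_pi]; congr 1; rw [← hη]; ring
  have ew3 : wv τ (2 * ηc - Real.pi * a - ηc) = wv τ (Real.pi * a - ηc) := by rw [eneg, wv_neg]
  have hw := hpol_wheel h d0 d1
  have hpr := wv_prod h l0 l1 l2
  have key := Zn_wheel_eq h hΨ t ε _ (2 * ηc - Real.pi * a) xs h1 h2 hx (by rw [eneg, Dth_neg]; exact d2)
    (by rw [eneg, Lth_neg]; exact neg_ne_zero.2 l2) hc
  rw [show 2 * ηc - (2 * ηc - (Real.pi : ℂ) * a) = Real.pi * a by ring, ew3] at key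
  unfold Closed
  rw [key, List.map_cons, List.map_cons, ew,
    Rn_wheel hH hB (by rw [hpol_comm]; exact hw) (w₃ := wv τ (Real.pi * a - ηc)) (by linear_combination hpr), List.length_map]
  simp only [List.length_cons]

theorem closed_step (h : PosNome τ) (hΨ : PsiOK τ Ψ) (hH : IsHFamily (zet τ) H) {t : ℂ}
    (h1 : t - zet τ ≠ 0) (h2 : 1 - t * zet τ ≠ 0) {as : List ℝ} (hg : GoodArgs as)
    (hc : ∀ ε : ℂ, ε = 1 ∨ ε = -1 → Closed τ Ψ H t ε (pts as))
    (hw : ∀ ε : ℂ, ε = 1 ∨ ε = -1 → ∀ a bs, as.Perm (a :: bs) → Closed τ Ψ H t ε (pts bs))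
    {ε : ℂ} (hε : ε = 1 ∨ ε = -1) {p : Polynomial ℂ} (hp : p.natDegree ≤ (pts as).length + 1)
    (hR : ∀ x, Rn H (zet τ) t ε (x :: (pts as).map (wv τ)) = p.eval x) :
    (fun z => Zn τ t ε Ψ (z :: pts as)) = closedFun τ p (pts as) := by
  have hB : 1 - zet τ ^ 2 ≠ 0 := zet_sq_ne h
  have hζ := zet_ne h
  have hD := pts_Dth h hg.1
  have h4 : Zn τ t ε Ψ (-β4c τ :: pts as) = closedFun τ p (pts as) (-β4c τ) := by
    rw [closedFun_eq hp hR (Dth_beta4_ne h), Zn_beta4_eq h hΨ t ε _ _ hD (hc ε hε), List.map_cons, wv_neg,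
      wv_beta4 h, Rn_J4 hH hB hζ h1 h2 hε, List.length_map]
    rfl
  have h3 : Zn τ t ε Ψ (-β3c τ :: pts as) = closedFun τ p (pts as) (-β3c τ) := by
    rw [closedFun_eq hp hR (Dth_beta3_ne h), Zn_beta3_eq h hΨ t ε _ _ hD (hc (-ε) (by rcases hε with rfl | rfl <;> simp)),
      List.map_cons, wv_neg, wv_beta3 h, Rn_J3 hH hB hζ h1 h2 hε, List.length_map]
    rfl
  have hj : ∀ a ∈ as, Zn τ t ε Ψ ((2 * ηc - Real.pi * a) :: pts as) = closedFun τ p (pts as) (2 * ηc - Real.pi * a) := by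
    intro a ha
    have hperm := List.perm_cons_erase ha
    have hs := hg.1 a ha
    have hgb : GoodArgs (as.erase a) := (hg.perm hperm).of_cons
    have hpp : (pts as).Perm (pts (a :: as.erase a)) := hperm.map _
    have key := closed_wheel h hΨ hH h1 h2 hs (hg.2.1 a ha) (pts_Dth h hgb.1) (hw ε hε a _ hperm)
    have hd : Dth τ (2 * ηc - Real.pi * a) ≠ 0 := by
      obtain ⟨ha1, ha2⟩ := hs
      have ha1 : 0 < a := lt_of_le_of_ne ha1 (hg.2.1 a ha).symm
      rw [Dth_ne_iff h]
      exact ⟨Lth_ne_of_real h (1 - a) (by unfold ηc; push_cast; ring) 0 (by push_cast; linarith) (by push_cast; linarith),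
        Lth_ne_of_real h (1 / 3 - a) (by unfold ηc; push_cast; ring) 0 (by push_cast; linarith) (by push_cast; linarith)⟩
    rw [closedFun_eq hp hR hd, Zn_cons_perm h hΨ t ε _ hpp (pts_gen h hg.1)]
    refine key.trans ?_
    have hl : (pts as).length = (pts (a :: as.erase a)).length := hpp.length_eq
    have e1 : Pref τ (pts as).length.succ ((2 * ηc - Real.pi * a : ℂ) :: pts as)
        = Pref τ (pts as).length.succ ((2 * ηc - Real.pi * a : ℂ) :: pts (a :: as.erase a)) :=
      ((hpp.cons _).map _).prod_eq
    have e2 : Rn H (zet τ) t ε (((2 * ηc - Real.pi * a : ℂ) :: pts as).map (wv τ))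
        = Rn H (zet τ) t ε (((2 * ηc - Real.pi * a : ℂ) :: pts (a :: as.erase a)).map (wv τ)) :=
      Rn_perm hH hB ((hpp.cons _).map _)
    rw [e2]
    change _ = gco τ (pts as).length.succ * Pref τ (pts as).length.succ ((2 * ηc - Real.pi * a : ℂ) :: pts as) * _
    rw [e1, hl]
    rfl
  refine QP.eq_of_list h.im_pos (Zn_qp h hΨ t ε (pts as)) (closedFun_qp h p (pts as)) one_ne_zero
    (mul_ne_zero (neg_ne_zero.2 (exp_ne_zero _)) (inv_ne_zero (pow_ne_zero _ (exp_ne_zero _))))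
    ((nodes as).map (latPt τ)) ?_ (nodes_pairwise h hg.1 hg.2.1 hg.2.2) ?_
  · simp [nodes, pts]; omega
  · intro z hz
    obtain ⟨q, hq, rfl⟩ := List.mem_map.1 hz
    simp only [nodes, List.mem_append, List.mem_cons, List.not_mem_nil, or_false, List.mem_map] at hq
    rcases hq with (rfl | rfl | rfl | rfl | rfl) | ⟨a, ha, rfl⟩ | ⟨a, ha, rfl⟩
    · have e : latPt τ (-1/3, 0) = -ηc := by unfold latPt ηc; push_cast; ring
      rw [e]
      have hr := Zl_reflect h hΨ t ε _ (pts as) rfl (x := ηc)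
        (Lth_ne_of_real h (-1/3) (by unfold ηc; push_cast; ring) (-1) (by norm_num) (by norm_num))
      rw [show -2 * ηc + 2 * ηc = 0 by ring, T1_zero, zero_mul, mul_eq_zero] at hr
      have hz : Zn τ t ε Ψ (-ηc :: pts as) = 0 := hr.resolve_left
        (T1_ne_of_real h (4/3) (by unfold ηc; push_cast; ring) 1 (by norm_num) (by norm_num))
      rw [hz, closedFun, show 2 * -ηc + 2 * ηc = 0 by ring, T1_zero]; ring
    · have e : latPt τ (-1/3, -1/2) = -β4c τ := by unfold latPt β4c ηc; push_cast; ring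
      rw [e, h4]
    · have e : latPt τ (1/3, 1/2) = β4c τ := by unfold latPt β4c ηc; push_cast; ring
      rw [e]
      refine eq_at_reflected h hΨ t ε p _ ?_ ?_ h4
      · rw [Ne, Lth_eq_zero_iff h]
        exact not_plat_of_im h.im_pos (a := -1/3) (b := -1) (by unfold β4c ηc; push_cast; ring)
          (Or.inl (ne_int_of_between (-1) (by norm_num) (by norm_num)))
      · rw [T1_beta4]; exact mul_ne_zero (mul_ne_zero (neg_ne_zero.2 I_ne_zero) (exp_ne_zero _)) (T4_zero_ne h)
    · have e : latPt τ (-5/6, -1/2) = -β3c τ := by unfold latPt β3c ηc; push_cast; ring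
      rw [e, h3]
    · have e : latPt τ (5/6, 1/2) = β3c τ := by unfold latPt β3c ηc; push_cast; ring
      rw [e]
      refine eq_at_reflected h hΨ t ε p _ ?_ ?_ h3
      · rw [Ne, Lth_eq_zero_iff h]
        exact not_plat_of_im h.im_pos (a := -4/3) (b := -1) (by unfold β3c ηc; push_cast; ring)
          (Or.inl (ne_int_of_between (-2) (by norm_num) (by norm_num)))
      · rw [T1_beta3]; exact mul_ne_zero (mul_ne_zero I_ne_zero (exp_ne_zero _)) (T4_zero_ne h)
    · have e : latPt τ (2/3 - a, 0) = 2 * ηc - Real.pi * a := by unfold latPt ηc; push_cast; ring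
      rw [e, hj a ha]
    · have e : latPt τ (a - 2/3, 0) = -(2 * ηc - Real.pi * a) := by unfold latPt ηc; push_cast; ring
      have ha1 : 0 < a := lt_of_le_of_ne (hg.1 a ha).1 (hg.2.1 a ha).symm
      have ha2 := (hg.1 a ha).2
      rw [e]
      refine eq_at_reflected h hΨ t ε p _ ?_ ?_ (by rw [neg_neg]; exact hj a ha)
      · exact Lth_ne_of_real h (5 / 3 - 2 * a) (by unfold ηc; push_cast; ring) 1 (by push_cast; linarith) (by push_cast; linarith)
      · exact T1_ne_of_real h (2 - 2 * a) (by unfold ηc; push_cast; ring) 1 (by push_cast; linarith) (by push_cast; linarith)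

theorem closed_good (h : PosNome τ) (hΨ : PsiOK τ Ψ) (hH : IsHFamily (zet τ) H) {t : ℂ} (h0 : t ≠ 0)
    (h1 : t - zet τ ≠ 0) (h2 : 1 - t * zet τ ≠ 0) (n : ℕ) : ∀ (as : List ℝ), as.length = n → GoodArgs as →
      ∀ ε : ℂ, ε = 1 ∨ ε = -1 → Closed τ Ψ H t ε (pts as) := by
  induction n using Nat.strong_induction_on with
  | _ n ih =>
    intro as hl hg ε hε
    cases as with
    | nil =>
      have e : pts [] = [] := rfl
      rw [Closed, e, List.map_nil, Rn_nil hH h0 hε, Zn_nil hΨ]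
      simp [gco, Pref]
    | cons a as =>
      obtain ⟨p, hp, hR⟩ := Rn_deg (t := t) (ε := ε) hH ((pts as).map (wv τ))
      rw [List.length_map] at hp
      have hs := closed_step h hΨ hH h1 h2 hg.of_cons
        (ih as.length (by simp at hl; omega) as rfl hg.of_cons)
        (fun ε hε b bs hb => ih bs.length (by have := hb.length_eq; simp at hl this; omega) bs rfl
          (hg.of_cons.perm hb).of_cons ε hε) hε hp hR
      exact (congrFun hs (Real.pi * a)).trans
        (closedFun_eq hp hR (Dth_ne_of_small h (hg.1 a (List.mem_cons_self))))

theorem Closed.perm (h : PosNome τ) (hΨ : PsiOK τ Ψ) (hH : IsHFamily (zet τ) H) {t ε : ℂ} {as bs : List ℝ}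
    (ha : ∀ a ∈ as, SmallArg a) (hp : as.Perm bs) (hc : Closed τ Ψ H t ε (pts bs)) : Closed τ Ψ H t ε (pts as) := by
  have hpp : (pts as).Perm (pts bs) := hp.map _
  unfold Closed at *
  have e : Pref τ (pts bs).length (pts as) = Pref τ (pts bs).length (pts bs) := (hpp.map _).prod_eq
  rw [Zn_perm h hΨ t ε hpp (pts_gen h ha), hc, Rn_perm hH (zet_sq_ne h) (hpp.map _), hpp.length_eq, e]

theorem closed_zero_append (h : PosNome τ) (hΨ : PsiOK τ Ψ) (hH : IsHFamily (zet τ) H) {t : ℂ} (h0 : t ≠ 0)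
    (h1 : t - zet τ ≠ 0) (h2 : 1 - t * zet τ ≠ 0) {ε : ℂ} (hε : ε = 1 ∨ ε = -1) (j : ℕ) : ∀ as : List ℝ, GoodArgs as →
      Closed τ Ψ H t ε (pts (List.replicate j 0 ++ as)) := by
  induction j with
  | zero => intro as hg; exact closed_good h hΨ hH h0 h1 h2 _ as rfl hg ε hε
  | succ j ih =>
    intro as hg
    have hsm : ∀ a ∈ List.replicate j 0 ++ as, SmallArg a := by
      intro a ha
      rcases List.mem_append.1 ha with ha | ha
      · rw [(List.mem_replicate.1 ha).2]; exact ⟨le_refl _, by norm_num⟩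
      · exact hg.1 a ha
    set bs := List.replicate j 0 ++ as with hbs
    obtain ⟨p, hp, hR⟩ := Rn_deg (t := t) (ε := ε) hH ((pts bs).map (wv τ))
    rw [List.length_map] at hp
    have c1 : Continuous fun a : ℝ => Zn τ t ε Ψ ((Real.pi * a : ℂ) :: pts bs) :=
      (Zn_qp h hΨ t ε (pts bs)).diff.continuous.comp (by fun_prop)
    have c2 : Continuous fun a : ℝ => closedFun τ p (pts bs) (Real.pi * a : ℂ) :=
      (closedFun_qp h p (pts bs)).diff.continuous.comp (by fun_prop)
    have hev : ∀ᶠ a : ℝ in nhdsWithin 0 (Set.Ioi 0), Zn τ t ε Ψ ((Real.pi * a : ℂ) :: pts bs)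
        = closedFun τ p (pts bs) (Real.pi * a : ℂ) := by
      have hfin : ∀ᶠ a : ℝ in nhdsWithin 0 (Set.Ioi 0), ∀ b ∈ as, a ≠ b := by
        have : ∀ᶠ a : ℝ in nhds 0, ∀ b ∈ as.toFinset, a ≠ b := by
          rw [Filter.eventually_all_finset]
          intro b hb
          exact isOpen_ne.mem_nhds (hg.2.1 b (List.mem_toFinset.1 hb)).symm
        filter_upwards [nhdsWithin_le_nhds this] with a ha b hb using ha b (List.mem_toFinset.2 hb)
      filter_upwards [self_mem_nhdsWithin, nhdsWithin_le_nhds (Iio_mem_nhds (show (0 : ℝ) < 1 / 100 by norm_num)), hfin]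
        with a ha1 ha2 ha3
      have hsa : SmallArg a := ⟨le_of_lt ha1, ha2⟩
      have hga : GoodArgs (a :: as) :=
        ⟨by intro b hb; rcases List.mem_cons.1 hb with rfl | hb; exacts [hsa, hg.1 b hb],
          by intro b hb; rcases List.mem_cons.1 hb with rfl | hb; exacts [ne_of_gt ha1, hg.2.1 b hb],
          List.nodup_cons.2 ⟨fun hm => ha3 a hm rfl, hg.2.2⟩⟩
      have hcl := Closed.perm h hΨ hH (as := a :: bs)
        (by intro b hb; rcases List.mem_cons.1 hb with rfl | hb; exacts [hsa, hsm b hb]) List.perm_middle.symm (ih (a :: as) hga)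
      rw [closedFun_eq hp hR (Dth_ne_of_small h hsa)]
      exact hcl
    have := tendsto_nhds_unique_of_eventuallyEq
      ((c1.tendsto 0).mono_left nhdsWithin_le_nhds) ((c2.tendsto 0).mono_left nhdsWithin_le_nhds) hev
    have e : pts (List.replicate (j + 1) 0 ++ as) = ((Real.pi : ℂ) * (0 : ℝ)) :: pts bs := by
      simp [pts, List.replicate_succ, hbs]
    rw [Closed, e]
    exact this.trans (closedFun_eq hp hR (Dth_ne_of_small h ⟨le_refl _, by norm_num⟩))

theorem closed_zero (h : PosNome τ) (hΨ : PsiOK τ Ψ) (hH : IsHFamily (zet τ) H) {t : ℂ} (h0 : t ≠ 0)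
    (h1 : t - zet τ ≠ 0) (h2 : 1 - t * zet τ ≠ 0) {ε : ℂ} (hε : ε = 1 ∨ ε = -1) (n : ℕ) :
    Closed τ Ψ H t ε (List.replicate n 0) := by
  have := closed_zero_append h hΨ hH h0 h1 h2 hε n [] ⟨by simp, by simp, by simp⟩
  simpa [pts] using this

end

theorem sum_conf_succ {M : Type*} [AddCommMonoid M] {m : ℕ} (F : (Fin (m + 1) → Fin 2) → M) :
    ∑ α : Fin (m + 1) → Fin 2, F α = ∑ β : Fin m → Fin 2, F (Fin.cons 0 β) + ∑ β : Fin m → Fin 2, F (Fin.cons 1 β) := by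
  rw [← (Fin.consEquiv fun _ => Fin 2).sum_comp, Fintype.sum_prod_type, Fin.sum_univ_two]
  rfl

section
variable {τ : ℂ} {Ψ : PsiFam}

/-- The weight of a pair of spins in a covector `a⟨↑↑| + d⟨↓↓|`. -/
def pairW (a d : ℂ) (s t : Fin 2) : ℂ := if s = 0 ∧ t = 0 then a else if s = 1 ∧ t = 1 then d else 0

theorem Zl_zero_eq_sum (t ε : ℂ) (n : ℕ) : ∀ Φ : SiteList → ℂ,
    Zl τ t ε (List.replicate n 0) Φ = ∑ α : Fin (2*n+1) → Fin 2,
      (∏ m : Fin n, pairW (Ka τ t 0) (Kd τ t 0)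
        (α ⟨2*(m:ℕ), by have := m.2; omega⟩) (α ⟨2*(m:ℕ)+1, by have := m.2; omega⟩))
      * (if α ⟨2*n, by omega⟩ = 0 then (1:ℂ) else ε) * Φ (List.ofFn fun j => ((0 : ℂ), α j)) := by
  induction n with
  | zero =>
    intro Φ
    have e := sum_conf_succ (m := 0) fun α : Fin 1 → Fin 2 =>
      (if α 0 = 0 then (1:ℂ) else ε) * Φ (List.ofFn fun j => ((0 : ℂ), α j))
    simp [Zl] at e ⊢
    exact e.symm
  | succ n ih =>
    intro Φ
    rw [List.replicate_succ, Zl, ih]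
    have e : ∀ G : (Fin (2*(n+1)+1) → Fin 2) → ℂ, ∑ α, G α =
        (∑ β : Fin (2*n+1) → Fin 2, G (Fin.cons (n := 2*n+2) 0 (Fin.cons (n := 2*n+1) 0 β))
          + ∑ β : Fin (2*n+1) → Fin 2, G (Fin.cons (n := 2*n+2) 0 (Fin.cons (n := 2*n+1) 1 β)))
        + (∑ β : Fin (2*n+1) → Fin 2, G (Fin.cons (n := 2*n+2) 1 (Fin.cons (n := 2*n+1) 0 β))
          + ∑ β : Fin (2*n+1) → Fin 2, G (Fin.cons (n := 2*n+2) 1 (Fin.cons (n := 2*n+1) 1 β))) := by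
      intro G
      have h1 := sum_conf_succ (m := 2*n+2) G
      rw [sum_conf_succ (m := 2*n+1), sum_conf_succ (m := 2*n+1)] at h1
      exact h1
    rw [e, ← Finset.sum_add_distrib, ← Finset.sum_add_distrib, ← Finset.sum_add_distrib]
    refine Finset.sum_congr rfl fun β _ => ?_
    have key : ∀ a b : Fin 2,
        (∏ m : Fin (n + 1), pairW (Ka τ t 0) (Kd τ t 0)
          ((Fin.cons (n := 2*n+2) a (Fin.cons (n := 2*n+1) b β) : Fin (2*(n+1)+1) → Fin 2) ⟨2*(m:ℕ), by have := m.2; omega⟩)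
          ((Fin.cons (n := 2*n+2) a (Fin.cons (n := 2*n+1) b β) : Fin (2*(n+1)+1) → Fin 2) ⟨2*(m:ℕ)+1, by have := m.2; omega⟩))
        * (if (Fin.cons (n := 2*n+2) a (Fin.cons (n := 2*n+1) b β) : Fin (2*(n+1)+1) → Fin 2) ⟨2*(n+1), by omega⟩ = 0 then (1:ℂ) else ε)
        * Φ (List.ofFn fun j => ((0 : ℂ), (Fin.cons (n := 2*n+2) a (Fin.cons (n := 2*n+1) b β) : Fin (2*(n+1)+1) → Fin 2) j))
        = (pairW (Ka τ t 0) (Kd τ t 0) a b * ∏ m : Fin n, pairW (Ka τ t 0) (Kd τ t 0)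
            (β ⟨2*(m:ℕ), by have := m.2; omega⟩) (β ⟨2*(m:ℕ)+1, by have := m.2; omega⟩))
          * (if β ⟨2*n, by omega⟩ = 0 then (1:ℂ) else ε)
          * Φ ((0, a) :: (0, b) :: List.ofFn fun j => ((0 : ℂ), β j)) := by
      intro a b
      congr 1
      · rw [Fin.prod_univ_succ]; rfl
      · have h1 := List.ofFn_succ (n := 2*n+2) (f := fun j => ((0 : ℂ), (Fin.cons (n := 2*n+2) a (Fin.cons (n := 2*n+1) b β) : Fin (2*n+2+1) → Fin 2) j))
        have h2 := List.ofFn_succ (n := 2*n+1) (f := fun j => ((0 : ℂ), (Fin.cons (n := 2*n+1) b β : Fin (2*n+1+1) → Fin 2) j))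
        exact congrArg Φ (h1.trans (congrArg (List.cons _) h2))
    refine Eq.trans ?_ (congrArg₂ (· + ·) (congrArg₂ (· + ·) (key 0 0) (key 0 1)) (congrArg₂ (· + ·) (key 1 0) (key 1 1))).symm
    have p00 : pairW (Ka τ t 0) (Kd τ t 0) 0 0 = Ka τ t 0 := by simp [pairW]
    have p01 : pairW (Ka τ t 0) (Kd τ t 0) 0 1 = 0 := by simp [pairW]
    have p10 : pairW (Ka τ t 0) (Kd τ t 0) 1 0 = 0 := by simp [pairW]
    have p11 : pairW (Ka τ t 0) (Kd τ t 0) 1 1 = Kd τ t 0 := by simp [pairW]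
    simp only [p00, p01, p10, p11, con, neg_zero, zero_mul, add_zero, zero_add]
    ring

theorem PsiL_ofFn_zero (n : ℕ) (α : Fin (2*n+1) → Fin 2) :
    PsiL Ψ n (List.ofFn fun j => ((0 : ℂ), α j)) = Ψ n (fun _ => 0) α := by
  unfold PsiL
  have e : ∀ j : Fin (2*n+1), (List.ofFn fun j => ((0 : ℂ), α j)).getD j (0, 0) = (0, α j) := by
    intro j
    rw [List.getD_eq_getElem _ _ (by rw [List.length_ofFn]; exact j.2), List.getElem_ofFn]
  simp only [e]

theorem Sbarfun_eq {t c ν : ℂ} (hc : Ka τ t 0 = c) (hd : Kd τ t 0 = c * ν) (ε : ℂ) (n : ℕ) :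
    c ^ n * Sbarfun τ ε Ψ n ν = Ncoef τ n * Zn τ t ε Ψ (List.replicate n 0) := by
  unfold Zn
  rw [Zl_zero_eq_sum, Sbarfun, Finset.mul_sum, Finset.mul_sum, List.length_replicate]
  refine Finset.sum_congr rfl fun α _ => ?_
  rw [PsiL_ofFn_zero, psiH]
  have e : ∏ m : Fin n, pairW (Ka τ t 0) (Kd τ t 0)
      (α ⟨2*(m:ℕ), by have := m.2; omega⟩) (α ⟨2*(m:ℕ)+1, by have := m.2; omega⟩)
      = c ^ n * ∏ m : Fin n, pairW 1 ν
      (α ⟨2*(m:ℕ), by have := m.2; omega⟩) (α ⟨2*(m:ℕ)+1, by have := m.2; omega⟩) := by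
    have hcn : c ^ n = ∏ _m : Fin n, c := by simp
    rw [hcn, ← Finset.prod_mul_distrib]
    refine Finset.prod_congr rfl fun m _ => ?_
    rw [hc, hd]
    unfold pairW
    split_ifs <;> simp
  rw [e]
  simp only [pairW]
  ring
end

section
variable {τ : ℂ} {Ψ : PsiFam} {H : (k : ℕ) → (Fin (2 * k) → ℂ) → ℂ}

theorem Dth_zero : Dth τ 0 = -(zet τ * T4 τ 0 ^ 4) := by
  unfold Dth; rw [T1_zero]; ring

theorem wv_zero : wv τ 0 = 0 := by
  simp [wv, Nth, Lth, T1_zero]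

theorem Pref_replicate_zero (n : ℕ) :
    Pref τ n (List.replicate n 0) = T1 τ ηc ^ n * (-(zet τ * T4 τ 0 ^ 4)) ^ (n ^ 2) := by
  rw [Pref, List.map_replicate, List.prod_replicate, mul_zero, zero_add, T1_two_eta, Dth_zero, mul_pow, ← pow_mul, sq]

theorem gco_mul_Pref (h : PosNome τ) (n : ℕ) : gco τ n * (T1 τ ηc ^ n * (-(zet τ * T4 τ 0 ^ 4)) ^ (n ^ 2))
    = (-(zet τ * T4 τ ηc ^ 2)) ^ n * (Clan τ * Lth τ ηc) ^ (n ^ 2) * kap τ ^ (n * (n + 1) / 2) := by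
  induction n with
  | zero => simp [gco]
  | succ n ih =>
    have hT := T4_zero_ne h
    have hζ := zet_ne h
    have e1 : (n + 1) ^ 2 = n ^ 2 + (2 * n + 1) := by ring
    have e2 : (n + 1) * (n + 1 + 1) / 2 = n * (n + 1) / 2 + (n + 1) := by
      rw [show (n + 1) * (n + 1 + 1) = n * (n + 1) + 2 * (n + 1) by ring, Nat.add_mul_div_left _ _ (by norm_num)]
    have hs : (T1 τ ηc ^ 2) ^ n = (zet τ * T4 τ ηc ^ 2) ^ n := by rw [T1_eta_sq h]
    have hodd : (-(zet τ * T4 τ 0 ^ 4)) ^ (2 * n + 1) = -(zet τ * T4 τ 0 ^ 4) * ((zet τ * T4 τ 0 ^ 4) ^ n) ^ 2 := by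
      rw [pow_succ, pow_mul, neg_sq, ← pow_mul, ← pow_mul]; ring
    have hstep : kap τ ^ (5 * n + 4) / (T4 τ 0 * (zet τ * T4 τ 0 ^ 4) ^ n) * (T1 τ ηc * (-(zet τ * T4 τ 0 ^ 4)) ^ (2 * n + 1))
        = -(zet τ * T4 τ ηc ^ 2) * Lth τ ηc ^ (2 * n + 1) * kap τ ^ (n + 1) := by
      have hL : Lth τ ηc ^ (2 * n + 1) = T1 τ ηc * (T1 τ ηc ^ 2) ^ n * T4 τ ηc ^ (2 * n + 1) := by
        unfold Lth; ring
      rw [hodd, hL, hs, T4_eta_eq h]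
      field_simp
      ring
    rw [gco, e1, e2, pow_add, pow_add (Clan τ * Lth τ ηc), pow_add (kap τ), mul_pow (Clan τ) _ (2 * n + 1)]
    linear_combination (Clan τ ^ (2 * n + 1) * (kap τ ^ (5 * n + 4) / (T4 τ 0 * (zet τ * T4 τ 0 ^ 4) ^ n))
      * (T1 τ ηc * (-(zet τ * T4 τ 0 ^ 4)) ^ (2 * n + 1))) * ih
      + (-(zet τ * T4 τ ηc ^ 2)) ^ n * (Clan τ * Lth τ ηc) ^ (n ^ 2) * kap τ ^ (n * (n + 1) / 2) * Clan τ ^ (2 * n + 1) * hstep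

theorem Ka_zero (h : PosNome τ) (t : ℂ) : Ka τ t 0 = T4 τ ηc ^ 2 * (zet τ - t) := by
  rw [Ka, zero_sub, T1_neg, T4_neg, neg_sq, T1_eta_sq h]; ring

theorem Kd_zero (h : PosNome τ) (t : ℂ) : Kd τ t 0 = T4 τ ηc ^ 2 * (1 - t * zet τ) := by
  rw [Kd, zero_sub, T1_neg, T4_neg, neg_sq, T1_eta_sq h]; ring

theorem Sbarfun_eq_Rn (h : PosNome τ) (hΨ : PsiOK τ Ψ) (hH : IsHFamily (zet τ) H) {t ν ε : ℂ} (h0 : t ≠ 0)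
    (h1 : t - zet τ ≠ 0) (h2 : 1 - t * zet τ ≠ 0) (hν : 1 - t * zet τ = (zet τ - t) * ν) (hε : ε = 1 ∨ ε = -1) (n : ℕ) :
    (zet τ - t) ^ n * Sbarfun τ ε Ψ n ν
      = (-1) ^ ((n + 1) / 2) * (-zet τ) ^ n * Rn H (zet τ) t ε (List.replicate n 0) := by
  have key := Sbarfun_eq (Ψ := Ψ) (Ka_zero h t) (by rw [Kd_zero h, hν]; ring) ε n (ν := ν)
  have hc := closed_zero h hΨ hH h0 h1 h2 hε n
  rw [Closed, List.length_replicate, Pref_replicate_zero, gco_mul_Pref h, List.map_replicate, wv_zero] at hc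
  have hth : th1 ηc τ ≠ 0 := by
    rw [landen h]; exact mul_ne_zero (Clan_ne h) (mul_ne_zero (T1_eta_ne h) (T4_eta_ne h))
  have hN : Ncoef τ n * (th1 ηc τ ^ (n ^ 2) * kap τ ^ (n * (n + 1) / 2)) = (-1) ^ ((n + 1) / 2) := by
    have hk := kap_ne h
    change (-1 : ℂ) ^ ((n+1)/2) * (th1 ηc τ ^ (n^2))⁻¹ * (T4 τ 0 / T4 τ ηc) ^ (n*(n+1)/2) * _ = _
    rw [← inv_div, show T4 τ ηc / T4 τ 0 = kap τ from rfl, inv_pow]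
    field_simp
  rw [hc, ← landen h] at key
  apply mul_left_cancel₀ (pow_ne_zero n (pow_ne_zero 2 (T4_eta_ne h)))
  rw [← mul_assoc, ← mul_pow, key, ← hN, neg_pow (zet τ * T4 τ ηc ^ 2), mul_pow, neg_pow (zet τ)]
  ring

theorem HL_replicate_append (hH : IsHFamily (zet τ) H) (h : PosNome τ) {K m : ℕ} {l : List ℂ} (hl : m + l.length ≤ 2 * K) :
    HL H K (List.replicate m 0 ++ l) = HL H K l := by
  rw [HL_perm hH (zet_sq_ne h) List.perm_append_comm (by simpa using hl), HL_pad]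

theorem HL_nil (K : ℕ) : HL H K [] = H K fun _ => 0 := rfl

theorem HL_zero_cons (hH : IsHFamily (zet τ) H) (h : PosNome τ) {K : ℕ} {l : List ℂ} (hl : l.length + 1 ≤ 2 * K) :
    HL H K (0 :: l) = HL H K l :=
  HL_replicate_append hH h (m := 1) (by omega)

theorem Sbarfun_even (h : PosNome τ) (hΨ : PsiOK τ Ψ) (hH : IsHFamily (zet τ) H) {t ν ε : ℂ} (h0 : t ≠ 0)
    (h1 : t - zet τ ≠ 0) (h2 : 1 - t * zet τ ≠ 0) (hν : 1 - t * zet τ = (zet τ - t) * ν) (hε : ε = 1 ∨ ε = -1) (k : ℕ) :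
    Sbarfun τ ε Ψ (2 * k) ν = ν ^ k / (2 * t) *
      ((1 + t) * (ε * (1 + ε * t)) * HL H (k + 1) [J4c (zet τ)] * HL H (k + 1) [J3c (zet τ), ybar (zet τ) t]
      - (1 - t) * (ε * (1 - ε * t)) * HL H (k + 1) [J3c (zet τ)] * HL H (k + 1) [J4c (zet τ), ybar (zet τ) t]) := by
  have key := Sbarfun_eq_Rn h hΨ hH h0 h1 h2 hν hε (2 * k)
  have hζ := zet_ne h
  have h3 : zet τ - t ≠ 0 := by rw [← neg_sub]; exact neg_ne_zero.2 h1
  rw [Rn_even (k := k) (by simp), Rev, HL_replicate_append hH h (by simp; omega), HL_replicate_append hH h (by simp; omega),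
    HL_replicate_append hH h (by simp; omega), HL_replicate_append hH h (by simp; omega), HL_zero_cons hH h (by simp),
    HL_zero_cons hH h (by simp), show (2 * k + 1) / 2 = k by omega] at key
  apply mul_left_cancel₀ (pow_ne_zero (2 * k) h3)
  rw [key, mco, hν]
  have e : (-1 : ℂ) ^ k * (-zet τ) ^ (2 * k) * (-((zet τ - t) * ν * (zet τ - t)) / zet τ ^ 2) ^ k = (zet τ - t) ^ (2 * k) * ν ^ k := by
    rw [pow_mul, neg_sq, pow_mul, ← mul_pow, ← mul_pow, ← mul_pow]
    congr 1
    field_simp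
  generalize (1 + t) * _ * _ * _ - _ = X
  linear_combination (X / (2 * t)) * e

theorem Sbarfun_odd (h : PosNome τ) (hΨ : PsiOK τ Ψ) (hH : IsHFamily (zet τ) H) {t ν ε : ℂ} (h0 : t ≠ 0)
    (h1 : t - zet τ ≠ 0) (h2 : 1 - t * zet τ ≠ 0) (hν : 1 - t * zet τ = (zet τ - t) * ν) (hε : ε = 1 ∨ ε = -1) (k : ℕ) :
    Sbarfun τ ε Ψ (2 * k + 1) ν = -(ν ^ (k + 1) * (zet τ - t) / zet τ) * (ε * (1 + ε * t) / (2 * t)) *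
      (H (k + 1) (fun _ => 0) * HL H (k + 2) [J3c (zet τ), J4c (zet τ), ybar (zet τ) t]
      - zet τ * (1 - ε * t) ^ 2 / ((zet τ - t) ^ 2 * ν) * HL H (k + 1) [ybar (zet τ) t] * HL H (k + 2) [J3c (zet τ), J4c (zet τ)]) := by
  have key := Sbarfun_eq_Rn h hΨ hH h0 h1 h2 hν hε (2 * k + 1)
  have hζ := zet_ne h
  have h3 : zet τ - t ≠ 0 := by rw [← neg_sub]; exact neg_ne_zero.2 h1
  rw [Rn_odd (k := k) (by simp), Rod, HL_replicate_append hH h (by simp; omega), HL_replicate_append hH h (by simp; omega),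
    HL_replicate_append hH h (by simp; omega), HL_replicate_append hH h (by simp; omega), HL_zero_cons hH h (by simp; omega),
    HL_zero_cons hH h (by simp; omega), HL_nil, show (2 * k + 1 + 1) / 2 = k + 1 by omega] at key
  apply mul_left_cancel₀ (pow_ne_zero (2 * k + 1) h3)
  rw [key, mco, hν]
  have e : (-1 : ℂ) ^ (k + 1) * (-zet τ) ^ (2 * k + 1) * (-((zet τ - t) * ν * (zet τ - t)) / zet τ ^ 2) ^ (k + 1)
      = (zet τ - t) ^ (2 * k + 1) * -(ν ^ (k + 1) * (zet τ - t) / zet τ) := by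
    have e1 : (-1 : ℂ) ^ (k + 1) * (-zet τ) ^ (2 * (k + 1)) * (-((zet τ - t) * ν * (zet τ - t)) / zet τ ^ 2) ^ (k + 1) = (zet τ - t) ^ (2 * (k + 1)) * ν ^ (k + 1) := by
      rw [pow_mul, neg_sq, pow_mul, ← mul_pow, ← mul_pow, ← mul_pow]
      congr 1
      field_simp
    apply mul_right_cancel₀ (neg_ne_zero.2 hζ)
    calc _ = (-1 : ℂ) ^ (k + 1) * (-zet τ) ^ (2 * (k + 1)) * (-((zet τ - t) * ν * (zet τ - t)) / zet τ ^ 2) ^ (k + 1) := by ring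
      _ = _ := by rw [e1]; field_simp; ring
  rw [show (zet τ - t) * ν * (zet τ - t) = (zet τ - t) ^ 2 * ν by ring] at e ⊢
  generalize H (k + 1) (fun _ => 0) * _ - _ = X
  linear_combination (ε * (1 + ε * t) * X / (2 * t)) * e
end

section
variable {τ : ℂ} {Ψ : PsiFam} {H : (k : ℕ) → (Fin (2 * k) → ℂ) → ℂ}

/-- The parameter of the boundary covector corresponding to `ν`. -/
def tpar (ζ ν : ℂ) : ℂ := (ν * ζ - 1) / (ν - ζ)

theorem tpar_facts {ζ ν : ℂ} (hB : 1 - ζ ^ 2 ≠ 0) (h0 : ν ≠ 0) (h1 : ν ≠ ζ) (h2 : ν * ζ ≠ 1) : tpar ζ ν ≠ 0 ∧ tpar ζ ν - ζ ≠ 0 ∧ 1 - tpar ζ ν * ζ ≠ 0 ∧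
    1 - tpar ζ ν * ζ = (ζ - tpar ζ ν) * ν ∧ ybar ζ (tpar ζ ν) = nubar ζ ν := by
  have h1 := sub_ne_zero.2 h1
  have h2 := sub_ne_zero.2 h2
  have hB' : ζ ^ 2 - 1 ≠ 0 := by rw [← neg_sub]; exact neg_ne_zero.2 hB
  have e1 : tpar ζ ν - ζ = (ζ ^ 2 - 1) / (ν - ζ) := by unfold tpar; field_simp; ring
  have e2 : 1 - tpar ζ ν * ζ = ν * (1 - ζ ^ 2) / (ν - ζ) := by unfold tpar; field_simp; ring
  have e3 : 1 - tpar ζ ν * ζ ≠ 0 := by rw [e2]; exact div_ne_zero (mul_ne_zero h0 hB) h1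
  have e4 : tpar ζ ν - ζ ≠ 0 := by rw [e1]; exact div_ne_zero hB' h1
  refine ⟨div_ne_zero h2 h1, e4, e3, ?_, ?_⟩
  · rw [e2, ← neg_sub (tpar ζ ν), e1]; field_simp; ring
  · rw [ybar, e1, e2]; unfold tpar nubar; field_simp

theorem Sbarfun_even_plus (h : PosNome τ) (hΨ : PsiOK τ Ψ) (hH : IsHFamily (zet τ) H) {ν : ℂ} (h0 : ν ≠ 0)
    (h1 : ν ≠ zet τ) (h2 : ν * zet τ ≠ 1) (k : ℕ) : Sbarfun τ 1 Ψ (2 * k) ν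
    = ν^k * (((zet τ + 1)*(ν - 1))^2 * HL H (k+1) [J4c (zet τ)] * HL H (k+1) [J3c (zet τ), nubar (zet τ) ν]
        - ((zet τ - 1)*(ν + 1))^2 * HL H (k+1) [J3c (zet τ)] * HL H (k+1) [J4c (zet τ), nubar (zet τ) ν])
      / (2*(ν - zet τ)*(ν * zet τ - 1)) := by
  obtain ⟨t0, t1, t2, t3, t4⟩ := tpar_facts (zet_sq_ne h) h0 h1 h2
  rw [Sbarfun_even h hΨ hH t0 t1 t2 t3 (Or.inl rfl) k, t4]
  have h1 := sub_ne_zero.2 h1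
  have h2 := sub_ne_zero.2 h2
  unfold tpar
  field_simp
  ring

theorem Sbarfun_even_minus (h : PosNome τ) (hΨ : PsiOK τ Ψ) (hH : IsHFamily (zet τ) H) {ν : ℂ} (h0 : ν ≠ 0)
    (h1 : ν ≠ zet τ) (h2 : ν * zet τ ≠ 1) (k : ℕ) : Sbarfun τ (-1) Ψ (2 * k) ν
    = (zet τ + 1)*(ν - 1)*(zet τ - 1)*(ν + 1) * ν^k
      * (HL H (k+1) [J4c (zet τ)] * HL H (k+1) [J3c (zet τ), nubar (zet τ) ν]
        - HL H (k+1) [J3c (zet τ)] * HL H (k+1) [J4c (zet τ), nubar (zet τ) ν])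
      / (2*(ν - zet τ)*(ν * zet τ - 1)) := by
  obtain ⟨t0, t1, t2, t3, t4⟩ := tpar_facts (zet_sq_ne h) h0 h1 h2
  rw [Sbarfun_even h hΨ hH t0 t1 t2 t3 (Or.inr rfl) k, t4]
  have h1 := sub_ne_zero.2 h1
  have h2 := sub_ne_zero.2 h2
  unfold tpar
  field_simp
  ring

theorem Sbarfun_odd_plus (h : PosNome τ) (hΨ : PsiOK τ Ψ) (hH : IsHFamily (zet τ) H) {ν : ℂ} (h0 : ν ≠ 0)
    (h1 : ν ≠ zet τ) (h2 : ν * zet τ ≠ 1) (k : ℕ) : Sbarfun τ 1 Ψ (2 * k + 1) ν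
    = (zet τ - 1)*(ν - 1) * ν^k
      * (ν*(zet τ + 1)^2 * H (k+1) (fun _ => 0) * HL H (k+2) [J3c (zet τ), J4c (zet τ), nubar (zet τ) ν]
        - zet τ*(ν + 1)^2 * HL H (k+1) [nubar (zet τ) ν] * HL H (k+2) [J3c (zet τ), J4c (zet τ)])
      / (2 * zet τ * (ν - zet τ)*(ν * zet τ - 1)) := by
  obtain ⟨t0, t1, t2, t3, t4⟩ := tpar_facts (zet_sq_ne h) h0 h1 h2
  rw [Sbarfun_odd h hΨ hH t0 t1 t2 t3 (Or.inl rfl) k, t4]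
  have h1 := sub_ne_zero.2 h1
  have h2 := sub_ne_zero.2 h2
  have hB := zet_sq_ne h
  have hζ := zet_ne h
  have e1 : zet τ - tpar (zet τ) ν = (1 - zet τ ^ 2) / (ν - zet τ) := by unfold tpar; field_simp; ring
  have e2 : 1 - 1 * tpar (zet τ) ν = (ν + 1) * (1 - zet τ) / (ν - zet τ) := by unfold tpar; field_simp; ring
  have e3 : 1 + 1 * tpar (zet τ) ν = (ν - 1) * (1 + zet τ) / (ν - zet τ) := by unfold tpar; field_simp; ring
  rw [e1, e2, e3]
  unfold tpar
  field_simp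
  ring

theorem Sbarfun_odd_minus (h : PosNome τ) (hΨ : PsiOK τ Ψ) (hH : IsHFamily (zet τ) H) {ν : ℂ} (h0 : ν ≠ 0)
    (h1 : ν ≠ zet τ) (h2 : ν * zet τ ≠ 1) (k : ℕ) : Sbarfun τ (-1) Ψ (2 * k + 1) ν
    = (zet τ + 1)*(ν + 1) * ν^k
      * (ν*(zet τ - 1)^2 * H (k+1) (fun _ => 0) * HL H (k+2) [J3c (zet τ), J4c (zet τ), nubar (zet τ) ν]
        - zet τ*(ν - 1)^2 * HL H (k+1) [nubar (zet τ) ν] * HL H (k+2) [J3c (zet τ), J4c (zet τ)])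
      / (2 * zet τ * (ν - zet τ)*(ν * zet τ - 1)) := by
  obtain ⟨t0, t1, t2, t3, t4⟩ := tpar_facts (zet_sq_ne h) h0 h1 h2
  rw [Sbarfun_odd h hΨ hH t0 t1 t2 t3 (Or.inr rfl) k, t4]
  have h1 := sub_ne_zero.2 h1
  have h2 := sub_ne_zero.2 h2
  have hB := zet_sq_ne h
  have hζ := zet_ne h
  have e1 : zet τ - tpar (zet τ) ν = (1 - zet τ ^ 2) / (ν - zet τ) := by unfold tpar; field_simp; ring
  have e2 : 1 + -1 * tpar (zet τ) ν = (ν + 1) * (1 - zet τ) / (ν - zet τ) := by unfold tpar; field_simp; ring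
  have e3 : 1 - -1 * tpar (zet τ) ν = (ν - 1) * (1 + zet τ) / (ν - zet τ) := by unfold tpar; field_simp; ring
  rw [e1, e2, e3]
  unfold tpar
  field_simp
  ring
end

section ParameterDependence

/-- `f` agrees with a polynomial away from the points `ζ = ±1`. -/
def PolyZ (f : ℂ → ℂ) : Prop := ∃ p : Polynomial ℂ, ∀ ζ : ℂ, 1 - ζ ^ 2 ≠ 0 → f ζ = p.eval ζ

theorem PolyZ.const (c : ℂ) : PolyZ fun _ => c := ⟨Polynomial.C c, fun _ _ => by simp⟩
theorem PolyZ.mul {f g : ℂ → ℂ} (hf : PolyZ f) (hg : PolyZ g) : PolyZ fun ζ => f ζ * g ζ := by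
  obtain ⟨p, hp⟩ := hf; obtain ⟨q, hq⟩ := hg
  exact ⟨p * q, fun ζ h => by simp [hp ζ h, hq ζ h]⟩
theorem PolyZ.congr {f g : ℂ → ℂ} (hf : PolyZ f) (h : ∀ ζ : ℂ, 1 - ζ ^ 2 ≠ 0 → g ζ = f ζ) : PolyZ g := by
  obtain ⟨p, hp⟩ := hf
  exact ⟨p, fun ζ hζ => (h ζ hζ).trans (hp ζ hζ)⟩

theorem PolyZ.det {K : ℕ} {M : Fin K → Fin K → ℂ → ℂ} (hM : ∀ i j, PolyZ (M i j)) :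
    PolyZ fun ζ => Matrix.det (Matrix.of fun i j => M i j ζ) := by
  choose p hp using hM
  refine ⟨Matrix.det (Matrix.of p), fun ζ hζ => ?_⟩
  rw [← Polynomial.coe_evalRingHom, RingHom.map_det]
  refine congrArg Matrix.det (Matrix.ext fun i j => ?_)
  simp [hp i j ζ hζ]

theorem PolyZ.prod {ι : Type} (s : Finset ι) {f : ι → ℂ → ℂ} (hf : ∀ i, PolyZ (f i)) :
    PolyZ fun ζ => ∏ i ∈ s, f i ζ := by
  choose p hp using hf
  exact ⟨∏ i ∈ s, p i, fun ζ hζ => by simp [Polynomial.eval_prod, fun i => hp i ζ hζ]⟩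

theorem vdm_mul_left {K : ℕ} (c : ℂ) (a : Fin K → ℂ) :
    vdm (fun i => c * a i) = (∏ i : Fin K, ∏ j : Fin K, if i < j then c else 1) * vdm a := by
  simp only [vdm, ← Finset.prod_mul_distrib]
  refine Finset.prod_congr rfl fun i _ => Finset.prod_congr rfl fun j _ => ?_
  split_ifs <;> ring

theorem vdm_scale {K : ℕ} {c : ℂ} (hc : c ≠ 0) (a b : Fin K → ℂ) :
    vdm (fun i => c * a i) * vdm (fun i => b i / c) = vdm a * vdm b := by
  have e : (∏ i : Fin K, ∏ j : Fin K, if i < j then c else 1) * (∏ i : Fin K, ∏ j : Fin K, if i < j then c⁻¹ else 1) = 1 := by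
    simp only [← Finset.prod_mul_distrib]
    refine Finset.prod_eq_one fun i _ => Finset.prod_eq_one fun j _ => ?_
    split_ifs <;> simp [hc]
  simp only [div_eq_inv_mul, vdm_mul_left]
  linear_combination vdm a * vdm b * e

theorem vdm_ne_zero {K : ℕ} {a : Fin K → ℂ} (ha : Function.Injective a) : vdm a ≠ 0 := by
  refine Finset.prod_ne_zero_iff.2 fun i _ => Finset.prod_ne_zero_iff.2 fun j _ => ?_
  split_ifs with h
  · exact sub_ne_zero.2 (ha.ne h.ne')
  · exact one_ne_zero

theorem getD_injective {K : ℕ} {l : List ℂ} (hl : l.Nodup) (h : l.length = K) :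
    Function.Injective fun i : Fin K => l.getD i 0 := by
  subst h
  intro i j hij
  simp only [List.getD_eq_getElem?_getD, List.getElem?_eq_getElem i.2, List.getElem?_eq_getElem j.2, Option.getD_some] at hij
  exact Fin.ext ((List.Nodup.getElem_inj_iff hl).1 hij)

theorem exists_nodes (l : List ℂ) (K : ℕ) : ∃ u : Fin K → ℂ, Function.Injective u ∧ ∀ i, u i ∉ l := by
  have : Infinite {x : ℂ // x ∉ l} := by
    have h : Set.Infinite {x : ℂ | x ∈ l}ᶜ := (List.finite_toSet l).infinite_compl
    exact h.to_subtype
  let e := Infinite.natEmbedding {x : ℂ // x ∉ l}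
  exact ⟨fun i => (e i).1, fun i j h => Fin.ext (e.injective (Subtype.ext h)), fun i => (e i).2⟩

theorem PolyZ.interpolate {K : ℕ} {f : ℂ → ℂ → ℂ} (hf : ∀ ζ : ℂ, 1 - ζ ^ 2 ≠ 0 → DegLE K (f ζ))
    {u : Fin (K + 1) → ℂ} (hu : Function.Injective u) (h : ∀ i, PolyZ fun ζ => f ζ (u i)) :
    ∃ P : Polynomial (Polynomial ℂ), P.natDegree ≤ K ∧
      ∀ ζ : ℂ, 1 - ζ ^ 2 ≠ 0 → ∀ x, f ζ x = (P.map (Polynomial.evalRingHom ζ)).eval x := by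
  choose p hp using h
  refine ⟨∑ i, Polynomial.C (p i) * (Lagrange.basis Finset.univ u i).map Polynomial.C, ?_, fun ζ hζ x => ?_⟩
  · refine Polynomial.natDegree_sum_le_of_forall_le _ _ fun i _ => ?_
    refine (Polynomial.natDegree_C_mul_le _ _).trans (Polynomial.natDegree_map_le.trans ?_)
    have := Lagrange.degree_basis (hu.injOn (s := ((Finset.univ : Finset (Fin (K + 1))) : Set _))) (Finset.mem_univ i)
    rw [Polynomial.natDegree_le_iff_degree_le, this]
    simp
  · obtain ⟨q, hq, hfq⟩ := hf ζ hζ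
    have := Lagrange.eq_interpolate (f := q) (hu.injOn (s := ((Finset.univ : Finset (Fin (K + 1))) : Set _))) (by
      simp only [Finset.card_univ, Fintype.card_fin]
      exact (Polynomial.degree_le_of_natDegree_le hq).trans_lt (by exact_mod_cast Nat.lt_succ_self K))
    rw [hfq x, this, Lagrange.interpolate_apply]
    simp only [Polynomial.map_sum, Polynomial.eval_finsetSum, Polynomial.map_mul, Polynomial.map_C, Polynomial.eval_mul,
      Polynomial.eval_C, Polynomial.map_map, Polynomial.coe_evalRingHom, ← hp _ ζ hζ, hfq]
    refine Finset.sum_congr rfl fun i _ => ?_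
    congr 2
    conv_lhs => rw [← Polynomial.map_id (p := Lagrange.basis Finset.univ u i)]
    congr 1
    ext <;> simp

theorem PolyZ.comp_interpolate {K : ℕ} {f : ℂ → ℂ → ℂ} (hf : ∀ ζ : ℂ, 1 - ζ ^ 2 ≠ 0 → DegLE K (f ζ))
    {u : Fin (K + 1) → ℂ} (hu : Function.Injective u) (h : ∀ i, PolyZ fun ζ => f ζ (u i)) (q : Polynomial ℂ) :
    PolyZ fun ζ => f ζ (q.eval ζ) := by
  obtain ⟨P, -, hP⟩ := PolyZ.interpolate hf hu h
  refine ⟨P.eval q, fun ζ hζ => ?_⟩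
  beta_reduce
  rw [hP ζ hζ, Polynomial.eval_map, ← Polynomial.coe_evalRingHom, Polynomial.eval₂_at_apply]

variable {H : ℂ → (k : ℕ) → (Fin (2 * k) → ℂ) → ℂ}

theorem DegLE.comp_mul {d : ℕ} {f : ℂ → ℂ} (hf : DegLE d f) (c : ℂ) : DegLE d fun x => f (c * x) := by
  obtain ⟨p, hp, h⟩ := hf
  refine ⟨p.comp (Polynomial.C c * Polynomial.X), ?_, fun x => by simp [h]⟩
  refine Polynomial.natDegree_comp_le.trans ?_
  calc p.natDegree * (Polynomial.C c * Polynomial.X : Polynomial ℂ).natDegree ≤ d * 1 :=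
        Nat.mul_le_mul hp ((Polynomial.natDegree_C_mul_le _ _).trans Polynomial.natDegree_X_le)
    _ = d := mul_one d

theorem HL_polyZ_nodes (hH : ∀ ζ, IsHFamily ζ (H ζ)) {K : ℕ} {fs ts : List ℂ} (hf : fs.Nodup) (ht : ts.Nodup)
    (hfl : fs.length = K) (htl : ts.length = K) :
    PolyZ fun ζ => HL (H ζ) K (fs.map (fun x => (1 - ζ ^ 2) * x) ++ ts.map (fun x => x / (1 - ζ ^ 2))) := by
  set a : Fin K → ℂ := fun i => fs.getD i 0 with ha
  set b : Fin K → ℂ := fun i => ts.getD i 0 with hb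
  have hv : vdm a * vdm b ≠ 0 := mul_ne_zero (vdm_ne_zero (getD_injective hf hfl)) (vdm_ne_zero (getD_injective ht htl))
  have hM : PolyZ fun ζ => Matrix.det (Matrix.of fun i j : Fin K => ∏ l ∈ Finset.univ.erase j,
      (1 - (3 + ζ ^ 2) * a i * b l + (1 - ζ ^ 2) ^ 2 * a i ^ 2 * b l + a i * b l ^ 2)) := by
    refine PolyZ.det fun i j => PolyZ.prod _ fun l => ?_
    refine ⟨1 - (3 + Polynomial.X ^ 2) * Polynomial.C (a i) * Polynomial.C (b l)
      + (1 - Polynomial.X ^ 2) ^ 2 * Polynomial.C (a i) ^ 2 * Polynomial.C (b l)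
      + Polynomial.C (a i) * Polynomial.C (b l) ^ 2, fun ζ _ => ?_⟩
    simp
  refine ((PolyZ.const (vdm a * vdm b)⁻¹).mul hM).congr fun ζ hζ => ?_
  rw [HL_append (by simpa using hfl)]
  have ea : (fun i : Fin K => (fs.map (fun x => (1 - ζ ^ 2) * x)).getD i 0) = fun i => (1 - ζ ^ 2) * a i := by
    funext i
    simp only [ha, List.getD_eq_getElem?_getD, List.getElem?_map, List.getElem?_eq_getElem (show (i : ℕ) < fs.length by omega)]
    simp
  have eb : (fun i : Fin K => (ts.map (fun x => x / (1 - ζ ^ 2))).getD i 0) = fun i => b i / (1 - ζ ^ 2) := by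
    funext i
    simp only [hb, List.getD_eq_getElem?_getD, List.getElem?_map, List.getElem?_eq_getElem (show (i : ℕ) < ts.length by omega)]
    simp
  rw [ea, eb, eq_inv_mul_iff_mul_eq₀ hv, mul_comm, ← vdm_scale hζ a b, Hab_mul_vdm (hH ζ), Mdet]
  congr 2
  funext i j
  refine Finset.prod_congr rfl fun l _ => ?_
  unfold hpol
  field_simp
  ring

theorem HL_polyZ_right (hH : ∀ ζ, IsHFamily ζ (H ζ)) {K : ℕ} {fs : List ℂ} (hf : fs.Nodup) (hfl : fs.length = K)
    (qs : List (Polynomial ℂ)) : ∀ {ts : List ℂ}, ts.Nodup → qs.length + ts.length = K →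
    PolyZ fun ζ => HL (H ζ) K (qs.map (fun q => q.eval ζ / (1 - ζ ^ 2)) ++
      (fs.map (fun x => (1 - ζ ^ 2) * x) ++ ts.map (fun x => x / (1 - ζ ^ 2)))) := by
  induction qs with
  | nil => intro ts ht hl; simpa using HL_polyZ_nodes hH hf ht hfl (by simpa using hl)
  | cons q qs ih =>
    intro ts ht hl
    obtain ⟨M, rfl⟩ : ∃ M, K = M + 1 := ⟨K - 1, by simp at hl; omega⟩
    obtain ⟨u, hu, hut⟩ := exists_nodes ts (M + 1)
    refine PolyZ.comp_interpolate (f := fun ζ x => HL (H ζ) (M + 1) (x / (1 - ζ ^ 2) :: (qs.map (fun q => q.eval ζ / (1 - ζ ^ 2)) ++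
      (fs.map (fun x => (1 - ζ ^ 2) * x) ++ ts.map (fun x => x / (1 - ζ ^ 2)))))) (fun ζ _ => ?_) hu (fun i => ?_) q
    · simp only [div_eq_inv_mul]
      exact (HL_deg (hH ζ) _).comp_mul _
    · refine (ih (ts := u i :: ts) (List.nodup_cons.2 ⟨hut i, ht⟩) (by simp at hl ⊢; omega)).congr fun ζ hζ => ?_
      refine HL_perm (hH ζ) hζ ?_ (by simp at hl ⊢; omega)
      rw [List.map_cons, ← List.append_assoc, ← List.append_assoc]
      exact List.perm_middle.symm

theorem HL_polyZ_left (hH : ∀ ζ, IsHFamily ζ (H ζ)) {K : ℕ} {qs : List (Polynomial ℂ)} (hq : qs.length = K) (m : ℕ) :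
    ∀ {fs : List ℂ}, fs.Nodup → m + fs.length = K →
    PolyZ fun ζ => HL (H ζ) K (List.replicate m 0 ++ (qs.map (fun q => q.eval ζ / (1 - ζ ^ 2)) ++
      fs.map (fun x => (1 - ζ ^ 2) * x))) := by
  induction m with
  | zero => intro fs hf hl; simpa using HL_polyZ_right hH hf (by simpa using hl) qs (ts := []) List.nodup_nil (by simpa using hq)
  | succ m ih =>
    intro fs hf hl
    obtain ⟨M, rfl⟩ : ∃ M, K = M + 1 := ⟨K - 1, by omega⟩
    obtain ⟨u, hu, hut⟩ := exists_nodes fs (M + 1)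
    have := PolyZ.comp_interpolate (f := fun ζ x => HL (H ζ) (M + 1) ((1 - ζ ^ 2) * x :: (List.replicate m 0 ++
      (qs.map (fun q => q.eval ζ / (1 - ζ ^ 2)) ++ fs.map (fun x => (1 - ζ ^ 2) * x)))))
      (fun ζ _ => (HL_deg (hH ζ) _).comp_mul _) hu (fun i => ?_) 0
    · simpa [List.replicate_succ] using this
    · refine (ih (fs := u i :: fs) (List.nodup_cons.2 ⟨hut i, hf⟩) (by simp; omega)).congr fun ζ hζ => ?_
      refine HL_perm (hH ζ) hζ ?_ (by simp; omega)
      rw [List.map_cons, ← List.append_assoc, ← List.append_assoc]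
      exact List.perm_middle.symm

theorem HL_polyZ (hH : ∀ ζ, IsHFamily ζ (H ζ)) {K : ℕ} (qs : List (Polynomial ℂ)) (hq : qs.length ≤ K) :
    PolyZ fun ζ => HL (H ζ) K (qs.map fun q => q.eval ζ / (1 - ζ ^ 2)) := by
  have := HL_polyZ_left hH (K := K) (qs := qs ++ List.replicate (K - qs.length) 0) (by simp; omega) K (fs := []) List.nodup_nil (by simp)
  refine this.congr fun ζ hζ => ?_
  rw [HL_perm (hH ζ) hζ List.perm_append_comm (by simp; omega), HL_pad]
  simp [HL_pad]

theorem HL_polyZ_cons (hH : ∀ ζ, IsHFamily ζ (H ζ)) {K : ℕ} (qs : List (Polynomial ℂ)) (hq : qs.length ≤ K) :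
    ∃ P : Polynomial (Polynomial ℂ), P.natDegree ≤ K ∧ ∀ ζ : ℂ, 1 - ζ ^ 2 ≠ 0 → ∀ v,
      HL (H ζ) (K + 1) (v / (1 - ζ ^ 2) :: qs.map fun q => q.eval ζ / (1 - ζ ^ 2)) = (P.map (Polynomial.evalRingHom ζ)).eval v := by
  obtain ⟨u, hu, -⟩ := exists_nodes [] (K + 1)
  refine PolyZ.interpolate (f := fun ζ v => HL (H ζ) (K + 1) (v / (1 - ζ ^ 2) :: qs.map fun q => q.eval ζ / (1 - ζ ^ 2)))
    (fun ζ _ => ?_) hu fun i => ?_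
  · simp only [div_eq_inv_mul]
    exact (HL_deg (hH ζ) _).comp_mul _
  · simpa using HL_polyZ hH (K := K + 1) (Polynomial.C (u i) :: qs) (by simp; omega)

end ParameterDependence

section Bivariate

/-- `f` is a polynomial function of two variables. -/
def PolyTwo (f : ℂ → ℂ → ℂ) : Prop := ∃ P : Polynomial (Polynomial ℂ), ∀ ν ζ, f ν ζ = P.evalEval ν ζ

variable {f g : ℂ → ℂ → ℂ}

theorem PolyTwo.const (c : ℂ) : PolyTwo fun _ _ => c := ⟨Polynomial.C (Polynomial.C c), fun ν ζ => by simp [Polynomial.evalEval]⟩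
theorem PolyTwo.fst : PolyTwo fun ν _ => ν := ⟨Polynomial.C Polynomial.X, fun ν ζ => by simp [Polynomial.evalEval]⟩
theorem PolyTwo.snd : PolyTwo fun _ ζ => ζ := ⟨Polynomial.X, fun ν ζ => by simp [Polynomial.evalEval]⟩
theorem PolyTwo.add (hf : PolyTwo f) (hg : PolyTwo g) : PolyTwo fun ν ζ => f ν ζ + g ν ζ := by
  obtain ⟨P, hP⟩ := hf; obtain ⟨Q, hQ⟩ := hg
  exact ⟨P + Q, fun ν ζ => by simp only [hP, hQ, Polynomial.evalEval_add]⟩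
theorem PolyTwo.mul (hf : PolyTwo f) (hg : PolyTwo g) : PolyTwo fun ν ζ => f ν ζ * g ν ζ := by
  obtain ⟨P, hP⟩ := hf; obtain ⟨Q, hQ⟩ := hg
  exact ⟨P * Q, fun ν ζ => by simp only [hP, hQ, Polynomial.evalEval_mul]⟩
theorem PolyTwo.sub (hf : PolyTwo f) (hg : PolyTwo g) : PolyTwo fun ν ζ => f ν ζ - g ν ζ := by
  obtain ⟨P, hP⟩ := hf; obtain ⟨Q, hQ⟩ := hg
  exact ⟨P - Q, fun ν ζ => by simp only [hP, hQ, Polynomial.evalEval_sub]⟩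
theorem PolyTwo.pow (hf : PolyTwo f) (n : ℕ) : PolyTwo fun ν ζ => f ν ζ ^ n := by
  obtain ⟨P, hP⟩ := hf
  exact ⟨P ^ n, fun ν ζ => by simp only [hP, Polynomial.evalEval_pow]⟩
theorem PolyTwo.sum {ι : Type} (s : Finset ι) {f : ι → ℂ → ℂ → ℂ} (hf : ∀ i, PolyTwo (f i)) :
    PolyTwo fun ν ζ => ∑ i ∈ s, f i ν ζ := by
  choose P hP using hf
  exact ⟨∑ i ∈ s, P i, fun ν ζ => by simp [Polynomial.evalEval_finsetSum, hP]⟩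
theorem PolyTwo.eval_snd (p : Polynomial ℂ) : PolyTwo fun _ ζ => p.eval ζ := by
  refine ⟨p.map Polynomial.C, fun ν ζ => ?_⟩
  rw [Polynomial.evalEval, Polynomial.eval_map, Polynomial.eval₂_at_apply, Polynomial.eval_C]

theorem PolyTwo.div_snd (hf : PolyTwo f) (h : ∀ ν, f ν 0 = 0) : ∃ g, PolyTwo g ∧ ∀ ν ζ, f ν ζ = ζ * g ν ζ := by
  obtain ⟨P, hP⟩ := hf
  refine ⟨fun ν ζ => P.divX.evalEval ν ζ, ⟨P.divX, fun _ _ => rfl⟩, fun ν ζ => ?_⟩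
  have h0 : P.coeff 0 = 0 := by
    refine Polynomial.funext fun ν => ?_
    have := h ν
    rw [hP, Polynomial.evalEval, Polynomial.C_0, ← Polynomial.coeff_zero_eq_eval_zero] at this
    simpa using this
  have e := Polynomial.divX_mul_X_add P
  rw [h0, Polynomial.C_0, add_zero] at e
  rw [hP]
  conv_lhs => rw [← e]
  simp [Polynomial.evalEval, mul_comm]

theorem PolyTwo.exists_mvPolynomial (hf : PolyTwo f) :
    ∃ P : MvPolynomial (Fin 2) ℂ, ∀ ν ζ, f ν ζ = MvPolynomial.eval ![ν, ζ] P := by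
  obtain ⟨P, hP⟩ := hf
  refine ⟨P.eval₂ (Polynomial.eval₂RingHom MvPolynomial.C (MvPolynomial.X 0)) (MvPolynomial.X 1), fun ν ζ => ?_⟩
  rw [hP, Polynomial.hom_eval₂, Polynomial.evalEval, ← Polynomial.coe_evalRingHom, ← Polynomial.eval₂_at_apply]
  simp only [Polynomial.coe_evalRingHom, Polynomial.eval_C, MvPolynomial.eval_X, Matrix.cons_val_one, Matrix.cons_val_zero]
  congr 1
  ext <;> simp

/-- The homogenised value `ν^d P(ζ, -(ν-ζ)(νζ-1)/ν)`. -/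
def homVal (d : ℕ) (P : Polynomial (Polynomial ℂ)) (ν ζ : ℂ) : ℂ :=
  ∑ i ∈ Finset.range (d + 1), (P.coeff i).eval ζ * (0 - (ν - ζ) * (ν * ζ - 1)) ^ i * ν ^ (d - i)

theorem PolyTwo.homVal (d : ℕ) (P : Polynomial (Polynomial ℂ)) : PolyTwo (homVal d P) :=
  .sum _ fun i => ((PolyTwo.eval_snd _).mul (((PolyTwo.const 0).sub ((PolyTwo.fst.sub .snd).mul
    ((PolyTwo.fst.mul .snd).sub (.const 1)))).pow i)).mul (PolyTwo.fst.pow _)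

theorem homVal_eq {d : ℕ} {P : Polynomial (Polynomial ℂ)} (hP : P.natDegree ≤ d) {ν ζ v : ℂ} (hv : ν * v = -((ν - ζ) * (ν * ζ - 1))) :
    homVal d P ν ζ = ν ^ d * (P.map (Polynomial.evalRingHom ζ)).eval v := by
  rw [Polynomial.eval_eq_sum_range' (n := d + 1) (lt_of_le_of_lt Polynomial.natDegree_map_le (by omega)), Finset.mul_sum]
  refine Finset.sum_congr rfl fun i hi => ?_
  have hi : i ≤ d := by simpa [Nat.lt_succ_iff] using hi
  rw [zero_sub, ← hv, mul_pow, Polynomial.coeff_map, Polynomial.coe_evalRingHom, ← Nat.add_sub_cancel' hi, pow_add, Nat.add_sub_cancel_left]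
  ring

theorem eval_eq_divX (P : Polynomial (Polynomial ℂ)) (ζ v : ℂ) :
    (P.map (Polynomial.evalRingHom ζ)).eval v = (P.coeff 0).eval ζ + v * (P.divX.map (Polynomial.evalRingHom ζ)).eval v := by
  conv_lhs => rw [← Polynomial.divX_mul_X_add P]
  simp only [Polynomial.map_add, Polynomial.map_mul, Polynomial.map_X, Polynomial.map_C, Polynomial.eval_add, Polynomial.eval_mul,
    Polynomial.eval_X, Polynomial.eval_C, Polynomial.coe_evalRingHom]
  ring

theorem homVal_divX {m : ℕ} {P : Polynomial (Polynomial ℂ)} (hP : P.natDegree ≤ m + 1) {ν ζ v : ℂ} (hv : ν * v = -((ν - ζ) * (ν * ζ - 1))) :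
    ν ^ (m + 1) * (P.map (Polynomial.evalRingHom ζ)).eval v
      = ν ^ (m + 1) * (P.coeff 0).eval ζ - (ν - ζ) * (ν * ζ - 1) * homVal m P.divX ν ζ := by
  rw [homVal_eq (by rw [Polynomial.natDegree_divX_eq_natDegree_tsub_one]; omega) hv, eval_eq_divX]
  linear_combination ν ^ m * (P.divX.map (Polynomial.evalRingHom ζ)).eval v * hv

end Bivariate

section

variable {τ ε : ℂ} {Ψ : PsiFam}

theorem Sbarfun_continuous (n : ℕ) : Continuous (Sbarfun τ ε Ψ n) := by
  unfold Sbarfun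
  refine continuous_finsetSum _ fun α _ => Continuous.mul (Continuous.mul ?_ continuous_const) continuous_const
  refine continuous_finsetProd _ fun m _ => ?_
  split_ifs <;> fun_prop

theorem PolyTwo.continuous {f : ℂ → ℂ → ℂ} (hf : PolyTwo f) (ζ : ℂ) : Continuous fun ν => f ν ζ := by
  obtain ⟨P, hP⟩ := hf
  simp only [hP, Polynomial.evalEval]
  fun_prop

theorem Sbarfun_eq_of_generic {f : ℂ → ℂ → ℂ} (hf : PolyTwo f) {n : ℕ}
    (h : ∀ ν, ν ≠ 0 → ν ≠ zet τ → ν * zet τ ≠ 1 → Sbarfun τ ε Ψ n ν = f ν (zet τ)) (ν : ℂ) :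
    Sbarfun τ ε Ψ n ν = f ν (zet τ) := by
  have hd : Dense ({0, zet τ, (zet τ)⁻¹} : Set ℂ)ᶜ := Set.Countable.dense_compl ℂ (Set.toFinite _).countable
  refine congrFun (Continuous.ext_on hd (Sbarfun_continuous n) (hf.continuous (zet τ)) fun x hx => ?_) ν
  simp only [Set.mem_compl_iff, Set.mem_insert_iff, Set.mem_singleton_iff, not_or] at hx
  exact h x hx.1 hx.2.1 fun e => hx.2.2 (eq_inv_of_mul_eq_one_left e)

end

section Polynomiality

variable {H : ℂ → (k : ℕ) → (Fin (2 * k) → ℂ) → ℂ} {τ : ℂ}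

theorem J3c_eq {ζ : ℂ} (hζ : 1 - ζ ^ 2 ≠ 0) : J3c ζ = (1 - Polynomial.X : Polynomial ℂ).eval ζ / (1 - ζ ^ 2) := by
  have h : 1 - ζ ^ 2 = (1 + ζ) * (1 - ζ) := by ring
  rw [h] at hζ ⊢
  have h1 := left_ne_zero_of_mul hζ
  have h2 := right_ne_zero_of_mul hζ
  simp only [J3c, Polynomial.eval_sub, Polynomial.eval_one, Polynomial.eval_X]
  field_simp

theorem J4c_eq {ζ : ℂ} (hζ : 1 - ζ ^ 2 ≠ 0) : J4c ζ = (1 + Polynomial.X : Polynomial ℂ).eval ζ / (1 - ζ ^ 2) := by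
  have h : 1 - ζ ^ 2 = (1 + ζ) * (1 - ζ) := by ring
  rw [h] at hζ ⊢
  have h1 := left_ne_zero_of_mul hζ
  have h2 := right_ne_zero_of_mul hζ
  simp only [J4c, Polynomial.eval_add, Polynomial.eval_one, Polynomial.eval_X]
  field_simp

theorem nubar_eq {ζ ν : ℂ} (hζ : 1 - ζ ^ 2 ≠ 0) (hν : ν ≠ 0) :
    nubar ζ ν = (-((ν - ζ) * (ν * ζ - 1)) / ν) / (1 - ζ ^ 2) := by
  have : ζ ^ 2 - 1 ≠ 0 := by rw [← neg_sub]; exact neg_ne_zero.2 hζ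
  unfold nubar
  rw [div_div, div_eq_div_iff (by positivity) (by positivity)]
  ring

/-- Dependence of `H_{2k}(…, ν̄)` on `ν` and `ζ`, with the last argument moved to the front of the expansion. -/
theorem HL_nubar (hH : ∀ ζ, IsHFamily ζ (H ζ)) {m : ℕ} (qs : List (Polynomial ℂ)) (hq : qs.length ≤ m + 1) :
    ∃ P : Polynomial (Polynomial ℂ), P.natDegree ≤ m + 1 ∧
      (∀ ζ : ℂ, 1 - ζ ^ 2 ≠ 0 → ∀ v, HL (H ζ) (m + 2) (v / (1 - ζ ^ 2) :: qs.map fun q => q.eval ζ / (1 - ζ ^ 2))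
        = (P.map (Polynomial.evalRingHom ζ)).eval v) ∧
      (∀ ζ : ℂ, 1 - ζ ^ 2 ≠ 0 → HL (H ζ) (m + 2) (qs.map fun q => q.eval ζ / (1 - ζ ^ 2)) = (P.coeff 0).eval ζ) ∧
      ∀ ζ ν : ℂ, 1 - ζ ^ 2 ≠ 0 → ν ≠ 0 →
        ν ^ (m + 1) * HL (H ζ) (m + 2) ((qs.map fun q => q.eval ζ / (1 - ζ ^ 2)) ++ [nubar ζ ν])
          = ν ^ (m + 1) * (P.coeff 0).eval ζ - (ν - ζ) * (ν * ζ - 1) * homVal m P.divX ν ζ := by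
  obtain ⟨P, hP, h⟩ := HL_polyZ_cons hH (K := m + 1) qs hq
  refine ⟨P, hP, h, fun ζ hζ => ?_, fun ζ ν hζ hν => ?_⟩
  · have := h ζ hζ 0
    rw [eval_eq_divX, zero_mul, add_zero, zero_div, HL_perm (hH ζ) hζ (List.perm_append_singleton 0 _).symm (by simp; omega)] at this
    rw [← this]
    exact (HL_pad _ 1).symm
  · rw [HL_perm (hH ζ) hζ (List.perm_append_singleton _ _) (by simp; omega), nubar_eq hζ hν, h ζ hζ]
    exact homVal_divX hP (by field_simp)

theorem HL_one_one_one {K : ℕ} {H : (k : ℕ) → (Fin (2 * k) → ℂ) → ℂ} (hH : IsHFamily 0 H) : HL H (K + 2) [1, 1, 1] = 0 := by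
  have hl : ([1] ++ List.replicate (2 * K + 1) 0 : List ℂ).length = 2 * (K + 1) := by simp; omega
  have := HL_wheel hH (by simp) (w₁ := 1) (w₂ := 1) (w₃ := 1) (by unfold hpol; norm_num) (by simp) _ hl
  rw [show (1 :: 1 :: ([1] ++ List.replicate (2 * K + 1) 0) : List ℂ) = [1, 1, 1] ++ List.replicate (2 * K + 1) 0 from rfl, HL_pad] at this
  simpa using this

theorem Sbarfun_even_poly (Ψ : ℂ → PsiFam) (hH : ∀ ζ, IsHFamily ζ (H ζ)) {k : ℕ} (hk : 1 ≤ k) {ε : ℂ} (hε : ε = 1 ∨ ε = -1) :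
    ∃ P : MvPolynomial (Fin 2) ℂ, ∀ τ, PosNome τ → PsiOK τ (Ψ τ) → ∀ ν, Sbarfun τ ε (Ψ τ) (2 * k) ν = MvPolynomial.eval ![ν, zet τ] P := by
  obtain ⟨m, rfl⟩ : ∃ m, k = m + 1 := ⟨k - 1, by omega⟩
  obtain ⟨P, -, -, hP0, hP⟩ := HL_nubar hH (m := m) [1 - Polynomial.X] (by simp)
  obtain ⟨Q, -, -, hQ0, hQ⟩ := HL_nubar hH (m := m) [1 + Polynomial.X] (by simp)
  simp only [List.map_cons, List.map_nil, List.cons_append, List.nil_append] at hP hQ hP0 hQ0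
  have hp : ∀ a b : ℂ, PolyTwo fun ν ζ => (ζ + a) * (ν + b) := fun a b =>
    (PolyTwo.snd.add (.const a)).mul (PolyTwo.fst.add (.const b))
  have pP0 := PolyTwo.eval_snd (P.coeff 0)
  have pQ0 := PolyTwo.eval_snd (Q.coeff 0)
  have pP := PolyTwo.homVal m P.divX
  have pQ := PolyTwo.homVal m Q.divX
  rcases hε with rfl | rfl
  · have key : PolyTwo fun ν ζ => 2 * ν ^ (m + 1) * (P.coeff 0).eval ζ * (Q.coeff 0).eval ζ
        - 1 / 2 * (((ζ + 1) * (ν + -1)) ^ 2 * (Q.coeff 0).eval ζ * homVal m P.divX ν ζ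
          - ((ζ + -1) * (ν + 1)) ^ 2 * (P.coeff 0).eval ζ * homVal m Q.divX ν ζ) :=
      ((((PolyTwo.const 2).mul (PolyTwo.fst.pow _)).mul pP0).mul pQ0).sub ((PolyTwo.const (1 / 2)).mul
        (((((hp 1 (-1)).pow 2).mul pQ0).mul pP).sub ((((hp (-1) 1).pow 2).mul pP0).mul pQ)))
    obtain ⟨R, hR⟩ := key.exists_mvPolynomial
    refine ⟨R, fun τ h hΨ ν => ?_⟩
    rw [← hR]
    refine Sbarfun_eq_of_generic key (fun ν h0 h1 h2 => ?_) ν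
    have hB := zet_sq_ne h
    have eP := hP _ ν hB h0
    have eQ := hQ _ ν hB h0
    have eP0 := hP0 _ hB
    have eQ0 := hQ0 _ hB
    rw [← J3c_eq hB] at eP eP0
    rw [← J4c_eq hB] at eQ eQ0
    rw [Sbarfun_even_plus h hΨ (hH _) h0 h1 h2 (m + 1), eP0, eQ0]
    have h1 := sub_ne_zero.2 h1
    have h2 := sub_ne_zero.2 h2
    rw [div_eq_iff (mul_ne_zero (mul_ne_zero two_ne_zero h1) h2)]
    linear_combination ((zet τ + 1) * (ν - 1)) ^ 2 * (Q.coeff 0).eval (zet τ) * eP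
      - ((zet τ - 1) * (ν + 1)) ^ 2 * (P.coeff 0).eval (zet τ) * eQ
  · have key : PolyTwo fun ν ζ => (-1 / 2) * ((ζ + 1) * (ν + -1)) * ((ζ + -1) * (ν + 1)) *
        ((Q.coeff 0).eval ζ * homVal m P.divX ν ζ - (P.coeff 0).eval ζ * homVal m Q.divX ν ζ) :=
      (((PolyTwo.const (-1 / 2)).mul (hp 1 (-1))).mul (hp (-1) 1)).mul ((pQ0.mul pP).sub (pP0.mul pQ))
    obtain ⟨R, hR⟩ := key.exists_mvPolynomial
    refine ⟨R, fun τ h hΨ ν => ?_⟩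
    rw [← hR]
    refine Sbarfun_eq_of_generic key (fun ν h0 h1 h2 => ?_) ν
    have hB := zet_sq_ne h
    have eP := hP _ ν hB h0
    have eQ := hQ _ ν hB h0
    have eP0 := hP0 _ hB
    have eQ0 := hQ0 _ hB
    rw [← J3c_eq hB] at eP eP0
    rw [← J4c_eq hB] at eQ eQ0
    rw [Sbarfun_even_minus h hΨ (hH _) h0 h1 h2 (m + 1), eP0, eQ0]
    have h1 := sub_ne_zero.2 h1
    have h2 := sub_ne_zero.2 h2
    rw [div_eq_iff (mul_ne_zero (mul_ne_zero two_ne_zero h1) h2)]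
    linear_combination (zet τ + 1) * (ν - 1) * ((zet τ - 1) * (ν + 1)) * ((Q.coeff 0).eval (zet τ) * eP
      - (P.coeff 0).eval (zet τ) * eQ)

theorem Sbarfun_odd_poly (Ψ : ℂ → PsiFam) (hH : ∀ ζ, IsHFamily ζ (H ζ)) {k : ℕ} (hk : 1 ≤ k) {ε : ℂ} (hε : ε = 1 ∨ ε = -1) :
    ∃ P : MvPolynomial (Fin 2) ℂ, ∀ τ, PosNome τ → PsiOK τ (Ψ τ) → ∀ ν, Sbarfun τ ε (Ψ τ) (2 * k + 1) ν = MvPolynomial.eval ![ν, zet τ] P := by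
  obtain ⟨m, rfl⟩ : ∃ m, k = m + 1 := ⟨k - 1, by omega⟩
  obtain ⟨P, hPd, hPv, hP0, hP⟩ := HL_nubar hH (m := m + 1) [1 - Polynomial.X, 1 + Polynomial.X] (by simp)
  obtain ⟨Q, -, -, hQ0, hQ⟩ := HL_nubar hH (m := m) [] (by simp)
  simp only [List.map_cons, List.map_nil, List.cons_append, List.nil_append] at hP hQ hP0 hQ0 hPv
  have hε2 : ε ^ 2 = 1 := by rcases hε with rfl | rfl <;> norm_num
  have hp : ∀ a b : ℂ, PolyTwo fun ν ζ => (ζ + a) * (ν + b) := fun a b =>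
    (PolyTwo.snd.add (.const a)).mul (PolyTwo.fst.add (.const b))
  have pP0 := PolyTwo.eval_snd (P.coeff 0)
  have pQ0 := PolyTwo.eval_snd (Q.coeff 0)
  have pP := PolyTwo.homVal (m + 1) P.divX
  have pQ := PolyTwo.homVal m Q.divX
  have hW : PolyTwo fun ν ζ => (P.coeff 0).eval ζ * ν ^ (m + 1) + (ζ + ε) ^ 2 * homVal (m + 1) P.divX ν ζ :=
    (pP0.mul (PolyTwo.fst.pow _)).add (((PolyTwo.snd.add (.const ε)).pow 2).mul pP)
  obtain ⟨W, pW, hW⟩ := hW.div_snd fun ν => by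
    have hv := hPv 0 (by simp) 1
    rw [eval_eq_divX] at hv
    simp only [Polynomial.eval_sub, Polynomial.eval_add, Polynomial.eval_one, Polynomial.eval_X, sub_zero, add_zero,
      ne_eq, OfNat.ofNat_ne_zero, not_false_eq_true, zero_pow, div_one] at hv
    rw [HL_one_one_one (hH 0)] at hv
    rw [homVal_eq (v := 1) (by rw [Polynomial.natDegree_divX_eq_natDegree_tsub_one]; omega) (by ring)]
    linear_combination -ν ^ (m + 1) * hv + ν ^ (m + 1) * (P.divX.map (Polynomial.evalRingHom 0)).eval 1 * hε2
  have key : PolyTwo fun ν ζ => (-1 / 2) * ((ζ + -ε) * (ν + -ε)) *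
      ((Q.coeff 0).eval ζ * W ν ζ - (ν + ε) ^ 2 * ((P.coeff 0).eval ζ * homVal m Q.divX ν ζ)) :=
    ((PolyTwo.const (-1 / 2)).mul (hp (-ε) (-ε))).mul ((pQ0.mul pW).sub (((PolyTwo.fst.add (.const ε)).pow 2).mul (pP0.mul pQ)))
  obtain ⟨R, hR⟩ := key.exists_mvPolynomial
  refine ⟨R, fun τ h hΨ ν => ?_⟩
  rw [← hR]
  refine Sbarfun_eq_of_generic key (fun ν h0 h1 h2 => ?_) ν
  have hB := zet_sq_ne h
  have hζ := zet_ne h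
  have eP := hP _ ν hB h0
  have eQ := hQ _ ν hB h0
  have eP0 := hP0 _ hB
  have eQ0 := hQ0 _ hB
  have eW := hW ν (zet τ)
  rw [← J3c_eq hB, ← J4c_eq hB] at eP eP0
  rw [HL_nil] at eQ0
  have h1' := sub_ne_zero.2 h1
  have h2' := sub_ne_zero.2 h2
  have hS : Sbarfun τ ε (Ψ τ) (2 * (m + 1) + 1) ν = (zet τ - ε)*(ν - ε) * ν^(m + 1)
      * (ν*(zet τ + ε)^2 * H (zet τ) (m+1+1) (fun _ => 0) * HL (H (zet τ)) (m+1+2) [J3c (zet τ), J4c (zet τ), nubar (zet τ) ν]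
        - zet τ*(ν + ε)^2 * HL (H (zet τ)) (m+1+1) [nubar (zet τ) ν] * HL (H (zet τ)) (m+1+2) [J3c (zet τ), J4c (zet τ)])
      / (2 * zet τ * (ν - zet τ)*(ν * zet τ - 1)) := by
    rcases hε with rfl | rfl
    · exact Sbarfun_odd_plus h hΨ (hH _) h0 h1 h2 (m + 1)
    · simpa only [sub_neg_eq_add, ← sub_eq_add_neg] using Sbarfun_odd_minus h hΨ (hH _) h0 h1 h2 (m + 1)
  rw [hS, div_eq_iff (mul_ne_zero (mul_ne_zero (mul_ne_zero two_ne_zero hζ) h1') h2'), eQ0, eP0]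
  linear_combination (zet τ - ε) * (ν - ε) * (zet τ + ε) ^ 2 * (Q.coeff 0).eval (zet τ) * eP
    - (zet τ - ε) * (ν - ε) * zet τ * (ν + ε) ^ 2 * (P.coeff 0).eval (zet τ) * eQ
    - (zet τ - ε) * (ν - ε) * (Q.coeff 0).eval (zet τ) * (ν - zet τ) * (ν * zet τ - 1) * eW
    + (zet τ - ε) * (ν - ε) * (Q.coeff 0).eval (zet τ) * (P.coeff 0).eval (zet τ) * ν ^ (m + 1) * (ν - zet τ) * hε2

end Polynomiality

theorem stmt17 (Ψ : ℂ → PsiFam) (H : ℂ → (k : ℕ) → (Fin (2*k) → ℂ) → ℂ)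
    (hΨ : ∀ τ : ℂ, 0 < τ.im →
      PsiEntire (Ψ τ) ∧ PsiP1 τ (Ψ τ) ∧ PsiP2 τ (Ψ τ) ∧ PsiP3 τ (Ψ τ) ∧
        PsiP4 (Ψ τ) ∧ PsiP5 τ (Ψ τ) ∧ PsiP6 (Ψ τ))
    (hH : ∀ ζ, IsHFamily ζ (H ζ)) (k : ℕ) (hk : 1 ≤ k) :
    (∃ P : MvPolynomial (Fin 2) ℂ, ∀ τ : ℂ, 0 < τ.im → preal τ → ∀ ν : ℂ,
        Sbarfun τ 1 (Ψ τ) (2*k) ν = MvPolynomial.eval ![ν, zet τ] P) ∧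
    (∃ P : MvPolynomial (Fin 2) ℂ, ∀ τ : ℂ, 0 < τ.im → preal τ → ∀ ν : ℂ,
        Sbarfun τ (-1) (Ψ τ) (2*k) ν = MvPolynomial.eval ![ν, zet τ] P) ∧
    (∃ P : MvPolynomial (Fin 2) ℂ, ∀ τ : ℂ, 0 < τ.im → preal τ → ∀ ν : ℂ,
        Sbarfun τ 1 (Ψ τ) (2*k+1) ν = MvPolynomial.eval ![ν, zet τ] P) ∧
    (∃ P : MvPolynomial (Fin 2) ℂ, ∀ τ : ℂ, 0 < τ.im → preal τ → ∀ ν : ℂ,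
        Sbarfun τ (-1) (Ψ τ) (2*k+1) ν = MvPolynomial.eval ![ν, zet τ] P) ∧
    (∀ τ : ℂ, 0 < τ.im → preal τ → ∀ ν : ℂ, ν ≠ 0 →
      (zet τ)^2 ≠ 1 → ν ≠ zet τ → ν * zet τ ≠ 1 →
      (Sbarfun τ 1 (Ψ τ) (2*k) ν
        = ν^k * (((zet τ + 1)*(ν - 1))^2
              * H (zet τ) (k+1) (padded [J4c (zet τ)])
              * H (zet τ) (k+1) (padded [J3c (zet τ), nubar (zet τ) ν])
            - ((zet τ - 1)*(ν + 1))^2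
              * H (zet τ) (k+1) (padded [J3c (zet τ)])
              * H (zet τ) (k+1) (padded [J4c (zet τ), nubar (zet τ) ν]))
          / (2*(ν - zet τ)*(ν * zet τ - 1))) ∧
      (Sbarfun τ (-1) (Ψ τ) (2*k) ν
        = (zet τ + 1)*(ν - 1)*(zet τ - 1)*(ν + 1) * ν^k
            * (H (zet τ) (k+1) (padded [J4c (zet τ)])
                * H (zet τ) (k+1) (padded [J3c (zet τ), nubar (zet τ) ν])
              - H (zet τ) (k+1) (padded [J3c (zet τ)])
                * H (zet τ) (k+1) (padded [J4c (zet τ), nubar (zet τ) ν]))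
          / (2*(ν - zet τ)*(ν * zet τ - 1))) ∧
      (zet τ ≠ 0 →
        (Sbarfun τ 1 (Ψ τ) (2*k+1) ν
          = (zet τ - 1)*(ν - 1) * ν^k
              * (ν*(zet τ + 1)^2 * H (zet τ) (k+1) (fun _ => 0)
                  * H (zet τ) (k+2) (padded [J3c (zet τ), J4c (zet τ), nubar (zet τ) ν])
                - zet τ*(ν + 1)^2 * H (zet τ) (k+1) (padded [nubar (zet τ) ν])
                  * H (zet τ) (k+2) (padded [J3c (zet τ), J4c (zet τ)]))
            / (2 * zet τ * (ν - zet τ)*(ν * zet τ - 1))) ∧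
        (Sbarfun τ (-1) (Ψ τ) (2*k+1) ν
          = (zet τ + 1)*(ν + 1) * ν^k
              * (ν*(zet τ - 1)^2 * H (zet τ) (k+1) (fun _ => 0)
                  * H (zet τ) (k+2) (padded [J3c (zet τ), J4c (zet τ), nubar (zet τ) ν])
                - zet τ*(ν - 1)^2 * H (zet τ) (k+1) (padded [nubar (zet τ) ν])
                  * H (zet τ) (k+2) (padded [J3c (zet τ), J4c (zet τ)]))
            / (2 * zet τ * (ν - zet τ)*(ν * zet τ - 1))))) := by
  have hN : ∀ τ : ℂ, 0 < τ.im → preal τ → PosNome τ := fun τ h hp => ⟨h, hp.1, hp.2.1⟩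
  have hO : ∀ τ : ℂ, 0 < τ.im → PsiOK τ (Ψ τ) := fun τ h =>
    have ⟨e, p1, p2, p3, _, p5, p6⟩ := hΨ τ h
    ⟨e, p1, p2, p3, p5, p6⟩
  have even : ∀ {ε : ℂ}, ε = 1 ∨ ε = -1 → ∃ P : MvPolynomial (Fin 2) ℂ, ∀ τ : ℂ, 0 < τ.im → preal τ → ∀ ν : ℂ,
      Sbarfun τ ε (Ψ τ) (2*k) ν = MvPolynomial.eval ![ν, zet τ] P := fun hε =>
    have ⟨P, hP⟩ := Sbarfun_even_poly Ψ hH hk hε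
    ⟨P, fun τ h hp => hP τ (hN τ h hp) (hO τ h)⟩
  have odd : ∀ {ε : ℂ}, ε = 1 ∨ ε = -1 → ∃ P : MvPolynomial (Fin 2) ℂ, ∀ τ : ℂ, 0 < τ.im → preal τ → ∀ ν : ℂ,
      Sbarfun τ ε (Ψ τ) (2*k+1) ν = MvPolynomial.eval ![ν, zet τ] P := fun hε =>
    have ⟨P, hP⟩ := Sbarfun_odd_poly Ψ hH hk hε
    ⟨P, fun τ h hp => hP τ (hN τ h hp) (hO τ h)⟩
  refine ⟨even (.inl rfl), even (.inr rfl), odd (.inl rfl), odd (.inr rfl), fun τ h hp ν h0 _ h1 h2 => ⟨?_, ?_, fun _ => ⟨?_, ?_⟩⟩⟩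
  · exact Sbarfun_even_plus (hN τ h hp) (hO τ h) (hH _) h0 h1 h2 k
  · exact Sbarfun_even_minus (hN τ h hp) (hO τ h) (hH _) h0 h1 h2 k
  · exact Sbarfun_odd_plus (hN τ h hp) (hO τ h) (hH _) h0 h1 h2 k
  · exact Sbarfun_odd_minus (hN τ h hp) (hO τ h) (hH _) h0 h1 h2 k

end
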